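/- Let T be an irreducible regular 1-dimensional scheme and f : X -> T a flat morphism, essentially of finite type, with S2 fibers. Let D be a generically flat family of fiber-wise Cartier divisors on X. Assume there is a closed subscheme W of X such that for every t in T the codimension of X_t intersect W in the fiber X_t is at least 3, and that D is a Cartier divisor on X \ W. Then D is a Cartier divisor on X. -/

import Mathlib

open AlgebraicGeometry CategoryTheory Opposite TopologicalSpace

universe u

namespace LocalPic

/-- Restriction of invertible sections along an inclusion of opens. -/
def resU (X : Scheme.{u}) {U V : X.Opens} (h : V ≤ U) :
    (Γ(X, U))ˣ →* (Γ(X, V))ˣ :=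
  Units.map (X.presheaf.map (homOfLE h).op).hom.toMonoidHom

/-- Restriction of sections along an inclusion of opens. -/
def resS (X : Scheme.{u}) {U V : X.Opens} (h : V ≤ U) : ↥Γ(X, U) →+* ↥Γ(X, V) :=
  (X.presheaf.map (homOfLE h).op).hom

lemma resU_resU (X : Scheme.{u}) {U V W : X.Opens} (h1 : W ≤ V) (h2 : V ≤ U)
    (u : (Γ(X, U))ˣ) :
    resU X h1 (resU X h2 u) = resU X (h1.trans h2) u := by
  ext
  show (X.presheaf.map (homOfLE h1).op) ((X.presheaf.map (homOfLE h2).op) u) = _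
  rw [← CategoryTheory.comp_apply, ← Functor.map_comp, ← op_comp, homOfLE_comp]
  rfl

/-- A line bundle on the open subset `V` of a scheme `X`, presented by a Čech 1-cocycle
of invertible sections with respect to an open cover of `V`. -/
structure LineBundleOn (X : Scheme.{u}) (V : X.Opens) : Type (u + 1) where
  ι : Type u
  U : ι → X.Opens
  le : ∀ i, U i ≤ V
  covers : ∀ x ∈ V, ∃ i, x ∈ U i
  t : ∀ i j, (Γ(X, U i ⊓ U j))ˣ
  cocycle : ∀ i j k,
    resU X (inf_le_left : U i ⊓ U j ⊓ U k ≤ U i ⊓ U j) (t i j) *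
      resU X (le_inf (inf_le_left.trans inf_le_right) inf_le_right :
        U i ⊓ U j ⊓ U k ≤ U j ⊓ U k) (t j k) =
    resU X (le_inf (inf_le_left.trans inf_le_left) inf_le_right :
        U i ⊓ U j ⊓ U k ≤ U i ⊓ U k) (t i k)

namespace LineBundleOn

variable {X Y : Scheme.{u}} {V : X.Opens}

lemma cocycle_res (L : LineBundleOn X V) (i j k : L.ι) {W : X.Opens}
    (h : W ≤ L.U i ⊓ L.U j ⊓ L.U k)
    (h1 : W ≤ L.U i ⊓ L.U j) (h2 : W ≤ L.U j ⊓ L.U k) (h3 : W ≤ L.U i ⊓ L.U k) :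
    resU X h1 (L.t i j) * resU X h2 (L.t j k) = resU X h3 (L.t i k) := by
  have e := congrArg (resU X h) (L.cocycle i j k)
  rw [map_mul, resU_resU, resU_resU, resU_resU] at e
  exact e

/-- Tensor powers of a line bundle. -/
def pow (L : LineBundleOn X V) (n : ℕ) : LineBundleOn X V where
  ι := L.ι
  U := L.U
  le := L.le
  covers := L.covers
  t i j := (L.t i j) ^ n
  cocycle i j k := by rw [map_pow, map_pow, map_pow, ← mul_pow, L.cocycle]

/-- The inverse (dual) of a line bundle. -/
def inv (L : LineBundleOn X V) : LineBundleOn X V where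
  ι := L.ι
  U := L.U
  le := L.le
  covers := L.covers
  t i j := (L.t i j)⁻¹
  cocycle i j k := by rw [map_inv, map_inv, map_inv, ← mul_inv, L.cocycle]

/-- A line bundle is trivial if its cocycle is a coboundary, i.e. if it admits a
nowhere vanishing global section. -/
def IsTrivial (L : LineBundleOn X V) : Prop :=
  ∃ s : ∀ i, (Γ(X, L.U i))ˣ, ∀ i j,
    L.t i j = resU X inf_le_left (s i) * (resU X inf_le_right (s j))⁻¹

/-- A line bundle is torsion if some positive tensor power of it is trivial. -/
def IsTorsion (L : LineBundleOn X V) : Prop :=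
  ∃ n : ℕ, 0 < n ∧ IsTrivial (L.pow n)

def preimage_inf_le (f : Y ⟶ X) (A B : X.Opens) :
    f ⁻¹ᵁ A ⊓ f ⁻¹ᵁ B ≤ f ⁻¹ᵁ (A ⊓ B) := by
  intro x hx
  have hx' : x ∈ (↑(f ⁻¹ᵁ A ⊓ f ⁻¹ᵁ B) : Set Y) := hx
  rw [Opens.coe_inf] at hx'
  exact ⟨hx'.1, hx'.2⟩

/-- Mapping invertible sections along the pull-back of sections of a morphism. -/
def mapU (f : Y ⟶ X) {U : X.Opens} {W : Y.Opens} (e : W ≤ f ⁻¹ᵁ U) :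
    (Γ(X, U))ˣ →* (Γ(Y, W))ˣ :=
  Units.map (f.appLE U W e).hom.toMonoidHom

lemma resU_mapU (f : Y ⟶ X) {U : X.Opens} {W W' : Y.Opens} (e : W ≤ f ⁻¹ᵁ U)
    (h : W' ≤ W) (u : (Γ(X, U))ˣ) :
    resU Y h (mapU f e u) = mapU f (h.trans e) u := by
  ext
  show (Y.presheaf.map (homOfLE h).op) ((f.appLE U W e) u) = (f.appLE U W' _) u
  rw [← CategoryTheory.comp_apply, Scheme.Hom.appLE_map]

lemma mapU_resU (f : Y ⟶ X) {U U' : X.Opens} {W : Y.Opens} (hU : U' ≤ U)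
    (e : W ≤ f ⁻¹ᵁ U') (e' : W ≤ f ⁻¹ᵁ U) (u : (Γ(X, U))ˣ) :
    mapU f e (resU X hU u) = mapU f e' u := by
  ext
  show (f.appLE U' W e) ((X.presheaf.map (homOfLE hU).op) u) = (f.appLE U W e') u
  rw [← CategoryTheory.comp_apply, Scheme.Hom.map_appLE]

/-- Pullback of a line bundle along a morphism of schemes. -/
def pullback (f : Y ⟶ X) (L : LineBundleOn X V) : LineBundleOn Y (f ⁻¹ᵁ V) where
  ι := L.ι
  U i := f ⁻¹ᵁ L.U i
  le i x hx := L.le i hx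
  covers x hx := by
    obtain ⟨i, hi⟩ := L.covers (f.base x) hx
    exact ⟨i, hi⟩
  t i j := mapU f (preimage_inf_le f (L.U i) (L.U j)) (L.t i j)
  cocycle i j k := by
    rw [resU_mapU, resU_mapU, resU_mapU,
        ← mapU_resU f (inf_le_left : L.U i ⊓ L.U j ⊓ L.U k ≤ L.U i ⊓ L.U j),
        ← mapU_resU f (le_inf (inf_le_left.trans inf_le_right) inf_le_right :
          L.U i ⊓ L.U j ⊓ L.U k ≤ L.U j ⊓ L.U k),
        ← mapU_resU f (le_inf (inf_le_left.trans inf_le_left) inf_le_right :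
          L.U i ⊓ L.U j ⊓ L.U k ≤ L.U i ⊓ L.U k),
        ← map_mul, L.cocycle]
    all_goals
      intro x hx
      have hx' : x ∈ (↑(f ⁻¹ᵁ L.U i ⊓ f ⁻¹ᵁ L.U j ⊓ f ⁻¹ᵁ L.U k) : Set Y) := hx
      rw [Opens.coe_inf, Opens.coe_inf] at hx'
      exact ⟨⟨hx'.1.1, hx'.1.2⟩, hx'.2⟩

/-- Tensor product of two line bundles on the same open set. -/
def mul (L M : LineBundleOn X V) : LineBundleOn X V where
  ι := L.ι × M.ι
  U p := L.U p.1 ⊓ M.U p.2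
  le p := inf_le_left.trans (L.le p.1)
  covers x hx := by
    obtain ⟨i, hi⟩ := L.covers x hx
    obtain ⟨a, ha⟩ := M.covers x hx
    exact ⟨(i, a), ⟨hi, ha⟩⟩
  t p q := resU X (le_inf (inf_le_left.trans inf_le_left) (inf_le_right.trans inf_le_left))
      (L.t p.1 q.1) *
    resU X (le_inf (inf_le_left.trans inf_le_right) (inf_le_right.trans inf_le_right))
      (M.t p.2 q.2)
  cocycle := by
    rintro ⟨i, a⟩ ⟨j, b⟩ ⟨k, c⟩
    simp only [map_mul, resU_resU]
    rw [mul_mul_mul_comm,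
      L.cocycle_res i j k (h := le_inf (le_inf
        ((inf_le_left.trans inf_le_left).trans inf_le_left)
        ((inf_le_left.trans inf_le_right).trans inf_le_left))
        (inf_le_right.trans inf_le_left)),
      M.cocycle_res a b c (h := le_inf (le_inf
        ((inf_le_left.trans inf_le_left).trans inf_le_right)
        ((inf_le_left.trans inf_le_right).trans inf_le_right))
        (inf_le_right.trans inf_le_right))]

/-- Restriction of a line bundle to a smaller open set. -/
def restrict (L : LineBundleOn X V) {V' : X.Opens} (h : V' ≤ V) : LineBundleOn X V' where
  ι := L.ι
  U i := L.U i ⊓ V'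
  le i := inf_le_right
  covers x hx := by
    obtain ⟨i, hi⟩ := L.covers x (h hx)
    exact ⟨i, ⟨hi, hx⟩⟩
  t i j := resU X (le_inf (inf_le_left.trans inf_le_left)
      (inf_le_right.trans inf_le_left)) (L.t i j)
  cocycle i j k := by
    simp only [resU_resU]
    exact L.cocycle_res i j k (h := le_inf (le_inf
      (inf_le_left.trans (inf_le_left.trans inf_le_left))
      (inf_le_left.trans (inf_le_right.trans inf_le_left)))
      (inf_le_right.trans inf_le_left)) _ _ _

/-- Two line bundles are isomorphic iff `L ⊗ M⁻¹` is trivial. -/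
def Isomorphic (L M : LineBundleOn X V) : Prop :=
  IsTrivial (mul L (inv M))

end LineBundleOn

/-- `depth ≥ n` for a local ring: there is a weakly regular sequence of length `n`
inside the maximal ideal. -/
def DepthGE (R : Type u) [CommRing R] [IsLocalRing R] (n : ℕ) : Prop :=
  ∃ rs : List R, rs.length = n ∧ (∀ r ∈ rs, r ∈ IsLocalRing.maximalIdeal R) ∧
    RingTheory.Sequence.IsWeaklyRegular R rs

/-- A morphism of schemes is flat if all of its stalk maps are flat ring maps. -/
def IsFlatMorphism {X Y : Scheme.{u}} (f : X ⟶ Y) : Prop :=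
  ∀ x : X,
    letI : Algebra ↥(Y.presheaf.stalk (f.base x)) ↥(X.presheaf.stalk x) :=
      RingHom.toAlgebra (f.stalkMap x).hom
    Module.Flat ↥(Y.presheaf.stalk (f.base x)) ↥(X.presheaf.stalk x)

/-- Serre's condition `S2` for a scheme: for every point, the depth of the local ring is
at least `min 2 (dim)`. -/
def IsS2Scheme (X : Scheme.{u}) : Prop :=
  ∀ (x : X) (n : ℕ), (n : WithBot (WithTop ℕ)) ≤
      min 2 (ringKrullDim ↥(X.presheaf.stalk x)) → DepthGE ↥(X.presheaf.stalk x) n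

/-- A closed subset has codimension `≥ n` if every one of its points admits a strictly
increasing chain of generalizations of length `n`. -/
def CodimGE {T : Type u} [TopologicalSpace T] (Z : Set T) (n : ℕ) : Prop :=
  ∀ z ∈ Z, ∃ c : Fin (n + 1) → T, c 0 = z ∧
    ∀ i : Fin n, c i.succ ⤳ c i.castSucc ∧ c i.succ ≠ c i.castSucc

/-- A local ring is regular if it is Noetherian and its Krull dimension equals the
dimension of the cotangent space over the residue field. -/
def IsRegularLocal (R : Type u) [CommRing R] [IsLocalRing R] : Prop :=
  IsNoetherianRing R ∧
    ringKrullDim R =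
      Module.finrank (IsLocalRing.ResidueField R) (IsLocalRing.CotangentSpace R)

/-- A Cartier divisor on the open subset `V` of a scheme `Z`: a line bundle `O(D)`
together with local fractions `a i / b i` with nonzerodivisor germs realizing its
transition functions. -/
structure CartierDataOn (Z : Scheme.{u}) (V : Z.Opens) extends LineBundleOn Z V where
  a : ∀ i, ↥Γ(Z, U i)
  b : ∀ i, ↥Γ(Z, U i)
  rega : ∀ (i) (x : Z) (hx : x ∈ U i),
    Z.presheaf.germ (U i) x hx (a i) ∈ nonZeroDivisors ↥(Z.presheaf.stalk x)
  regb : ∀ (i) (x : Z) (hx : x ∈ U i),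
    Z.presheaf.germ (U i) x hx (b i) ∈ nonZeroDivisors ↥(Z.presheaf.stalk x)
  rel : ∀ i j, ((t i j : (Γ(Z, U i ⊓ U j))ˣ) : ↥Γ(Z, U i ⊓ U j)) *
      (resS Z inf_le_right (a j) * resS Z inf_le_left (b i)) =
    resS Z inf_le_left (a i) * resS Z inf_le_right (b j)

/-- Two Cartier divisor data (possibly defined on different open subsets) define the
same divisor where both are defined: the local fractions agree up to units. -/
def SameDiv {Z : Scheme.{u}} {V V' : Z.Opens} (D : CartierDataOn Z V)
    (D' : CartierDataOn Z V') : Prop :=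
  ∀ i i', ∃ u : (Γ(Z, D.U i ⊓ D'.U i'))ˣ,
    resS Z inf_le_left (D.a i) * resS Z inf_le_right (D'.b i') =
      (u : ↥Γ(Z, D.U i ⊓ D'.U i')) *
        (resS Z inf_le_right (D'.a i') * resS Z inf_le_left (D.b i))

/-- A Cartier divisor `Dt` on the source of `p : F ⟶ Z` is the restriction (pullback)
of the divisor `D` on `Z`: the fractions agree up to units. -/
def ExtendsPullback {F Z : Scheme.{u}} (p : F ⟶ Z) {VF : F.Opens} {V : Z.Opens}
    (Dt : CartierDataOn F VF) (D : CartierDataOn Z V) : Prop :=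
  ∀ α i, ∃ u : (Γ(F, Dt.U α ⊓ p ⁻¹ᵁ D.U i))ˣ,
    resS F inf_le_left (Dt.a α) *
        (p.appLE (D.U i) (Dt.U α ⊓ p ⁻¹ᵁ D.U i) inf_le_right (D.b i)) =
      (u : ↥Γ(F, Dt.U α ⊓ p ⁻¹ᵁ D.U i)) *
        ((p.appLE (D.U i) (Dt.U α ⊓ p ⁻¹ᵁ D.U i) inf_le_right (D.a i)) *
          resS F inf_le_left (Dt.b α))

/-- The local equations of `D` restrict to nonzerodivisors on every fiber of `f`:
`D` is a relative Cartier divisor (on its open set of definition). -/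
def FiberRegular {X T : Scheme.{u}} (f : X ⟶ T) {V : X.Opens}
    (D : CartierDataOn X V) : Prop :=
  ∀ (t : T) (z : ↥(Limits.pullback f (T.fromSpecResidueField t))) (i)
    (hz : z ∈ (Limits.pullback.fst f (T.fromSpecResidueField t)) ⁻¹ᵁ D.U i),
    ((Limits.pullback f (T.fromSpecResidueField t)).presheaf.germ
        ((Limits.pullback.fst f (T.fromSpecResidueField t)) ⁻¹ᵁ D.U i) z hz
        (((Limits.pullback.fst f (T.fromSpecResidueField t)).app (D.U i)) (D.a i)) ∈
      nonZeroDivisors _) ∧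
    ((Limits.pullback f (T.fromSpecResidueField t)).presheaf.germ
        ((Limits.pullback.fst f (T.fromSpecResidueField t)) ⁻¹ᵁ D.U i) z hz
        (((Limits.pullback.fst f (T.fromSpecResidueField t)).app (D.U i)) (D.b i)) ∈
      nonZeroDivisors _)

/-- `D` is a generically flat family of fiber-wise Cartier divisors for `f : X ⟶ T`:
it is a relative Cartier divisor on an open set whose complement has codimension `≥ 2`
in every fiber, and its restriction to every fiber extends to a Cartier divisor `D_t`
on the whole fiber. -/
def IsGenericallyFlatFamilyOfCartierDivisors {X T : Scheme.{u}} (f : X ⟶ T)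
    {V : X.Opens} (D : CartierDataOn X V) : Prop :=
  (∀ t : T, CodimGE {z : ↥(Limits.pullback f (T.fromSpecResidueField t)) |
      (Limits.pullback.fst f (T.fromSpecResidueField t)).base z ∉ V} 2) ∧
  FiberRegular f D ∧
  (∀ t : T, ∃ Dt : CartierDataOn (Limits.pullback f (T.fromSpecResidueField t)) ⊤,
    ExtendsPullback (Limits.pullback.fst f (T.fromSpecResidueField t)) Dt D)

/-- A morphism of schemes is essentially of finite type if every point has an affine
open neighborhood whose ring of sections is essentially of finite type over the ring of
sections of an affine open of the base. -/
def IsEssFiniteTypeMorphism {X T : Scheme.{u}} (f : X ⟶ T) : Prop :=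
  ∀ x : X, ∃ (U : X.Opens) (_ : x ∈ U) (_ : IsAffineOpen U) (W : T.Opens)
    (_ : IsAffineOpen W) (hle : U ≤ f ⁻¹ᵁ W),
    letI : Algebra ↥Γ(T, W) ↥Γ(X, U) := RingHom.toAlgebra (f.appLE W U hle).hom
    Algebra.EssFiniteType ↥Γ(T, W) ↥Γ(X, U)

end LocalPic

set_option linter.style.haveILetI false
namespace LPaux
open IsLocalRing (maximalIdeal)

section

section RelLength
variable {A : Type*} [CommRing A]
variable {E F : Type*} [AddCommGroup E] [Module A E] [AddCommGroup F] [Module A F]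

/-- relative length of `N / N'` (for submodules of an ambient module). -/
noncomputable def rl (N' N : Submodule A E) : ℕ∞ := Module.length A (N ⧸ N'.submoduleOf N)

lemma rl_add {N'' N' N : Submodule A E} (h1 : N'' ≤ N') (h2 : N' ≤ N) :
    rl N'' N = rl N'' N' + rl N' N := by
  unfold rl
  let f : (N' ⧸ N''.submoduleOf N') →ₗ[A] (N ⧸ N''.submoduleOf N) :=
    Submodule.mapQ _ _ (Submodule.inclusion h2) (by
      intro x hx
      simpa [Submodule.submoduleOf] using hx)
  let g : (N ⧸ N''.submoduleOf N) →ₗ[A] (N ⧸ N'.submoduleOf N) :=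
    Submodule.mapQ _ _ LinearMap.id (by
      intro x hx
      have : (x : E) ∈ N'' := by simpa [Submodule.submoduleOf] using hx
      simpa [Submodule.submoduleOf] using h1 this)
  refine Module.length_eq_add_of_exact f g ?_ ?_ ?_
  · rw [← LinearMap.ker_eq_bot, LinearMap.ker_eq_bot']
    intro m hm
    induction m using Submodule.Quotient.induction_on with
    | H x =>
      have : f (Submodule.Quotient.mk x) = Submodule.Quotient.mk (Submodule.inclusion h2 x) := rfl
      rw [this, Submodule.Quotient.mk_eq_zero] at hm
      rw [Submodule.Quotient.mk_eq_zero]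
      simpa [Submodule.submoduleOf] using hm
  · intro m
    induction m using Submodule.Quotient.induction_on with
    | H x => exact ⟨Submodule.Quotient.mk x, rfl⟩
  · intro m
    induction m using Submodule.Quotient.induction_on with
    | H x =>
      have e : g (Submodule.Quotient.mk x) = Submodule.Quotient.mk x := rfl
      rw [e, Submodule.Quotient.mk_eq_zero]
      constructor
      · intro hx
        have hx' : (x : E) ∈ N' := by simpa [Submodule.submoduleOf] using hx
        exact ⟨Submodule.Quotient.mk ⟨x, hx'⟩, rfl⟩
      · rintro ⟨y, hy⟩
        induction y using Submodule.Quotient.induction_on with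
        | H y =>
          have e2 : f (Submodule.Quotient.mk y) = Submodule.Quotient.mk (Submodule.inclusion h2 y) := rfl
          rw [e2, Submodule.Quotient.eq] at hy
          have : ((y : E) - x) ∈ N'' := by simpa [Submodule.submoduleOf] using hy
          have h3 := N'.sub_mem y.2 (h1 this)
          have : (x : E) ∈ N' := by simpa using h3
          simpa [Submodule.submoduleOf] using this

/-- the comparison map used in the transfer lemmas -/
lemma rl_transfer_aux (f : E →ₗ[A] F) {N' N : Submodule A E} {P' P : Submodule A F}
    (h1 : ∀ z ∈ N, f z ∈ P) (h2 : ∀ z ∈ N, (f z ∈ P' ↔ z ∈ N')) :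
    ∃ φ : (N ⧸ N'.submoduleOf N) →ₗ[A] (P ⧸ P'.submoduleOf P), Function.Injective φ ∧
      ∀ z : N, φ (Submodule.Quotient.mk z) = Submodule.Quotient.mk ⟨f z, h1 z z.2⟩ := by
  refine ⟨Submodule.mapQ _ _ (f.restrict h1) ?_, ?_, fun z => rfl⟩
  · intro x hx
    have : (x : E) ∈ N' := by simpa [Submodule.submoduleOf] using hx
    simpa [Submodule.submoduleOf] using (h2 x x.2).2 this
  · rw [← LinearMap.ker_eq_bot, LinearMap.ker_eq_bot']
    intro m hm
    induction m using Submodule.Quotient.induction_on with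
    | H x =>
      rw [Submodule.mapQ_apply, Submodule.Quotient.mk_eq_zero] at hm
      rw [Submodule.Quotient.mk_eq_zero]
      have : f x ∈ P' := by simpa [Submodule.submoduleOf] using hm
      simpa [Submodule.submoduleOf] using (h2 x x.2).1 this

lemma rl_le (f : E →ₗ[A] F) {N' N : Submodule A E} {P' P : Submodule A F}
    (h1 : ∀ z ∈ N, f z ∈ P) (h2 : ∀ z ∈ N, (f z ∈ P' ↔ z ∈ N')) :
    rl N' N ≤ rl P' P := by
  obtain ⟨φ, hφ, -⟩ := rl_transfer_aux f h1 h2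
  exact Module.length_le_of_injective φ hφ

lemma rl_eq (f : E →ₗ[A] F) {N' N : Submodule A E} {P' P : Submodule A F}
    (h1 : ∀ z ∈ N, f z ∈ P) (h2 : ∀ z ∈ N, (f z ∈ P' ↔ z ∈ N'))
    (h3 : ∀ p ∈ P, ∃ z ∈ N, p - f z ∈ P') :
    rl N' N = rl P' P := by
  obtain ⟨φ, hφ, hz⟩ := rl_transfer_aux f h1 h2
  refine (LinearEquiv.ofBijective φ ⟨hφ, ?_⟩).length_eq
  intro p
  induction p using Submodule.Quotient.induction_on with
  | H p =>
    obtain ⟨z, hzN, hp⟩ := h3 p p.2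
    refine ⟨Submodule.Quotient.mk ⟨z, hzN⟩, ?_⟩
    rw [hz, Submodule.Quotient.eq]
    have : f z - p ∈ P' := by simpa using P'.neg_mem hp
    simpa [Submodule.submoduleOf] using this

lemma rl_map (f : E →ₗ[A] F) {N' N : Submodule A E} (h : N' ≤ N) :
    rl N' N = rl (N'.map f) (N.map f) + rl (N' ⊓ LinearMap.ker f) (N ⊓ LinearMap.ker f) := by
  rw [rl_add (N' := N' ⊔ (N ⊓ LinearMap.ker f)) le_sup_left (sup_le h inf_le_left), add_comm]
  congr 1
  · refine rl_eq f (fun z hz => ⟨z, hz, rfl⟩) (fun z hz => ?_) ?_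
    · constructor
      · rintro ⟨y, hy, hyz⟩
        rw [Submodule.mem_sup]
        refine ⟨y, hy, z - y, ⟨N.sub_mem hz (h hy), ?_⟩, by abel⟩
        simp [hyz]
      · intro hz'
        rw [Submodule.mem_sup] at hz'
        obtain ⟨y, hy, w, hw, rfl⟩ := hz'
        refine ⟨y, hy, ?_⟩
        have := hw.2
        simp at this
        simp [this]
    · rintro p ⟨z, hz, rfl⟩
      exact ⟨z, hz, by simp⟩
  · symm
    refine rl_eq LinearMap.id (fun z hz => Submodule.mem_sup_right hz) (fun z hz => ?_) ?_
    · simp only [LinearMap.id_coe, id_eq]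
      constructor
      · intro hz'
        exact ⟨hz', hz.2⟩
      · intro hz'
        exact hz'.1
    · intro p hp
      rw [Submodule.mem_sup] at hp
      obtain ⟨y, hy, w, hw, rfl⟩ := hp
      exact ⟨w, hw, by simpa using hy⟩

lemma rl_self (N : Submodule A E) : rl N N = 0 := by
  unfold rl
  rw [Module.length_eq_zero_iff, Submodule.Quotient.subsingleton_iff]
  simp

lemma le_of_rl_eq_zero {N' N : Submodule A E} (h : rl N' N = 0) : N ≤ N' := by
  unfold rl at h
  rw [Module.length_eq_zero_iff, Submodule.Quotient.subsingleton_iff] at h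
  simpa using h

lemma rl_prod {N' N : Submodule A E} {P' P : Submodule A F} (hN : N' ≤ N) (hP : P' ≤ P) :
    rl (N'.prod P') (N.prod P) = rl N' N + rl P' P := by
  rw [rl_add (N' := N'.prod P) (Submodule.prod_mono le_rfl hP) (Submodule.prod_mono hN le_rfl), add_comm]
  congr 1
  · refine rl_eq (LinearMap.fst A E F) (fun z hz => hz.1) (fun z hz => ?_) ?_
    · exact ⟨fun h => ⟨h, hz.2⟩, fun h => h.1⟩
    · intro p hp
      exact ⟨(p, 0), ⟨hp, P.zero_mem⟩, by simp⟩
  · refine rl_eq (LinearMap.snd A E F) (fun z hz => hz.2) (fun z hz => ?_) ?_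
    · exact ⟨fun h => ⟨hz.1, h⟩, fun h => h.2⟩
    · intro p hp
      exact ⟨(0, p), ⟨N'.zero_mem, hp⟩, by simp⟩

lemma rl_ne_top [IsNoetherianRing A] [IsLocalRing A] {N' N : Submodule A E} (hN : N.FG) (k : ℕ)
    (hk : ∀ a ∈ maximalIdeal A ^ k, ∀ z ∈ N, a • z ∈ N') : rl N' N ≠ ⊤ := by
  unfold rl
  set I := maximalIdeal A ^ k
  haveI : Module.Finite A N := Module.Finite.iff_fg.2 hN
  haveI : IsArtinianRing (A ⧸ I) := by
    by_cases hI : I = ⊤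
    · haveI : Subsingleton (A ⧸ I) := Ideal.Quotient.subsingleton_iff.2 hI
      infer_instance
    · haveI : Nontrivial (A ⧸ I) := Ideal.Quotient.nontrivial_iff.2 hI
      haveI : IsLocalRing (A ⧸ I) := IsLocalRing.of_surjective' (Ideal.Quotient.mk I) Ideal.Quotient.mk_surjective
      rw [isArtinianRing_iff_isNilpotent_maximalIdeal]
      refine ⟨k, ?_⟩
      rw [← IsLocalRing.map_maximalIdeal_of_surjective (Ideal.Quotient.mk I) Ideal.Quotient.mk_surjective,
        ← Ideal.map_pow]
      simp [I]
  set Q := (N ⧸ N'.submoduleOf N)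
  have hQ : Module.IsTorsionBySet A Q I := by
    intro x a
    induction x using Submodule.Quotient.induction_on with
    | H x =>
      show Submodule.Quotient.mk ((a : A) • x) = _
      rw [Submodule.Quotient.mk_eq_zero]
      simpa [Submodule.submoduleOf] using hk a a.2 x x.2
  letI := hQ.module
  haveI := hQ.isScalarTower (S := A)
  haveI : Module.Finite (A ⧸ I) Q := Module.Finite.of_restrictScalars_finite A _ _
  rw [Module.length_eq_of_surjective (R := A ⧸ I) (S := A) (M := Q) Ideal.Quotient.mk_surjective]
  exact Module.length_ne_top

end RelLength

end

section

section Euler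
variable {A : Type*} [CommRing A]
variable {E0 E1 F0 F1 : Type*} [AddCommGroup E0] [Module A E0] [AddCommGroup E1] [Module A E1]
  [AddCommGroup F0] [Module A F0] [AddCommGroup F1] [Module A F1]

/-- length of homology at the first spot -/
noncomputable def hl (d1 : E1 →ₗ[A] E0) (d0 : E0 →ₗ[A] E1) (N1 : Submodule A E1)
    (N0 : Submodule A E0) : ℕ∞ := rl (N1.map d1) (N0 ⊓ LinearMap.ker d0)

lemma euler_sub (d0 : E0 →ₗ[A] E1) (d1 : E1 →ₗ[A] E0) (h01 : ∀ z, d1 (d0 z) = 0)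
    (h10 : ∀ z, d0 (d1 z) = 0) {N0 N0' : Submodule A E0} {N1 N1' : Submodule A E1}
    (hN0 : N0' ≤ N0) (hN1 : N1' ≤ N1) (hd0 : ∀ z ∈ N0, d0 z ∈ N1) (hd1 : ∀ z ∈ N1, d1 z ∈ N0)
    (hd0' : ∀ z ∈ N0', d0 z ∈ N1') (hd1' : ∀ z ∈ N1', d1 z ∈ N0') :
    hl d1 d0 N1 N0 + rl N1' N1 + hl d0 d1 N0' N1' = hl d0 d1 N0 N1 + rl N0' N0 + hl d1 d0 N1' N0' := by
  have e0 : hl d1 d0 N1 N0 + rl (N1'.map d1) (N1.map d1) =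
      hl d1 d0 N1' N0' + rl (N0' ⊓ LinearMap.ker d0) (N0 ⊓ LinearMap.ker d0) := by
    unfold hl
    rw [add_comm, ← rl_add (Submodule.map_mono hN1), ← rl_add]
    · rintro _ ⟨z, hz, rfl⟩
      exact ⟨hd1' z hz, by simp [h10]⟩
    · exact inf_le_inf_right _ hN0
    · rintro _ ⟨z, hz, rfl⟩
      exact ⟨hd1 z hz, by simp [h10]⟩
  have e1 : hl d0 d1 N0 N1 + rl (N0'.map d0) (N0.map d0) =
      hl d0 d1 N0' N1' + rl (N1' ⊓ LinearMap.ker d1) (N1 ⊓ LinearMap.ker d1) := by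
    unfold hl
    rw [add_comm, ← rl_add (Submodule.map_mono hN0), ← rl_add]
    · rintro _ ⟨z, hz, rfl⟩
      exact ⟨hd0' z hz, by simp [h01]⟩
    · exact inf_le_inf_right _ hN1
    · rintro _ ⟨z, hz, rfl⟩
      exact ⟨hd0 z hz, by simp [h01]⟩
  rw [rl_map d1 hN1, rl_map d0 hN0]
  calc _ = (hl d1 d0 N1 N0 + rl (N1'.map d1) (N1.map d1)) +
        (hl d0 d1 N0' N1' + rl (N1' ⊓ LinearMap.ker d1) (N1 ⊓ LinearMap.ker d1)) := by ring
    _ = _ := by rw [e0, ← e1]; ring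

/-- multiplication by `t` -/
abbrev tm (E : Type*) [AddCommGroup E] [Module A E] (t : A) : E →ₗ[A] E := LinearMap.lsmul A E t

lemma euler_red_aux (t : A) (d0 : E0 →ₗ[A] E1) (d1 : E1 →ₗ[A] E0) (h01 : ∀ z, d1 (d0 z) = 0)
    (h10 : ∀ z, d0 (d1 z) = 0) {N0 : Submodule A E0} {N1 : Submodule A E1}
    (hd0 : ∀ z ∈ N0, d0 z ∈ N1) (hd1 : ∀ z ∈ N1, d1 z ∈ N0)
    (ht0 : ∀ z : E0, t • z = 0 → z = 0) (ht1 : ∀ z : E1, t • z = 0 → z = 0)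
    (r0 : E0 →ₗ[A] F0) (r1 : E1 →ₗ[A] F1) (D0 : F0 →ₗ[A] F1) (D1 : F1 →ₗ[A] F0)
    (c0 : ∀ z, D0 (r0 z) = r1 (d0 z)) (c1 : ∀ z, D1 (r1 z) = r0 (d1 z))
    (tF0 : ∀ z : F0, t • z = 0) (tF1 : ∀ z : F1, t • z = 0)
    (k0 : ∀ z ∈ N0, r0 z = 0 → ∃ w ∈ N0, z = t • w)
    (k1 : ∀ z ∈ N1, r1 z = 0 → ∃ w ∈ N1, z = t • w)
    (hfin : hl d0 d1 N0 N1 ≠ ⊤) :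
    hl D1 D0 (N1.map r1) (N0.map r0) =
      rl (N1.map d1 ⊔ (N0 ⊓ LinearMap.ker d0).map (tm E0 t)) (N0 ⊓ LinearMap.ker d0) +
      rl (N0.map d0 ⊔ (N1 ⊓ LinearMap.ker d1).map (tm E1 t)) (N1 ⊓ LinearMap.ker d1) := by
  set Z : Submodule A E0 := N0 ⊓ (N1.map (tm E1 t)).comap d0 with hZ
  set K0 := N0 ⊓ LinearMap.ker d0
  set K1 := N1 ⊓ LinearMap.ker d1
  set P : Submodule A E1 := N1 ⊓ (N0.map d0).comap (tm E1 t) with hP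
  have s1 : rl (N1.map d1 ⊔ N0.map (tm E0 t)) Z = hl D1 D0 (N1.map r1) (N0.map r0) := by
    refine rl_eq r0 ?_ ?_ ?_
    · rintro z ⟨hz, w, hw, hwz⟩
      refine ⟨⟨z, hz, rfl⟩, ?_⟩
      show D0 (r0 z) = 0
      rw [c0, ← hwz]
      simp [tF1]
    · rintro z ⟨hz, -⟩
      constructor
      · rintro ⟨_, ⟨y, hy, rfl⟩, h⟩
        rw [c1] at h
        obtain ⟨w, hw, e⟩ := k0 (z - d1 y) (N0.sub_mem hz (hd1 y hy)) (by simp [h])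
        rw [Submodule.mem_sup]
        refine ⟨d1 y, ⟨y, hy, rfl⟩, t • w, ⟨w, hw, rfl⟩, ?_⟩
        rw [← e]; abel
      · intro h
        rw [Submodule.mem_sup] at h
        obtain ⟨_, ⟨y, hy, rfl⟩, _, ⟨w, hw, rfl⟩, rfl⟩ := h
        refine ⟨r1 y, ⟨y, hy, rfl⟩, ?_⟩
        simp [c1, tF0]
    · rintro _ ⟨⟨z, hz, rfl⟩, h⟩
      refine ⟨z, ⟨hz, ?_⟩, by simp⟩
      change D0 (r0 z) = 0 at h
      rw [c0] at h
      obtain ⟨w, hw, e⟩ := k1 _ (hd0 z hz) h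
      exact ⟨w, hw, e.symm⟩
  have s2 : rl (N1.map d1 ⊔ K0.map (tm E0 t)) K0 = rl (N1.map d1 ⊔ N0.map (tm E0 t)) (K0 ⊔ N0.map (tm E0 t)) := by
    refine rl_eq LinearMap.id (fun z hz => Submodule.mem_sup_left hz) ?_ ?_
    · rintro z ⟨hz, hz'⟩
      simp only [LinearMap.id_coe, id_eq]
      constructor
      · intro h
        rw [Submodule.mem_sup] at h
        obtain ⟨_, ⟨y, hy, rfl⟩, _, ⟨w, hw, rfl⟩, rfl⟩ := h
        rw [Submodule.mem_sup]
        refine ⟨_, ⟨y, hy, rfl⟩, _, ⟨w, ⟨hw, ?_⟩, rfl⟩, rfl⟩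
        apply ht1
        simpa [h10] using hz'
      · intro h
        have hh : K0.map (tm E0 t) ≤ N0.map (tm E0 t) := Submodule.map_mono inf_le_left
        exact (sup_le_sup_left hh _ : N1.map d1 ⊔ K0.map (tm E0 t) ≤ _) h
    · intro p hp
      rw [Submodule.mem_sup] at hp
      obtain ⟨y, hy, w, hw, rfl⟩ := hp
      exact ⟨y, hy, by simpa using Submodule.mem_sup_right hw⟩
  have s3 : rl (K0 ⊔ N0.map (tm E0 t)) Z = rl ((N0.map d0).map (tm E1 t)) (P.map (tm E1 t)) := by
    refine rl_eq d0 ?_ ?_ ?_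
    · rintro z ⟨hz, w, hw, hwz⟩
      refine ⟨w, ⟨hw, ?_⟩, hwz⟩
      exact ⟨z, hz, hwz.symm⟩
    · rintro z ⟨hz, -⟩
      constructor
      · rintro ⟨_, ⟨y, hy, rfl⟩, h⟩
        rw [Submodule.mem_sup]
        refine ⟨z - t • y, ⟨N0.sub_mem hz (N0.smul_mem _ hy), ?_⟩, t • y, ⟨y, hy, rfl⟩, by abel⟩
        simp only [LinearMap.lsmul_apply] at h
        simp [← h]
      · intro h
        rw [Submodule.mem_sup] at h
        obtain ⟨y, ⟨hy, hy'⟩, _, ⟨w, hw, rfl⟩, rfl⟩ := h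
        refine ⟨d0 w, ⟨w, hw, rfl⟩, ?_⟩
        change d0 y = 0 at hy'
        simp [hy']
    · rintro _ ⟨w, ⟨hw, z, hz, hzw⟩, rfl⟩
      exact ⟨z, ⟨hz, w, hw, hzw.symm⟩, by simp [hzw]⟩
  have s4 : rl (N0.map d0) P = rl ((N0.map d0).map (tm E1 t)) (P.map (tm E1 t)) := by
    refine rl_eq (tm E1 t) (fun z hz => ⟨z, hz, rfl⟩) ?_ ?_
    · intro z hz
      constructor
      · rintro ⟨y, hy, h⟩
        have : y - z = 0 := ht1 _ (by simpa [smul_sub, sub_eq_zero] using h)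
        rwa [← sub_eq_zero.1 this]
      · intro h
        exact ⟨z, h, rfl⟩
    · rintro _ ⟨z, hz, rfl⟩
      exact ⟨z, hz, by simp⟩
  have hPK : P ≤ K1 := by
    rintro z ⟨hz, y, hy, h⟩
    refine ⟨hz, ht0 _ ?_⟩
    rw [← map_smul]
    change d0 y = t • z at h
    rw [← h, h01]
  have hdP : N0.map d0 ≤ P := by
    rintro _ ⟨y, hy, rfl⟩
    exact ⟨hd0 y hy, t • y, N0.smul_mem _ hy, by simp⟩
  have s5 : rl P K1 = rl (N0.map d0) (N0.map d0 ⊔ K1.map (tm E1 t)) := by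
    refine rl_eq (tm E1 t) (fun z hz => Submodule.mem_sup_right ⟨z, hz, rfl⟩) ?_ ?_
    · rintro z ⟨hz, -⟩
      exact ⟨fun h => ⟨hz, h⟩, fun h => h.2⟩
    · intro p hp
      rw [Submodule.mem_sup] at hp
      obtain ⟨y, hy, _, ⟨w, hw, rfl⟩, rfl⟩ := hp
      exact ⟨w, hw, by simpa using hy⟩
  have s6 : rl (N0.map d0) P = rl (N0.map d0 ⊔ K1.map (tm E1 t)) K1 := by
    have hle : N0.map d0 ⊔ K1.map (tm E1 t) ≤ K1 := by
      refine sup_le (hdP.trans hPK) ?_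
      rintro _ ⟨z, hz, rfl⟩
      exact K1.smul_mem _ hz
    have a1 : rl (N0.map d0) K1 = _ := rl_add hdP hPK
    have a2 : rl (N0.map d0) K1 = _ := rl_add le_sup_left hle
    rw [← s5, add_comm] at a2
    rw [a1] at a2
    have hf : rl P K1 ≠ ⊤ := by
      intro h
      apply hfin
      show rl (N0.map d0) K1 = ⊤
      rw [a1, h, add_top]
    exact ENat.add_left_injective_of_ne_top hf a2
  have hBle : N1.map d1 ⊔ N0.map (tm E0 t) ≤ K0 ⊔ N0.map (tm E0 t) := by
    refine sup_le_sup_right ?_ _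
    rintro _ ⟨y, hy, rfl⟩
    exact ⟨hd1 y hy, by simp [h10]⟩
  have hle2 : K0 ⊔ N0.map (tm E0 t) ≤ Z := by
    refine sup_le ?_ ?_
    · rintro z ⟨hz, hz'⟩
      refine ⟨hz, 0, N1.zero_mem, ?_⟩
      change d0 z = 0 at hz'
      simp [hz']
    · rintro _ ⟨z, hz, rfl⟩
      exact ⟨N0.smul_mem _ hz, d0 z, hd0 z hz, by simp⟩
  rw [← s1, rl_add hBle hle2, ← s2, s3, ← s4, s6]

lemma euler_red (t : A) (d0 : E0 →ₗ[A] E1) (d1 : E1 →ₗ[A] E0) (h01 : ∀ z, d1 (d0 z) = 0)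
    (h10 : ∀ z, d0 (d1 z) = 0) {N0 : Submodule A E0} {N1 : Submodule A E1}
    (hd0 : ∀ z ∈ N0, d0 z ∈ N1) (hd1 : ∀ z ∈ N1, d1 z ∈ N0)
    (ht0 : ∀ z : E0, t • z = 0 → z = 0) (ht1 : ∀ z : E1, t • z = 0 → z = 0)
    (r0 : E0 →ₗ[A] F0) (r1 : E1 →ₗ[A] F1) (D0 : F0 →ₗ[A] F1) (D1 : F1 →ₗ[A] F0)
    (c0 : ∀ z, D0 (r0 z) = r1 (d0 z)) (c1 : ∀ z, D1 (r1 z) = r0 (d1 z))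
    (tF0 : ∀ z : F0, t • z = 0) (tF1 : ∀ z : F1, t • z = 0)
    (k0 : ∀ z ∈ N0, r0 z = 0 → ∃ w ∈ N0, z = t • w)
    (k1 : ∀ z ∈ N1, r1 z = 0 → ∃ w ∈ N1, z = t • w)
    (hfin0 : hl d1 d0 N1 N0 ≠ ⊤) (hfin : hl d0 d1 N0 N1 ≠ ⊤) :
    hl D1 D0 (N1.map r1) (N0.map r0) = hl D0 D1 (N0.map r0) (N1.map r1) := by
  rw [euler_red_aux t d0 d1 h01 h10 hd0 hd1 ht0 ht1 r0 r1 D0 D1 c0 c1 tF0 tF1 k0 k1 hfin,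
    euler_red_aux t d1 d0 h10 h01 hd1 hd0 ht1 ht0 r1 r0 D1 D0 c1 c0 tF1 tF0 k1 k0 hfin0, add_comm]

end Euler

end

section

universe v w

section Koszul
variable {A : Type w} [CommRing A]

/-- A two-periodic complex of `R`-modules together with a family of `A`-submodules. -/
structure Cx (A : Type w) [CommRing A] (R : Type v) [CommRing R] [Algebra A R]
    (M : ℤ → Submodule A R) (l : List R) where
  X : Type v
  Y : Type v
  [acX : AddCommGroup X]
  [acY : AddCommGroup Y]
  [mrX : Module R X]
  [mrY : Module R Y]
  [maX : Module A X]
  [maY : Module A Y]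
  [stX : IsScalarTower A R X]
  [stY : IsScalarTower A R Y]
  d0 : X →ₗ[R] Y
  d1 : Y →ₗ[R] X
  dd0 : ∀ x, d1 (d0 x) = 0
  dd1 : ∀ x, d0 (d1 x) = 0
  CX : ℤ → Submodule A X
  CY : ℤ → Submodule A Y
  dCX : ∀ n, ∀ x ∈ CX n, d0 x ∈ CY n
  dCY : ∀ n, ∀ x ∈ CY n, d1 x ∈ CX n
  mCX : ∀ k n, ∀ r ∈ M k, ∀ x ∈ CX n, r • x ∈ CX (n + k)
  mCY : ∀ k n, ∀ r ∈ M k, ∀ x ∈ CY n, r • x ∈ CY (n + k)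
  fgX : ∀ n, (CX n).FG
  fgY : ∀ n, (CY n).FG
  homo : ∀ s ∈ l, ∃ (i0 : X →ₗ[R] Y) (i1 : Y →ₗ[R] X),
    (∀ x, d1 (i0 x) + i1 (d0 x) = s • x) ∧ (∀ y, d0 (i1 y) + i0 (d1 y) = s • y) ∧
    (∀ n, ∀ x ∈ CX n, i0 x ∈ CY (n + 1)) ∧ (∀ n, ∀ y ∈ CY n, i1 y ∈ CX (n + 1))

attribute [instance] Cx.acX Cx.acY Cx.mrX Cx.mrY Cx.maX Cx.maY Cx.stX Cx.stY

variable {R : Type v} [CommRing R] [Algebra A R] {M : ℤ → Submodule A R}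

/-- base case: just the family `M` itself -/
def Cx.base (hM : ∀ k n, ∀ r ∈ M k, ∀ x ∈ M n, r * x ∈ M (n + k)) (hfg : ∀ n, (M n).FG) :
    Cx A R M [] where
  X := R
  Y := PUnit
  d0 := 0
  d1 := 0
  dd0 := by simp
  dd1 := by simp
  CX := M
  CY := fun _ => ⊥
  dCX := by simp
  dCY := by simp
  mCX := fun k n r hr x hx => hM k n r hr x hx
  mCY := by simp
  fgX := hfg
  fgY := fun n => Submodule.fg_bot
  homo := by simp

/-- the step -/
def Cx.step {l : List R} (c : Cx A R M l) (s : R) (hs : s ∈ M 1) : Cx A R M (s :: l) where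
  X := c.X × c.Y
  Y := c.Y × c.X
  d0 := (c.d0.comp (LinearMap.fst R c.X c.Y)).prod
    (s • LinearMap.fst R c.X c.Y - c.d1.comp (LinearMap.snd R c.X c.Y))
  d1 := (c.d1.comp (LinearMap.fst R c.Y c.X)).prod
    (s • LinearMap.fst R c.Y c.X - c.d0.comp (LinearMap.snd R c.Y c.X))
  dd0 := by rintro ⟨x, y⟩; simp [c.dd0, c.dd1]
  dd1 := by rintro ⟨x, y⟩; simp [c.dd0, c.dd1]
  CX := fun n => (c.CX n).prod (c.CY (n + 1))
  CY := fun n => (c.CY n).prod (c.CX (n + 1))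
  dCX := by
    rintro n ⟨x, y⟩ ⟨hx, hy⟩
    exact ⟨c.dCX n x hx, Submodule.sub_mem _ (c.mCX 1 n s hs x hx) (c.dCY _ y hy)⟩
  dCY := by
    rintro n ⟨x, y⟩ ⟨hx, hy⟩
    exact ⟨c.dCY n x hx, Submodule.sub_mem _ (c.mCY 1 n s hs x hx) (c.dCX _ y hy)⟩
  mCX := by
    rintro k n r hr ⟨x, y⟩ ⟨hx, hy⟩
    refine ⟨c.mCX k n r hr x hx, ?_⟩
    have := c.mCY k _ r hr y hy
    rwa [show n + 1 + k = n + k + 1 by ring] at this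
  mCY := by
    rintro k n r hr ⟨x, y⟩ ⟨hx, hy⟩
    refine ⟨c.mCY k n r hr x hx, ?_⟩
    have := c.mCX k _ r hr y hy
    rwa [show n + 1 + k = n + k + 1 by ring] at this
  fgX := fun n => (c.fgX n).prod (c.fgY (n + 1))
  fgY := fun n => (c.fgY n).prod (c.fgX (n + 1))
  homo := by
    intro s' hs'
    rw [List.mem_cons] at hs'
    rcases hs' with rfl | hs'
    · refine ⟨(LinearMap.snd R c.X c.Y).prod 0, (LinearMap.snd R c.Y c.X).prod 0, ?_, ?_, ?_, ?_⟩
      · rintro ⟨x, y⟩; simp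
      · rintro ⟨x, y⟩; simp
      · rintro n ⟨x, y⟩ ⟨hx, hy⟩
        exact ⟨hy, Submodule.zero_mem _⟩
      · rintro n ⟨x, y⟩ ⟨hx, hy⟩
        exact ⟨hy, Submodule.zero_mem _⟩
    · obtain ⟨i0, i1, h0, h1, g0, g1⟩ := c.homo s' hs'
      refine ⟨(i0.comp (LinearMap.fst R c.X c.Y)).prod (-(i1.comp (LinearMap.snd R c.X c.Y))),
        (i1.comp (LinearMap.fst R c.Y c.X)).prod (-(i0.comp (LinearMap.snd R c.Y c.X))), ?_, ?_, ?_, ?_⟩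
      · rintro ⟨x, y⟩
        refine Prod.ext ?_ ?_
        · simpa using h0 x
        · have := h1 y
          simp only [Prod.smul_mk]
          rw [← this]
          simp
          abel
      · rintro ⟨y, x⟩
        refine Prod.ext ?_ ?_
        · simpa using h1 y
        · have := h0 x
          simp only [Prod.smul_mk]
          rw [← this]
          simp
          abel
      · rintro n ⟨x, y⟩ ⟨hx, hy⟩
        exact ⟨g0 _ x hx, Submodule.neg_mem _ (g1 _ y hy)⟩
      · rintro n ⟨x, y⟩ ⟨hx, hy⟩
        exact ⟨g1 _ x hx, Submodule.neg_mem _ (g0 _ y hy)⟩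

/-- differentials over the base -/
abbrev Cx.e0 {l : List R} (c : Cx A R M l) : c.X →ₗ[A] c.Y := c.d0.restrictScalars A
/-- differentials over the base -/
abbrev Cx.e1 {l : List R} (c : Cx A R M l) : c.Y →ₗ[A] c.X := c.d1.restrictScalars A

lemma Cx.fin [IsNoetherianRing A] [IsLocalRing A] {l : List R} (c : Cx A R M l) (k : ℕ)
    (hk : ∀ a ∈ maximalIdeal A ^ k,
      algebraMap A R a ∈ Submodule.span A {r | ∃ s ∈ l, ∃ e ∈ M (-1), r = e * s}) (n : ℤ) :
    hl c.e1 c.e0 (c.CY n) (c.CX n) ≠ ⊤ ∧ hl c.e0 c.e1 (c.CX n) (c.CY n) ≠ ⊤ := by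
  constructor
  · have : IsNoetherian A (c.CX n) := isNoetherian_of_fg_of_noetherian _ (c.fgX n)
    refine rl_ne_top ?_ k ?_
    · exact Submodule.FG.of_le (c.fgX n) inf_le_left
    · rintro a ha z ⟨hz, hz'⟩
      replace hz' : c.d0 z = 0 := hz'
      have key : ∀ r ∈ Submodule.span A {r | ∃ s ∈ l, ∃ e ∈ M (-1), r = e * s},
          r • z ∈ (c.CY n).map c.e1 := by
        intro r hr
        induction hr using Submodule.span_induction with
        | mem r hr =>
          obtain ⟨s, hs, e, he, rfl⟩ := hr
          obtain ⟨i0, i1, h0, h1, g0, g1⟩ := c.homo s hs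
          refine ⟨e • i0 z, ?_, ?_⟩
          · have := c.mCY (-1) _ e he _ (g0 n z hz)
            simpa using this
          · have := h0 z
            rw [hz', map_zero, add_zero] at this
            simp [this, mul_smul]
        | zero => simp
        | add x y _ _ hx hy => rw [add_smul]; exact Submodule.add_mem _ hx hy
        | smul a x _ hx => rw [smul_assoc]; exact Submodule.smul_mem _ _ hx
      simpa using key _ (hk a ha)
  · have : IsNoetherian A (c.CY n) := isNoetherian_of_fg_of_noetherian _ (c.fgY n)
    refine rl_ne_top ?_ k ?_
    · exact Submodule.FG.of_le (c.fgY n) inf_le_left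
    · rintro a ha z ⟨hz, hz'⟩
      replace hz' : c.d1 z = 0 := hz'
      have key : ∀ r ∈ Submodule.span A {r | ∃ s ∈ l, ∃ e ∈ M (-1), r = e * s},
          r • z ∈ (c.CX n).map c.e0 := by
        intro r hr
        induction hr using Submodule.span_induction with
        | mem r hr =>
          obtain ⟨s, hs, e, he, rfl⟩ := hr
          obtain ⟨i0, i1, h0, h1, g0, g1⟩ := c.homo s hs
          refine ⟨e • i1 z, ?_, ?_⟩
          · have := c.mCX (-1) _ e he _ (g1 n z hz)
            simpa using this
          · have := h1 z
            rw [hz', map_zero, add_zero] at this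
            simp [this, mul_smul]
        | zero => simp
        | add x y _ _ hx hy => rw [add_smul]; exact Submodule.add_mem _ hx hy
        | smul a x _ hx => rw [smul_assoc]; exact Submodule.smul_mem _ _ hx
      simpa using key _ (hk a ha)

end Koszul
end

section

universe v w

section Red

lemma map_prod_prodMap {A : Type*} [CommRing A] {E F E' F' : Type*} [AddCommGroup E] [Module A E]
    [AddCommGroup F] [Module A F] [AddCommGroup E'] [Module A E'] [AddCommGroup F'] [Module A F']
    (f : E →ₗ[A] E') (g : F →ₗ[A] F') (N : Submodule A E) (P : Submodule A F) :
    (N.prod P).map (f.prodMap g) = (N.map f).prod (P.map g) := by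
  ext ⟨x, y⟩
  constructor
  · rintro ⟨⟨a, b⟩, ⟨ha, hb⟩, h⟩
    simp only [LinearMap.prodMap_apply, Prod.mk.injEq] at h
    exact ⟨⟨a, ha, h.1⟩, ⟨b, hb, h.2⟩⟩
  · rintro ⟨⟨a, ha, h1⟩, ⟨b, hb, h2⟩⟩
    exact ⟨(a, b), ⟨ha, hb⟩, Prod.ext h1 h2⟩

/-- backward difference -/
def bd (p : ℤ → ℤ) : ℤ → ℤ := fun n => p n - p (n + 1)

variable {A : Type w} [CommRing A]
variable {R S : Type v} [CommRing R] [Algebra A R] [CommRing S] [Algebra A S]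

lemma koszul_exists (t : A) (red : R →ₐ[A] S) (u : Sˣ) (M : ℤ → Submodule A R) (B : Submodule A S)
    (hM : ∀ k n, ∀ r ∈ M k, ∀ x ∈ M n, r * x ∈ M (n + k)) (hfg : ∀ n, (M n).FG)
    (hB : ∀ r ∈ B, ∀ x ∈ B, r * x ∈ B) (hBfg : B.FG)
    (ht : ∀ z : R, t • z = 0 → z = 0) (htM : ∀ n, ∀ z, t • z ∈ M n → z ∈ M n)
    (htS : ∀ z : S, t • z = 0)
    (hker : ∀ z, red z = 0 → ∃ w, z = t • w)
    (hρ : ∀ n, ∀ z ∈ M n, red z * ((u ^ (-n) : Sˣ) : S) ∈ B)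
    (p : ℤ → ℕ)
    (hp : ∀ n, rl ((M n).map (LinearMap.mulRight A ((u ^ (-n) : Sˣ) : S) ∘ₗ red.toLinearMap)) B = p n)
    (l : List R) (hl : ∀ s ∈ l, s ∈ M 1) :
    ∃ (c : Cx A R M l) (c' : Cx A S (fun _ => B) (l.map fun s => red s * ((u⁻¹ : Sˣ) : S)))
      (rX : ℤ → c.X →ₗ[A] c'.X) (rY : ℤ → c.Y →ₗ[A] c'.Y),
      (∀ n (r : R) x, rX (n + 1) (r • x) = (red r * ((u⁻¹ : Sˣ) : S)) • rX n x) ∧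
      (∀ n (r : R) x, rY (n + 1) (r • x) = (red r * ((u⁻¹ : Sˣ) : S)) • rY n x) ∧
      (∀ n x, c'.d0 (rX n x) = rY n (c.d0 x)) ∧
      (∀ n x, c'.d1 (rY n x) = rX n (c.d1 x)) ∧
      (∀ n x, rX n x = 0 → ∃ w, x = t • w) ∧
      (∀ n x, rY n x = 0 → ∃ w, x = t • w) ∧
      (∀ x : c.X, t • x = 0 → x = 0) ∧ (∀ x : c.Y, t • x = 0 → x = 0) ∧
      (∀ x : c'.X, t • x = 0) ∧ (∀ x : c'.Y, t • x = 0) ∧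
      (∀ n x, t • x ∈ c.CX n → x ∈ c.CX n) ∧ (∀ n x, t • x ∈ c.CY n → x ∈ c.CY n) ∧
      (∀ n, ∀ x ∈ c.CX n, rX n x ∈ c'.CX 0) ∧ (∀ n, ∀ x ∈ c.CY n, rY n x ∈ c'.CY 0) ∧
      (∀ n, c'.CX n = c'.CX 0) ∧ (∀ n, c'.CY n = c'.CY 0) ∧
      ∃ qX qY : ℤ → ℕ, (∀ n, rl ((c.CX n).map (rX n)) (c'.CX 0) = qX n) ∧
        (∀ n, rl ((c.CY n).map (rY n)) (c'.CY 0) = qY n) ∧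
        ∀ n, (qX n : ℤ) - qY n = (bd^[l.length] fun n => (p n : ℤ)) n := by
  induction l with
  | nil =>
    refine ⟨Cx.base hM hfg, Cx.base (fun _ _ => hB) (fun _ => hBfg),
      fun n => LinearMap.mulRight A ((u ^ (-n) : Sˣ) : S) ∘ₗ red.toLinearMap, fun _ => 0,
      ?_, fun _ _ _ => rfl, fun _ _ => rfl, ?_, ?_, fun n x h => ⟨0, rfl⟩, ht, fun _ _ => rfl, htS,
      fun _ => rfl, htM, ?_, hρ, ?_, fun _ => rfl, fun _ => rfl, p, fun _ => 0, hp, ?_, ?_⟩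
    · intro n r (x : R)
      have e : (u ^ (-(n + 1)) : Sˣ) = u⁻¹ * u ^ (-n) := by
        rw [neg_add, zpow_add, mul_comm, zpow_neg_one]
      change red (r * x) * ((u ^ (-(n + 1)) : Sˣ) : S) =
        (red r * ((u⁻¹ : Sˣ) : S)) * (red x * ((u ^ (-n) : Sˣ) : S))
      rw [e, map_mul, Units.val_mul]; ring
    · intro n x
      exact (map_zero (LinearMap.mulRight A ((u ^ (-n) : Sˣ) : S) ∘ₗ red.toLinearMap)).symm
    · intro n (x : R) hx
      apply hker
      change red x * ((u ^ (-n) : Sˣ) : S) = 0 at hx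
      simpa using hx
    · intro n x _
      exact Submodule.zero_mem (⊥ : Submodule A PUnit.{v+1})
    · intro n x _
      exact Submodule.zero_mem (⊥ : Submodule A PUnit.{v+1})
    · intro n
      change rl (Submodule.map (0 : PUnit.{v+1} →ₗ[A] PUnit.{v+1}) (⊥ : Submodule A PUnit.{v+1}))
        (⊥ : Submodule A PUnit.{v+1}) = 0
      rw [Submodule.map_bot]; exact rl_self _
    · intro n; simp
  | cons s l ih =>
    obtain ⟨c, c', rX, rY, lX, lY, cX, cY, kX, kY, tX, tY, tX', tY', sX, sY, iX, iY, eX, eY,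
      qX, qY, hqX, hqY, hq⟩ := ih (fun s hs => hl s (List.mem_cons_of_mem _ hs))
    have hs := hl s List.mem_cons_self
    have hσ : red s * ((u⁻¹ : Sˣ) : S) ∈ B := by simpa using hρ 1 s hs
    refine ⟨c.step s hs, c'.step _ hσ, fun n => (rX n).prodMap (rY (n + 1)),
      fun n => (rY n).prodMap (rX (n + 1)), ?_, ?_, ?_, ?_, ?_, ?_, ?_, ?_, ?_, ?_, ?_, ?_, ?_, ?_,
      ?_, ?_, fun n => qX n + qY (n + 1), fun n => qY n + qX (n + 1), ?_, ?_, ?_⟩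
    · rintro n r ⟨x, y⟩
      exact Prod.ext (lX n r x) (lY _ r y)
    · rintro n r ⟨x, y⟩
      exact Prod.ext (lY n r x) (lX _ r y)
    · rintro n ⟨x, y⟩
      refine Prod.ext (cX n x) ?_
      change (red s * ((u⁻¹ : Sˣ) : S)) • rX n x - c'.d1 (rY (n + 1) y) =
        rX (n + 1) (s • x - c.d1 y)
      rw [map_sub, lX, cY]
    · rintro n ⟨x, y⟩
      refine Prod.ext (cY n x) ?_
      change (red s * ((u⁻¹ : Sˣ) : S)) • rY n x - c'.d0 (rX (n + 1) y) =
        rY (n + 1) (s • x - c.d0 y)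
      rw [map_sub, lY, cX]
    · rintro n ⟨x, y⟩ h
      obtain ⟨w, hw⟩ := kX n x (congrArg Prod.fst h)
      obtain ⟨w', hw'⟩ := kY _ y (congrArg Prod.snd h)
      exact ⟨(w, w'), Prod.ext hw hw'⟩
    · rintro n ⟨x, y⟩ h
      obtain ⟨w, hw⟩ := kY n x (congrArg Prod.fst h)
      obtain ⟨w', hw'⟩ := kX _ y (congrArg Prod.snd h)
      exact ⟨(w, w'), Prod.ext hw hw'⟩
    · rintro ⟨x, y⟩ h
      exact Prod.ext (tX x (congrArg Prod.fst h)) (tY y (congrArg Prod.snd h))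
    · rintro ⟨x, y⟩ h
      exact Prod.ext (tY x (congrArg Prod.fst h)) (tX y (congrArg Prod.snd h))
    · rintro ⟨x, y⟩
      exact Prod.ext (tX' x) (tY' y)
    · rintro ⟨x, y⟩
      exact Prod.ext (tY' x) (tX' y)
    · rintro n ⟨x, y⟩ ⟨h1, h2⟩
      exact ⟨sX n x h1, sY _ y h2⟩
    · rintro n ⟨x, y⟩ ⟨h1, h2⟩
      exact ⟨sY n x h1, sX _ y h2⟩
    · rintro n ⟨x, y⟩ ⟨h1, h2⟩
      exact ⟨iX n x h1, (eY (0 + 1)).symm ▸ iY _ y h2⟩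
    · rintro n ⟨x, y⟩ ⟨h1, h2⟩
      exact ⟨iY n x h1, (eX (0 + 1)).symm ▸ iX _ y h2⟩
    · intro n
      change (c'.CX n).prod (c'.CY (n + 1)) = (c'.CX 0).prod (c'.CY (0 + 1))
      rw [eX n, eY (n + 1), eY (0 + 1)]
    · intro n
      change (c'.CY n).prod (c'.CX (n + 1)) = (c'.CY 0).prod (c'.CX (0 + 1))
      rw [eY n, eX (n + 1), eX (0 + 1)]
    · intro n
      change rl (((c.CX n).prod (c.CY (n + 1))).map ((rX n).prodMap (rY (n + 1))))
        ((c'.CX 0).prod (c'.CY (0 + 1))) = _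
      rw [map_prod_prodMap, eY (0 + 1), rl_prod, hqX, hqY]
      · push_cast; rfl
      · rintro _ ⟨x, hx, rfl⟩; exact iX n x hx
      · rintro _ ⟨x, hx, rfl⟩; exact iY _ x hx
    · intro n
      change rl (((c.CY n).prod (c.CX (n + 1))).map ((rY n).prodMap (rX (n + 1))))
        ((c'.CY 0).prod (c'.CX (0 + 1))) = _
      rw [map_prod_prodMap, eX (0 + 1), rl_prod, hqX, hqY]
      · push_cast; rfl
      · rintro _ ⟨x, hx, rfl⟩; exact iY n x hx
      · rintro _ ⟨x, hx, rfl⟩; exact iX _ x hx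
    · intro n
      rw [List.length_cons, Function.iterate_succ_apply']
      have h1 := hq n
      have h2 := hq (n + 1)
      rw [bd, ← h1, ← h2]
      push_cast; ring

lemma bd_iter_const (p : ℤ → ℤ) (C : ℤ) (hb : ∀ n, |p n| ≤ C) (r : ℕ) (c : ℤ)
    (h : ∀ n, (bd^[r] p) n = c) : ∀ n, p n = p 0 := by
  induction r generalizing p C c with
  | zero => intro n; rw [show p n = c from h n, show p 0 = c from h 0]
  | succ r ih =>
    have h1 := ih (bd p) (2 * C) (fun n => by
      rw [bd]
      have := abs_sub (p n) (p (n + 1))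
      have := hb n
      have := hb (n + 1)
      linarith) c h
    set e := bd p 0
    have h2 : ∀ n : ℕ, p n = p 0 - n * e := by
      intro n
      induction n with
      | zero => simp
      | succ n ihn =>
        have := h1 n
        rw [bd] at this
        push_cast
        linarith
    have he : e = 0 := by
      by_contra hne
      have h3 := h2 (2 * C + 1).toNat
      have hC : 0 ≤ C := (abs_nonneg _).trans (hb 0)
      rw [Int.toNat_of_nonneg (by linarith)] at h3
      have h4 := hb (2 * C + 1)
      have h5 := hb 0
      have : (2 * C + 1) * e = p 0 - p (2 * C + 1) := by linarith
      have h6 : |(2 * C + 1) * e| ≤ 2 * C := by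
        rw [this]
        have := abs_sub (p 0) (p (2 * C + 1))
        linarith
      rw [abs_mul, abs_of_nonneg (by linarith : 0 ≤ 2 * C + 1)] at h6
      have : 1 ≤ |e| := Int.one_le_abs hne
      nlinarith
    intro n
    induction n using Int.induction_on with
    | zero => rfl
    | succ n ihn =>
      have := h1 n
      rw [bd] at this
      linarith
    | pred n ihn =>
      have := h1 (-n - 1)
      rw [bd] at this
      simp only [sub_add_cancel] at this
      linarith

end Red
end

section

universe v w

section CoreA

/-- image of the base ring -/
abbrev BB (A S : Type*) [CommRing A] [CommRing S] [Algebra A S] : Submodule A S :=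
  LinearMap.range (Algebra.linearMap A S)

lemma BB_fg (A S : Type*) [CommRing A] [CommRing S] [Algebra A S] : (BB A S).FG := by
  rw [BB, LinearMap.range_eq_map]
  exact (Module.Finite.fg_top : (⊤ : Submodule A A).FG).map _

/-- elements which become elements of `N` after multiplication by a power of `g` -/
def sat {A E : Type*} [CommRing A] [AddCommGroup E] [Module A E] (g : A) (N : Submodule A E) :
    Submodule A E where
  carrier := {z | ∃ k : ℕ, g ^ k • z ∈ N}
  zero_mem' := ⟨0, by simp⟩
  add_mem' := by
    rintro x y ⟨k, hk⟩ ⟨l, hl⟩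
    refine ⟨k + l, ?_⟩
    rw [smul_add]
    refine N.add_mem ?_ ?_
    · rw [add_comm, pow_add, mul_smul]; exact N.smul_mem _ hk
    · rw [pow_add, mul_smul]; exact N.smul_mem _ hl
  smul_mem' := by
    rintro a x ⟨k, hk⟩
    exact ⟨k, by rw [smul_comm]; exact N.smul_mem _ hk⟩

lemma le_sat {A E : Type*} [CommRing A] [AddCommGroup E] [Module A E] (g : A) (N : Submodule A E) :
    N ≤ sat g N := fun z hz => ⟨0, by simpa using hz⟩

/-- elements of `N` which are `m`-power torsion modulo `N'` -/
def tors {A E : Type*} [CommRing A] [IsLocalRing A] [AddCommGroup E] [Module A E]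
    (N' N : Submodule A E) : Submodule A E where
  carrier := {z | z ∈ N ∧ ∃ k : ℕ, ∀ a ∈ maximalIdeal A ^ k, a • z ∈ N'}
  zero_mem' := ⟨N.zero_mem, 0, by simp⟩
  add_mem' := by
    rintro x y ⟨hx, k, hk⟩ ⟨hy, l, hl⟩
    refine ⟨N.add_mem hx hy, k + l, fun a ha => ?_⟩
    rw [smul_add]
    exact N'.add_mem (hk a (Ideal.pow_le_pow_right (by omega) ha))
      (hl a (Ideal.pow_le_pow_right (by omega) ha))
  smul_mem' := by
    rintro a x ⟨hx, k, hk⟩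
    exact ⟨N.smul_mem _ hx, k, fun b hb => by rw [smul_comm]; exact N'.smul_mem _ (hk b hb)⟩

/-- The abstract data for the core theorem. -/
structure Core (A : Type w) [CommRing A] [IsLocalRing A] (R S : Type v) [CommRing R]
    [Algebra A R] [CommRing S] [Algebra A S] (t g h : A) where
  red : R →ₐ[A] S
  u : Sˣ
  M : ℤ → Submodule A R
  tm : t ∈ maximalIdeal A
  M0 : M 0 = BB A R
  mulM : ∀ k n, ∀ r ∈ M k, ∀ x ∈ M n, r * x ∈ M (n + k)
  tinj : ∀ z : R, t • z = 0 → z = 0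
  tM : ∀ n, ∀ z, t • z ∈ M n → z ∈ M n
  tS : ∀ z : S, t • z = 0
  kerr : ∀ z, red z = 0 → ∃ w, z = t • w
  rhoM : ∀ n, ∀ z ∈ M n, red z * ((u ^ (-n) : Sˣ) : S) ∈ BB A S
  hk : ∃ k, ∀ a ∈ maximalIdeal A ^ k, algebraMap A R a ∈ M 1 * M (-1)
  gm : g ∈ maximalIdeal A
  hm : h ∈ maximalIdeal A
  ug : IsUnit (algebraMap A R g)
  uh : IsUnit (algebraMap A R h)
  satM : ∀ n, sat g (M n) ⊓ sat h (M n) ≤ M n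
  satB : sat g (BB A S) ⊓ sat h (BB A S) ≤ BB A S
  fin : rl (sat g (BB A S) ⊔ sat h (BB A S))
    (tors (sat g (BB A S) ⊔ sat h (BB A S)) (sat (g * h) (BB A S))) ≠ ⊤

namespace Core

variable {A : Type w} [CommRing A] [IsLocalRing A] {R S : Type v} [CommRing R]
    [Algebra A R] [CommRing S] [Algebra A S] {t g h : A} (c : Core A R S t g h)
include c

/-- the twisted reduction -/
def rho (n : ℤ) : R →ₗ[A] S := LinearMap.mulRight A ((c.u ^ (-n) : Sˣ) : S) ∘ₗ c.red.toLinearMap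

lemma rho_apply (n : ℤ) (z : R) : c.rho n z = c.red z * ((c.u ^ (-n) : Sˣ) : S) := rfl

lemma rho_mul (k n : ℤ) (x y : R) : c.rho (n + k) (x * y) = c.rho k x * c.rho n y := by
  rw [rho_apply, rho_apply, rho_apply, map_mul, neg_add, zpow_add, Units.val_mul]; ring

lemma rho_ker (n : ℤ) (z : R) (hz : c.rho n z = 0) : ∃ w, z = t • w := by
  apply c.kerr
  rw [rho_apply] at hz
  simpa using hz

lemma rho_t (n : ℤ) (z : R) : c.rho n (t • z) = 0 := by rw [map_smul, c.tS]

lemma hkn (n : ℕ) : ∃ k, ∀ a ∈ maximalIdeal A ^ k,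
    algebraMap A R a ∈ c.M n * c.M (-n) := by
  obtain ⟨k, hk⟩ := c.hk
  have hp : ∀ (ε : ℤ) (n : ℕ), c.M ε ^ n ≤ c.M (n * ε) := by
    intro ε n
    induction n with
    | zero => simp [c.M0, Submodule.one_eq_range]
    | succ n ih =>
      rw [pow_succ', Submodule.mul_le]
      intro x hx y hy
      have := c.mulM _ _ x hx y (ih hy)
      push_cast
      rwa [add_mul, one_mul]
  refine ⟨k * n, fun a ha => ?_⟩
  have h1 : (Submodule.map (Algebra.ofId A R).toLinearMap (maximalIdeal A ^ k)) ≤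
      c.M 1 * c.M (-1) := by
    rintro _ ⟨a, ha, rfl⟩
    exact hk a ha
  have h2 : algebraMap A R a ∈
      (Submodule.map (Algebra.ofId A R).toLinearMap (maximalIdeal A ^ k)) ^ n := by
    rw [← Submodule.map_pow, ← pow_mul]
    exact ⟨a, ha, rfl⟩
  have h3 := pow_le_pow_left' h1 n h2
  rw [mul_pow] at h3
  refine (mul_le_mul' ?_ ?_ : c.M 1 ^ n * c.M (-1) ^ n ≤ c.M n * c.M (-n)) h3
  · simpa using hp 1 n
  · simpa using hp (-1) n

lemma hkz (n : ℤ) : ∃ k, ∀ a ∈ maximalIdeal A ^ k,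
    algebraMap A R a ∈ c.M n * c.M (-n) := by
  obtain ⟨m, rfl | rfl⟩ := n.eq_nat_or_neg
  · exact c.hkn m
  · obtain ⟨k, hk⟩ := c.hkn m
    refine ⟨k, fun a ha => ?_⟩
    rw [neg_neg, mul_comm]; exact hk a ha

lemma fg [IsNoetherianRing A] (n : ℤ) : (c.M n).FG := by
  obtain ⟨k, hk⟩ := c.hkz n
  obtain ⟨T, T', hT, hT', hx⟩ := Submodule.mem_span_mul_finite_of_mem_mul
    (hk (t ^ k) (Ideal.pow_mem_pow c.tm k))
  have h0 : (c.M 0).FG := by rw [c.M0]; exact BB_fg A R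
  haveI : IsNoetherian A (c.M 0) := isNoetherian_of_fg_of_noetherian _ h0
  let φ : c.M n →ₗ[A] (T' → c.M 0) := LinearMap.pi fun e =>
    ((LinearMap.mulLeft A (e : R)) ∘ₗ (c.M n).subtype).codRestrict (c.M 0) (fun z => by
      have := c.mulM _ _ (e : R) (hT' e.2) z z.2
      simpa using this)
  have hφ : Function.Injective φ := by
    rw [← LinearMap.ker_eq_bot, LinearMap.ker_eq_bot']
    intro z hz
    have h1 : ∀ e ∈ T', e * (z : R) = 0 := fun e he =>
      congrArg Subtype.val (congrFun hz ⟨e, he⟩)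
    have h2 : algebraMap A R (t ^ k) * z = 0 := by
      generalize algebraMap A R (t ^ k) = y at hx
      induction hx using Submodule.span_induction with
      | mem x hx =>
        obtain ⟨a, ha, b, hb, rfl⟩ := Set.mem_mul.1 hx
        rw [mul_assoc, h1 b hb, mul_zero]
      | zero => simp
      | add x y _ _ hx hy => rw [add_mul, hx, hy, add_zero]
      | smul a x _ hx => rw [smul_mul_assoc, hx, smul_zero]
    have h3 : ∀ (k : ℕ) (z : R), t ^ k • z = 0 → z = 0 := by
      intro k
      induction k with
      | zero => simp
      | succ k ih =>
        intro z hz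
        rw [pow_succ', mul_smul] at hz
        exact ih z (c.tinj _ hz)
    rw [← Algebra.smul_def] at h2
    exact Subtype.ext (h3 k z h2)
  haveI := isNoetherian_of_injective φ hφ
  exact Module.Finite.iff_fg.1 inferInstance

lemma one_I (n : ℤ) : ∃ k, ∀ a ∈ maximalIdeal A ^ k, ∀ b ∈ BB A S,
    a • b ∈ (c.M n).map (c.rho n) := by
  obtain ⟨k, hk⟩ := c.hkz n
  refine ⟨k, ?_⟩
  rintro a ha _ ⟨b, rfl⟩
  have key : ∀ x ∈ c.M n * c.M (-n), c.rho 0 x ∈ (c.M n).map (c.rho n) := by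
    intro x hx
    refine Submodule.mul_induction_on hx ?_ ?_
    · intro s hs e he
      obtain ⟨d, hd⟩ := c.rhoM _ e he
      refine ⟨d • s, Submodule.smul_mem _ _ hs, ?_⟩
      have := c.rho_mul n (-n) s e
      rw [neg_add_cancel] at this
      rw [this, c.rho_apply (-n) e, ← hd, map_smul, Algebra.linearMap_apply, Algebra.smul_def,
        mul_comm]
    · intro x y hx hy
      rw [map_add]; exact Submodule.add_mem _ hx hy
  have h1 := key _ (hk a ha)
  rw [rho_apply] at h1
  simp only [neg_zero, zpow_zero, Units.val_one, mul_one, AlgHom.commutes] at h1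
  rw [Algebra.linearMap_apply, Algebra.smul_def, mul_comm, ← Algebra.smul_def]
  exact Submodule.smul_mem _ _ h1

lemma I_le (n : ℤ) : (c.M n).map (c.rho n) ≤ BB A S := by
  rintro _ ⟨z, hz, rfl⟩; exact c.rhoM n z hz

lemma P_fin [IsNoetherianRing A] (n : ℤ) : rl ((c.M n).map (c.rho n)) (BB A S) ≠ ⊤ := by
  obtain ⟨k, hk⟩ := c.one_I n
  exact rl_ne_top (BB_fg A S) k hk

lemma P_zero : rl ((c.M 0).map (c.rho 0)) (BB A S) = 0 := by
  have : (c.M 0).map (c.rho 0) = BB A S := by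
    refine le_antisymm (c.I_le 0) ?_
    rintro _ ⟨a, rfl⟩
    refine ⟨algebraMap A R a, ?_, ?_⟩
    · rw [SetLike.mem_coe, c.M0]; exact ⟨a, rfl⟩
    · rw [rho_apply]; simp
  rw [this, rl_self]

end Core
end CoreA
end

section

universe v w
open scoped Pointwise

namespace Core

variable {A : Type w} [CommRing A] [IsLocalRing A] {R S : Type v} [CommRing R]
    [Algebra A R] [CommRing S] [Algebra A S] {t g h : A} (c : Core A R S t g h)
include c

lemma list_exists [IsNoetherianRing A] : ∃ (k : ℕ) (l : List R), (∀ s ∈ l, s ∈ c.M 1) ∧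
    ∀ a ∈ maximalIdeal A ^ k,
      algebraMap A R a ∈ Submodule.span A {r | ∃ s ∈ l, ∃ e ∈ c.M (-1), r = e * s} := by
  classical
  obtain ⟨k, hk⟩ := c.hk
  obtain ⟨G, hG⟩ : (maximalIdeal A ^ k).FG := IsNoetherian.noetherian _
  have hG' : ∀ a ∈ G, ∃ T T' : Finset R, (T : Set R) ⊆ c.M 1 ∧ (T' : Set R) ⊆ c.M (-1) ∧
      algebraMap A R a ∈ Submodule.span A ((T : Set R) * (T' : Set R)) := fun a ha =>
    Submodule.mem_span_mul_finite_of_mem_mul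
      (hk a (by rw [← hG]; exact Submodule.subset_span ha))
  choose! T T' hT hT' hx using hG'
  refine ⟨k, (G.biUnion T).toList, ?_, ?_⟩
  · intro s hs
    rw [Finset.mem_toList, Finset.mem_biUnion] at hs
    obtain ⟨a, ha, hs⟩ := hs
    exact hT a ha hs
  · intro a ha
    rw [← hG] at ha
    induction ha using Submodule.span_induction with
    | mem a ha =>
      refine Submodule.span_mono ?_ (hx a ha)
      rintro x ⟨s, hs, e, he, rfl⟩
      refine ⟨s, ?_, e, hT' a ha he, mul_comm _ _⟩
      rw [Finset.mem_toList, Finset.mem_biUnion]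
      exact ⟨a, ha, hs⟩
    | zero => simp
    | add x y _ _ hx hy => rw [map_add]; exact Submodule.add_mem _ hx hy
    | smul b x _ hx =>
      rw [smul_eq_mul, map_mul, ← Algebra.smul_def]; exact Submodule.smul_mem _ _ hx

lemma diff_const [IsNoetherianRing A] : ∃ (r : ℕ) (C : ℤ), ∀ n,
    (bd^[r] fun n => ((rl ((c.M n).map (c.rho n)) (BB A S)).toNat : ℤ)) n = C := by
  obtain ⟨k, l, hlm, hkl⟩ := c.list_exists
  have hBm : ∀ r ∈ BB A S, ∀ x ∈ BB A S, r * x ∈ BB A S := by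
    rintro _ ⟨a, rfl⟩ _ ⟨b, rfl⟩
    exact ⟨a * b, by simp⟩
  obtain ⟨K, K', rX, rY, lX, lY, cX, cY, kX, kY, tX, tY, tX', tY', sX, sY, iX, iY, eX, eY,
      qX, qY, hqX, hqY, hq⟩ := koszul_exists t c.red c.u c.M (BB A S) c.mulM c.fg hBm (BB_fg A S)
    c.tinj c.tM c.tS c.kerr c.rhoM (fun n => (rl ((c.M n).map (c.rho n)) (BB A S)).toNat)
    (fun n => (ENat.natCast_toNat (c.P_fin n)).symm) l hlm
  have hfin := K.fin k hkl
  have hfin' := K'.fin k (by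
    intro a ha
    have key : ∀ r ∈ Submodule.span A {r | ∃ s ∈ l, ∃ e ∈ c.M (-1), r = e * s},
        c.rho 0 r ∈ Submodule.span A {r | ∃ s ∈ l.map (fun s => c.red s * ((c.u⁻¹ : Sˣ) : S)),
          ∃ e ∈ BB A S, r = e * s} := by
      intro r hr
      induction hr using Submodule.span_induction with
      | mem r hr =>
        obtain ⟨s, hs, e, he, rfl⟩ := hr
        apply Submodule.subset_span
        refine ⟨_, List.mem_map_of_mem hs, c.rho (-1) e, c.rhoM _ e he, ?_⟩
        have := c.rho_mul (-1) 1 e s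
        rw [add_neg_cancel] at this
        rw [this, c.rho_apply 1, zpow_neg_one]
      | zero => simp
      | add x y _ _ hx hy => rw [map_add]; exact Submodule.add_mem _ hx hy
      | smul b x _ hx => rw [map_smul]; exact Submodule.smul_mem _ _ hx
    have h1 := key _ (hkl a ha)
    rw [rho_apply] at h1
    simpa using h1) 0
  obtain ⟨x, hx⟩ := ENat.ne_top_iff_exists.1 hfin'.1
  obtain ⟨y, hy⟩ := ENat.ne_top_iff_exists.1 hfin'.2
  refine ⟨l.length, (x : ℤ) - y, fun n => ?_⟩
  rw [← hq n]
  have k0 : ∀ z ∈ K.CX n, rX n z = 0 → ∃ w ∈ K.CX n, z = t • w := by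
    intro z hz hz'
    obtain ⟨w, rfl⟩ := kX n z hz'
    exact ⟨w, sX n w hz, rfl⟩
  have k1 : ∀ z ∈ K.CY n, rY n z = 0 → ∃ w ∈ K.CY n, z = t • w := by
    intro z hz hz'
    obtain ⟨w, rfl⟩ := kY n z hz'
    exact ⟨w, sY n w hz, rfl⟩
  have h1 := euler_red t K.e0 K.e1 K.dd0 K.dd1 (K.dCX n) (K.dCY n) tX tY (rX n) (rY n) K'.e0 K'.e1
    (cX n) (cY n) tX' tY' k0 k1 (hfin n).1 (hfin n).2
  have h2 := euler_red_aux t K.e0 K.e1 K.dd0 K.dd1 (K.dCX n) (K.dCY n) tX tY (rX n) (rY n) K'.e0 K'.e1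
    (cX n) (cY n) tX' tY' k0 k1 (hfin n).2
  have h3 : hl K'.e1 K'.e0 ((K.CY n).map (rY n)) ((K.CX n).map (rX n)) ≠ ⊤ := by
    rw [h2]
    have aux : ∀ {E : Type v} [AddCommGroup E] [Module A E] (N'' N' N : Submodule A E),
        N'' ≤ N' → N' ≤ N → rl N'' N ≠ ⊤ → rl N' N ≠ ⊤ := by
      intro E _ _ N'' N' N a b hne htop
      apply hne
      rw [rl_add a b, htop, add_top]
    refine WithTop.add_ne_top.2 ⟨aux _ _ _ le_sup_left ?_ (hfin n).1, aux _ _ _ le_sup_left ?_ (hfin n).2⟩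
    · refine sup_le ?_ ?_
      · rintro _ ⟨z, hz, rfl⟩; exact ⟨K.dCY n z hz, K.dd1 z⟩
      · rintro _ ⟨z, hz, rfl⟩; exact Submodule.smul_mem _ _ hz
    · refine sup_le ?_ ?_
      · rintro _ ⟨z, hz, rfl⟩; exact ⟨K.dCX n z hz, K.dd0 z⟩
      · rintro _ ⟨z, hz, rfl⟩; exact Submodule.smul_mem _ _ hz
  have h4 := euler_sub K'.e0 K'.e1 K'.dd0 K'.dd1 (N0 := K'.CX 0) (N0' := (K.CX n).map (rX n))
    (N1 := K'.CY 0) (N1' := (K.CY n).map (rY n))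
    (by rintro _ ⟨z, hz, rfl⟩; exact iX n z hz) (by rintro _ ⟨z, hz, rfl⟩; exact iY n z hz)
    (K'.dCX 0) (K'.dCY 0)
    (by rintro _ ⟨z, hz, rfl⟩; exact ⟨K.d0 z, K.dCX n z hz, (cX n z).symm⟩)
    (by rintro _ ⟨z, hz, rfl⟩; exact ⟨K.d1 z, K.dCY n z hz, (cY n z).symm⟩)
  rw [hqX, hqY, ← hx, ← hy, ← h1] at h4
  obtain ⟨w, hw⟩ := ENat.ne_top_iff_exists.1 h3
  rw [← hw] at h4
  have h5 : x + qY n + w = y + qX n + w := by exact_mod_cast h4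
  omega

end Core
end

section

universe v w

namespace Core

variable {A : Type w} [CommRing A] [IsLocalRing A] {R S : Type v} [CommRing R]
    [Algebra A R] [CommRing S] [Algebra A S] {t g h : A} (c : Core A R S t g h)
include c

/-- the sum of the two localized modules -/
def Sg (n : ℤ) : Submodule A R := sat g (c.M n) ⊔ sat h (c.M n)

/-- the `t^k`-torsion part -/
def Tk (k : ℕ) (n : ℤ) : Submodule A R :=
  sat (g * h) (c.M n) ⊓ (c.Sg n).comap (LinearMap.lsmul A R (t ^ k))

lemma mem_Tk {k : ℕ} {n : ℤ} {z : R} :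
    z ∈ c.Tk k n ↔ z ∈ sat (g * h) (c.M n) ∧ t ^ k • z ∈ c.Sg n := Iff.rfl

/-- the torsion part -/
def Gm (n : ℤ) : Submodule A R := tors (c.Sg n) (sat (g * h) (c.M n))

lemma sat_t {x : A} {n : ℤ} {z : R} (hz : t • z ∈ sat x (c.M n)) : z ∈ sat x (c.M n) := by
  obtain ⟨k, hk⟩ := hz
  exact ⟨k, c.tM n _ (by rwa [smul_comm])⟩

lemma sat_gh_left {E : Type*} [AddCommGroup E] [Module A E] (N : Submodule A E) :
    sat g N ≤ sat (g * h) N := by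
  rintro z ⟨k, hk⟩
  exact ⟨k, by rw [mul_pow, mul_comm, mul_smul]; exact N.smul_mem _ hk⟩

lemma sat_gh_right {E : Type*} [AddCommGroup E] [Module A E] (N : Submodule A E) :
    sat h N ≤ sat (g * h) N := by
  rintro z ⟨k, hk⟩
  exact ⟨k, by rw [mul_pow, mul_smul]; exact N.smul_mem _ hk⟩

lemma Sg_le (n : ℤ) : c.Sg n ≤ sat (g * h) (c.M n) :=
  sup_le (c.sat_gh_left _) (c.sat_gh_right _)

lemma Sg_le_Tk (k : ℕ) (n : ℤ) : c.Sg n ≤ c.Tk k n := fun _ hz =>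
  ⟨c.Sg_le n hz, Submodule.smul_mem _ _ hz⟩

lemma Sg_le_Gm (n : ℤ) : c.Sg n ≤ c.Gm n := fun _ hz =>
  ⟨c.Sg_le n hz, 0, fun _ _ => Submodule.smul_mem _ _ hz⟩

lemma rho_sat {x : A} {n : ℤ} {z : R} (hz : z ∈ sat x (c.M n)) : c.rho n z ∈ sat x (BB A S) := by
  obtain ⟨k, hk⟩ := hz
  exact ⟨k, by rw [← map_smul]; exact c.rhoM n _ hk⟩

lemma lift_sat {x : A} (hx : x ∈ maximalIdeal A) (ux : IsUnit (algebraMap A R x))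
    (n : ℤ) {b : S} (hb : b ∈ sat x (BB A S)) : ∃ α ∈ sat x (c.M n), c.rho n α = b := by
  obtain ⟨k, hk⟩ := hb
  obtain ⟨l, hl⟩ := c.one_I n
  obtain ⟨z, hz, hz'⟩ := hl (x ^ l) (Ideal.pow_mem_pow hx l) _ hk
  rw [← mul_smul, ← pow_add] at hz'
  have ux' : IsUnit (algebraMap A R (x ^ (l + k))) := by rw [map_pow]; exact ux.pow _
  obtain ⟨v, hv⟩ := ux'
  have e : x ^ (l + k) • ((v⁻¹ : Rˣ) * z) = z := by
    rw [Algebra.smul_def, ← hv, ← mul_assoc, Units.mul_inv, one_mul]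
  refine ⟨(v⁻¹ : Rˣ) * z, ⟨l + k, by rw [e]; exact hz⟩, ?_⟩
  have us : IsUnit (algebraMap A S (x ^ (l + k))) := by
    rw [← c.red.commutes, ← hv]; exact v.isUnit.map c.red
  apply us.mul_left_cancel
  rw [← Algebra.smul_def, ← map_smul, e, hz', Algebra.smul_def]

/-- pairs with cancelling reductions -/
def Pb (n : ℤ) : Submodule A (R × R) :=
  (sat g (c.M n)).prod (sat h (c.M n)) ⊓ LinearMap.ker ((c.rho n).coprod (c.rho n))

lemma mem_Pb {n : ℤ} {α β : R} : (α, β) ∈ c.Pb n ↔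
    (α ∈ sat g (c.M n) ∧ β ∈ sat h (c.M n)) ∧ c.rho n α + c.rho n β = 0 := by
  simp [Pb]

lemma P_eq (n : ℤ) : rl ((c.M n).map (c.rho n)) (BB A S) = rl (c.Sg n) (c.Tk 1 n) := by
  have e1 : rl (c.Pb n ⊓ ((c.M n).map (c.rho n)).comap (c.rho n ∘ₗ LinearMap.fst A R R)) (c.Pb n) =
      rl ((c.M n).map (c.rho n)) (BB A S) := by
    refine rl_eq (c.rho n ∘ₗ LinearMap.fst A R R) ?_ ?_ ?_
    · rintro ⟨α, β⟩ hz
      obtain ⟨⟨h1, h2⟩, h3⟩ := c.mem_Pb.1 hz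
      refine c.satB ⟨c.rho_sat h1, ?_⟩
      change c.rho n α ∈ _
      rw [eq_neg_of_add_eq_zero_left h3]
      exact Submodule.neg_mem _ (c.rho_sat h2)
    · intro z hz
      exact ⟨fun h => ⟨hz, h⟩, fun h => h.2⟩
    · intro b hb
      obtain ⟨α, hα, h1⟩ := c.lift_sat c.gm c.ug n (le_sat g _ hb)
      obtain ⟨β, hβ, h2⟩ := c.lift_sat c.hm c.uh n (le_sat h _ (Submodule.neg_mem _ hb))
      refine ⟨(α, β), c.mem_Pb.2 ⟨⟨hα, hβ⟩, by rw [h1, h2, add_neg_cancel]⟩, ?_⟩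
      change b - c.rho n α ∈ _
      rw [h1, sub_self]; exact Submodule.zero_mem _
  have e2 : rl (c.Sg n) (c.Tk 1 n) =
      rl ((c.Sg n).map (LinearMap.lsmul A R t)) ((c.Tk 1 n).map (LinearMap.lsmul A R t)) := by
    refine rl_eq (LinearMap.lsmul A R t) (fun z hz => ⟨z, hz, rfl⟩) ?_ ?_
    · intro z hz
      constructor
      · rintro ⟨w, hw, hwz⟩
        have : t • (w - z) = 0 := by
          rw [smul_sub, sub_eq_zero]; exact hwz
        rw [← sub_eq_zero.1 (c.tinj _ this)]; exact hw
      · intro hz'; exact ⟨z, hz', rfl⟩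
    · rintro _ ⟨z, hz, rfl⟩
      exact ⟨z, hz, by rw [sub_self]; exact Submodule.zero_mem _⟩
  rw [← e1, e2]
  refine rl_eq (LinearMap.coprod LinearMap.id LinearMap.id) ?_ ?_ ?_
  · rintro ⟨α, β⟩ hz
    obtain ⟨⟨h1, h2⟩, h3⟩ := c.mem_Pb.1 hz
    rw [← map_add] at h3
    obtain ⟨w, hw⟩ := c.rho_ker n _ h3
    have hs : α + β ∈ c.Sg n := Submodule.add_mem_sup h1 h2
    refine ⟨w, c.mem_Tk.2 ⟨?_, ?_⟩, ?_⟩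
    · exact c.sat_t (by rw [← hw]; exact c.Sg_le n hs)
    · rw [pow_one, ← hw]; exact hs
    · simp [hw]
  · rintro ⟨α, β⟩ hz
    obtain ⟨⟨h1, h2⟩, h3⟩ := c.mem_Pb.1 hz
    constructor
    · rintro ⟨w, hw, hwz⟩
      refine ⟨hz, ?_⟩
      obtain ⟨α', hα', β', hβ', rfl⟩ := Submodule.mem_sup.1 hw
      have e : t • α' + t • β' = α + β := by
        rw [← smul_add]; simpa using hwz
      refine ⟨α - t • α', c.satM n ⟨Submodule.sub_mem _ h1 (Submodule.smul_mem _ _ hα'), ?_⟩, ?_⟩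
      · have : α - t • α' = -(β - t • β') := by linear_combination -e
        rw [this]
        exact Submodule.neg_mem _ (Submodule.sub_mem _ h2 (Submodule.smul_mem _ _ hβ'))
      · rw [map_sub, c.rho_t, sub_zero]; rfl
    · rintro ⟨-, z, hzM, hzα⟩
      change c.rho n z = c.rho n α at hzα
      obtain ⟨w1, hw1⟩ := c.rho_ker n (α - z) (by rw [map_sub, hzα, sub_self])
      obtain ⟨w2, hw2⟩ := c.rho_ker n (β + z) (by rw [map_add, hzα, add_comm, h3])
      refine ⟨w1 + w2, Submodule.add_mem_sup ?_ ?_, ?_⟩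
      · exact c.sat_t (by rw [← hw1]; exact Submodule.sub_mem _ h1 (le_sat _ _ hzM))
      · exact c.sat_t (by rw [← hw2]; exact Submodule.add_mem _ h2 (le_sat _ _ hzM))
      · change t • (w1 + w2) = α + β
        rw [smul_add, ← hw1, ← hw2]; ring
  · rintro _ ⟨w, hw, rfl⟩
    have := (c.mem_Tk.1 hw).2
    rw [pow_one] at this
    obtain ⟨α, hα, β, hβ, e⟩ := Submodule.mem_sup.1 this
    refine ⟨(α, β), c.mem_Pb.2 ⟨⟨hα, hβ⟩, by rw [← map_add, e, c.rho_t]⟩, ?_⟩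
    have : LinearMap.lsmul A R t w - (LinearMap.coprod LinearMap.id LinearMap.id : R × R →ₗ[A] R) (α, β) = 0 := by
      simp [e]
    rw [this]; exact Submodule.zero_mem _

lemma T0_le : c.Tk 1 0 ≤ c.Sg 0 := le_of_rl_eq_zero (by rw [← c.P_eq, c.P_zero])

lemma Tk0_le (k : ℕ) : c.Tk k 0 ≤ c.Sg 0 := by
  induction k with
  | zero => intro z hz; simpa using (c.mem_Tk.1 hz).2
  | succ k ih =>
    intro z hz
    obtain ⟨h1, h2⟩ := c.mem_Tk.1 hz
    apply ih
    refine c.mem_Tk.2 ⟨h1, c.T0_le (c.mem_Tk.2 ⟨Submodule.smul_mem _ _ h1, ?_⟩)⟩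
    rwa [pow_one, ← mul_smul, ← pow_succ']

lemma mul_sat {x : A} {k n : ℤ} {r z : R} (hr : r ∈ c.M k) (hz : z ∈ sat x (c.M n)) :
    r * z ∈ sat x (c.M (n + k)) := by
  obtain ⟨l, hl⟩ := hz
  exact ⟨l, by rw [← mul_smul_comm]; exact c.mulM _ _ r hr _ hl⟩

lemma mul_Sg {k n : ℤ} {r z : R} (hr : r ∈ c.M k) (hz : z ∈ c.Sg n) : r * z ∈ c.Sg (n + k) := by
  obtain ⟨α, hα, β, hβ, rfl⟩ := Submodule.mem_sup.1 hz
  rw [mul_add]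
  exact Submodule.add_mem_sup (c.mul_sat hr hα) (c.mul_sat hr hβ)

lemma unif (n : ℤ) : ∃ K, ∀ a ∈ maximalIdeal A ^ K, ∀ k, ∀ z ∈ c.Tk k n,
    a • z ∈ c.Sg n := by
  obtain ⟨K, hK⟩ := c.hkz n
  refine ⟨K, fun a ha k z hz => ?_⟩
  rw [Algebra.smul_def]
  refine Submodule.mul_induction_on (C := fun x => x * z ∈ c.Sg n) (hK a ha) ?_ ?_
  · intro s hs e he
    have h1 : e * z ∈ c.Sg (n + -n) := by
      have := c.mem_Tk.1 hz
      rw [add_neg_cancel]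
      apply c.Tk0_le k
      refine c.mem_Tk.2 ⟨?_, ?_⟩
      · have h2 := c.mul_sat he this.1
        rwa [add_neg_cancel] at h2
      · have h2 := c.mul_Sg he this.2
        rwa [add_neg_cancel, mul_smul_comm] at h2
    have h2 := c.mul_Sg hs h1
    rw [add_neg_cancel, zero_add] at h2
    rwa [mul_assoc]
  · intro x y hx hy
    rw [add_mul]; exact Submodule.add_mem _ hx hy

lemma Gm_le (n : ℤ) : ∃ k, c.Gm n ≤ c.Tk k n := by
  obtain ⟨K, hK⟩ := c.unif n
  refine ⟨K, ?_⟩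
  rintro z ⟨hz, k, hk⟩
  exact ⟨hz, hK _ (Ideal.pow_mem_pow c.tm K) k z ⟨hz, hk _ (Ideal.pow_mem_pow c.tm k)⟩⟩

lemma Tk_le_Gm (k : ℕ) (n : ℤ) : c.Tk k n ≤ c.Gm n := by
  intro z hz
  obtain ⟨K, hK⟩ := c.unif n
  exact ⟨hz.1, K, fun a ha => hK a ha k z hz⟩

lemma Tk_mono (k : ℕ) (n : ℤ) : c.Tk k n ≤ c.Tk (k + 1) n := by
  intro z hz
  refine ⟨hz.1, ?_⟩
  change t ^ (k + 1) • z ∈ c.Sg n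
  rw [pow_succ', mul_smul]
  exact Submodule.smul_mem _ _ hz.2

lemma fin_Tk [IsNoetherianRing A] (k : ℕ) (n : ℤ) : rl (c.Sg n) (c.Tk k n) ≠ ⊤ := by
  induction k with
  | zero =>
    have : c.Tk 0 n = c.Sg n := le_antisymm (fun z hz => by simpa using (c.mem_Tk.1 hz).2)
      (c.Sg_le_Tk 0 n)
    rw [this, rl_self]; simp
  | succ k ih =>
    rw [rl_add (c.Sg_le_Tk k n) (c.Tk_mono k n)]
    refine WithTop.add_ne_top.2 ⟨ih, ?_⟩
    refine ne_top_of_le_ne_top (c.P_eq n ▸ c.P_fin n : rl (c.Sg n) (c.Tk 1 n) ≠ ⊤) ?_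
    refine rl_le (LinearMap.lsmul A R (t ^ k)) ?_ ?_
    · intro z hz
      refine ⟨Submodule.smul_mem _ _ hz.1, ?_⟩
      change t ^ 1 • t ^ k • z ∈ c.Sg n
      rw [← mul_smul, ← pow_add, add_comm]; exact hz.2
    · intro z hz
      exact ⟨fun h => ⟨hz.1, h⟩, fun h => h.2⟩

lemma fin_Gm [IsNoetherianRing A] (n : ℤ) : rl (c.Sg n) (c.Gm n) ≠ ⊤ := by
  obtain ⟨k, hk⟩ := c.Gm_le n
  have := c.fin_Tk k n
  rw [rl_add (c.Sg_le_Gm n) hk] at this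
  exact (WithTop.add_ne_top.1 this).1

lemma P_le [IsNoetherianRing A] (n : ℤ) : rl ((c.M n).map (c.rho n)) (BB A S) ≤
    rl (sat g (BB A S) ⊔ sat h (BB A S))
    (tors (sat g (BB A S) ⊔ sat h (BB A S)) (sat (g * h) (BB A S))) := by
  set Q := c.Sg n ⊔ (c.Gm n).map (LinearMap.lsmul A R t) with hQ
  have hQ' : Q ≤ c.Gm n := sup_le (c.Sg_le_Gm n) (by
    rintro _ ⟨z, hz, rfl⟩; exact Submodule.smul_mem _ _ hz)
  have e1 : rl (c.Sg n) (c.Gm n) = rl (c.Sg n) Q + rl Q (c.Gm n) := rl_add le_sup_left hQ'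
  have e2 : rl (c.Sg n) (c.Gm n) = rl (c.Sg n) (c.Tk 1 n) + rl (c.Tk 1 n) (c.Gm n) :=
    rl_add (c.Sg_le_Tk 1 n) (c.Tk_le_Gm 1 n)
  have e3 : rl (c.Tk 1 n) (c.Gm n) = rl (c.Sg n) Q := by
    refine rl_eq (LinearMap.lsmul A R t) ?_ ?_ ?_
    · intro z hz; exact Submodule.mem_sup_right ⟨z, hz, rfl⟩
    · intro z hz
      constructor
      · intro h; exact ⟨hz.1, by simpa using h⟩
      · intro h; simpa using h.2
    · intro p hp
      obtain ⟨a, ha, _, ⟨b, hb, rfl⟩, rfl⟩ := Submodule.mem_sup.1 hp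
      exact ⟨b, hb, by simpa using ha⟩
  have hf : rl (c.Sg n) Q ≠ ⊤ := by
    have := c.fin_Gm n
    rw [e1] at this
    exact (WithTop.add_ne_top.1 this).1
  have e4 : rl (c.Sg n) (c.Tk 1 n) = rl Q (c.Gm n) := by
    rw [e3, e1, add_comm] at e2
    exact (ENat.add_left_injective_of_ne_top hf e2).symm
  rw [c.P_eq, e4]
  refine rl_le (c.rho n) ?_ ?_
  · rintro z ⟨hz, k, hk⟩
    refine ⟨c.rho_sat hz, k, fun a ha => ?_⟩
    obtain ⟨α, hα, β, hβ, e⟩ := Submodule.mem_sup.1 (hk a ha)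
    rw [← map_smul, ← e, map_add]
    exact Submodule.add_mem_sup (c.rho_sat hα) (c.rho_sat hβ)
  · intro z hz
    constructor
    · intro hz'
      obtain ⟨b, hb, b', hb', e⟩ := Submodule.mem_sup.1 hz'
      obtain ⟨α, hα, rfl⟩ := c.lift_sat c.gm c.ug n hb
      obtain ⟨β, hβ, rfl⟩ := c.lift_sat c.hm c.uh n hb'
      obtain ⟨w, hw⟩ := c.rho_ker n (z - (α + β)) (by rw [map_sub, map_add, e, sub_self])
      have hs : α + β ∈ c.Sg n := Submodule.add_mem_sup hα hβ
      rw [hQ, Submodule.mem_sup]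
      have htw : t • w ∈ c.Gm n := by
        rw [← hw]; exact Submodule.sub_mem _ hz (c.Sg_le_Gm n hs)
      refine ⟨_, hs, t • w, ⟨w, ?_, rfl⟩, by rw [← hw]; ring⟩
      obtain ⟨k, hk⟩ := c.Gm_le n
      have h2 := hk htw
      apply c.Tk_le_Gm (k + 1) n
      refine c.mem_Tk.2 ⟨c.sat_t htw.1, ?_⟩
      rw [pow_succ, mul_smul]; exact h2.2
    · intro hz'
      obtain ⟨a, ha, _, ⟨b, hb, rfl⟩, rfl⟩ := Submodule.mem_sup.1 hz'
      obtain ⟨α, hα, β, hβ, rfl⟩ := Submodule.mem_sup.1 ha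
      rw [map_add, map_add, LinearMap.lsmul_apply, c.rho_t, add_zero]
      exact Submodule.add_mem_sup (c.rho_sat hα) (c.rho_sat hβ)

theorem main [IsNoetherianRing A] : ∃ z ∈ c.M 1, ∃ z' ∈ c.M (-1), z * z' = 1 := by
  obtain ⟨r, C, hC⟩ := c.diff_const
  have h0 := bd_iter_const _ (rl (sat g (BB A S) ⊔ sat h (BB A S))
    (tors (sat g (BB A S) ⊔ sat h (BB A S)) (sat (g * h) (BB A S)))).toNat (fun n => by
      rw [abs_of_nonneg (by positivity)]
      exact_mod_cast ENat.toNat_le_toNat (c.P_le n) c.fin) r C hC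
  have h1 : ∀ n, BB A S ≤ (c.M n).map (c.rho n) := by
    intro n
    apply le_of_rl_eq_zero
    have := h0 n
    simp only [c.P_zero] at this
    rw [← ENat.natCast_toNat (c.P_fin n)]
    exact_mod_cast this
  have one : (1 : S) ∈ BB A S := ⟨1, by simp⟩
  obtain ⟨z, hz, ez⟩ := h1 1 one
  obtain ⟨z', hz', ez'⟩ := h1 (-1) one
  have hm : z' * z ∈ c.M 0 := by
    have := c.mulM _ _ z' hz' z hz
    simpa using this
  have e1 : c.red (z' * z) = 1 := by
    have := c.rho_mul (-1) 1 z' z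
    rw [ez, ez', c.rho_apply] at this
    simpa using this
  obtain ⟨w, hw⟩ := c.kerr (z' * z - 1) (by rw [map_sub, e1, map_one, sub_self])
  have hw0 : w ∈ c.M 0 := by
    apply c.tM
    rw [← hw]
    refine Submodule.sub_mem _ hm ?_
    rw [c.M0]; exact ⟨1, by simp⟩
  rw [c.M0] at hw0
  obtain ⟨a, rfl⟩ := hw0
  have hu : IsUnit (1 + t * a) := by
    by_contra hn
    have h2 : (1 + t * a) ∈ maximalIdeal A := hn
    have h3 : (1 : A) ∈ maximalIdeal A := by
      have := Ideal.sub_mem _ h2 (Ideal.mul_mem_right a _ c.tm)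
      simpa using this
    exact (IsLocalRing.maximalIdeal.isMaximal A).ne_top ((Ideal.eq_top_iff_one _).2 h3)
  obtain ⟨v, hv⟩ := hu
  refine ⟨z, hz, (v⁻¹ : Aˣ) • z', Submodule.smul_mem _ ((v⁻¹ : Aˣ) : A) hz', ?_⟩
  have e2 : z' * z = algebraMap A R v := by
    rw [hv, map_add, map_one, map_mul]
    rw [Algebra.linearMap_apply, Algebra.smul_def] at hw
    linear_combination hw
  change z * (((v⁻¹ : Aˣ) : A) • z') = 1
  rw [mul_smul_comm, mul_comm, e2, Algebra.smul_def, ← map_mul]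
  simp

end Core
end

section

section elem
variable {A : Type*} [CommRing A]

/-- `(x,y)` weakly regular, elementwise -/
def Reg2 (A : Type*) [CommRing A] (x y : A) : Prop :=
  (∀ z : A, x * z = 0 → z = 0) ∧ ∀ z w : A, y * z = x * w → ∃ v, z = x * v

lemma Reg2.pow_right {x y : A} (h : Reg2 A x y) (k : ℕ) : Reg2 A x (y ^ k) := by
  refine ⟨h.1, ?_⟩
  induction k with
  | zero => intro z w e; exact ⟨w, by simpa using e⟩
  | succ k ih =>
    intro z w e
    rw [pow_succ', mul_assoc] at e
    obtain ⟨v, hv⟩ := h.2 _ _ e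
    exact ih _ _ hv

lemma Reg2.pow_left {x y : A} (h : Reg2 A x y) (k : ℕ) : Reg2 A (x ^ k) y := by
  have h1 : ∀ k : ℕ, ∀ z : A, x ^ k * z = 0 → z = 0 := by
    intro k
    induction k with
    | zero => simp
    | succ k ih =>
      intro z hz
      rw [pow_succ', mul_assoc] at hz
      exact ih _ (h.1 _ hz)
  refine ⟨h1 k, ?_⟩
  induction k with
  | zero => intro z w e; exact ⟨z, by simp⟩
  | succ k ih =>
    intro z w e
    rw [pow_succ', mul_assoc] at e
    obtain ⟨v, rfl⟩ := h.2 _ _ e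
    have : y * v = x ^ k * w := by
      rw [← sub_eq_zero]; apply h.1; linear_combination e
    obtain ⟨v', rfl⟩ := ih _ _ this
    exact ⟨v', by ring⟩

lemma Reg2.pow {x y : A} (h : Reg2 A x y) (k l : ℕ) : Reg2 A (x ^ k) (y ^ l) :=
  (h.pow_left k).pow_right l

/-- the fundamental divisibility fact -/
lemma Reg2.dvd {x y s c : A} (h : Reg2 A x y) (hs : ∀ z, s * z = 0 → z = 0)
    (h1 : s ∣ x * c) (h2 : s ∣ y * c) : s ∣ c := by
  obtain ⟨a, ha⟩ := h1
  obtain ⟨b, hb⟩ := h2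
  have e : y * a = x * b := by
    rw [← sub_eq_zero]; apply hs; linear_combination x * hb - y * ha
  obtain ⟨v, rfl⟩ := h.2 _ _ e
  refine ⟨v, ?_⟩
  rw [← sub_eq_zero]; apply h.1; linear_combination ha

lemma Reg2.colon {g h : A} (H : Reg2 A g h) (H' : Reg2 A h g) (j k : ℕ) {e b1 b2 : A}
    (he : (g * h) ^ j * e = b1 * h ^ (j + k) + b2 * g ^ (j + k)) :
    ∃ c1 c2, e = c1 * h ^ k + c2 * g ^ k := by
  obtain ⟨v, rfl⟩ := (H.pow j (j + k)).2 b1 (h ^ j * e - b2 * g ^ k) (by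
    rw [mul_pow, pow_add, pow_add] at he; rw [pow_add]; linear_combination -he)
  have h1 : h ^ j * e - b2 * g ^ k = v * h ^ (j + k) := by
    rw [← sub_eq_zero]; apply (H.pow_left j).1
    rw [mul_pow, pow_add, pow_add] at he; rw [pow_add]; linear_combination he
  obtain ⟨w, rfl⟩ := (H'.pow j k).2 b2 (e - v * h ^ k) (by
    rw [pow_add] at h1; linear_combination -h1)
  refine ⟨v, w, ?_⟩
  rw [← sub_eq_zero]; apply (H'.pow_left j).1
  rw [pow_add] at h1; linear_combination h1

end elem

section fin
variable {A : Type*} [CommRing A] {S : Type*} [CommRing S] [Algebra A S] {g h : A}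

lemma mem_BB {z : S} : z ∈ BB A S ↔ ∃ a, algebraMap A S a = z := by
  simp [BB, LinearMap.mem_range]

lemma mem_sup_sat (ug : IsUnit (algebraMap A S g)) (uh : IsUnit (algebraMap A S h)) {z : S} :
    z ∈ sat g (BB A S) ⊔ sat h (BB A S) ↔ ∃ (l : ℕ) (b1 b2 : A),
      algebraMap A S ((g * h) ^ l) * z = algebraMap A S (b1 * h ^ l + b2 * g ^ l) := by
  rw [Submodule.mem_sup]
  constructor
  · rintro ⟨z1, ⟨k, hk⟩, z2, ⟨k', hk'⟩, rfl⟩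
    obtain ⟨c, hc⟩ := mem_BB.1 hk
    obtain ⟨c', hc'⟩ := mem_BB.1 hk'
    refine ⟨k + k', c * g ^ k', c' * h ^ k, ?_⟩
    rw [Algebra.smul_def] at hc hc'
    simp only [map_mul, map_pow, map_add, mul_pow, pow_add, hc, hc'] at *
    linear_combination
  · rintro ⟨l, b1, b2, e⟩
    obtain ⟨x, hx⟩ := (ug.pow l).exists_left_inv
    obtain ⟨y, hy⟩ := (uh.pow l).exists_left_inv
    refine ⟨algebraMap A S b1 * x, ⟨l, mem_BB.2 ⟨b1, ?_⟩⟩, algebraMap A S b2 * y,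
      ⟨l, mem_BB.2 ⟨b2, ?_⟩⟩, ?_⟩
    · rw [Algebra.smul_def, map_pow]; linear_combination -algebraMap A S b1 * hx
    · rw [Algebra.smul_def, map_pow]; linear_combination -algebraMap A S b2 * hy
    · simp only [map_mul, map_pow, map_add, mul_pow] at e
      linear_combination (-algebraMap A S b1 * x + z) * hy  +
        (-algebraMap A S b2 * y + algebraMap A S h ^ l * y * z) * hx + x * y * (-e)

/-- the image of `A` in `S`, as a ring -/
abbrev BR (A S : Type*) [CommRing A] [CommRing S] [Algebra A S] := (algebraMap A S).range

abbrev toBR (S : Type*) {A : Type*} [CommRing A] [CommRing S] [Algebra A S] (a : A) : BR A S :=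
  (algebraMap A S).rangeRestrict a

lemma key_colon (ug : IsUnit (algebraMap A S g)) (uh : IsUnit (algebraMap A S h))
    (H : Reg2 (BR A S) (toBR S g) (toBR S h)) (H' : Reg2 (BR A S) (toBR S h) (toBR S g))
    {z : S} {k : ℕ} {e : A} (he : algebraMap A S ((g * h) ^ k) * z = algebraMap A S e)
    (hz : z ∈ sat g (BB A S) ⊔ sat h (BB A S)) :
    ∃ c1 c2, algebraMap A S e = algebraMap A S (c1 * h ^ k + c2 * g ^ k) := by
  obtain ⟨l, b1, b2, e2⟩ := (mem_sup_sat ug uh).1 hz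
  have := Reg2.colon H H' l k (e := toBR S e) (b1 := toBR S (b1 * g ^ k)) (b2 := toBR S (b2 * h ^ k)) (by
    apply Subtype.ext
    simp only [map_mul, map_pow, map_add, Subring.coe_mul, Subring.coe_add, Subring.coe_pow,
      RingHom.coe_rangeRestrict, ] at *
    rw [pow_add, pow_add, ← he]
    linear_combination (algebraMap A S g * algebraMap A S h) ^ k * e2)
  obtain ⟨⟨_, c1, rfl⟩, ⟨_, c2, rfl⟩, hc⟩ := this
  refine ⟨c1, c2, ?_⟩
  have := congrArg Subtype.val hc
  simpa using this

lemma satB_lemma (ug : IsUnit (algebraMap A S g))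
    (H : Reg2 (BR A S) (toBR S g) (toBR S h)) :
    sat g (BB A S) ⊓ sat h (BB A S) ≤ BB A S := by
  rintro z ⟨⟨k, hk⟩, ⟨l, hl⟩⟩
  obtain ⟨c, hc⟩ := mem_BB.1 hk
  obtain ⟨c', hc'⟩ := mem_BB.1 hl
  rw [Algebra.smul_def] at hc hc'
  obtain ⟨⟨_, v, rfl⟩, hv⟩ := (H.pow k l).2 (toBR S c) (toBR S c') (by
    apply Subtype.ext
    simp only [map_mul, map_pow, map_add, Subring.coe_mul, Subring.coe_add, Subring.coe_pow,
      RingHom.coe_rangeRestrict, ] at *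
    rw [hc, hc']; ring)
  refine mem_BB.2 ⟨v, ?_⟩
  have := congrArg Subtype.val hv
  simp at this
  rw [hc, map_pow] at this
  exact ((ug.pow k).mul_left_cancel this).symm

lemma uniform_fg [IsLocalRing A] {E : Type*} [AddCommGroup E] [Module A E] {N N' : Submodule A E}
    (hN : N.FG)
    (hz : ∀ z ∈ N, ∃ k : ℕ, ∀ a ∈ maximalIdeal A ^ k, a • z ∈ N') :
    ∃ k : ℕ, ∀ a ∈ maximalIdeal A ^ k, ∀ z ∈ N, a • z ∈ N' := by
  obtain ⟨s, rfl⟩ := hN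
  choose! k hk using hz
  refine ⟨s.sup k, fun a ha z hz => ?_⟩
  induction hz using Submodule.span_induction with
  | mem x hx => exact hk x (Submodule.subset_span hx) a (Ideal.pow_le_pow_right (Finset.le_sup hx) ha)
  | zero => simp
  | add x y _ _ hx hy => rw [smul_add]; exact N'.add_mem hx hy
  | smul b x _ hx => rw [smul_comm]; exact N'.smul_mem _ hx

lemma fin_lemma [IsLocalRing A] [IsNoetherianRing A] (gm : g ∈ maximalIdeal A)
    (ug : IsUnit (algebraMap A S g)) (uh : IsUnit (algebraMap A S h))
    (H : Reg2 (BR A S) (toBR S g) (toBR S h)) (H' : Reg2 (BR A S) (toBR S h) (toBR S g))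
    (vii : ∀ (k : ℕ) (b : A) (K : ℕ),
      (∀ a ∈ maximalIdeal A ^ K, ∃ c1 c2, algebraMap A S (a * b) =
        algebraMap A S (c1 * h ^ k + c2 * g ^ k)) →
      (∃ c1 c2, algebraMap A S (g * b) = algebraMap A S (c1 * h ^ k + c2 * g ^ k)) ∧
      (∃ c1 c2, algebraMap A S (h * b) = algebraMap A S (c1 * h ^ k + c2 * g ^ k))) :
    rl (sat g (BB A S) ⊔ sat h (BB A S))
    (tors (sat g (BB A S) ⊔ sat h (BB A S)) (sat (g * h) (BB A S))) ≠ ⊤ := by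
  set Q := sat g (BB A S) ⊔ sat h (BB A S) with hQ
  obtain ⟨w, hw⟩ := (ug.mul uh).exists_left_inv
  let f : A →ₗ[A] S := LinearMap.mulRight A w ∘ₗ Algebra.linearMap A S
  have hf : ∀ a, f a = algebraMap A S a * w := fun a => rfl
  set Gt := tors Q (sat (g * h) (BB A S))
  let N : Submodule A A := Gt.comap f
  let N' : Submodule A A := Q.comap f
  have hN : N.FG := IsNoetherian.noetherian N
  rw [← rl_eq f (N := N) (N' := N') (fun z hz => hz) (fun z hz => Iff.rfl)]
  · -- finite length
    have : ∃ k : ℕ, ∀ a ∈ maximalIdeal A ^ k, ∀ z ∈ N, a • z ∈ N' := by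
      have hz : ∀ z ∈ N, ∃ k : ℕ, ∀ a ∈ maximalIdeal A ^ k, a • z ∈ N' := by
        rintro z ⟨-, k, hk⟩
        refine ⟨k, fun a ha => ?_⟩
        change f (a • z) ∈ Q
        rw [map_smul]; exact hk a ha
      exact uniform_fg hN hz
    obtain ⟨k, hk⟩ := this
    exact rl_ne_top hN k hk
  · have hQG : Q ≤ Gt := fun z hz => ⟨by
      refine (sup_le ?_ ?_ : Q ≤ _) hz
      · rintro y ⟨k, hk⟩
        exact ⟨k, by rw [mul_comm, mul_pow, mul_smul]; exact Submodule.smul_mem _ _ hk⟩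
      · rintro y ⟨k, hk⟩
        exact ⟨k, by rw [mul_pow, mul_smul]; exact Submodule.smul_mem _ _ hk⟩,
      0, fun a _ => Submodule.smul_mem _ _ hz⟩
    intro z hzG
    obtain ⟨⟨k, hk⟩, K, hK⟩ := id hzG
    obtain ⟨b, hb⟩ : ∃ b, algebraMap A S b = algebraMap A S ((g * h) ^ (k + 1)) * z := by
      obtain ⟨b, hb⟩ := mem_BB.1 hk
      rw [Algebra.smul_def] at hb
      exact ⟨g * h * b, by rw [map_mul, hb, pow_succ', map_mul _ (g * h), mul_assoc]⟩
    obtain ⟨⟨c1, c2, h1⟩, d1, d2, h2⟩ := vii (k + 1) b K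
      (fun a ha => key_colon ug uh H H' (z := a • z) (by
      rw [Algebra.smul_def, map_mul _ a b, hb]; ring) (hK a ha))
    have hhz : algebraMap A S h * z ∈ Q := (mem_sup_sat ug uh).2 ⟨k + 1, d1, d2, by
      rw [← h2, map_mul _ h, hb]; ring⟩
    obtain ⟨x, hx⟩ := ug.exists_left_inv
    have hy : algebraMap A S h * z - algebraMap A S (c1 * h) * x ^ (k + 2) ∈ Q := by
      refine Q.sub_mem hhz (Submodule.mem_sup_left ⟨k + 2, mem_BB.2 ⟨c1 * h, ?_⟩⟩)
      have : (x * algebraMap A S g) ^ (k + 2) = 1 := by rw [hx, one_pow]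
      rw [mul_pow] at this
      rw [Algebra.smul_def, map_pow]
      linear_combination (-algebraMap A S (c1 * h)) * this
    have hxg : (x * algebraMap A S g) ^ (k + 2) = 1 := by rw [hx, one_pow]
    have hgz : algebraMap A S ((g * h) ^ (k + 1)) * (algebraMap A S g * z) =
        algebraMap A S (c1 * h ^ (k + 1) + c2 * g ^ (k + 1)) := by
      rw [← h1, map_mul, hb]; ring
    obtain ⟨p, q, hpq⟩ := key_colon ug uh H H' (k := k + 1) (e := c2 * g ^ k * h) (by
      apply ug.mul_left_cancel
      simp only [map_mul, map_pow, map_add, mul_pow] at *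
      linear_combination (algebraMap A S h) * hgz -
        (algebraMap A S c1 * algebraMap A S h ^ (k + 2)) * hxg) hy
    obtain ⟨⟨_, q', rfl⟩, hq'⟩ := (H'.pow_right (k + 1)).2 (toBR S q)
      (toBR S (c2 * g ^ k - p * h ^ k)) (by
      apply Subtype.ext
      simp only [map_mul, map_pow, map_add, map_sub, Subring.coe_mul, Subring.coe_add,
        Subring.coe_pow, AddSubgroupClass.coe_sub, RingHom.coe_rangeRestrict] at *
      linear_combination -hpq)
    have hq2 : algebraMap A S q = algebraMap A S h * algebraMap A S q' := congrArg Subtype.val hq'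
    have h3 : algebraMap A S c2 * algebraMap A S g ^ k = algebraMap A S p * algebraMap A S h ^ k +
        algebraMap A S q' * algebraMap A S g ^ (k + 1) := by
      apply uh.mul_left_cancel
      simp only [map_mul, map_pow, map_add, hq2] at hpq
      linear_combination hpq
    obtain ⟨⟨_, p', rfl⟩, hp'⟩ := (H.pow k k).2 (toBR S p)
      (toBR S (c2 - q' * g)) (by
      apply Subtype.ext
      simp only [map_mul, map_pow, map_add, map_sub, Subring.coe_mul, Subring.coe_add,
        Subring.coe_pow, AddSubgroupClass.coe_sub, RingHom.coe_rangeRestrict] at *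
      linear_combination -h3)
    have hp2 : algebraMap A S p = algebraMap A S g ^ k * algebraMap A S p' := by
      have := congrArg Subtype.val hp'
      simpa using this
    have h4 : algebraMap A S c2 = algebraMap A S p' * algebraMap A S h ^ k +
        algebraMap A S q' * algebraMap A S g := by
      apply (ug.pow k).mul_left_cancel
      rw [hp2] at h3
      linear_combination h3
    have h5 : z - f p' ∈ Q := by
      refine (mem_sup_sat ug uh).2 ⟨k + 2, c1, q' * h, ?_⟩
      rw [hf]
      simp only [map_mul, map_pow, map_add, mul_pow] at *
      linear_combination algebraMap A S h * hgz - (algebraMap A S g ^ (k + 1) *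
        algebraMap A S h ^ (k + 1) * algebraMap A S p') * hw +
        algebraMap A S h * algebraMap A S g ^ (k + 1) * h4
    refine ⟨p', ?_, h5⟩
    have : f p' = z - (z - f p') := by ring
    change f p' ∈ Gt
    rw [this]
    exact Gt.sub_mem hzG (hQG h5)

end fin
end

section

section base
variable {A : Type*} [CommRing A]

/-- nonzerodivisor modulo `t` -/
def NZm (t s : A) : Prop := ∀ z, t ∣ s * z → t ∣ z

def Reg2m (t x y : A) : Prop := NZm t x ∧ ∀ z w, t ∣ y * z - x * w → ∃ v, t ∣ z - x * v

lemma NZm.mul {t a b : A} (ha : NZm t a) (hb : NZm t b) : NZm t (a * b) := fun z hz =>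
  hb _ (ha _ (by rwa [← mul_assoc]))

lemma NZm.pow {t a : A} (ha : NZm t a) (n : ℕ) : NZm t (a ^ n) := by
  induction n with
  | zero => intro z hz; simpa using hz
  | succ n ih => rw [pow_succ]; exact ih.mul ha

lemma NZm.of_dvd {t a b : A} (hb : NZm t b) (h : a ∣ b) : NZm t a := by
  obtain ⟨c, rfl⟩ := h
  intro z hz
  exact hb z (by rw [mul_comm a c, mul_assoc]; exact dvd_mul_of_dvd_right hz c)

lemma Reg2m.to_BR {S : Type*} [CommRing S] [Algebra A S] {t x y : A} (H : Reg2m t x y)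
    (hk : ∀ a, algebraMap A S a = 0 ↔ t ∣ a) : Reg2 (BR A S) (toBR S x) (toBR S y) := by
  constructor
  · rintro ⟨_, z, rfl⟩ e
    have e' := congrArg Subtype.val e
    have : algebraMap A S (x * z) = 0 := by simpa using e'
    exact Subtype.ext ((hk _).2 (H.1 _ ((hk _).1 this)))
  · rintro ⟨_, z, rfl⟩ ⟨_, w, rfl⟩ e
    have e' := congrArg Subtype.val e
    have : algebraMap A S (y * z - x * w) = 0 := by
      rw [map_sub, sub_eq_zero]; simpa using e'
    obtain ⟨v, hv⟩ := H.2 _ _ ((hk _).1 this)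
    refine ⟨LPaux.toBR S v, Subtype.ext ?_⟩
    have := (hk _).2 hv
    rw [map_sub, sub_eq_zero] at this
    simpa using this

lemma nzd_of_NZm [IsLocalRing A] [IsNoetherianRing A] {t s : A}
    (tm : t ∈ maximalIdeal A)
    (ht : ∀ z, t * z = 0 → z = 0) (h : NZm t s) (z : A) (hz : s * z = 0) : z = 0 := by
  have h1 : ∀ n : ℕ, ∀ z, s * z = 0 → z ∈ (Ideal.span {t} : Ideal A) ^ n := by
    intro n
    induction n with
    | zero => simp
    | succ n ih =>
      intro z hz
      obtain ⟨w, rfl⟩ := h z (by rw [hz]; exact dvd_zero t)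
      have : s * w = 0 := ht _ (by linear_combination hz)
      rw [pow_succ']
      exact Ideal.mul_mem_mul (Ideal.mem_span_singleton_self t) (ih w this)
  have h2 : z ∈ (⨅ i : ℕ, (Ideal.span {t} : Ideal A) ^ i) := by
    rw [Ideal.mem_iInf]; exact fun n => h1 n z hz
  rw [Ideal.iInf_pow_eq_bot_of_isLocalRing] at h2
  · simpa using h2
  · intro h
    rw [Ideal.span_singleton_eq_top] at h
    exact (IsLocalRing.mem_maximalIdeal _).1 tm h

lemma sat_span {E ι : Type*} [AddCommGroup E] [Module A E] {N : Submodule A E} {h : ι → A} {x : A}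
    {z : E} (hz : ∀ i, z ∈ sat (h i) N) (hx : x ∈ Ideal.span (Set.range h)) : z ∈ sat x N := by
  have h1 : Ideal.span (Set.range h) ≤ Ideal.radical (N.comap (LinearMap.toSpanSingleton A E z) : Ideal A) := by
    rw [Ideal.span_le]
    rintro _ ⟨i, rfl⟩
    obtain ⟨k, hk⟩ := hz i
    exact ⟨k, hk⟩
  obtain ⟨k, hk⟩ := h1 hx
  exact ⟨k, hk⟩

lemma span_pow_mem {ι : Type*} {I : Ideal A} {h : ι → A} {x c : A}
    (hz : ∀ i, ∃ k : ℕ, h i ^ k * c ∈ I) (hx : x ∈ Ideal.span (Set.range h)) :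
    ∃ k : ℕ, x ^ k * c ∈ I :=
  sat_span (N := I) (z := c) hz hx

lemma inter_lemma {S : Type*} [CommRing S] [Algebra A S] {h0 x y : A}
    (u : IsUnit (algebraMap A S h0))
    (surj : ∀ z : S, ∃ (K : ℕ) (a : A), algebraMap A S (h0 ^ K) * z = algebraMap A S a)
    (H : Reg2 (BR A S) (toBR S x) (toBR S y)) {z : S} (hx : z ∈ sat x (BB A S))
    (hy : z ∈ sat y (BB A S)) : z ∈ BB A S := by
  obtain ⟨k, hk⟩ := hx
  obtain ⟨l, hl⟩ := hy
  obtain ⟨c, hc⟩ := mem_BB.1 hk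
  obtain ⟨d, hd⟩ := mem_BB.1 hl
  obtain ⟨K, a, ha⟩ := surj z
  rw [Algebra.smul_def] at hc hd
  obtain ⟨⟨_, v, rfl⟩, hv⟩ := (H.pow k l).dvd (s := toBR S (h0 ^ K)) (c := toBR S a) (by
      rintro ⟨w, hw⟩ e
      have e' : algebraMap A S (h0 ^ K) * w = 0 := congrArg Subtype.val e
      rw [map_pow] at e'
      exact Subtype.ext (by simpa using (u.pow K).mul_left_cancel (e'.trans (mul_zero _).symm)))
    ⟨toBR S c, by
      apply Subtype.ext
      simp only [map_pow, Subring.coe_mul, Subring.coe_pow, RingHom.coe_rangeRestrict] at *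
      rw [← ha, hc]; ring⟩
    ⟨toBR S d, by
      apply Subtype.ext
      simp only [map_pow, Subring.coe_mul, Subring.coe_pow, RingHom.coe_rangeRestrict] at *
      rw [← ha, hd]; ring⟩
  refine mem_BB.2 ⟨v, ?_⟩
  have hv' := congrArg Subtype.val hv
  simp only [map_pow, Subring.coe_mul, Subring.coe_pow, RingHom.coe_rangeRestrict] at *
  exact (u.pow K).mul_left_cancel (by rw [ha, hv'])

lemma exists_nzm [IsNoetherianRing A] (t : A) (J : Ideal A)
    (hJ : ∀ c, (∀ j ∈ J, t ∣ j * c) → t ∣ c) : ∃ s ∈ J, NZm t s := by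
  by_contra hcon
  push Not at hcon
  let π := Ideal.Quotient.mk (Ideal.span {t} : Ideal A)
  have hπ : ∀ a, π a = 0 ↔ t ∣ a := fun a => by
    rw [Ideal.Quotient.eq_zero_iff_mem, Ideal.mem_span_singleton]
  have hfin := associatedPrimes.finite (A ⧸ (Ideal.span {t} : Ideal A)) (A ⧸ (Ideal.span {t} : Ideal A))
  have hsub : ((J.map π : Ideal _) : Set (A ⧸ (Ideal.span {t} : Ideal A))) ⊆
      ⋃ p ∈ (hfin.toFinset : Set _), ((id p : Ideal (A ⧸ (Ideal.span {t} : Ideal A))) : Set (A ⧸ (Ideal.span {t} : Ideal A))) := by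
    intro s hs
    obtain ⟨j, hj, rfl⟩ := (Ideal.mem_map_iff_of_surjective π Ideal.Quotient.mk_surjective).1 hs
    have := hcon j hj
    unfold NZm at this
    push Not at this
    obtain ⟨z, hz, hz'⟩ := this
    have h2 := biUnion_associatedPrimes_eq_compl_nonZeroDivisors (A ⧸ (Ideal.span {t} : Ideal A))
    have h3 : π j ∈ ((nonZeroDivisors (A ⧸ (Ideal.span {t} : Ideal A)) : Set _))ᶜ := by
      intro hn
      have := (mem_nonZeroDivisors_iff.1 hn).1 (π z) (by rw [← map_mul]; exact (hπ _).2 hz)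
      exact hz' ((hπ _).1 this)
    rw [← h2] at h3
    simpa using h3
  obtain ⟨p, hp, hle⟩ := (Ideal.subset_union_prime (f := id) ⊥ ⊥
    (fun p hp _ _ => (hfin.mem_toFinset.1 hp).isPrime)).1 hsub
  have hp := (hfin.mem_toFinset.1 hp)
  obtain ⟨hpp, c, hc⟩ := isAssociatedPrime_iff.1 hp
  obtain ⟨c, rfl⟩ := Ideal.Quotient.mk_surjective c
  have : t ∣ c := hJ c (fun j hj => by
    rw [← hπ, map_mul]
    have : π j ∈ p := hle (Ideal.mem_map_of_mem π hj)
    rw [hc] at this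
    simpa using this)
  apply hpp.ne_top
  rw [hc, Ideal.eq_top_iff_one]
  have := (hπ c).2 this
  simp [π] at this
  simp [this]

end base

section single
variable {A : Type*} [CommRing A] {L : Type*} [CommRing L] [Algebra A L] {η h0 t : A}
  [IsLocalization.Away (η * h0) L]

lemma C_mul {x y : L} (hx : x ∈ sat η (BB A L)) (hy : y ∈ sat η (BB A L)) : x * y ∈ sat η (BB A L) := by
  obtain ⟨k, hk⟩ := hx
  obtain ⟨l, hl⟩ := hy
  obtain ⟨c, hc⟩ := mem_BB.1 hk
  obtain ⟨d, hd⟩ := mem_BB.1 hl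
  refine ⟨k + l, mem_BB.2 ⟨c * d, ?_⟩⟩
  rw [map_mul, hc, hd, pow_add]
  simp only [Algebra.smul_def, map_mul]; ring

variable (η h0 L) in
lemma L_surj (w : L) : ∃ (K : ℕ) (a : A), algebraMap A L ((η * h0) ^ K) * w = algebraMap A L a := by
  obtain ⟨n, a, e⟩ := IsLocalization.Away.surj (η * h0) w
  exact ⟨n, a, by rw [← e, map_pow, mul_comm]⟩

lemma L_eq (n0 : ∀ z, h0 * z = 0 → z = 0) {a b : A} (e : algebraMap A L a = algebraMap A L b) :
    ∃ N : ℕ, η ^ N * a = η ^ N * b := by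
  obtain ⟨n, hn⟩ := IsLocalization.Away.exists_of_eq (η * h0) e
  refine ⟨n, ?_⟩
  have hp : ∀ (n : ℕ) (z : A), h0 ^ n * z = 0 → z = 0 := by
    intro n
    induction n with
    | zero => simp
    | succ n ih => intro z hz; exact n0 _ (ih _ (by rw [← mul_assoc, ← pow_succ, hz]))
  rw [← sub_eq_zero]
  apply hp n
  rw [mul_pow] at hn
  linear_combination hn

variable (η h0 L) in
lemma L_u : IsUnit (algebraMap A L (η * h0)) := IsLocalization.Away.algebraMap_isUnit _

lemma L_uη (h0 : A) [IsLocalization.Away (η * h0) L] : IsUnit (algebraMap A L η) := by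
  have := L_u L η h0
  rw [map_mul] at this
  exact isUnit_of_mul_isUnit_left this

lemma L_u0 (η : A) [IsLocalization.Away (η * h0) L] : IsUnit (algebraMap A L h0) := by
  have := L_u L η h0
  rw [map_mul] at this
  exact isUnit_of_mul_isUnit_right this

lemma L_dvd (n0 : ∀ z, h0 * z = 0 → z = 0) (nt : NZm t h0) {a : A}
    (e : algebraMap A L t ∣ algebraMap A L a) : ∃ N : ℕ, t ∣ η ^ N * a := by
  obtain ⟨w, hw⟩ := e
  obtain ⟨K, b, hb⟩ := L_surj L η h0 w
  have : algebraMap A L ((η * h0) ^ K * a) = algebraMap A L (t * b) := by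
    rw [map_mul, map_mul, hw, ← hb]; ring
  obtain ⟨N, hN⟩ := L_eq (η := η) n0 this
  refine ⟨N + K, nt.pow K _ ⟨η ^ N * b, ?_⟩⟩
  rw [mul_pow] at hN
  rw [pow_add]
  linear_combination hN

lemma dvd_L {a : A} (h0 : A) [IsLocalization.Away (η * h0) L] (N : ℕ) (h : t ∣ η ^ N * a) :
    algebraMap A L t ∣ algebraMap A L a := by
  have h1 := map_dvd (algebraMap A L) h
  rw [map_mul, map_pow] at h1
  exact (((L_uη (L := L) h0).pow N).dvd_mul_left).1 h1

lemma L_t (η : A) [IsLocalization.Away (η * h0) L] (n0 : ∀ z, h0 * z = 0 → z = 0) (ht : ∀ z, t * z = 0 → z = 0) {w : L}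
    (e : algebraMap A L t * w = 0) : w = 0 := by
  obtain ⟨K, b, hb⟩ := L_surj L η h0 w
  have : algebraMap A L (t * b) = algebraMap A L 0 := by
    rw [map_mul, ← hb, map_zero]; linear_combination (algebraMap A L ((η * h0) ^ K)) * e
  obtain ⟨N, hN⟩ := L_eq (η := η) n0 this
  have hb0 : η ^ N * b = 0 := ht _ (by linear_combination hN)
  have h2 : algebraMap A L (η ^ N) * (algebraMap A L ((η * h0) ^ K) * w) = 0 := by
    rw [hb, ← map_mul, hb0, map_zero]
  rw [map_pow, map_pow] at h2
  exact ((L_u L η h0).pow K).mul_left_cancel (((L_uη (L := L) h0).pow N).mul_left_cancel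
    (by rw [h2, mul_zero, mul_zero]))

lemma C_t (n0 : ∀ z, h0 * z = 0 → z = 0) (ht : ∀ z, t * z = 0 → z = 0) (nt : NZm t h0) {w : L}
    (hw : algebraMap A L t * w ∈ sat η (BB A L)) : w ∈ sat η (BB A L) := by
  obtain ⟨k, hk⟩ := hw
  obtain ⟨a, ha⟩ := mem_BB.1 hk
  rw [Algebra.smul_def] at ha
  obtain ⟨N, b, hb⟩ := L_dvd n0 nt (L := L) (η := η) (t := t) (a := a) ⟨algebraMap A L (η ^ k) * w, by
    rw [ha]; ring⟩
  refine ⟨N + k, mem_BB.2 ⟨b, ?_⟩⟩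
  rw [Algebra.smul_def, ← sub_eq_zero]
  apply L_t η n0 ht
  have h2 := congrArg (algebraMap A L) hb
  simp only [map_mul, map_pow, pow_add] at *
  linear_combination -h2 + algebraMap A L η ^ N * ha

lemma C_gh (n0 : ∀ z, h0 * z = 0 → z = 0) {g h : A} (H : Reg2 A g h)
    (ug : IsUnit (algebraMap A L g)) {w : L} {k l : ℕ}
    (h1 : algebraMap A L (g ^ k) * w ∈ sat η (BB A L))
    (h2 : algebraMap A L (h ^ l) * w ∈ sat η (BB A L)) : w ∈ sat η (BB A L) := by
  obtain ⟨k1, hk1⟩ := h1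
  obtain ⟨k2, hk2⟩ := h2
  obtain ⟨c, hc⟩ := mem_BB.1 hk1
  obtain ⟨d, hd⟩ := mem_BB.1 hk2
  rw [Algebra.smul_def] at hc hd
  have : algebraMap A L (h ^ l * c * η ^ k2) = algebraMap A L (g ^ k * d * η ^ k1) := by
    rw [map_mul, map_mul, map_mul, map_mul, hc, hd]; ring
  obtain ⟨N, hN⟩ := L_eq (η := η) n0 this
  obtain ⟨v, hv⟩ := (H.pow k l).2 (η ^ N * η ^ k2 * c) (η ^ N * η ^ k1 * d) (by linear_combination hN)
  refine ⟨N + k2 + k1, mem_BB.2 ⟨v, ?_⟩⟩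
  apply (ug.pow k).mul_left_cancel
  have h3 := congrArg (algebraMap A L) hv
  rw [Algebra.smul_def]
  simp only [map_mul, map_pow, pow_add] at *
  rw [← h3, hc]; ring

end single
end

section
universe v

structure CData (A : Type u) [CommRing A] [IsLocalRing A] {ι : Type v} (t g h x y a0 b0 : A)
    (η a b : ι → A) : Prop where
  tm : t ∈ maximalIdeal A
  tnz : ∀ z, t * z = 0 → z = 0
  anz1 : ∀ i z, t ∣ a i * z → ∃ N : ℕ, t ∣ η i ^ N * z
  bnz1 : ∀ i z, t ∣ b i * z → ∃ N : ℕ, t ∣ η i ^ N * z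
  anz : ∀ i z, a i * z = 0 → ∃ N : ℕ, η i ^ N * z = 0
  bnz : ∀ i z, b i * z = 0 → ∃ N : ℕ, η i ^ N * z = 0
  comp : ∀ i j, ∃ N : ℕ, a j * b i ∣ (η i * η j) ^ N * (a i * b j)
  xm : x ∈ Ideal.span (Set.range η)
  ym : y ∈ Ideal.span (Set.range η)
  xyA : Reg2 A x y
  xyt : Reg2m t x y
  gm : g ∈ maximalIdeal A
  hm : h ∈ maximalIdeal A
  ghA : Reg2 A g h
  ght : Reg2m t g h
  hgt : Reg2m t h g
  a0nz : NZm t a0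
  b0nz : NZm t b0
  f0 : ∀ i, ∃ (N : ℕ) (e : A), t ∣ η i ^ N * (a0 * b i) - b0 * a i * e
  f1 : ∀ i, ∃ (N : ℕ) (e : A), t ∣ η i ^ N * (b0 * a i) - a0 * b i * e
  pr : ∀ P : Ideal A, P.IsPrime → P ≠ maximalIdeal A → ∃ aP bP : A,
    (∀ z, aP * z = 0 → ∃ f ∉ P, f * z = 0) ∧ (∀ z, bP * z = 0 → ∃ f ∉ P, f * z = 0) ∧
    ∀ i, ∃ N : ℕ, ∃ f ∉ P, bP * a i ∣ f * η i ^ N * (aP * b i) ∧ aP * b i ∣ f * η i ^ N * (bP * a i)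
  vii : ∀ (k : ℕ) (b : A) (K : ℕ),
      (∀ a ∈ maximalIdeal A ^ K, ∃ c1 c2, t ∣ a * b - (c1 * h ^ k + c2 * g ^ k)) →
      (∃ c1 c2, t ∣ g * b - (c1 * h ^ k + c2 * g ^ k)) ∧
      (∃ c1 c2, t ∣ h * b - (c1 * h ^ k + c2 * g ^ k))

section C
variable {A : Type u} [CommRing A] [IsLocalRing A] {ι : Type v} {t g h x y a0 b0 : A}
    {η a b : ι → A}

lemma CData.exists_h0 [IsNoetherianRing A] (c : CData A t g h x y a0 b0 η a b) :
    ∃ h0, NZm t h0 ∧ g ∣ h0 ∧ h ∣ h0 ∧ a0 ∣ h0 ∧ b0 ∣ h0 ∧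
      h0 ∈ Ideal.span (Set.range fun i => η i * a i * b i) := by
  obtain ⟨s, hs, hn⟩ := exists_nzm t (Ideal.span (Set.range fun i => η i * a i * b i)) (by
    intro d hd
    have h1 : ∀ i, ∃ k : ℕ, η i ^ k * d ∈ Ideal.span {t} := by
      intro i
      have := hd _ (Ideal.subset_span ⟨i, rfl⟩)
      obtain ⟨N, hN⟩ := c.anz1 i (η i * b i * d) (by convert this using 1; ring)
      obtain ⟨N', hN'⟩ := c.bnz1 i (η i ^ N * η i * d) (by convert hN using 1; ring)
      refine ⟨N' + N + 1, Ideal.mem_span_singleton.2 ?_⟩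
      convert hN' using 1; ring
    obtain ⟨k, hk⟩ := span_pow_mem h1 c.xm
    exact c.xyt.1.pow k _ (Ideal.mem_span_singleton.1 hk))
  refine ⟨s * (g * h * (a0 * b0)), hn.mul ((c.ght.1.mul c.hgt.1).mul (c.a0nz.mul c.b0nz)),
    ⟨s * h * a0 * b0, by ring⟩, ⟨s * g * a0 * b0, by ring⟩, ⟨s * g * h * b0, by ring⟩,
    ⟨s * g * h * a0, by ring⟩, Ideal.mul_mem_right _ _ hs⟩

abbrev RR (h0 : A) := Localization.Away h0
abbrev LL (h0 η : A) := Localization.Away (algebraMap A (RR h0) η)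

instance inst_LL (h0 η : A) : IsLocalization.Away (η * h0) (LL h0 η) :=
  IsLocalization.Away.mul (RR h0) (LL h0 η) h0 η

/-- multiplication map into `L i` -/
noncomputable def Mmap (h0 η : A) (w : LL h0 η) : RR h0 →ₗ[A] LL h0 η :=
  (LinearMap.mulLeft A w) ∘ₗ (IsScalarTower.toAlgHom A (RR h0) (LL h0 η)).toLinearMap

noncomputable def MM (h0 : A) (η : ι → A) (v : ∀ i, (LL h0 (η i))ˣ) (n : ℤ) : Submodule A (RR h0) :=
  ⨅ i, (sat (η i) (BB A (LL h0 (η i)))).comap (Mmap h0 (η i) ((v i ^ (-n) : (LL h0 (η i))ˣ)))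

lemma mem_MM {h0 : A} {v : ∀ i, (LL h0 (η i))ˣ} {n : ℤ} {z : RR h0} :
    z ∈ MM h0 η v n ↔ ∀ i, ((v i ^ (-n) : (LL h0 (η i))ˣ) : LL h0 (η i)) *
      algebraMap (RR h0) (LL h0 (η i)) z ∈ sat (η i) (BB A (LL h0 (η i))) := by
  simp [MM, Mmap]

lemma R_surj (h0 : A) (w : RR h0) : ∃ (K : ℕ) (a : A), algebraMap A (RR h0) (h0 ^ K) * w =
    algebraMap A (RR h0) a := by
  obtain ⟨n, a, e⟩ := IsLocalization.Away.surj h0 w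
  exact ⟨n, a, by rw [← e, map_pow, mul_comm]⟩

lemma pow_nz {h0 : A} (n0 : ∀ z, h0 * z = 0 → z = 0) (n : ℕ) : ∀ z, h0 ^ n * z = 0 → z = 0 := by
  induction n with
  | zero => simp
  | succ n ih => intro z hz; exact n0 _ (ih _ (by rw [← mul_assoc, ← pow_succ, hz]))

lemma R_inj {h0 : A} (n0 : ∀ z, h0 * z = 0 → z = 0) {a b : A}
    (e : algebraMap A (RR h0) a = algebraMap A (RR h0) b) : a = b := by
  obtain ⟨n, hn⟩ := IsLocalization.Away.exists_of_eq h0 e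
  rw [← sub_eq_zero]
  apply pow_nz n0 n
  linear_combination hn

lemma CData.exists_v (c : CData A t g h x y a0 b0 η a b) {h0 : A}
    (n0 : ∀ z, h0 * z = 0 → z = 0)
    (hs : h0 ∈ Ideal.span (Set.range fun i => η i * a i * b i)) (i : ι) :
    ∃ v : (LL h0 (η i))ˣ, algebraMap A (LL h0 (η i)) (a i) = v * algebraMap A (LL h0 (η i)) (b i) := by
  have key : ∀ a' b' : ι → A, (∀ j, η j * a j * b j = η j * a' j * b' j) →
      (∀ i j, ∃ N : ℕ, a' j * b' i ∣ (η i * η j) ^ N * (a' i * b' j)) →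
      ∃ w, algebraMap A (LL h0 (η i)) (a' i) = w * algebraMap A (LL h0 (η i)) (b' i) := by
    intro a' b' hab hN
    have h1 : ∀ j, ∃ k : ℕ, (η j * a j * b j) ^ k * a' i ∈
        Ideal.comap (algebraMap A (LL h0 (η i))) (Ideal.span {algebraMap A (LL h0 (η i)) (b' i)}) := by
      intro j
      obtain ⟨N, d, hd⟩ := hN i j
      refine ⟨N + 1, ?_⟩
      rw [Ideal.mem_comap, Ideal.mem_span_singleton]
      refine ((((L_uη (L := LL h0 (η i)) (η := η i) h0).pow N).dvd_mul_left).1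
        ⟨algebraMap A _ (a' j ^ (N + 2) * b' j ^ N * η j * d), ?_⟩)
      rw [hab, ← map_pow, ← map_mul, ← map_mul]
      congr 1
      linear_combination (η j * a' j ^ (N + 1) * b' j ^ N) * hd
    obtain ⟨k, hk⟩ := span_pow_mem h1 hs
    rw [Ideal.mem_comap, Ideal.mem_span_singleton, map_mul, map_pow,
      ((L_u0 (L := LL h0 (η i)) (h0 := h0) (η i)).pow k).dvd_mul_left] at hk
    obtain ⟨w, hw⟩ := hk
    exact ⟨w, by rw [hw, mul_comm]⟩
  obtain ⟨w, hw⟩ := key a b (fun j => rfl) c.comp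
  obtain ⟨w', hw'⟩ := key b a (fun j => by ring) (fun i j => by
    obtain ⟨N, hN⟩ := c.comp j i
    refine ⟨N, ?_⟩
    convert hN using 1 <;> ring)
  have hnz : ∀ r : LL h0 (η i), r * algebraMap A (LL h0 (η i)) (b i) = 0 → r = 0 := by
    intro r hr
    obtain ⟨K, α, hα⟩ := L_surj (LL h0 (η i)) (η i) h0 r
    have h1 : algebraMap A (LL h0 (η i)) (b i * α) = algebraMap A (LL h0 (η i)) 0 := by
      rw [map_mul, ← hα, map_zero]
      linear_combination (algebraMap A (LL h0 (η i)) ((η i * h0) ^ K)) * hr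
    obtain ⟨N, hN⟩ := L_eq (η := η i) n0 h1
    obtain ⟨N', hN'⟩ := c.bnz i (η i ^ N * α) (by linear_combination hN)
    have h2 : algebraMap A (LL h0 (η i)) (η i ^ N' * η i ^ N * (η i * h0) ^ K) * r = 0 := by
      rw [map_mul, mul_assoc, hα, ← map_mul, mul_assoc, hN', map_zero]
    have u1 : IsUnit (algebraMap A (LL h0 (η i)) (η i ^ N' * η i ^ N * (η i * h0) ^ K)) := by
      simp only [map_mul, map_pow]
      have := L_uη (L := LL h0 (η i)) (η := η i) h0
      have u0 := L_u0 (L := LL h0 (η i)) (h0 := h0) (η i)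
      exact (((this.pow _).mul (this.pow _)).mul ((this.mul u0).pow _))
    exact u1.mul_left_cancel (by rw [h2, mul_zero])
  have e : w * w' = 1 := by
    rw [← sub_eq_zero]; apply hnz; linear_combination -w' * hw - hw'
  exact ⟨⟨w, w', e, by rw [mul_comm, e]⟩, hw⟩

end C
end

section
universe v

section C
variable {A : Type u} [CommRing A] [IsLocalRing A] {ι : Type v} {t g h x y a0 b0 : A}
    {η a b : ι → A}

lemma algRL {h0 e : A} (r : A) : algebraMap (RR h0) (LL h0 e) (algebraMap A (RR h0) r) =
    algebraMap A (LL h0 e) r := (IsScalarTower.algebraMap_apply A (RR h0) (LL h0 e) r).symm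

lemma L_to_R {h0 e : A} {z z' : RR h0} (h : algebraMap (RR h0) (LL h0 e) z = algebraMap (RR h0) (LL h0 e) z') :
    ∃ N : ℕ, algebraMap A (RR h0) (e ^ N) * z = algebraMap A (RR h0) (e ^ N) * z' := by
  obtain ⟨n, hn⟩ := IsLocalization.Away.exists_of_eq (algebraMap A (RR h0) e) h
  exact ⟨n, by rwa [map_pow]⟩

lemma sat_R_of_L {h0 e : A} {z : RR h0}
    (hz : algebraMap (RR h0) (LL h0 e) z ∈ sat e (BB A (LL h0 e))) : z ∈ sat e (BB A (RR h0)) := by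
  obtain ⟨k, hk⟩ := hz
  obtain ⟨d, hd⟩ := mem_BB.1 hk
  rw [Algebra.smul_def, ← algRL, ← algRL, ← map_mul] at hd
  obtain ⟨N, hN⟩ := L_to_R hd
  refine ⟨N + k, mem_BB.2 ⟨e ^ N * d, ?_⟩⟩
  rw [map_mul, hN, Algebra.smul_def, ← mul_assoc, ← map_mul, pow_add]

lemma CData.inA (c : CData A t g h x y a0 b0 η a b) {h0 : A} (n0 : ∀ z, h0 * z = 0 → z = 0)
    {z : RR h0} (hz : ∀ i, z ∈ sat (η i) (BB A (RR h0))) : z ∈ BB A (RR h0) := by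
  refine inter_lemma (h0 := h0) (IsLocalization.Away.algebraMap_isUnit _) (R_surj h0) (x := x) (y := y) ?_
    (sat_span hz c.xm) (sat_span hz c.ym)
  refine Reg2m.to_BR (t := 0) ⟨fun z hz => ?_, fun z w hzw => ?_⟩ (fun a => ⟨fun h => ?_, fun h => ?_⟩)
  · rw [zero_dvd_iff] at *; exact c.xyA.1 _ hz
  · obtain ⟨v, hv⟩ := c.xyA.2 z w (sub_eq_zero.1 (zero_dvd_iff.1 hzw))
    exact ⟨v, by simp [hv]⟩
  · rw [zero_dvd_iff]; exact R_inj n0 (by simpa using h)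
  · rw [zero_dvd_iff] at h; simp [h]

lemma CData.M0 (c : CData A t g h x y a0 b0 η a b) {h0 : A} (n0 : ∀ z, h0 * z = 0 → z = 0)
    (v : ∀ i, (LL h0 (η i))ˣ) : MM h0 η v 0 = BB A (RR h0) := by
  apply le_antisymm
  · intro z hz
    refine c.inA n0 (fun i => sat_R_of_L ?_)
    simpa using mem_MM.1 hz i
  · intro z hz
    obtain ⟨d, rfl⟩ := mem_BB.1 hz
    rw [mem_MM]
    intro i
    rw [algRL]
    exact ⟨0, mem_BB.2 ⟨d, by simp⟩⟩

lemma MM_mul {h0 : A} (v : ∀ i, (LL h0 (η i))ˣ) (k n : ℤ) (r : RR h0) (hr : r ∈ MM h0 η v k)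
    (z : RR h0) (hz : z ∈ MM h0 η v n) : r * z ∈ MM h0 η v (n + k) := by
  rw [mem_MM] at *
  intro i
  have := C_mul (hr i) (hz i)
  convert this using 1
  rw [neg_add, zpow_add, map_mul, Units.val_mul]; ring

lemma R_t {h0 : A} (n0 : ∀ z, h0 * z = 0 → z = 0) (ht : ∀ z, t * z = 0 → z = 0) (z : RR h0)
    (hz : algebraMap A (RR h0) t * z = 0) : z = 0 := by
  obtain ⟨K, d, hd⟩ := R_surj h0 z
  have : algebraMap A (RR h0) (t * d) = algebraMap A (RR h0) 0 := by
    rw [map_mul, ← hd, map_zero]; linear_combination algebraMap A (RR h0) (h0 ^ K) * hz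
  have := ht _ (R_inj n0 this)
  have u : IsUnit (algebraMap A (RR h0) (h0 ^ K)) := by
    rw [map_pow]; exact (IsLocalization.Away.algebraMap_isUnit h0).pow K
  exact u.mul_left_cancel (by rw [hd, this, map_zero, mul_zero])

lemma MM_t {h0 : A} (n0 : ∀ z, h0 * z = 0 → z = 0) (ht : ∀ z, t * z = 0 → z = 0) (nt : NZm t h0)
    (v : ∀ i, (LL h0 (η i))ˣ) (n : ℤ) (z : RR h0) (hz : t • z ∈ MM h0 η v n) : z ∈ MM h0 η v n := by
  rw [mem_MM] at *
  intro i
  refine C_t (h0 := h0) n0 ht nt ?_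
  convert hz i using 1
  rw [Algebra.smul_def, map_mul, algRL]; ring

lemma MM_gh {h0 : A} (n0 : ∀ z, h0 * z = 0 → z = 0) (H : Reg2 A g h) (hg : g ∣ h0)
    (v : ∀ i, (LL h0 (η i))ˣ) (n : ℤ) : sat g (MM h0 η v n) ⊓ sat h (MM h0 η v n) ≤ MM h0 η v n := by
  rintro z ⟨⟨k, hk⟩, ⟨l, hl⟩⟩
  rw [mem_MM] at *
  intro i
  refine C_gh (h0 := h0) n0 H (isUnit_of_dvd_unit (map_dvd _ hg) (L_u0 (η i))) (k := k) (l := l) ?_ ?_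
  · convert hk i using 1
    rw [Algebra.smul_def, map_mul, algRL]; ring
  · convert hl i using 1
    rw [Algebra.smul_def, map_mul, algRL]; ring

/-- `C + tL` -/
def EE (t e : A) {L : Type*} [CommRing L] [Algebra A L] (w : L) : Prop :=
  ∃ (N : ℕ) (d : A) (w' : L), algebraMap A L (e ^ N) * w = algebraMap A L d + algebraMap A L t * w'

lemma EE.mul {e : A} {L : Type*} [CommRing L] [Algebra A L] {w w2 : L} (h1 : EE t e w)
    (h2 : EE t e w2) : EE t e (w * w2) := by
  obtain ⟨N, d, w', h1⟩ := h1
  obtain ⟨N2, d2, w2', h2⟩ := h2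
  refine ⟨N + N2, d * d2, algebraMap A L d * w2' + w' * (algebraMap A L (e ^ N2) * w2), ?_⟩
  rw [pow_add, map_mul, map_mul]
  linear_combination (algebraMap A L (e ^ N2) * w2) * h1 + algebraMap A L d * h2

lemma EE.pow {e : A} {L : Type*} [CommRing L] [Algebra A L] {w : L} (h1 : EE t e w) (n : ℕ) :
    EE t e (w ^ n) := by
  induction n with
  | zero => exact ⟨0, 1, 0, by simp⟩
  | succ n ih => rw [pow_succ]; exact ih.mul h1

lemma EE.zpow {e : A} {L : Type*} [CommRing L] [Algebra A L] {w : Lˣ} (h1 : EE t e (w : L))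
    (h2 : EE t e ((w⁻¹ : Lˣ) : L)) (n : ℤ) : EE t e ((w ^ n : Lˣ) : L) := by
  obtain ⟨m, rfl | rfl⟩ := n.eq_nat_or_neg
  · simpa using h1.pow m
  · rw [zpow_neg, ← inv_zpow]; simpa using h2.pow m

/-- key for the comparison with the fibre equation -/
lemma CData.EE_aux {h0 : A} (n0 : ∀ z, h0 * z = 0 → z = 0) (nt : NZm t h0) {e a b a0 b0 : A}
    (bnz1 : ∀ z, t ∣ b * z → ∃ N : ℕ, t ∣ e ^ N * z) (v : (LL h0 e)) (u0 : RR h0)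
    (hu0 : u0 * algebraMap A (RR h0) b0 = algebraMap A (RR h0) a0) (hb0 : b0 ∣ h0)
    (v' : LL h0 e) (hvv : v * v' = 1)
    (hv : algebraMap A (LL h0 e) a = v * algebraMap A (LL h0 e) b)
    (f0 : ∃ (N : ℕ) (d : A), t ∣ e ^ N * (a0 * b) - b0 * a * d) :
    EE t e (v' * algebraMap (RR h0) (LL h0 e) u0) := by
  have ub0 : IsUnit (algebraMap A (LL h0 e) b0) :=
    isUnit_of_dvd_unit (map_dvd _ hb0) (L_u0 e)
  have hb : ∀ w : LL h0 e, algebraMap A (LL h0 e) t ∣ algebraMap A (LL h0 e) b * w →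
      algebraMap A (LL h0 e) t ∣ w := by
    intro w hw
    obtain ⟨K, α, hα⟩ := L_surj (LL h0 e) e h0 w
    have h1 : algebraMap A (LL h0 e) t ∣ algebraMap A (LL h0 e) (b * α) := by
      rw [map_mul, ← hα, mul_left_comm]; exact dvd_mul_of_dvd_right hw _
    obtain ⟨N, hN⟩ := L_dvd (η := e) n0 nt h1
    obtain ⟨N', hN'⟩ := bnz1 (e ^ N * α) (by convert hN using 1; ring)
    have h2 := dvd_L (L := LL h0 e) (η := e) (a := α) h0 (N' + N) (by convert hN' using 1; ring)
    rw [← hα, map_pow] at h2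
    exact (((L_u (LL h0 e) e h0).pow K).dvd_mul_left).1 h2
  obtain ⟨N, d, hd⟩ := f0
  have hu := congrArg (algebraMap (RR h0) (LL h0 e)) hu0
  rw [map_mul, algRL, algRL] at hu
  have h3 := map_dvd (algebraMap A (LL h0 e)) hd
  obtain ⟨w, hw⟩ := hb (algebraMap A (LL h0 e) (e ^ N) * algebraMap (RR h0) (LL h0 e) u0 -
    v * algebraMap A (LL h0 e) d) (by
      refine (ub0.dvd_mul_left).1 ?_
      convert h3 using 1
      simp only [map_mul, map_sub]
      linear_combination (algebraMap A (LL h0 e) (e ^ N) * algebraMap A (LL h0 e) b) * hu +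
        algebraMap A (LL h0 e) b0 * hv * algebraMap A (LL h0 e) d)
  refine ⟨N, d, v' * w, ?_⟩
  linear_combination v' * hw + algebraMap A (LL h0 e) d * hvv

abbrev SS (h0 t : A) := RR h0 ⧸ Ideal.span {algebraMap A (RR h0) t}

lemma S_dvd {h0 : A} (n0 : ∀ z, h0 * z = 0 → z = 0) (nt : NZm t h0) (r : A) :
    algebraMap A (SS h0 t) r = 0 ↔ t ∣ r := by
  have : algebraMap A (SS h0 t) r = Ideal.Quotient.mk _ (algebraMap A (RR h0) r) := rfl
  rw [this, Ideal.Quotient.eq_zero_iff_mem, Ideal.mem_span_singleton]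
  constructor
  · rintro ⟨w, hw⟩
    obtain ⟨K, d, hd⟩ := R_surj h0 w
    refine nt.pow K r ⟨d, R_inj n0 ?_⟩
    rw [map_mul, hw, map_mul, ← hd]; ring
  · exact map_dvd _

lemma EE_to_sat {h0 e : A} {Z : RR h0} (h1 : EE t e (algebraMap (RR h0) (LL h0 e) Z)) :
    Ideal.Quotient.mkₐ A (Ideal.span {algebraMap A (RR h0) t}) Z ∈ sat e (BB A (SS h0 t)) := by
  obtain ⟨N, d, w, hw⟩ := h1
  obtain ⟨K, r, hr⟩ := IsLocalization.Away.surj (algebraMap A (RR h0) e) w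
  have h6 : algebraMap (RR h0) (LL h0 e) (algebraMap A (RR h0) (e ^ (K + N)) * Z) =
      algebraMap (RR h0) (LL h0 e) (algebraMap A (RR h0) (e ^ K * d) + algebraMap A (RR h0) t * r) := by
    rw [map_pow] at hw
    simp only [map_mul, map_add, map_pow, pow_add, algRL, ← hr]
    linear_combination algebraMap A (LL h0 e) e ^ K * hw
  obtain ⟨N', hN'⟩ := L_to_R h6
  refine ⟨N' + (K + N), mem_BB.2 ⟨e ^ N' * (e ^ K * d), ?_⟩⟩
  have h7 : e ^ (N' + (K + N)) • Z = algebraMap A (RR h0) (e ^ N' * (e ^ K * d)) +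
      algebraMap A (RR h0) t * (algebraMap A (RR h0) (e ^ N') * r) := by
    rw [Algebra.smul_def, pow_add, map_mul, mul_assoc, hN', map_mul _ (e ^ N')]; ring
  rw [← map_smul, h7, map_add]
  have ht : Ideal.Quotient.mkₐ A (Ideal.span {algebraMap A (RR h0) t})
      (algebraMap A (RR h0) t * (algebraMap A (RR h0) (e ^ N') * r)) = 0 :=
    Ideal.Quotient.eq_zero_iff_mem.2 (Ideal.mul_mem_right _ _ (Ideal.mem_span_singleton_self _))
  rw [ht, add_zero]
  rfl

lemma EE_shift {R L : Type*} [CommRing R] [CommRing L] [Algebra A L] [Algebra R L] {e : A}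
    (v : Lˣ) (u0 : Rˣ) (n : ℤ) (z : R)
    (he1 : EE t e ((v⁻¹ : Lˣ) * algebraMap R L u0))
    (he2 : EE t e ((v : L) * algebraMap R L (u0⁻¹ : Rˣ)))
    (h2 : EE t e (((v ^ (-n) : Lˣ) : L) * algebraMap R L z)) :
    EE t e (algebraMap R L (z * ((u0 ^ (-n) : Rˣ) : R))) := by
  let e' : Lˣ := v⁻¹ * Units.map (algebraMap R L).toMonoidHom u0
  have h3 := (EE.zpow (w := e') he1 (by
    have : e'⁻¹ = v * Units.map (algebraMap R L).toMonoidHom u0⁻¹ := by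
      rw [mul_inv, inv_inv, map_inv]
    rw [this]; exact he2) (-n)).mul h2
  convert h3 using 1
  have h4 : e' ^ (-n) = (v ^ (-n))⁻¹ * Units.map (algebraMap R L).toMonoidHom (u0 ^ (-n)) := by
    rw [mul_zpow, inv_zpow, map_zpow]
  rw [h4, map_mul, Units.val_mul]
  have h5 : ((Units.map (algebraMap R L).toMonoidHom (u0 ^ (-n)) : Lˣ) : L) =
    algebraMap R L ((u0 ^ (-n) : Rˣ) : R) := rfl
  rw [h5]
  generalize v ^ (-n) = w
  generalize ((u0 ^ (-n) : Rˣ) : R) = w1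
  have := w.inv_mul
  linear_combination (- algebraMap R L z * algebraMap R L w1) * this

lemma CData.rho_sat (c : CData A t g h x y a0 b0 η a b) {h0 : A} (n0 : ∀ z, h0 * z = 0 → z = 0)
    (nt : NZm t h0) (ha0 : a0 ∣ h0) (hb0 : b0 ∣ h0) (v : ∀ i, (LL h0 (η i))ˣ)
    (hv : ∀ i, algebraMap A (LL h0 (η i)) (a i) = v i * algebraMap A (LL h0 (η i)) (b i))
    (u0 : (RR h0)ˣ) (h1 : (u0 : RR h0) * algebraMap A (RR h0) b0 = algebraMap A (RR h0) a0)
    (n : ℤ) (z : RR h0) (hz : z ∈ MM h0 η v n) (i : ι) :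
    Ideal.Quotient.mkₐ A (Ideal.span {algebraMap A (RR h0) t}) (z * ((u0 ^ (-n) : (RR h0)ˣ) : RR h0))
      ∈ sat (η i) (BB A (SS h0 t)) := by
  rw [mem_MM] at hz
  refine EE_to_sat (EE_shift (v i) u0 n z ?_ ?_ ?_)
  · exact CData.EE_aux n0 nt (c.bnz1 i) (v i) u0 (a0 := a0) (b0 := b0) h1 hb0 _ (v i).mul_inv (hv i) (c.f0 i)
  · refine CData.EE_aux n0 nt (c.anz1 i) ((v i)⁻¹ : (LL h0 (η i))ˣ) ((u0⁻¹ : (RR h0)ˣ)) (a0 := b0)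
        (b0 := a0) (a := b i) ?_ ha0 (v i) (v i).inv_mul ?_ (c.f1 i)
    · rw [← h1, ← mul_assoc, u0.inv_mul, one_mul]
    · rw [hv, ← mul_assoc, (v i).inv_mul, one_mul]
  · obtain ⟨k, hk⟩ := hz i
    obtain ⟨d, hd⟩ := mem_BB.1 hk
    exact ⟨k, d, 0, by rw [hd, Algebra.smul_def]; simp⟩

lemma CData.rhoM (c : CData A t g h x y a0 b0 η a b) {h0 : A} (n0 : ∀ z, h0 * z = 0 → z = 0)
    (nt : NZm t h0) (ha0 : a0 ∣ h0) (hb0 : b0 ∣ h0) (v : ∀ i, (LL h0 (η i))ˣ)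
    (hv : ∀ i, algebraMap A (LL h0 (η i)) (a i) = v i * algebraMap A (LL h0 (η i)) (b i)) :
    ∃ u : (SS h0 t)ˣ, ∀ n, ∀ z ∈ MM h0 η v n,
      Ideal.Quotient.mkₐ A (Ideal.span {algebraMap A (RR h0) t}) z * ((u ^ (-n) : (SS h0 t)ˣ) : SS h0 t)
        ∈ BB A (SS h0 t) := by
  have uh0 : IsUnit (algebraMap A (RR h0) h0) := IsLocalization.Away.algebraMap_isUnit _
  obtain ⟨ua, hua⟩ := isUnit_of_dvd_unit (map_dvd (algebraMap A (RR h0)) ha0) uh0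
  obtain ⟨ub, hub⟩ := isUnit_of_dvd_unit (map_dvd (algebraMap A (RR h0)) hb0) uh0
  have h1 : ((ua * ub⁻¹ : (RR h0)ˣ) : RR h0) * algebraMap A (RR h0) b0 = algebraMap A (RR h0) a0 := by
    rw [← hub, ← Units.val_mul, inv_mul_cancel_right, hua]
  refine ⟨Units.map (Ideal.Quotient.mkₐ A (Ideal.span {algebraMap A (RR h0) t})).toRingHom.toMonoidHom
    (ua * ub⁻¹), fun n z hz => ?_⟩
  generalize ua * ub⁻¹ = u0 at *
  have hz2 := c.rho_sat n0 nt ha0 hb0 v hv u0 h1 n z hz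
  rw [← map_zpow]
  change Ideal.Quotient.mkₐ A (Ideal.span {algebraMap A (RR h0) t}) z *
    Ideal.Quotient.mkₐ A (Ideal.span {algebraMap A (RR h0) t}) ((u0 ^ (-n) : (RR h0)ˣ) : RR h0) ∈ _
  rw [← map_mul]
  refine inter_lemma (h0 := h0) (uh0.map (Ideal.Quotient.mkₐ A (Ideal.span {algebraMap A (RR h0) t})))
    (fun z => ?_) (c.xyt.to_BR (S_dvd n0 nt))
    (sat_span hz2 c.xm) (sat_span hz2 c.ym)
  obtain ⟨z, rfl⟩ := Ideal.Quotient.mk_surjective z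
  obtain ⟨K, d, hd⟩ := R_surj h0 z
  exact ⟨K, d, by
    have := congrArg (Ideal.Quotient.mk (Ideal.span {algebraMap A (RR h0) t})) hd
    rw [map_mul] at this
    exact this⟩

end C
end

section
universe v

section C
variable {A : Type u} [CommRing A] [IsLocalRing A] {ι : Type v} {t g h x y a0 b0 : A}
    {η a b : ι → A}

lemma hk_aux [Finite ι] {h0 : A}
    (hs : h0 ∈ Ideal.span (Set.range fun i => η i * a i * b i)) (v : ∀ i, (LL h0 (η i))ˣ)
    (hv : ∀ i, algebraMap A (LL h0 (η i)) (a i) = v i * algebraMap A (LL h0 (η i)) (b i))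
    (hnz : ∀ i (w : LL h0 (η i)), algebraMap A (LL h0 (η i)) (a i) * w = 0 → w = 0)
    (P : Ideal A) [P.IsPrime] {aP bP : A} (hb : ∀ z, bP * z = 0 → ∃ f ∉ P, f * z = 0)
    (H : ∀ i, ∃ N : ℕ, ∃ f ∉ P, bP * a i ∣ f * η i ^ N * (aP * b i)) :
    ∃ z : RR h0, ∃ f ∉ P, algebraMap A (RR h0) bP * z = algebraMap A (RR h0) (f * aP) ∧
      ∀ i, ((v i)⁻¹ : (LL h0 (η i))ˣ) * algebraMap (RR h0) (LL h0 (η i)) z ∈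
        sat (η i) (BB A (LL h0 (η i))) := by
  classical
  have := Fintype.ofFinite ι
  choose N f hf d hd using H
  let F := ∏ i, f i
  have hF : F ∉ P := by
    intro h
    obtain ⟨i, -, hi⟩ := (Ideal.IsPrime.prod_mem_iff (p := P)).1 h
    exact hf i hi
  have fF : ∀ i, f i ∣ F := fun i => Finset.dvd_prod_of_mem f (Finset.mem_univ i)
  have h1 : ∀ i, ∃ k : ℕ, (η i * a i * b i) ^ k * (F * aP) ∈ Ideal.span {bP} := by
    intro i
    obtain ⟨q, hq⟩ := fF i
    refine ⟨N i + 1, Ideal.mem_span_singleton.2 ⟨q * η i * a i ^ (N i + 1) * b i ^ (N i) * a i * d i, ?_⟩⟩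
    rw [hq]
    linear_combination (q * η i * a i ^ (N i + 1) * b i ^ (N i)) * hd i
  obtain ⟨k, hk⟩ := span_pow_mem h1 hs
  obtain ⟨c0, hc0⟩ := Ideal.mem_span_singleton.1 hk
  have h2 : ∀ i, ∃ e ∉ P, e * (f i * η i ^ N i * b i * c0 - a i * d i * h0 ^ k * F) = 0 := by
    intro i
    apply hb
    linear_combination (-f i * η i ^ N i * b i) * hc0 + (h0 ^ k * F) * hd i
  choose e he he0 using h2
  let G := ∏ i, e i * f i
  have hG : G ∉ P := by
    intro h
    obtain ⟨i, -, hi⟩ := (Ideal.IsPrime.prod_mem_iff (p := P)).1 h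
    exact (Ideal.IsPrime.mem_or_mem ‹_› hi).elim (he i) (hf i)
  have uh0 : IsUnit (algebraMap A (RR h0) h0) := IsLocalization.Away.algebraMap_isUnit _
  obtain ⟨w, hw⟩ := (uh0.pow k).exists_left_inv
  rw [← map_pow] at hw
  refine ⟨algebraMap A _ (G * c0) * w, G * F, fun h => (Ideal.IsPrime.mem_or_mem ‹_› h).elim hG hF, ?_, ?_⟩
  · rw [← mul_assoc, ← map_mul, show bP * (G * c0) = G * (F * aP) * h0 ^ k by linear_combination -G * hc0,
      map_mul, mul_assoc, mul_comm _ w, hw, mul_one, mul_assoc]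
  · intro i
    obtain ⟨q, hq⟩ : e i * f i ∣ G := Finset.dvd_prod_of_mem (fun i => e i * f i) (Finset.mem_univ i)
    refine ⟨N i, mem_BB.2 ⟨q * e i * d i * F, ?_⟩⟩
    rw [Algebra.smul_def]
    rw [← sub_eq_zero]
    apply hnz i
    have hw' := congrArg (algebraMap (RR h0) (LL h0 (η i))) hw
    rw [map_mul, algRL, map_one] at hw'
    rw [map_mul (algebraMap (RR h0) (LL h0 (η i))), algRL]
    generalize algebraMap (RR h0) (LL h0 (η i)) w = w1 at *
    have h3 : algebraMap A (LL h0 (η i)) (η i ^ N i * b i * (G * c0)) =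
        algebraMap A (LL h0 (η i)) (a i * (q * e i * d i * F) * h0 ^ k) := by
      congr 1
      rw [hq]
      linear_combination q * he0 i
    have h4 : algebraMap A (LL h0 (η i)) (a i) * ((v i)⁻¹ : (LL h0 (η i))ˣ) = algebraMap A (LL h0 (η i)) (b i) := by
      rw [hv, mul_right_comm, Units.mul_inv, one_mul]
    simp only [map_mul] at h3 hw' ⊢
    linear_combination (- w1 * algebraMap A (LL h0 (η i)) (η i ^ N i) * (algebraMap A (LL h0 (η i)) G * algebraMap A (LL h0 (η i)) c0)) * h4 - w1 * h3 - (algebraMap A (LL h0 (η i)) (a i) * (algebraMap A (LL h0 (η i)) q * algebraMap A (LL h0 (η i)) (e i) * algebraMap A (LL h0 (η i)) (d i) * algebraMap A (LL h0 (η i)) F)) * hw'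

lemma L_nz {h0 η α : A} (n0 : ∀ z, h0 * z = 0 → z = 0)
    (nz : ∀ z, α * z = 0 → ∃ N : ℕ, η ^ N * z = 0) (r : LL h0 η)
    (hr : algebraMap A (LL h0 η) α * r = 0) : r = 0 := by
  obtain ⟨K, d, hd⟩ := L_surj (LL h0 η) η h0 r
  have h1 : algebraMap A (LL h0 η) (α * d) = algebraMap A (LL h0 η) 0 := by
    rw [map_mul, ← hd, map_zero]
    linear_combination (algebraMap A (LL h0 η) ((η * h0) ^ K)) * hr
  obtain ⟨N, hN⟩ := L_eq (η := η) n0 h1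
  obtain ⟨N', hN'⟩ := nz (η ^ N * d) (by linear_combination hN)
  have h2 : algebraMap A (LL h0 η) (η ^ N' * η ^ N * (η * h0) ^ K) * r = 0 := by
    rw [map_mul, mul_assoc, hd, ← map_mul, mul_assoc, hN', map_zero]
  have u1 : IsUnit (algebraMap A (LL h0 η) (η ^ N' * η ^ N * (η * h0) ^ K)) := by
    simp only [map_mul, map_pow]
    have := L_uη (L := LL h0 η) (η := η) h0
    have u0 := L_u0 (L := LL h0 η) (h0 := h0) η
    exact (((this.pow _).mul (this.pow _)).mul ((this.mul u0).pow _))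
  exact u1.mul_left_cancel (by rw [h2, mul_zero])

lemma CData.hk [IsNoetherianRing A] [Finite ι] (c : CData A t g h x y a0 b0 η a b) {h0 : A} (n0 : ∀ z, h0 * z = 0 → z = 0)
    (hs : h0 ∈ Ideal.span (Set.range fun i => η i * a i * b i)) (v : ∀ i, (LL h0 (η i))ˣ)
    (hv : ∀ i, algebraMap A (LL h0 (η i)) (a i) = v i * algebraMap A (LL h0 (η i)) (b i)) :
    ∃ k, ∀ a ∈ maximalIdeal A ^ k,
      algebraMap A (RR h0) a ∈ MM h0 η v 1 * MM h0 η v (-1) := by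
  let J : Ideal A := (MM h0 η v 1 * MM h0 η v (-1)).comap (Algebra.linearMap A (RR h0))
  have hJ : maximalIdeal A ≤ J.radical := by
    rw [Ideal.radical_eq_sInf]
    refine le_sInf ?_
    rintro P ⟨hP, hPp⟩
    by_contra hne
    have hne' : P ≠ maximalIdeal A := fun h => hne h.ge
    obtain ⟨aP, bP, na, nb, H⟩ := c.pr P hPp hne'
    obtain ⟨z, f, hf, hz, hzM⟩ := hk_aux hs v hv (fun i => L_nz n0 (c.anz i)) P nb
      (fun i => by obtain ⟨N, f, hf, h1, -⟩ := H i; exact ⟨N, f, hf, h1⟩)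
    have hs' : h0 ∈ Ideal.span (Set.range fun i => η i * b i * a i) := by
      have : (fun i => η i * b i * a i) = fun i => η i * a i * b i := by funext i; ring
      rw [this]; exact hs
    obtain ⟨z', f', hf', hz', hzM'⟩ := hk_aux (a := b) (b := a) hs' (fun i => (v i)⁻¹) (fun i => by
        rw [hv, ← mul_assoc, (v i).inv_mul, one_mul]) (fun i => L_nz n0 (c.bnz i)) P na
      (fun i => by obtain ⟨N, f, hf, -, h1⟩ := H i; exact ⟨N, f, hf, h1⟩)
    have m1 : z ∈ MM h0 η v 1 := mem_MM.2 fun i => by simpa using hzM i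
    have m2 : z' ∈ MM h0 η v (-1) := mem_MM.2 fun i => by simpa using hzM' i
    obtain ⟨K, α, hα⟩ := R_surj h0 (z * z')
    have h1 : bP * (aP * (α - h0 ^ K * f * f')) = 0 := by
      apply R_inj n0
      simp only [map_mul, map_sub, map_zero] at *
      rw [← hα]
      linear_combination (algebraMap A (RR h0) (h0 ^ K) * algebraMap A (RR h0) aP * z') * hz +
        algebraMap A (RR h0) (h0 ^ K) * algebraMap A (RR h0) aP * algebraMap A (RR h0) f * hz'
    obtain ⟨e, he, h2⟩ := nb _ h1
    obtain ⟨e', he', h3⟩ := na (e * (α - h0 ^ K * f * f')) (by linear_combination h2)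
    have h4 : e' * e * f * f' ∈ J := by
      change algebraMap A (RR h0) (e' * e * f * f') ∈ MM h0 η v 1 * MM h0 η v (-1)
      have h5 : algebraMap A (RR h0) (e' * e * f * f') = ((e' * e) • z) * z' := by
        have u : IsUnit (algebraMap A (RR h0) (h0 ^ K)) := by
          rw [map_pow]; exact (IsLocalization.Away.algebraMap_isUnit h0).pow K
        apply u.mul_left_cancel
        have h6 := congrArg (algebraMap A (RR h0)) h3
        simp only [map_mul, map_sub, map_zero, Algebra.smul_def] at *
        linear_combination -h6 - algebraMap A (RR h0) e' * algebraMap A (RR h0) e * hα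
      rw [h5]
      exact Submodule.mul_mem_mul (Submodule.smul_mem _ _ m1) m2
    have := hP h4
    rcases hPp.mem_or_mem this with h | h
    · rcases hPp.mem_or_mem h with h | h
      · exact (hPp.mem_or_mem h).elim he' he
      · exact hf h
    · exact hf' h
  obtain ⟨k, hk⟩ := Ideal.exists_pow_le_of_le_radical_of_fg hJ (IsNoetherian.noetherian _)
  exact ⟨k, fun a ha => hk ha⟩

theorem CData.main [IsNoetherianRing A] [Finite ι] (c : CData A t g h x y a0 b0 η a b) :
    ∃ α β : A, NZm t α ∧ NZm t β ∧
      ∀ i, ∃ N : ℕ, β * a i ∣ η i ^ N * (α * b i) ∧ α * b i ∣ η i ^ N * (β * a i) := by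
  obtain ⟨h0, nt, hg, hh, ha0, hb0, hs⟩ := c.exists_h0
  have n0 : ∀ z, h0 * z = 0 → z = 0 := nzd_of_NZm c.tm c.tnz nt
  choose v hv using c.exists_v n0 hs
  obtain ⟨u, hu⟩ := c.rhoM n0 nt ha0 hb0 v hv
  have uh0 : IsUnit (algebraMap A (RR h0) h0) := IsLocalization.Away.algebraMap_isUnit _
  have uS0 : IsUnit (algebraMap A (SS h0 t) h0) := uh0.map (Ideal.Quotient.mkₐ A (Ideal.span {algebraMap A (RR h0) t}))
  have ug : IsUnit (algebraMap A (SS h0 t) g) := isUnit_of_dvd_unit (map_dvd _ hg) uS0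
  have uh : IsUnit (algebraMap A (SS h0 t) h) := isUnit_of_dvd_unit (map_dvd _ hh) uS0
  have hS := S_dvd n0 nt
  let C : Core A (RR h0) (SS h0 t) t g h :=
    { red := Ideal.Quotient.mkₐ A (Ideal.span {algebraMap A (RR h0) t})
      u := u
      M := MM h0 η v
      tm := c.tm
      M0 := c.M0 n0 v
      mulM := MM_mul v
      tinj := fun z hz => R_t n0 c.tnz z (by rwa [Algebra.smul_def] at hz)
      tM := MM_t n0 c.tnz nt v
      tS := fun z => by
        rw [Algebra.smul_def, (hS t).2 dvd_rfl, zero_mul]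
      kerr := fun z hz => by
        obtain ⟨w, hw⟩ := Ideal.mem_span_singleton.1 (Ideal.Quotient.eq_zero_iff_mem.1 hz)
        exact ⟨w, by rw [Algebra.smul_def, hw]⟩
      rhoM := hu
      hk := c.hk n0 hs v hv
      gm := c.gm
      hm := c.hm
      ug := isUnit_of_dvd_unit (map_dvd _ hg) uh0
      uh := isUnit_of_dvd_unit (map_dvd _ hh) uh0
      satM := MM_gh n0 c.ghA hg v
      satB := satB_lemma ug (c.ght.to_BR hS)
      fin := fin_lemma c.gm ug uh (c.ght.to_BR hS) (c.hgt.to_BR hS) (by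
        intro k b K hK
        have key : ∀ p q, algebraMap A (SS h0 t) p = algebraMap A (SS h0 t) q ↔ t ∣ p - q := by
          intro p q; rw [← hS, map_sub, sub_eq_zero]
        simp only [key] at hK ⊢
        exact c.vii k b K hK) }
  obtain ⟨z, hz, z', hz', hzz⟩ := C.main
  obtain ⟨K, α, hα⟩ := R_surj h0 z
  obtain ⟨K', α', hα'⟩ := R_surj h0 z'
  have hprod : α * α' = h0 ^ (K + K') := by
    apply R_inj n0
    rw [map_mul, ← hα, ← hα', pow_add, map_mul]
    linear_combination (algebraMap A (RR h0) (h0 ^ K) * algebraMap A (RR h0) (h0 ^ K')) * hzz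
  refine ⟨α, h0 ^ K, NZm.of_dvd (nt.pow _) ⟨α', hprod.symm⟩, nt.pow _, fun i => ?_⟩
  have hα1 := congrArg (algebraMap (RR h0) (LL h0 (η i))) hα
  have hzz1 := congrArg (algebraMap (RR h0) (LL h0 (η i))) hzz
  rw [map_mul, algRL, algRL] at hα1
  rw [map_mul, map_one] at hzz1
  obtain ⟨k, hk⟩ := mem_MM.1 hz i
  obtain ⟨k', hk'⟩ := mem_MM.1 hz' i
  obtain ⟨d, hd⟩ := mem_BB.1 hk
  obtain ⟨d', hd'⟩ := mem_BB.1 hk'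
  rw [Algebra.smul_def] at hd hd'
  have e1 : ((v i ^ (-1 : ℤ) : (LL h0 (η i))ˣ) : LL h0 (η i)) = ((v i)⁻¹ : (LL h0 (η i))ˣ) := by simp
  have e2 : ((v i ^ (-(-1 : ℤ)) : (LL h0 (η i))ˣ) : LL h0 (η i)) = v i := by simp
  rw [e1] at hd
  rw [e2] at hd'
  have hvi := hv i
  have hin := (v i).mul_inv
  generalize algebraMap (RR h0) (LL h0 (η i)) z = Z at *
  generalize algebraMap (RR h0) (LL h0 (η i)) z' = Z' at *
  generalize (((v i)⁻¹ : (LL h0 (η i))ˣ) : LL h0 (η i)) = vi at *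
  generalize ((v i : (LL h0 (η i))ˣ) : LL h0 (η i)) = vv at *
  have E1 : algebraMap A (LL h0 (η i)) (η i ^ k * (α * b i)) = algebraMap A (LL h0 (η i)) (h0 ^ K * a i * d) := by
    simp only [map_mul]
    rw [← hα1, hvi, hd]
    linear_combination (- algebraMap A (LL h0 (η i)) (η i ^ k) * (algebraMap A (LL h0 (η i)) (h0 ^ K) * Z * algebraMap A (LL h0 (η i)) (b i))) * hin
  have E2 : algebraMap A (LL h0 (η i)) (η i ^ k' * (h0 ^ K * a i)) = algebraMap A (LL h0 (η i)) (α * b i * d') := by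
    simp only [map_mul]
    rw [← hα1, hvi, hd']
    linear_combination (- algebraMap A (LL h0 (η i)) (η i ^ k') * (algebraMap A (LL h0 (η i)) (h0 ^ K) * vv * algebraMap A (LL h0 (η i)) (b i))) * hzz1
  obtain ⟨N1, E1⟩ := L_eq (η := η i) n0 E1
  obtain ⟨N2, E2⟩ := L_eq (η := η i) n0 E2
  refine ⟨N1 + k + (N2 + k'), ⟨η i ^ (N1 + N2 + k') * d, ?_⟩, ⟨η i ^ (N1 + k + N2) * d', ?_⟩⟩
  · linear_combination η i ^ (N2 + k') * E1
  · linear_combination η i ^ (N1 + k) * E2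

end C
end

section
universe v

section Nagata
open Polynomial MvPolynomial Ideal Nat RingHom List
variable {k : Type u} [Field k] {n : ℕ} (f : MvPolynomial (Fin (n + 1)) k)
variable (v w : Fin (n + 1) →₀ ℕ)
variable {f v} in
lemma lt_up (vlt : ∀ i, v i < (2 + MvPolynomial.totalDegree f)) : ∀ l ∈ ofFn v, l < (2 + MvPolynomial.totalDegree f) := by
  grind

/-- We construct an algebra map `NT1 f c` which maps `X_i` into `X_i + c • X_0 ^ r_i` when `i ≠ 0`
and `X_0` to `X_0`. -/
noncomputable abbrev NT1 (c : k) :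
    MvPolynomial (Fin (n + 1)) k →ₐ[k] MvPolynomial (Fin (n + 1)) k :=
  aeval fun i ↦ if i = 0 then X 0 else X i + c • X 0 ^ ((2 + MvPolynomial.totalDegree f) ^ (i : Fin (n+1)).1)

lemma t1_comp_t1_neg (c : k) : (NT1 f c).comp (NT1 f (-c)) = AlgHom.id _ _ := by
  rw [comp_aeval, ← MvPolynomial.aeval_X_left]
  ext i v
  cases i using Fin.cases <;> simp

/-- `NT1 f 1` leads to an algebra equiv `NT f`. -/
noncomputable abbrev NT := AlgEquiv.ofAlgHom (NT1 f 1) (NT1 f (-1))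
  (t1_comp_t1_neg f 1) (by simpa using t1_comp_t1_neg f (-1))

lemma sum_r_mul_ne (vlt : ∀ i, v i < (2 + MvPolynomial.totalDegree f)) (wlt : ∀ i, w i < (2 + MvPolynomial.totalDegree f)) (ne : v ≠ w) :
    ∑ x : Fin (n + 1), (2 + MvPolynomial.totalDegree f) ^ (x : Fin (n+1)).1 * v x ≠ ∑ x : Fin (n + 1), (2 + MvPolynomial.totalDegree f) ^ (x : Fin (n+1)).1 * w x := by
  intro h
  refine ne <| Finsupp.ext <| congrFun <| ofFn_inj.mp ?_
  apply ofDigits_inj_of_len_eq (Nat.lt_add_right f.totalDegree one_lt_two)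
    (by simp) (lt_up vlt) (lt_up wlt)
  simpa only [ofDigits_eq_sum_mapIdx, mapIdx_eq_ofFn, get_ofFn, length_ofFn,
    Fin.val_cast, mul_comm, sum_ofFn] using! h

lemma degreeOf_zero_t {a : k} (ha : a ≠ 0) : ((NT f) (monomial v a)).degreeOf 0 =
    ∑ i : Fin (n + 1), (2 + MvPolynomial.totalDegree f) ^ (i : Fin (n+1)).1 * v i := by
  rw [← natDegree_finSuccEquiv, monomial_eq, Finsupp.prod_pow v fun a ↦ X a]
  simp only [Fin.prod_univ_succ, Fin.sum_univ_succ, map_mul, map_prod, map_pow,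
    AlgEquiv.ofAlgHom_apply, MvPolynomial.aeval_C, MvPolynomial.aeval_X, if_pos, Fin.succ_ne_zero,
    ite_false, one_smul, map_add, finSuccEquiv_X_zero, finSuccEquiv_X_succ, algebraMap_eq]
  have h (i : Fin n) :
      (Polynomial.C (X (R := k) i) + Polynomial.X ^ ((2 + MvPolynomial.totalDegree f) ^ (i.succ : Fin (n+1)).1)) ^ v i.succ ≠ 0 :=
    pow_ne_zero (v i.succ) (leadingCoeff_ne_zero.mp <| by simp [add_comm, leadingCoeff_X_pow_add_C])
  rw [natDegree_mul (by simp [ha]) (mul_ne_zero (by simp) (Finset.prod_ne_zero_iff.mpr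
    (fun i _ ↦ h i))), natDegree_mul (by simp) (Finset.prod_ne_zero_iff.mpr (fun i _ ↦ h i)),
    natDegree_prod _ _ (fun i _ ↦ h i), natDegree_finSuccEquiv, degreeOf_C]
  simpa only [natDegree_pow, zero_add, natDegree_X, mul_one, Fin.val_zero, pow_zero, one_mul,
    add_right_inj] using Finset.sum_congr rfl (fun i _ ↦ by
    rw [add_comm (Polynomial.C _), natDegree_X_pow_add_C, mul_comm])

/-- `NT` maps different monomials of `f` to polynomials with different degrees in `X_0`. -/
lemma degreeOf_t_ne_of_ne (hv : v ∈ f.support) (hw : w ∈ f.support) (ne : v ≠ w) :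
    (NT f <| monomial v <| coeff v f).degreeOf 0 ≠
    (NT f <| monomial w <| coeff w f).degreeOf 0 := by
  rw [degreeOf_zero_t _ _ <| mem_support_iff.mp hv, degreeOf_zero_t _ _ <| mem_support_iff.mp hw]
  refine sum_r_mul_ne f v w (fun i ↦ ?_) (fun i ↦ ?_) ne <;>
  exact lt_of_le_of_lt ((monomial_le_degreeOf i ‹_›).trans (degreeOf_le_totalDegree f i))
    (by lia)

lemma leadingCoeff_finSuccEquiv_t :
    (finSuccEquiv k n ((NT f) ((monomial v) (coeff v f)))).leadingCoeff =
    algebraMap k _ (coeff v f) := by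
  rw [monomial_eq, Finsupp.prod_fintype]
  · simp only [map_mul, map_prod, leadingCoeff_mul, leadingCoeff_prod]
    rw [AlgEquiv.ofAlgHom_apply, algHom_C, algebraMap_eq, finSuccEquiv_apply,
      eval₂Hom_C, coe_comp]
    simp only [AlgEquiv.ofAlgHom_apply, Function.comp_apply, leadingCoeff_C, map_pow,
      leadingCoeff_pow, algebraMap_eq]
    have : ∀ j, ((finSuccEquiv k n) ((NT1 f) 1 (X j))).leadingCoeff = 1 := fun j ↦ by
      by_cases h : j = 0
      · simp [h, finSuccEquiv_apply]
      · simp only [aeval_eq_bind₁, bind₁_X_right, if_neg h, one_smul, map_add, map_pow]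
        obtain ⟨i, rfl⟩ := Fin.exists_succ_eq.mpr h
        simp [finSuccEquiv_X_succ, finSuccEquiv_X_zero, add_comm]
    simp only [this, one_pow, Finset.prod_const_one, mul_one]
  exact fun i ↦ pow_zero _

/-- `NT` maps `f` into some polynomial in `X_0` such that the leading coefficient is invertible. -/
lemma T_leadingcoeff_isUnit (fne : f ≠ 0) :
    IsUnit (finSuccEquiv k n (NT f f)).leadingCoeff := by
  obtain ⟨v, vin, vs⟩ := Finset.exists_max_image f.support
    (fun v ↦ (NT f ((monomial v) (coeff v f))).degreeOf 0) (support_nonempty.mpr fne)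
  set h := fun w ↦ (MvPolynomial.monomial w) (coeff w f)
  simp only [← natDegree_finSuccEquiv] at vs
  replace vs : ∀ x ∈ f.support \ {v}, (finSuccEquiv k n ((NT f) (h x))).degree <
      (finSuccEquiv k n ((NT f) (h v))).degree := by
    intro x hx
    obtain ⟨h1, h2⟩ := Finset.mem_sdiff.mp hx
    apply degree_lt_degree <| lt_of_le_of_ne (vs x h1) ?_
    simpa only [natDegree_finSuccEquiv]
      using degreeOf_t_ne_of_ne f _ _ h1 vin <| ne_of_not_mem_cons h2
  have coeff : (finSuccEquiv k n ((NT f) (h v + ∑ x ∈ f.support \ {v}, h x))).leadingCoeff =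
      (finSuccEquiv k n ((NT f) (h v))).leadingCoeff := by
    simp only [map_add, map_sum]
    rw [add_comm]
    apply leadingCoeff_add_of_degree_lt <| (lt_of_le_of_lt <| degree_sum_le _ _) ?_
    have h2 : h v ≠ 0 := by simpa [h] using mem_support_iff.mp vin
    replace h2 : (finSuccEquiv k n ((NT f) (h v))) ≠ 0 := fun eq ↦ h2 <|
      by simpa only [map_eq_zero_iff _ (AlgEquiv.injective _)] using eq
    exact (Finset.sup_lt_iff <| Ne.bot_lt (fun x ↦ h2 <| degree_eq_bot.mp x)).mpr vs
  nth_rw 2 [← f.support_sum_monomial_coeff]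
  rw [Finset.sum_eq_add_sum_sdiff_singleton_of_mem vin h]
  rw [leadingCoeff_finSuccEquiv_t] at coeff
  simpa only [coeff, algebraMap_eq] using (mem_support_iff.mp vin).isUnit.map MvPolynomial.C

end Nagata
end

section
universe v
open Polynomial in
lemma comap_C_lt {R : Type u} [CommRing R] {g : R[X]} (hg : g.Monic) {I J : Ideal R[X]} [I.IsPrime]
    (hI : g ∈ I) (h : I < J) : I.comap (C : R →+* R[X]) < J.comap C := by
  obtain ⟨hle, r, hr, hr'⟩ := SetLike.lt_iff_le_and_exists.1 h
  have : Module.Finite R (AdjoinRoot g) := (AdjoinRoot.powerBasis' hg).finite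
  obtain ⟨p, hp, hp0⟩ := Algebra.IsIntegral.isIntegral (R := R) (AdjoinRoot.mk g r)
  refine Ideal.comap_lt_comap_of_root_mem_sdiff hle ⟨hr, hr'⟩ (p := p) ?_ ?_
  · have : Nontrivial (R ⧸ Ideal.comap (C : R →+* R[X]) I) :=
      Ideal.Quotient.nontrivial_iff.2 (Ideal.IsPrime.comap C).ne_top
    exact (hp.map _).ne_zero
  · have h1 : AdjoinRoot.mk g (p.eval₂ C r) = 0 := by
      rw [Polynomial.hom_eval₂]; exact hp0
    rw [AdjoinRoot.mk_eq_zero] at h1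
    exact Ideal.mem_of_dvd I h1 hI

/-- two coprime elements in a prime of height `≥ 2` of a UFD -/
lemma exists_coprime {R : Type u} [CommRing R] [IsDomain R] [UniqueFactorizationMonoid R]
    {Q n : Ideal R} [hQp : Q.IsPrime] [n.IsPrime] (hQ : Q ≠ ⊥) (h : Q < n) :
    ∃ p ∈ n, ∃ q ∈ n, Prime p ∧ ¬ p ∣ q := by
  obtain ⟨p, hp, pp⟩ := hQp.exists_mem_prime_of_ne_bot hQ
  obtain ⟨hle, r, hr, hr'⟩ := SetLike.lt_iff_le_and_exists.1 h
  exact ⟨p, hle hp, r, hr, pp, fun hd => hr' (Ideal.mem_of_dvd Q hd hp)⟩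

lemma free_coprime {R M : Type*} [CommRing R] [IsDomain R] [AddCommGroup M] [Module R M]
    {ι : Type*} (B : Module.Basis ι R M) {p q : R} (pp : Prime p) (hq : ¬ p ∣ q) (K : ℕ) {w1 w2 : M}
    (e : q ^ K • w1 = p ^ K • w2) : ∃ w, w1 = p ^ K • w := by
  have h : ∀ i, p ^ K ∣ B.repr w1 i := by
    intro i
    have h1 : q ^ K * B.repr w1 i = p ^ K * B.repr w2 i := by
      have := congrArg (fun z => B.repr z i) e
      simpa using this
    exact pp.pow_dvd_of_dvd_mul_left K (fun h => hq (pp.dvd_of_dvd_pow h)) ⟨_, h1⟩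
  choose d hd using h
  classical
  refine ⟨(B.repr w1).sum fun i _ => d i • B i, ?_⟩
  rw [Finsupp.smul_sum]
  conv_lhs => rw [← B.linearCombination_repr w1, Finsupp.linearCombination_apply]
  refine Finsupp.sum_congr fun i _ => ?_
  rw [smul_smul, ← hd]

open Polynomial in
lemma claim_poly {R : Type u} [CommRing R] [IsDomain R] [UniqueFactorizationMonoid R] {g h c : R[X]}
    (hg : IsUnit g.leadingCoeff) (hh : ∀ z, g ∣ h * z → g ∣ z) {Q0 Q1 n : Ideal R[X]} [Q0.IsPrime]
    [Q1.IsPrime] [n.IsPrime] (h0 : g ∈ Q0) (h01 : Q0 < Q1) (h1 : Q1 < n) (K : ℕ)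
    (hc : ∀ a ∈ n ^ K, a * c ∈ Ideal.span {g, h}) : c ∈ Ideal.span {g, h} := by
  wlog hm : g.Monic generalizing g
  · obtain ⟨u, hu⟩ := hg
    have hA : Associated g (C (↑u⁻¹ : R) * g) :=
      ⟨(Units.map C.toMonoidHom u⁻¹ : R[X]ˣ), by rw [mul_comm]; rfl⟩
    have hs : Ideal.span {C (↑u⁻¹ : R) * g, h} = Ideal.span {g, h} := by
      rw [Ideal.span_insert, Ideal.span_insert, Ideal.span_singleton_eq_span_singleton.2 hA]
    have hm : (C (↑u⁻¹ : R) * g).Monic := by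
      rw [Monic, leadingCoeff_mul, leadingCoeff_C, ← hu, u.inv_mul]
    rw [← hs]
    refine this (g := C (↑u⁻¹ : R) * g) (by rw [hm]; exact isUnit_one) (fun z hz => ?_) (Ideal.mul_mem_left _ _ h0) (by rwa [hs]) hm
    rw [hA.symm.dvd_iff_dvd_left]; rw [hA.symm.dvd_iff_dvd_left] at hz; exact hh z hz
  have l1 := comap_C_lt hm h0 h01
  have l2 := comap_C_lt hm (h01.le h0) h1
  obtain ⟨p, hp, q, hq, pp, hpq⟩ := exists_coprime (ne_bot_of_gt l1) l2
  have key : ∀ a, a * c ∈ Ideal.span {g, h} → ∃ w, AdjoinRoot.mk g (a * c) = AdjoinRoot.mk g (h * w) := by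
    intro a ha
    obtain ⟨s, w, hw⟩ := Ideal.mem_span_pair.1 ha
    exact ⟨w, by rw [← hw]; simp [mul_comm]⟩
  obtain ⟨w1, hw1⟩ := key (C p ^ K) (hc _ (Ideal.pow_mem_pow (Ideal.mem_comap.1 hp) K))
  obtain ⟨w2, hw2⟩ := key (C q ^ K) (hc _ (Ideal.pow_mem_pow (Ideal.mem_comap.1 hq) K))
  have hcan : ∀ z : AdjoinRoot g, AdjoinRoot.mk g h * z = 0 → z = 0 := by
    intro z hz
    obtain ⟨z, rfl⟩ := AdjoinRoot.mk_surjective z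
    rw [← map_mul, AdjoinRoot.mk_eq_zero] at hz
    rw [AdjoinRoot.mk_eq_zero]; exact hh z hz
  have hsm : ∀ (r : R) (z : AdjoinRoot g), r ^ K • z = AdjoinRoot.mk g (C r ^ K) * z := by
    intro r z; rw [Algebra.smul_def, AdjoinRoot.algebraMap_eq, ← map_pow C]; rfl
  have B := (AdjoinRoot.powerBasis' hm).basis
  obtain ⟨w, hw⟩ := free_coprime B pp hpq K (w1 := AdjoinRoot.mk g w1) (w2 := AdjoinRoot.mk g w2) (by
    rw [← sub_eq_zero]
    apply hcan
    rw [hsm, hsm]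
    simp only [map_mul] at hw1 hw2
    linear_combination AdjoinRoot.mk g (C p ^ K) * hw2 - AdjoinRoot.mk g (C q ^ K) * hw1)
  have : Module.Free R (AdjoinRoot g) := Module.Free.of_basis B
  have h5 : AdjoinRoot.mk g c - AdjoinRoot.mk g h * w = 0 := by
    have : p ^ K • (AdjoinRoot.mk g c - AdjoinRoot.mk g h * w) = 0 := by
      rw [hsm]
      rw [hsm] at hw
      simp only [map_mul] at hw1 hw
      linear_combination hw1 + AdjoinRoot.mk g h * hw
    exact (smul_eq_zero.1 this).resolve_left (pow_ne_zero _ pp.ne_zero)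
  obtain ⟨w, rfl⟩ := AdjoinRoot.mk_surjective w
  rw [← map_mul, ← map_sub, AdjoinRoot.mk_eq_zero] at h5
  obtain ⟨d, hd⟩ := h5
  exact Ideal.mem_span_pair.2 ⟨d, w, by linear_combination -hd⟩

lemma claim_mv {k : Type u} [Field k] {s : ℕ} {g h c : MvPolynomial (Fin s) k} (g0 : g ≠ 0)
    (hh : ∀ z, g ∣ h * z → g ∣ z) {Q0 Q1 n : Ideal (MvPolynomial (Fin s) k)} [Q0.IsPrime]
    [Q1.IsPrime] [n.IsPrime] (h0 : g ∈ Q0) (h01 : Q0 < Q1) (h1 : Q1 < n) (K : ℕ)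
    (hc : ∀ a ∈ n ^ K, a * c ∈ Ideal.span {g, h}) : c ∈ Ideal.span {g, h} := by
  obtain _ | s := s
  · exfalso
    have : IsUnit g := by
      rw [MvPolynomial.eq_C_of_isEmpty g] at g0 ⊢
      exact (IsUnit.mk0 _ (fun h => g0 (by rw [h, map_zero]))).map _
    exact Ideal.IsPrime.ne_top ‹Q0.IsPrime› (Ideal.eq_top_of_isUnit_mem _ h0 this)
  obtain ⟨T, hT⟩ : ∃ T : MvPolynomial (Fin (s + 1)) k ≃+* Polynomial (MvPolynomial (Fin s) k),
      IsUnit (T g).leadingCoeff :=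
    ⟨((NT g).trans (MvPolynomial.finSuccEquiv k s)).toRingEquiv, T_leadingcoeff_isUnit g g0⟩
  have hdv : ∀ a b, T a ∣ T b ↔ a ∣ b := fun a b => map_dvd_iff T
  have hlt : ∀ I J : Ideal (MvPolynomial (Fin (s + 1)) k), I < J → I.comap T.symm < J.comap T.symm := by
    intro I J hIJ
    refine lt_of_le_of_ne (Ideal.comap_mono hIJ.le) fun he => hIJ.ne ?_
    exact Ideal.comap_injective_of_surjective T.symm T.symm.surjective he
  have hmem : ∀ z, T z ∈ Ideal.span {T g, T h} ↔ z ∈ Ideal.span {g, h} := by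
    intro z
    rw [Ideal.mem_span_pair, Ideal.mem_span_pair]
    constructor
    · rintro ⟨a, b, e⟩
      refine ⟨T.symm a, T.symm b, T.injective ?_⟩
      simpa using e
    · rintro ⟨a, b, e⟩
      exact ⟨T a, T b, by rw [← e]; simp⟩
  rw [← hmem]
  refine claim_poly hT (fun z hz => ?_) (Q0 := Q0.comap T.symm) (Q1 := Q1.comap T.symm) (n := n.comap T.symm)
    (by simpa using h0) (hlt _ _ h01) (hlt _ _ h1) K (fun a ha => ?_)
  · obtain ⟨z, rfl⟩ := T.surjective z
    rw [← map_mul, hdv] at hz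
    rw [hdv]; exact hh z hz
  · obtain ⟨a, rfl⟩ := T.surjective a
    rw [← map_mul, hmem]
    apply hc
    have : T.symm (T a) ∈ n ^ K := by
      have := Ideal.le_comap_pow T.symm (K := n) K ha
      exact this
    simpa using this
end

section

/-- regularity of `x, y` at the prime `P`, elementwise -/
def RegAt {A : Type*} [CommRing A] (P : Ideal A) (x y : A) : Prop :=
  (∀ z, x * z = 0 → ∃ f ∉ P, f * z = 0) ∧
    ∀ z w, y * z = x * w → ∃ f ∉ P, ∃ v, f * z = x * v

/-- The condition S2, in chain form -/
structure S2R (A : Type*) [CommRing A] : Prop where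
  s1 : ∀ P0 P : Ideal A, P0.IsPrime → P.IsPrime → P0 < P →
    ∃ x ∈ P, ∀ z, x * z = 0 → ∃ f ∉ P, f * z = 0
  s2 : ∀ P0 P1 P : Ideal A, P0.IsPrime → P1.IsPrime → P.IsPrime → P0 < P1 → P1 < P →
    ∃ x ∈ P, ∃ y ∈ P, RegAt P x y

section
variable {A : Type*} [CommRing A]

lemma exists_prime_avoid (P I : Ideal A) [hP : P.IsPrime] (N : Submonoid A)
    (h : ∀ n ∈ N, ∀ f ∉ P, n * f ∉ I) : ∃ Q : Ideal A, Q.IsPrime ∧ I ≤ Q ∧ Q ≤ P ∧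
      ∀ n ∈ N, n ∉ Q := by
  obtain ⟨Q, hQ, hI, hd⟩ := Ideal.exists_le_prime_disjoint I (N ⊔ P.primeCompl) (by
    rw [Set.disjoint_left]
    intro z hz hz'
    obtain ⟨n, hn, f, hf, rfl⟩ := Submonoid.mem_sup.1 hz'
    exact h n hn f hf hz)
  rw [Set.disjoint_left] at hd
  refine ⟨Q, hQ, hI, fun z hz => ?_, fun n hn hq => hd hq (Submonoid.mem_sup_left hn)⟩
  by_contra hzP
  exact hd hz (Submonoid.mem_sup_right hzP)

lemma mem_minimal_pow {I P : Ideal A} (hP : P ∈ I.minimalPrimes) {x : A} (hx : x ∈ P) :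
    ∃ k : ℕ, ∃ e ∉ P, e * x ^ k ∈ I := by
  by_contra hc
  push Not at hc
  haveI := hP.1.1
  obtain ⟨Q, hQ, hI, hle, hn⟩ := exists_prime_avoid P I (Submonoid.powers x) (by
    rintro _ ⟨k, rfl⟩ f hf
    rw [mul_comm]; exact hc k f hf)
  exact hn x (Submonoid.mem_powers x) (hP.2 ⟨hQ, hI⟩ hle hx)

variable {P : Ideal A}

lemma RegAt.pow_right [hP : P.IsPrime] {x y : A} (h : RegAt P x y) (k : ℕ) : RegAt P x (y ^ k) := by
  refine ⟨h.1, ?_⟩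
  induction k with
  | zero => intro z w e; exact ⟨1, fun h => hP.ne_top ((Ideal.eq_top_iff_one _).2 h), w, by simpa using e⟩
  | succ k ih =>
    intro z w e
    rw [pow_succ', mul_assoc] at e
    obtain ⟨f, hf, v, hv⟩ := h.2 _ _ e
    obtain ⟨f', hf', v', hv'⟩ := ih (f * z) v (by rw [← hv]; ring)
    exact ⟨f' * f, hP.mul_notMem hf' hf, v', by rw [← hv']; ring⟩

lemma RegAt.pow_left [hP : P.IsPrime] {x y : A} (h : RegAt P x y) (k : ℕ) : RegAt P (x ^ k) y := by
  have one : (1 : A) ∉ P := fun h => hP.ne_top ((Ideal.eq_top_iff_one _).2 h)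
  have h1 : ∀ k : ℕ, ∀ z : A, x ^ k * z = 0 → ∃ f ∉ P, f * z = 0 := by
    intro k
    induction k with
    | zero => intro z hz; exact ⟨1, one, by simpa using hz⟩
    | succ k ih =>
      intro z hz
      rw [pow_succ', mul_assoc] at hz
      obtain ⟨f, hf, e⟩ := h.1 _ hz
      obtain ⟨f', hf', e'⟩ := ih (f * z) (by rw [← e]; ring)
      exact ⟨f' * f, hP.mul_notMem hf' hf, by rw [← e']; ring⟩
  refine ⟨h1 k, ?_⟩
  induction k with
  | zero => intro z w e; exact ⟨1, one, z, by simp⟩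
  | succ k ih =>
    intro z w e
    rw [pow_succ', mul_assoc] at e
    obtain ⟨f, hf, v, hv⟩ := h.2 _ _ e
    obtain ⟨f1, hf1, e1⟩ := h.1 (y * v - f * x ^ k * w) (by linear_combination f * e - y * hv)
    obtain ⟨f2, hf2, v', e2⟩ := ih (f1 * v) (f1 * f * w) (by linear_combination e1)
    exact ⟨f2 * f1 * f, hP.mul_notMem (hP.mul_notMem hf2 hf1) hf, v',
      by linear_combination f2 * f1 * hv + x * e2⟩

lemma RegAt.mul [hP : P.IsPrime] {x y : A} (h : RegAt P x y) {e e' : A} (he : e ∉ P) (he' : e' ∉ P) :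
    RegAt P (e * x) (e' * y) := by
  constructor
  · intro z hz
    obtain ⟨f, hf, hz⟩ := h.1 (e * z) (by rw [← hz]; ring)
    exact ⟨f * e, hP.mul_notMem hf he, by rw [← hz]; ring⟩
  · intro z w hz
    obtain ⟨f, hf, v, hz⟩ := h.2 (e' * z) (e * w) (by linear_combination hz)
    exact ⟨e * f * e', hP.mul_notMem (hP.mul_notMem he hf) he', v, by linear_combination e * hz⟩

/-- Hartshorne connectedness, local form -/
lemma hartshorne {I J : Ideal A} (hP : P ∈ (I ⊔ J).minimalPrimes) (hIJ : ∀ i ∈ I, ∀ j ∈ J, i * j = 0)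
    {x y : A} (hx : x ∈ P) (hy : y ∈ P) (h : RegAt P x y) :
    (∀ j ∈ J, ∃ f ∉ P, f * j = 0) ∨ ∀ i ∈ I, ∃ f ∉ P, f * i = 0 := by
  haveI hPp := hP.1.1
  obtain ⟨k, e, he, hxe⟩ := mem_minimal_pow hP hx
  obtain ⟨l, e', he', hye⟩ := mem_minimal_pow hP hy
  have H := ((h.pow_left k).pow_right l).mul he he'
  obtain ⟨x1, hx1, x2, hx2, ex⟩ := Submodule.mem_sup.1 hxe
  obtain ⟨y1, hy1, y2, hy2, ey⟩ := Submodule.mem_sup.1 hye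
  obtain ⟨f, hf, v, hv⟩ := H.2 x1 y1 (by
    linear_combination - x1 * ey + y1 * ex + hIJ _ hx1 _ hy2 - hIJ _ hy1 _ hx2)
  have H2 := (H.pow_left 2).1 (v * (f - v)) (by
    linear_combination (f * x1 - (f * (e * x ^ k) - (e * x ^ k) * v)) * hv - f * f * x1 * ex +
      f * f * hIJ _ hx1 _ hx2)
  obtain ⟨f', hf', e2⟩ := H2
  by_cases hvP : v ∈ P
  · have hfv : f - v ∉ P := fun h => hf (by simpa using P.add_mem h hvP)
    right
    intro i hi
    have e3 : f' * (f - v) * f * x1 = 0 := by linear_combination f' * (f - v) * hv + (e * x ^ k) * e2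
    obtain ⟨f2, hf2, e4⟩ := H.1 (f' * (f - v) * f * i) (by
      linear_combination i * e3 + f' * (f - v) * f * (hIJ i hi x2 hx2 - i * ex))
    exact ⟨f2 * (f' * (f - v) * f), hPp.mul_notMem hf2 (hPp.mul_notMem (hPp.mul_notMem hf' hfv) hf),
      by linear_combination e4⟩
  · left
    intro j hj
    have e3 : f' * v * f * x2 = 0 := by
      linear_combination f' * v * f * ex - f' * v * hv + (e * x ^ k) * e2
    obtain ⟨f2, hf2, e4⟩ := H.1 (f' * v * f * j) (by
      linear_combination j * e3 + f' * v * f * (hIJ x1 hx1 j hj - j * ex))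
    exact ⟨f2 * (f' * v * f), hPp.mul_notMem hf2 (hPp.mul_notMem (hPp.mul_notMem hf' hvP) hf),
      by linear_combination e4⟩

lemma S2R.ass (s : S2R A) {P0 P : Ideal A} [h0 : P0.IsPrime] [hP : P.IsPrime] {z : A}
    (hz : ∀ a, a ∈ P ↔ a * z = 0) (h : P0 < P) : False := by
  obtain ⟨x, hx, H⟩ := s.s1 P0 P h0 hP h
  obtain ⟨f, hf, e⟩ := H z ((hz x).1 hx)
  exact hf ((hz f).2 e)

lemma S2R.ass2 (s : S2R A) {P0 P1 P : Ideal A} [h0 : P0.IsPrime] [h1 : P1.IsPrime] [hP : P.IsPrime] {g z : A}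
    (hg : ∀ z, g * z = 0 → z = 0)
    (hz : ∀ a, a ∈ P ↔ g ∣ a * z) (h01 : P0 < P1) (h : P1 < P) : False := by
  obtain ⟨x, hx, y, hy, H⟩ := s.s2 P0 P1 P h0 h1 hP h01 h
  obtain ⟨a, ha⟩ := (hz x).1 hx
  obtain ⟨b, hb⟩ := (hz y).1 hy
  have : y * a = x * b := by
    rw [← sub_eq_zero]; apply hg; linear_combination x * hb - y * ha
  obtain ⟨f, hf, v, hv⟩ := H.2 _ _ this
  obtain ⟨f', hf', e⟩ := H.1 (f * z - g * v) (by linear_combination g * hv + f * ha)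
  exact hP.mul_notMem hf' hf ((hz _).2 ⟨f' * v, by linear_combination e⟩)
end

end

section

section
variable {A : Type*} [CommRing A]

lemma exists_ass_le [IsNoetherianRing A] (I P : Ideal A) [P.IsPrime] (h : ∀ a, (∀ i ∈ I, a * i = 0) → a ∈ P) :
    ∃ Q : Ideal A, Q.IsPrime ∧ Q ≤ P ∧ (∀ a, (∀ i ∈ I, a * i = 0) → a ∈ Q) ∧
      ∃ z, ∀ a, a ∈ Q ↔ a * z = 0 := by
  obtain ⟨Q, hQ, hQP⟩ := Ideal.exists_minimalPrimes_le (I := Module.annihilator A I) (J := P) (by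
    intro a ha
    apply h
    intro i hi
    have := Module.mem_annihilator.1 ha ⟨i, hi⟩
    simpa using congrArg Subtype.val this)
  have := Module.associatedPrimes.minimalPrimes_annihilator_subset_associatedPrimes A I hQ
  obtain ⟨hp, z, hz⟩ := isAssociatedPrime_iff.1 (this : IsAssociatedPrime Q I)
  refine ⟨Q, hp, hQP, fun a ha => hQ.1.2 (Module.mem_annihilator.2 fun i => Subtype.ext (ha i i.2)), z, ?_⟩
  intro a
  rw [hz, Submodule.mem_colon_singleton, Submodule.mem_bot, ← Subtype.coe_inj]
  simp

variable {R S : Type*} [CommRing R] [IsDomain R] [IsIntegrallyClosed R] [CommRing S] [Algebra R S] [Algebra.IsIntegral R S]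
  (M : Submonoid S) [Algebra S A] [IsLocalization M A] [Algebra R A] [IsScalarTower R S A]

lemma comap_lt_loc (M : Submonoid S) [IsLocalization M A] {P Q : Ideal A} (h : P < Q) :
    P.comap (algebraMap S A) < Q.comap (algebraMap S A) := by
  have e : ∀ J : Ideal A, (J.comap (algebraMap S A)).map (algebraMap S A) = J :=
    fun J => IsLocalization.map_under M A J
  refine lt_of_le_of_ne (Ideal.comap_mono h.le) fun h' => ?_
  have := congrArg (Ideal.map (algebraMap S A)) h'
  rw [e, e] at this
  exact h.ne this

include M in
lemma comap_lt_R {P Q : Ideal A} [P.IsPrime] (h : P < Q) :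
    P.comap (algebraMap R A) < Q.comap (algebraMap R A) := by
  have h1 := comap_lt_loc M h
  haveI : (P.comap (algebraMap S A)).IsPrime := inferInstance
  have := Ideal.IsIntegral.comap_lt_comap (R := R) h1
  rwa [Ideal.comap_comap, Ideal.comap_comap, ← IsScalarTower.algebraMap_eq] at this

include M in
lemma going_down {p P : Ideal A} [hp : p.IsPrime] [hP : P.IsPrime] (hpP : p ≤ P)
    (h0 : p.comap (algebraMap R A) = ⊥) {q : Ideal R} [hq : q.IsPrime] (hq0 : q ≠ ⊥)
    (hqP : q < P.comap (algebraMap R A)) : ∃ Q : Ideal A, Q.IsPrime ∧ p < Q ∧ Q < P := by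
  set p' := p.comap (algebraMap S A) with hp'
  set P' := P.comap (algebraMap S A) with hP'
  have e0 : p'.comap (algebraMap R S) = ⊥ := by
    rw [hp', Ideal.comap_comap, ← IsScalarTower.algebraMap_eq, h0]
  have hle : p' ≤ P' := Ideal.comap_mono hpP
  haveI : p'.IsPrime := Ideal.IsPrime.comap _
  haveI : P'.IsPrime := Ideal.IsPrime.comap _
  haveI : FaithfulSMul R (S ⧸ p') := by
    rw [faithfulSMul_iff_algebraMap_injective, injective_iff_map_eq_zero]
    intro r hr
    have : r ∈ p'.comap (algebraMap R S) := by
      rw [Ideal.mem_comap]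
      exact Ideal.Quotient.eq_zero_iff_mem.1 hr
    rw [e0] at this
    simpa using this
  let P'' := P'.map (Ideal.Quotient.mk p')
  have cP : P''.comap (Ideal.Quotient.mk p') = P' := by
    rw [Ideal.comap_map_of_surjective _ Ideal.Quotient.mk_surjective]
    simpa [← RingHom.ker_eq_comap_bot] using hle
  haveI : P''.IsPrime := Ideal.map_isPrime_of_surjective Ideal.Quotient.mk_surjective (by simpa using hle)
  haveI : P''.LiesOver (P.comap (algebraMap R A)) := ⟨by
    show _ = P''.comap (algebraMap R (S ⧸ p'))
    have : algebraMap R (S ⧸ p') = (Ideal.Quotient.mk p').comp (algebraMap R S) := rfl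
    rw [this, ← Ideal.comap_comap, cP, hP', Ideal.comap_comap, ← IsScalarTower.algebraMap_eq]⟩
  obtain ⟨Q'', hQle, hQ, ⟨hQq⟩⟩ := Ideal.exists_ideal_le_liesOver_of_le P'' hqP.le
  have hQq : q = Q''.comap (algebraMap R (S ⧸ p')) := hQq
  set Q' := Q''.comap (Ideal.Quotient.mk p') with hQ'
  haveI : Q'.IsPrime := Ideal.IsPrime.comap _
  have hQP' : Q' ≤ P' := by rw [← cP]; exact Ideal.comap_mono hQle
  have hpQ' : p' ≤ Q' := by
    intro z hz
    rw [hQ', Ideal.mem_comap, Ideal.Quotient.eq_zero_iff_mem.2 hz]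
    exact Q''.zero_mem
  have hdis : Disjoint (M : Set S) (Q' : Set S) := by
    rw [Set.disjoint_left]
    intro m hm hmQ
    exact hP.ne_top (Ideal.eq_top_of_isUnit_mem _ (hQP' hmQ) (IsLocalization.map_units A ⟨m, hm⟩))
  have cQ : (Q'.map (algebraMap S A)).comap (algebraMap S A) = Q' :=
    IsLocalization.under_map_of_isPrime_disjoint M A inferInstance hdis
  have e : ∀ J : Ideal A, (J.comap (algebraMap S A)).map (algebraMap S A) = J :=
    fun J => IsLocalization.map_under M A J
  have cQR : Q'.comap (algebraMap R S) = q := by rw [hQq]; rfl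
  refine ⟨Q'.map (algebraMap S A), IsLocalization.isPrime_of_isPrime_disjoint M A _ inferInstance hdis,
    lt_of_le_of_ne ?_ ?_, lt_of_le_of_ne ?_ ?_⟩
  · rw [← e p]; exact Ideal.map_mono hpQ'
  · intro h
    apply hq0
    rw [← cQR, ← cQ, ← h, ← hp', e0]
  · rw [← e P]; exact Ideal.map_mono hQP'
  · intro h
    apply hqP.ne
    rw [← cQR, ← cQ, h, Ideal.comap_comap, ← IsScalarTower.algebraMap_eq]

include M in
lemma nzd_of_S2 [IsNoetherianRing A] [IsLocalRing A] (s : S2R A)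
    (inj : Function.Injective (algebraMap R A)) {r : R} (r0 : r ≠ 0) (a : A)
    (ha : algebraMap R A r * a = 0) : a = 0 := by
  classical
  by_contra ane
  have hz0 : ∀ r : R, algebraMap R A r = 0 → r = 0 := fun r hr => inj (by rw [hr, map_zero])
  let I : Ideal A :=
    { carrier := {a | ∃ r : R, r ≠ 0 ∧ algebraMap R A r * a = 0}
      add_mem' := by
        rintro a b ⟨r, hr, e⟩ ⟨r', hr', e'⟩
        exact ⟨r * r', mul_ne_zero hr hr', by
          rw [map_mul]; linear_combination algebraMap R A r' * e + algebraMap R A r * e'⟩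
      zero_mem' := ⟨1, one_ne_zero, by simp⟩
      smul_mem' := by
        rintro c a ⟨r, hr, e⟩
        exact ⟨r, hr, by rw [smul_eq_mul]; linear_combination c * e⟩ }
  have hI : ∀ a, a ∈ I ↔ ∃ r : R, r ≠ 0 ∧ algebraMap R A r * a = 0 := fun a => Iff.rfl
  obtain ⟨r1, hr1, hrI⟩ : ∃ r : R, r ≠ 0 ∧ ∀ i ∈ I, algebraMap R A r * i = 0 := by
    obtain ⟨t, ht⟩ := IsNoetherian.noetherian I
    have hmem : ∀ z ∈ t, z ∈ I := fun z hz => by rw [← ht]; exact Submodule.subset_span hz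
    choose! ρ h1 h2 using fun z (hz : z ∈ t) => (hI z).1 (hmem z hz)
    refine ⟨∏ z ∈ t, ρ z, Finset.prod_ne_zero_iff.2 h1, fun i hi => ?_⟩
    rw [← ht] at hi
    induction hi using Submodule.span_induction with
    | mem x hx =>
      rw [← Finset.mul_prod_erase t ρ hx, map_mul]
      linear_combination (algebraMap R A (∏ z ∈ t.erase x, ρ z)) * h2 x hx
    | zero => simp
    | add x y _ _ hx hy => rw [mul_add, hx, hy, add_zero]
    | smul c x _ hx => rw [smul_eq_mul]; linear_combination c * hx
  let J : Ideal A :=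
    { carrier := {a | ∀ i ∈ I, a * i = 0}
      add_mem' := by
        intro a b ha hb i hi
        rw [add_mul, ha i hi, hb i hi, add_zero]
      zero_mem' := by intro i _; simp
      smul_mem' := by
        intro c a ha i hi
        rw [smul_eq_mul, mul_assoc, ha i hi, mul_zero] }
  have hJ : ∀ a, a ∈ J ↔ ∀ i ∈ I, a * i = 0 := fun a => Iff.rfl
  have I1 : I ≠ ⊤ := by
    intro h
    obtain ⟨r, hr, e⟩ := (hI 1).1 ((Ideal.eq_top_iff_one _).1 h)
    exact hr (hz0 r (by simpa using e))
  have J1 : J ≠ ⊤ := by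
    intro h
    have := (hJ 1).1 ((Ideal.eq_top_iff_one _).1 h) a ((hI a).2 ⟨r, r0, ha⟩)
    exact ane (by simpa using this)
  obtain ⟨P, hPm, -⟩ := Ideal.exists_minimalPrimes_le (I := I ⊔ J) (J := maximalIdeal A)
    (sup_le (IsLocalRing.le_maximalIdeal I1) (IsLocalRing.le_maximalIdeal J1))
  haveI hP := hPm.1.1
  have IP : I ≤ P := le_sup_left.trans hPm.1.2
  have JP : J ≤ P := le_sup_right.trans hPm.1.2
  have nochain : ∀ P0 P1 : Ideal A, P0.IsPrime → P1.IsPrime → P0 < P1 → P1 < P → False := by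
    intro P0 P1 h0 h1 h01 h
    obtain ⟨x, hx, y, hy, H⟩ := s.s2 P0 P1 P h0 h1 hP h01 h
    rcases hartshorne hPm (fun i hi j hj => by rw [mul_comm]; exact (hJ j).1 hj i hi) hx hy H with h | h
    · obtain ⟨f, hf, e⟩ := h (algebraMap R A r1) ((hJ _).2 hrI)
      exact hf (IP ((hI f).2 ⟨r1, hr1, by rw [mul_comm]; exact e⟩))
    · obtain ⟨t, ht⟩ := IsNoetherian.noetherian I
      have hmem : ∀ z ∈ t, z ∈ I := fun z hz => by rw [← ht]; exact Submodule.subset_span hz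
      choose! ρ h1 h2 using fun z (hz : z ∈ t) => h z (hmem z hz)
      have : ∏ z ∈ t, ρ z ∉ P := by
        intro hc
        obtain ⟨z, hz, hc⟩ := (Ideal.IsPrime.prod_mem_iff (p := P)).1 hc
        exact h1 z hz hc
      refine this (JP ((hJ _).2 fun i hi => ?_))
      rw [← ht] at hi
      induction hi using Submodule.span_induction with
      | mem x hx =>
        rw [← Finset.mul_prod_erase t ρ hx]
        linear_combination (∏ z ∈ t.erase x, ρ z) * h2 x hx
      | zero => simp
      | add x y _ _ hx hy => rw [mul_add, hx, hy, add_zero]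
      | smul c x _ hx => rw [smul_eq_mul]; linear_combination c * hx
  obtain ⟨p1, hp1, -, hp1P, hp1R⟩ := exists_prime_avoid P ⊥ ((nonZeroDivisors R).map (algebraMap R A)) (by
    rintro _ ⟨r, hr, rfl⟩ f hf h
    exact hf (IP ((hI f).2 ⟨r, nonZeroDivisors.ne_zero hr, h⟩)))
  have hp1b : p1.comap (algebraMap R A) = ⊥ := by
    rw [eq_bot_iff]
    intro r hr
    by_contra h
    exact hp1R _ ⟨r, mem_nonZeroDivisors_of_ne_zero h, rfl⟩ hr
  obtain ⟨p2, hp2, hp2P, hp2J, z, hz⟩ := exists_ass_le I P (fun a ha => JP ha)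
  have hr2 := hp2J _ hrI
  have hlt : p2 < P := by
    refine lt_of_le_of_ne hp2P fun h => ?_
    subst h
    exact s.ass hz (lt_of_le_of_ne hp1P fun h => hp1R _ ⟨r1, mem_nonZeroDivisors_of_ne_zero hr1, rfl⟩ (h ▸ hr2))
  obtain ⟨Q, hQ, h1, h2⟩ := going_down (R := R) M hp1P hp1b (q := p2.comap (algebraMap R A)) (by
    intro h
    have : r1 ∈ p2.comap (algebraMap R A) := hr2
    rw [h] at this
    exact hr1 (by simpa using this)) (comap_lt_R M hlt)
  exact nochain _ _ hp1 hQ h1 h2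
end
end

section

section
variable {R S : Type*} [CommRing R] [AddCommGroup S] [Module R S]

/-- elements whose multiplication on `S` factors through a free module -/
def trI (R S : Type*) [CommRing R] [AddCommGroup S] [Module R S] : Ideal R :=
  Submodule.comap (LinearMap.lsmul R S) (Submodule.span R
    {φ | ∃ (f : S →ₗ[R] R) (m : S), φ = f.smulRight m})

lemma trI_mem {r : R} (h : r ∈ trI R S) (N : Submodule R S) (b : S)
    (H : ∀ (f : S →ₗ[R] R) (m : S), f b • m ∈ N) : r • b ∈ N := by
  have h : LinearMap.lsmul R S r ∈ Submodule.span R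
    {φ | ∃ (f : S →ₗ[R] R) (m : S), φ = f.smulRight m} := h
  have : ∀ φ ∈ Submodule.span R {φ : S →ₗ[R] S | ∃ (f : S →ₗ[R] R) (m : S), φ = f.smulRight m}, φ b ∈ N := by
    intro φ hφ
    induction hφ using Submodule.span_induction with
    | mem x hx => obtain ⟨f, m, rfl⟩ := hx; exact H f m
    | zero => simp
    | add x y _ _ hx hy => exact N.add_mem hx hy
    | smul c x _ hx => exact N.smul_mem c hx
  exact this _ h

lemma trI_not_le [IsDomain R] [IsNoetherianRing R] [Module.Finite R S] [Module.IsTorsionFree R S]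
    (p : Ideal R) [hp : p.IsPrime] (hpp : Submodule.IsPrincipal p) : ∃ r ∈ trI R S, r ∉ p := by
  classical
  let Rp := Localization.AtPrime p
  let Sp := LocalizedModule p.primeCompl S
  haveI : IsDomain Rp := IsLocalization.isDomain_localization p.primeCompl_le_nonZeroDivisors
  haveI : IsNoetherianRing Rp := IsLocalization.isNoetherianRing p.primeCompl Rp inferInstance
  haveI : IsPrincipalIdealRing Rp := by
    refine ((tfae_of_isNoetherianRing_of_isLocalRing_of_isDomain Rp).out 0 4).2 ?_
    rw [← IsLocalization.AtPrime.map_eq_maximalIdeal p Rp]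
    obtain ⟨a, ha⟩ := hpp
    exact ⟨algebraMap R Rp a, by
      refine (congrArg (Ideal.map (algebraMap R Rp)) ha).trans ?_
      exact Ideal.map_span _ _ |>.trans (by simp [Ideal.submodule_span_eq])⟩
  haveI : Module.Free Rp Sp := Module.free_of_finite_type_torsion_free'
  let B := Module.Free.chooseBasis Rp Sp
  haveI : Finite (Module.Free.ChooseBasisIndex Rp Sp) := inferInstance
  haveI : Fintype (Module.Free.ChooseBasisIndex Rp Sp) := Fintype.ofFinite _
  let ι := LocalizedModule.mkLinearMap p.primeCompl S
  haveI : Module.FinitePresentation R S := Module.finitePresentation_of_finite R S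
  have H : ∀ j, ∃ (h : S →ₗ[R] R) (s : p.primeCompl), Algebra.linearMap R Rp ∘ₗ h =
      s • ((B.coord j).restrictScalars R ∘ₗ ι) := fun j =>
    Module.FinitePresentation.exists_lift_of_isLocalizedModule p.primeCompl (Algebra.linearMap R Rp) _
  choose f s hf using H
  choose m hm using fun j => IsLocalizedModule.surj p.primeCompl ι (B j)
  let r : R := ∏ j, ((s j : R) * ((m j).2 : R))
  refine ⟨r, ?_, ?_⟩
  · have key : LinearMap.lsmul R S r = ∑ j, (∏ i ∈ Finset.univ.erase j, ((s i : R) * ((m i).2 : R))) •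
        (f j).smulRight (m j).1 := by
      ext b
      have inj : Function.Injective ι := by
        intro a b hab
        obtain ⟨c, hc⟩ := IsLocalizedModule.exists_of_eq (S := p.primeCompl) (f := ι) hab
        exact smul_right_injective S (fun h => c.2 (by rw [h]; exact p.zero_mem)) hc
      apply inj
      have e1 : ∀ j, algebraMap R Rp (f j b) = (s j : R) • B.repr (ι b) j := by
        intro j
        have := LinearMap.congr_fun (hf j) b
        exact this
      have e2 : ∀ j, ι (m j).1 = ((m j).2 : R) • B j := fun j => (hm j).symm
      simp only [LinearMap.lsmul_apply, map_smul, LinearMap.sum_apply, map_sum, LinearMap.smul_apply,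
        LinearMap.smulRight_apply]
      conv_lhs => rw [← B.sum_repr (ι b)]
      rw [Finset.smul_sum]
      refine Finset.sum_congr rfl fun j _ => ?_
      have cv : ∀ (c : R) (v : Sp), c • v = algebraMap R Rp c • v := fun c v => (algebraMap_smul Rp c v).symm
      rw [e2, cv (f j b), e1, cv r, cv, cv ((m j).2 : R), smul_smul, smul_smul, smul_smul]
      congr 1
      show algebraMap R Rp (∏ j, ((s j : R) * ((m j).2 : R))) * _ = _
      rw [← Finset.mul_prod_erase Finset.univ _ (Finset.mem_univ j), map_mul, map_mul, Algebra.smul_def]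
      ring
    show LinearMap.lsmul R S r ∈ Submodule.span R _
    rw [key]
    exact Submodule.sum_mem _ fun j _ => Submodule.smul_mem _ _ (Submodule.subset_span ⟨_, _, rfl⟩)
  · intro h
    obtain ⟨j, -, hj⟩ := (Ideal.IsPrime.prod_mem_iff (p := p)).1 h
    rcases hp.mem_or_mem hj with h | h
    · exact (s j).2 h
    · exact (m j).2.2 h
end

end

section

lemma Reg2.symm {A : Type*} [CommRing A] {x y : A} (h : Reg2 A x y) (hy : ∀ z, y * z = 0 → z = 0) :
    Reg2 A y x := by
  refine ⟨hy, fun z w e => ?_⟩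
  obtain ⟨v, rfl⟩ := h.2 _ _ e.symm
  exact ⟨v, by rw [← sub_eq_zero]; apply h.1; linear_combination e⟩

section
variable {κ : Type u} [Field κ] {s : ℕ} {S A : Type u} [CommRing S] [CommRing A]
  [Algebra (MvPolynomial (Fin s) κ) S] [Module.Finite (MvPolynomial (Fin s) κ) S]
  (M : Submonoid S) [Algebra S A] [IsLocalization M A] [Algebra (MvPolynomial (Fin s) κ) A]
  [IsScalarTower (MvPolynomial (Fin s) κ) S A] [IsNoetherianRing A] [IsLocalRing A]

open UniqueFactorizationMonoid in
include M in
lemma fibre_aux (s2 : S2R A) (injRA : Function.Injective (algebraMap (MvPolynomial (Fin s) κ) A))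
    (injSA : Function.Injective (algebraMap S A))
    {m0 m1 m2 : Ideal A} [m0.IsPrime] [m1.IsPrime] [m2.IsPrime] (h01 : m0 < m1) (h12 : m1 < m2)
    (h2m : m2 < maximalIdeal A) :
    ∃ g ∈ maximalIdeal A, ∃ h ∈ maximalIdeal A, Reg2 A g h ∧ Reg2 A h g ∧
    ∀ (k : ℕ) (b : A) (K : ℕ),
      (∀ a ∈ maximalIdeal A ^ K, ∃ c1 c2, a * b = c1 * h ^ k + c2 * g ^ k) →
      (∃ c1 c2, g * b = c1 * h ^ k + c2 * g ^ k) ∧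
      (∃ c1 c2, h * b = c1 * h ^ k + c2 * g ^ k) := by
  classical
  let R := MvPolynomial (Fin s) κ
  set m := maximalIdeal A with hm
  haveI : Algebra.IsIntegral R S := inferInstance
  have nzd : ∀ r : R, r ≠ 0 → ∀ a : A, algebraMap R A r * a = 0 → a = 0 :=
    fun r hr a ha => nzd_of_S2 M s2 injRA hr a ha
  haveI : Module.IsTorsionFree R S := by
    refine ⟨fun r hr a b hab => ?_⟩
    have h1 : r • (a - b) = 0 := by rw [smul_sub, sub_eq_zero]; exact hab
    have h2 : algebraMap S A (a - b) = 0 := by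
      apply nzd r hr.ne_zero
      rw [IsScalarTower.algebraMap_apply R S A, ← map_mul, ← Algebra.smul_def, h1, map_zero]
    rw [← sub_eq_zero]
    exact injSA (by rw [h2, map_zero])
  set n1 := m1.comap (algebraMap R A) with hn1
  set n2 := m2.comap (algebraMap R A) with hn2
  set n := m.comap (algebraMap R A) with hn
  have l12 : n1 < n2 := comap_lt_R M h12
  have l2n : n2 < n := comap_lt_R M h2m
  have n1b : n1 ≠ ⊥ := ((bot_le.trans_lt (comap_lt_R (R := R) M h01))).ne'
  haveI : n1.IsPrime := Ideal.IsPrime.comap _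
  haveI : n2.IsPrime := Ideal.IsPrime.comap _
  haveI : n.IsPrime := Ideal.IsPrime.comap _
  obtain ⟨r, hr, hr0⟩ := trI_not_le (R := R) (S := S) ⊥ inferInstance
  obtain ⟨r', hr', hr'0⟩ := Submodule.exists_mem_ne_zero_of_ne_bot n1b
  set g : R := r * r' with hg
  have g0 : g ≠ 0 := mul_ne_zero (by simpa using hr0) hr'0
  have gt : g ∈ trI R S := Ideal.mul_mem_right _ _ hr
  have gn : g ∈ n1 := Ideal.mul_mem_left _ _ hr'
  clear_value g
  have pf : ∀ π ∈ factors g, (Ideal.span {π}).IsPrime := fun π hπ =>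
    (Ideal.span_singleton_prime (prime_of_factor π hπ).ne_zero).2 (prime_of_factor π hπ)
  have pmem : ∀ p : Ideal R, p.IsPrime → g ∈ p → ∃ π ∈ factors g, π ∈ p := by
    intro p hp h
    rw [← hp.multiset_prod_mem_iff_exists_mem]
    obtain ⟨u, hu⟩ := factors_prod g0
    rw [← hu] at h
    exact (hp.mem_or_mem h).resolve_right fun h => hp.ne_top (Ideal.eq_top_of_isUnit_mem _ h u.isUnit)
  obtain ⟨π0, hπ0, -⟩ := pmem n1 inferInstance gn
  have hex : ∃ h ∈ trI R S ⊓ n, ∀ π ∈ factors g, ¬ π ∣ h := by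
    by_contra hc
    push Not at hc
    have h1 : ((trI R S ⊓ n : Ideal R) : Set R) ⊆ ⋃ π ∈ ((factors g).toFinset : Set R),
        ((Ideal.span {π} : Ideal R) : Set R) := by
      intro h hh
      obtain ⟨π, hπ, hd⟩ := hc h hh
      simp only [Set.mem_iUnion]
      exact ⟨π, by simpa using hπ, Ideal.mem_span_singleton.2 hd⟩
    rw [Ideal.subset_union_prime (f := fun π => Ideal.span {π}) π0 π0 (fun i hi _ _ => pf i (by simpa using hi))] at h1
    obtain ⟨π, hπ, hle⟩ := h1
    have hπ : π ∈ factors g := by simpa using hπ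
    haveI := pf π hπ
    rcases (pf π hπ).inf_le.1 hle with h | h
    · obtain ⟨r, hr, hr'⟩ := trI_not_le (R := R) (S := S) (Ideal.span {π}) ⟨π, rfl⟩
      exact hr' (h hr)
    · obtain ⟨π', hπ', hp'⟩ := Ideal.IsPrime.exists_mem_prime_of_ne_bot (I := n1) inferInstance n1b
      have hd : π ∣ π' := Ideal.mem_span_singleton.1 (h ((l12.trans l2n).le hπ'))
      have ha := (prime_of_factor π hπ).associated_of_dvd hp' hd
      have : n ≤ n1 := h.trans ((Ideal.span_singleton_le_iff_mem _).2 (Ideal.mem_of_dvd _ ha.symm.dvd hπ'))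
      exact absurd (l12.trans l2n) (not_lt_of_ge this)
  obtain ⟨h, ⟨ht, hhn⟩, hπ⟩ := hex
  have hh0 : h ≠ 0 := by rintro rfl; exact hπ π0 hπ0 (dvd_zero _)
  have cop : ∀ k : ℕ, ∀ z : R, g ^ k ∣ h ^ k * z → g ^ k ∣ z := by
    intro k z hz
    refine dvd_of_dvd_mul_left_of_no_prime_factors (c := h ^ k) (pow_ne_zero _ g0) ?_ (by rwa [mul_comm])
    intro d hd hd' hp
    obtain ⟨q, hq, ha⟩ := exists_mem_factors_of_dvd g0 hp.irreducible (hp.dvd_of_dvd_pow hd)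
    exact hπ q hq (ha.symm.dvd.trans (hp.dvd_of_dvd_pow hd'))
  have gA := nzd g g0
  have hA := nzd h hh0
  have R1 : Reg2 A (algebraMap R A g) (algebraMap R A h) := by
    refine ⟨gA, fun z w e => ?_⟩
    by_contra hc
    let Q := A ⧸ Ideal.span {algebraMap R A g}
    have hmk : ∀ a : A, (Ideal.Quotient.mk (Ideal.span {algebraMap R A g}) a) = 0 ↔ algebraMap R A g ∣ a :=
      fun a => by rw [Ideal.Quotient.eq_zero_iff_mem, Ideal.mem_span_singleton]
    obtain ⟨P, hPa, hP⟩ := exists_le_isAssociatedPrime_of_isNoetherianRing A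
      (Ideal.Quotient.mk (Ideal.span {algebraMap R A g}) z : Q) (by
        rw [Ne, hmk]; exact fun ⟨v, hv⟩ => hc ⟨v, hv⟩)
    obtain ⟨hPp, z', hz'⟩ := isAssociatedPrime_iff.1 hPa
    obtain ⟨z', rfl⟩ := Ideal.Quotient.mk_surjective z'
    have hPmem : ∀ a, a ∈ P ↔ algebraMap R A g ∣ a * z' := by
      intro a
      rw [hz', Submodule.mem_colon_singleton, Submodule.mem_bot, ← hmk, map_mul]
      rfl
    have hhP : algebraMap R A h ∈ P := hP (by
      rw [Submodule.mem_colon_singleton, Submodule.mem_bot]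
      show Ideal.Quotient.mk _ (algebraMap R A h * z) = 0
      rw [hmk, e]; exact dvd_mul_right _ _)
    have hgP : algebraMap R A g ∈ P := (hPmem _).2 (dvd_mul_right _ _)
    haveI := hPp
    obtain ⟨p0, hp0, hp0P, -, z0, hz0⟩ := exists_ass_le (⊤ : Ideal A) P (fun a ha => by
      have := ha 1 trivial
      rw [mul_one] at this; rw [this]; exact P.zero_mem)
    have hp0b : p0.comap (algebraMap R A) = ⊥ := by
      rw [eq_bot_iff]
      intro r hr
      by_contra hr0
      have := nzd r hr0 z0 ((hz0 _).1 hr)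
      exact hp0.ne_top ((Ideal.eq_top_iff_one _).2 ((hz0 _).2 (by rw [this, mul_zero])))
    obtain ⟨π, hπf, hπP⟩ := pmem (P.comap (algebraMap R A)) (Ideal.IsPrime.comap _) hgP
    have hle : Ideal.span {π} ≤ P.comap (algebraMap R A) := (Ideal.span_singleton_le_iff_mem _).2 hπP
    haveI := pf π hπf
    rcases hle.lt_or_eq with hlt | heq
    · obtain ⟨Q, hQ, h1, h2⟩ := going_down (R := R) M hp0P hp0b (q := Ideal.span {π}) (by
        rw [Ne, Ideal.span_singleton_eq_bot]; exact (prime_of_factor π hπf).ne_zero) hlt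
      exact s2.ass2 gA hPmem h1 h2
    · have : h ∈ Ideal.span {π} := by rw [heq]; exact hhP
      exact hπ π hπf (Ideal.mem_span_singleton.1 this)
  refine ⟨algebraMap R A g, (l12.trans l2n).le gn, algebraMap R A h, hhn, R1, R1.symm hA, ?_⟩
  intro k b K hb
  rcases Nat.eq_zero_or_pos k with rfl | hk
  · exact ⟨⟨algebraMap R A g * b, 0, by simp⟩, ⟨algebraMap R A h * b, 0, by simp⟩⟩
  obtain ⟨⟨b', u⟩, hu⟩ := IsLocalization.surj M b
  let J : Ideal S := Ideal.span {algebraMap R S (g ^ k), algebraMap R S (h ^ k)}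
  have mapJ : J.map (algebraMap S A) = Ideal.span {(algebraMap R A g) ^ k, (algebraMap R A h) ^ k} := by
    rw [Ideal.map_span, Set.image_pair, ← IsScalarTower.algebraMap_apply, ← IsScalarTower.algebraMap_apply,
      map_pow, map_pow]
  have hnm : ∀ a ∈ n ^ K, algebraMap R A a ∈ m ^ K := by
    intro a ha
    have : (n ^ K).map (algebraMap R A) ≤ m ^ K := by
      rw [Ideal.map_pow]; exact Ideal.pow_right_mono Ideal.map_comap_le _
    exact this (Ideal.mem_map_of_mem _ ha)
  have H1 : ∀ a ∈ n ^ K, ∃ v ∈ M, v * (algebraMap R S a * b') ∈ J := by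
    intro a ha
    rw [← IsLocalization.algebraMap_mem_map_algebraMap_iff M A, mapJ, map_mul,
      ← IsScalarTower.algebraMap_apply, show algebraMap S A b' = _ from hu.symm]
    obtain ⟨c1, c2, e⟩ := hb _ (hnm a ha)
    rw [Ideal.mem_span_pair]
    exact ⟨c2 * algebraMap S A u, c1 * algebraMap S A u, by linear_combination (- algebraMap S A u) * e⟩
  obtain ⟨v, hv, H2⟩ : ∃ v ∈ M, ∀ a ∈ n ^ K, v * (algebraMap R S a * b') ∈ J := by
    obtain ⟨t, ht⟩ := IsNoetherian.noetherian (n ^ K)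
    have hmem : ∀ z ∈ t, z ∈ n ^ K := fun z hz => by rw [← ht]; exact Submodule.subset_span hz
    choose! ρ h1 h2 using fun z (hz : z ∈ t) => H1 z (hmem z hz)
    refine ⟨∏ z ∈ t, ρ z, Submonoid.prod_mem _ h1, fun i hi => ?_⟩
    rw [← ht] at hi
    induction hi using Submodule.span_induction with
    | mem x hx =>
      rw [← Finset.mul_prod_erase t ρ hx]
      convert J.mul_mem_left (∏ z ∈ t.erase x, ρ z) (h2 x hx) using 1
      ring
    | zero => simp
    | add x y _ _ hx hy => rw [map_add, add_mul, mul_add]; exact J.add_mem hx hy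
    | smul c x _ hx =>
      rw [smul_eq_mul, map_mul]
      convert J.mul_mem_left (algebraMap R S c) hx using 1
      ring
  have H3 : ∀ f : S →ₗ[R] R, f (v * b') ∈ Ideal.span {g ^ k, h ^ k} := by
    intro f
    refine claim_mv (pow_ne_zero _ g0) (cop k) (Q0 := n1) (Ideal.pow_mem_of_mem _ gn _ hk) l12 l2n K ?_
    intro a ha
    obtain ⟨c1, c2, e⟩ := Ideal.mem_span_pair.1 (H2 a ha)
    rw [Ideal.mem_span_pair]
    refine ⟨f c1, f c2, ?_⟩
    rw [← smul_eq_mul a, ← map_smul, Algebra.smul_def,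
      show algebraMap R S a * (v * b') = v * (algebraMap R S a * b') by ring, ← e, map_add,
      mul_comm c1, mul_comm c2, ← Algebra.smul_def, ← Algebra.smul_def, map_smul, map_smul]
    simp only [smul_eq_mul]; ring
  have H4 : ∀ r ∈ trI R S, ∃ c1 c2, algebraMap R A r * b = c1 * (algebraMap R A h) ^ k + c2 * (algebraMap R A g) ^ k := by
    intro r hr
    have h5 : r • (v * b') ∈ J.restrictScalars R := by
      refine trI_mem hr _ _ fun f x => ?_
      obtain ⟨c1, c2, e⟩ := Ideal.mem_span_pair.1 (H3 f)
      show _ ∈ J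
      rw [← e, Ideal.mem_span_pair]
      refine ⟨algebraMap R S c1 * x, algebraMap R S c2 * x, ?_⟩
      rw [Algebra.smul_def, map_add, map_mul, map_mul]; ring
    have h6 : algebraMap S A (r • (v * b')) ∈ J.map (algebraMap S A) := Ideal.mem_map_of_mem _ h5
    rw [mapJ, Algebra.smul_def, map_mul, map_mul, ← IsScalarTower.algebraMap_apply,
      show algebraMap S A b' = _ from hu.symm, Ideal.mem_span_pair] at h6
    obtain ⟨c1, c2, e⟩ := h6
    obtain ⟨w1, hw1⟩ := (IsLocalization.map_units A (⟨v, hv⟩ : M)).exists_right_inv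
    obtain ⟨w2, hw2⟩ := (IsLocalization.map_units A u).exists_right_inv
    refine ⟨c2 * w1 * w2, c1 * w1 * w2, ?_⟩
    simp only at hw1
    linear_combination (-w1 * w2) * e - (algebraMap R A r * b) * hw1 * (algebraMap S A u * w2) - (algebraMap R A r * b) * hw2
  exact ⟨H4 g gt, H4 h ht⟩
end

theorem fibre_main (κ A : Type u) [Field κ] [CommRing A] [Algebra κ A] [Algebra.EssFiniteType κ A]
    [IsNoetherianRing A] [IsLocalRing A] (s2 : S2R A)
    {m0 m1 m2 : Ideal A} [m0.IsPrime] [m1.IsPrime] [m2.IsPrime] (h01 : m0 < m1) (h12 : m1 < m2)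
    (h2m : m2 < maximalIdeal A) :
    ∃ g ∈ maximalIdeal A, ∃ h ∈ maximalIdeal A, Reg2 A g h ∧ Reg2 A h g ∧
    ∀ (k : ℕ) (b : A) (K : ℕ),
      (∀ a ∈ maximalIdeal A ^ K, ∃ c1 c2, a * b = c1 * h ^ k + c2 * g ^ k) →
      (∃ c1 c2, g * b = c1 * h ^ k + c2 * g ^ k) ∧
      (∃ c1 c2, h * b = c1 * h ^ k + c2 * g ^ k) := by
  let S := Algebra.EssFiniteType.subalgebra κ A
  obtain ⟨s, φ, hφ, hfin⟩ := exists_finite_inj_algHom_of_fg κ S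
  letI : Algebra (MvPolynomial (Fin s) κ) S := φ.toRingHom.toAlgebra
  letI : Algebra (MvPolynomial (Fin s) κ) A := ((algebraMap S A).comp φ.toRingHom).toAlgebra
  haveI : IsScalarTower (MvPolynomial (Fin s) κ) S A := IsScalarTower.of_algebraMap_eq fun x => rfl
  haveI : Module.Finite (MvPolynomial (Fin s) κ) S := hfin
  have inj : Function.Injective (algebraMap S A) := Subtype.val_injective
  exact fibre_aux (Algebra.EssFiniteType.submonoid κ A) s2 (inj.comp hφ) inj h01 h12 h2m

end

section
open MvPolynomial

/-- `TL R Q d`: fewer than `d` algebraically independent elements modulo `Q`. -/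
def TL (R : Type*) {E : Type*} [CommRing R] [CommRing E] [Algebra R E] (Q : Ideal E) (d : ℕ) :
    Prop :=
  ∀ v : Fin d → E, ∃ F : MvPolynomial (Fin d) R, (∃ m, algebraMap R E (F.coeff m) ∉ Q) ∧
    aeval v F ∈ Q

section
variable {R E : Type*} [CommRing R] [CommRing E] [Algebra R E]

lemma aeval_mem_of_coeff {σ : Type*} (Q : Ideal E) (v : σ → E) (F : MvPolynomial σ R)
    (h : ∀ m, algebraMap R E (F.coeff m) ∈ Q) : aeval v F ∈ Q := by
  rw [F.as_sum, map_sum]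
  refine Ideal.sum_mem _ fun m _ => ?_
  rw [aeval_monomial]
  exact Ideal.mul_mem_right _ _ (h m)

lemma TL.strict_aux {P P' : Ideal E} [P.IsPrime] (hle : P ≤ P') (x : E) (hx : x ∈ P')
    (hxP : x ∉ P) (hov : ∀ r : R, algebraMap R E r ∈ P' → algebraMap R E r ∈ P)
    {d : ℕ} (v : Fin d → E) : ∀ (n : ℕ) (G : Polynomial (MvPolynomial (Fin d) R)),
    G.natDegree ≤ n → (∃ i m, algebraMap R E ((G.coeff i).coeff m) ∉ P) →
    G.eval₂ (aeval v : MvPolynomial (Fin d) R →ₐ[R] E).toRingHom x ∈ P →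
    ∃ F : MvPolynomial (Fin d) R, (∃ m, algebraMap R E (F.coeff m) ∉ P') ∧ aeval v F ∈ P' := by
  intro n
  induction n with
  | zero =>
    intro G hG ⟨i, m, him⟩ h
    rw [Polynomial.eq_C_of_natDegree_le_zero hG] at h him
    rw [Polynomial.eval₂_C] at h
    by_cases hi : i = 0
    · subst hi
      rw [Polynomial.coeff_C_zero] at him
      exact ⟨_, ⟨m, fun hh => him (hov _ hh)⟩, hle h⟩
    · rw [Polynomial.coeff_C_of_ne_zero hi] at him
      simp at him
  | succ n ih =>
    intro G hG ⟨i, m, him⟩ h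
    have hdiv := Polynomial.divX_mul_X_add G
    rw [← hdiv, Polynomial.eval₂_add, Polynomial.eval₂_mul, Polynomial.eval₂_X,
      Polynomial.eval₂_C] at h
    by_cases h0 : ∀ m, algebraMap R E ((G.coeff 0).coeff m) ∈ P
    · have h1 : aeval v (G.coeff 0) ∈ P := aeval_mem_of_coeff _ _ _ h0
      have h2 := (Ideal.add_mem_iff_left _ h1).mp h
      have h3 := (Ideal.IsPrime.mem_or_mem ‹_› h2).resolve_right hxP
      refine ih G.divX ?_ ?_ h3
      · rw [Polynomial.natDegree_divX_eq_natDegree_tsub_one]; omega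
      · cases i with
        | zero => exact absurd (h0 m) him
        | succ i => exact ⟨i, m, by rwa [Polynomial.coeff_divX]⟩
    · push Not at h0
      obtain ⟨m', hm'⟩ := h0
      refine ⟨G.coeff 0, ⟨m', fun hh => hm' (hov _ hh)⟩, ?_⟩
      exact (Ideal.add_mem_iff_right _ (Ideal.mul_mem_left _ _ hx)).mp (hle h)

lemma TL.strict {P P' : Ideal E} [P.IsPrime] (hlt : P < P')
    (hov : ∀ r : R, algebraMap R E r ∈ P' → algebraMap R E r ∈ P)
    {d : ℕ} (h : TL R P (d + 1)) : TL R P' d := by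
  intro v
  obtain ⟨x, hx, hxP⟩ := SetLike.exists_of_lt hlt
  obtain ⟨F, ⟨m, hm⟩, hF⟩ := h (Fin.cons x v)
  refine TL.strict_aux hlt.le x hx hxP hov v _ (finSuccEquiv R d F) le_rfl ?_ ?_
  · refine ⟨m 0, m.tail, ?_⟩
    rwa [finSuccEquiv_coeff_coeff, Finsupp.cons_tail]
  · convert hF using 1
    have : (aeval (Fin.cons x v : Fin (d+1) → E) : MvPolynomial (Fin (d+1)) R →ₐ[R] E).toRingHom =
      (Polynomial.eval₂RingHom (aeval v : MvPolynomial (Fin d) R →ₐ[R] E).toRingHom x).comp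
        (finSuccEquiv R d : MvPolynomial (Fin (d+1)) R →ₐ[R] _).toRingHom := by
      apply MvPolynomial.ringHom_ext
      · intro r; simp [finSuccEquiv_apply]
      · intro i
        refine Fin.cases ?_ (fun j => ?_) i <;> simp [finSuccEquiv_X_zero, finSuccEquiv_X_succ]
    exact (RingHom.congr_fun this F).symm

lemma TL.comap {E' : Type*} [CommRing E'] [Algebra R E'] (φ : E →ₐ[R] E') {Q : Ideal E'} {d : ℕ}
    (h : TL R Q d) : TL R (Q.comap φ.toRingHom) d := by
  intro v
  obtain ⟨F, ⟨m, hm⟩, hF⟩ := h (φ ∘ v)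
  refine ⟨F, ⟨m, fun hh => hm ?_⟩, ?_⟩
  · have := Ideal.mem_comap.mp hh
    simpa using this
  · show φ (aeval v F) ∈ Q
    rw [← AlgHom.comp_apply, comp_aeval]; exact hF

lemma TL.map_surj {E' : Type*} [CommRing E'] [Algebra R E'] (φ : E →ₐ[R] E')
    (hφ : Function.Surjective φ) {Q : Ideal E'} {d : ℕ}
    (h : TL R (Q.comap φ.toRingHom) d) : TL R Q d := by
  intro v
  choose w hw using fun i => hφ (v i)
  obtain ⟨F, ⟨m, hm⟩, hF⟩ := h w
  refine ⟨F, ⟨m, fun hh => hm ?_⟩, ?_⟩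
  · refine Ideal.mem_comap.mpr ?_
    simpa using hh
  · have : φ (aeval w F) ∈ Q := hF
    rw [← AlgHom.comp_apply, comp_aeval] at this
    have h2 : (fun i => φ (w i)) = v := funext hw
    rwa [h2] at this

lemma TL.of_alg {Q : Ideal E} [Q.IsPrime] {m d : ℕ} (hmd : m < d) (w : Fin m → E) (r : E)
    (hr : r ∉ Q) (h : ∀ x : E, ∃ n : ℕ,
      (aeval w : MvPolynomial (Fin m) R →ₐ[R] E).toRingHom.IsIntegralElem (r ^ n * x)) :
    TL R Q d := by
  intro v
  by_contra hcon
  push Not at hcon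
  set k := R ⧸ Q.under R
  have hind : AlgebraicIndependent k (fun i => Ideal.Quotient.mk Q (v i)) := by
    rw [algebraicIndependent_iff]
    intro p hp
    obtain ⟨F, rfl⟩ := map_surjective (σ := Fin d) (Ideal.Quotient.mk (Q.under R))
      Ideal.Quotient.mk_surjective p
    by_contra hne
    have : ∃ m, algebraMap R E (F.coeff m) ∉ Q := by
      by_contra hall
      push Not at hall
      apply hne
      ext m
      rw [coeff_map, coeff_zero, Ideal.Quotient.eq_zero_iff_mem]
      exact hall m
    obtain ⟨m', hm'⟩ := this
    refine hcon F ⟨m', hm'⟩ ?_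
    replace hp := (aeval_map_algebraMap (R := R) (A := k) (B := E ⧸ Q) (fun i => Ideal.Quotient.mk Q (v i)) F).symm.trans hp
    have h3 : (Ideal.Quotient.mkₐ R Q) (aeval v F) = 0 := by
      rw [← AlgHom.comp_apply, comp_aeval]; exact hp
    exact Ideal.Quotient.eq_zero_iff_mem.mp h3
  haveI : Nontrivial k := Ideal.Quotient.nontrivial_iff.mpr (Ideal.IsPrime.ne_top inferInstance)
  set s : Set (E ⧸ Q) := Set.range (fun i => Ideal.Quotient.mk Q (w i))
  haveI : Algebra.IsAlgebraic (Algebra.adjoin k s) (E ⧸ Q) := by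
    constructor
    intro y
    obtain ⟨x, rfl⟩ := Ideal.Quotient.mk_surjective y
    have key : ∀ x : E, ∃ n : ℕ, IsIntegral (Algebra.adjoin k s) (Ideal.Quotient.mk Q (r ^ n * x)) := by
      intro x
      obtain ⟨n, p, hp, hx⟩ := h x
      refine ⟨n, ?_⟩
      have hmem : ∀ F : MvPolynomial (Fin m) R, Ideal.Quotient.mk Q (aeval w F) ∈ Algebra.adjoin k s := by
        intro F
        have : Ideal.Quotient.mk Q (aeval w F) = aeval (fun i => Ideal.Quotient.mk Q (w i)) (map (algebraMap R k) F) := by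
          rw [aeval_map_algebraMap]
          show (Ideal.Quotient.mkₐ R Q) (aeval w F) = _
          rw [← AlgHom.comp_apply, comp_aeval]; rfl
        rw [this]
        rw [Algebra.adjoin_range_eq_range_aeval k]; exact ⟨_, rfl⟩
      let ψ : MvPolynomial (Fin m) R →+* Algebra.adjoin k s :=
        ((Ideal.Quotient.mk Q).comp (aeval w : MvPolynomial (Fin m) R →ₐ[R] E).toRingHom).codRestrict
          (Algebra.adjoin k s).toSubring hmem
      refine ⟨p.map ψ, hp.map _, ?_⟩
      rw [Polynomial.eval₂_map]
      have h5 : (algebraMap (Algebra.adjoin k s) (E ⧸ Q)).comp ψ =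
        (Ideal.Quotient.mk Q).comp (aeval w : MvPolynomial (Fin m) R →ₐ[R] E).toRingHom := by
        ext <;> rfl
      rw [h5, ← Polynomial.hom_eval₂, hx, map_zero]
    obtain ⟨n, hn⟩ := key x
    have hr0 : Ideal.Quotient.mk Q r ≠ 0 := fun h0 => hr (Ideal.Quotient.eq_zero_iff_mem.mp h0)
    obtain ⟨n1, hn1⟩ := key r
    have halg : IsAlgebraic (Algebra.adjoin k s) (Ideal.Quotient.mk Q r) := by
      rw [← pow_succ, map_pow] at hn1
      exact IsAlgebraic.of_pow (Nat.succ_pos n1) hn1.isAlgebraic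
    rw [map_mul, map_pow] at hn
    exact IsAlgebraic.of_mul (mem_nonZeroDivisors_of_ne_zero (pow_ne_zero n hr0)) (halg.pow n)
      hn.isAlgebraic
  have h1 := Algebra.IsAlgebraic.trdeg_le_cardinalMk (R := k) (A := E ⧸ Q) (s := s)
  have h2 := hind.lift_cardinalMk_le_trdeg
  have h3 : Cardinal.mk s ≤ (m : Cardinal) := by
    have := Cardinal.mk_range_le_lift (f := fun i => Ideal.Quotient.mk Q (w i))
    simpa using this
  have h4 := Cardinal.lift_le.{0}.mpr (h1.trans h3)
  simp only [Cardinal.mk_fin, Cardinal.lift_natCast] at h2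
  have h5 := h2.trans (by simpa using (h1.trans h3))
  have : d ≤ m := by exact_mod_cast h5
  omega

end
end

section
open MvPolynomial

/-- Localization at `q` is a valuation ring, elementwise. -/
def ValAt {B : Type*} [CommRing B] (q : Ideal B) : Prop :=
  ∀ c d : B, (∃ h ∉ q, c ∣ h * d) ∨ (∃ h ∉ q, d ∣ h * c)

section
variable {B E : Type*} [CommRing B] [CommRing E] [Algebra B E]

lemma ValAt.exists_min {q : Ideal B} [hq : q.IsPrime] (hv : ValAt q) (s : Finset B) (hs : s.Nonempty) :
    ∃ c ∈ s, ∀ d ∈ s, ∃ h ∉ q, c ∣ h * d := by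
  classical
  induction hs using Finset.Nonempty.cons_induction with
  | singleton a =>
    refine ⟨a, by simp, fun d hd => ⟨1, fun h1 => hq.ne_top ((Ideal.eq_top_iff_one _).mpr h1), ?_⟩⟩
    rw [Finset.mem_singleton] at hd; simp [hd]
  | cons a s ha hs ih =>
    obtain ⟨c, hc, hcs⟩ := ih
    have h1 : (1 : B) ∉ q := fun h1 => hq.ne_top ((Ideal.eq_top_iff_one _).mpr h1)
    rcases hv c a with ⟨h, hh, hd⟩ | ⟨h, hh, hd⟩
    · refine ⟨c, by simp [hc], fun d hd' => ?_⟩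
      rw [Finset.mem_cons] at hd'
      rcases hd' with rfl | hd'
      · exact ⟨h, hh, hd⟩
      · exact hcs d hd'
    · refine ⟨a, by simp, fun d hd' => ?_⟩
      rw [Finset.mem_cons] at hd'
      rcases hd' with rfl | hd'
      · exact ⟨1, h1, by simp⟩
      · obtain ⟨g, hg, hgd⟩ := hcs d hd'
        refine ⟨h * g, fun hx => (hq.mem_or_mem hx).elim hh hg, ?_⟩
        rw [mul_assoc]
        exact hd.trans (mul_dvd_mul_left h hgd)

lemma TL.scale [IsDomain B] (tf : ∀ (b : B) (x : E), b ≠ 0 → algebraMap B E b * x = 0 → x = 0)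
    (Q : Ideal E) [Q.IsPrime] (hv : ValAt (Q.comap (algebraMap B E))) {d : ℕ}
    (h : TL B (⊥ : Ideal E) d) : TL B Q d := by
  classical
  intro v
  obtain ⟨F, ⟨m, hm⟩, hF⟩ := h v
  rw [Ideal.mem_bot] at hm hF
  have hm0 : F.coeff m ≠ 0 := fun h => hm (by rw [h, map_zero])
  obtain ⟨c, hc, hcs⟩ := hv.exists_min (F.support.image fun m => F.coeff m)
    ⟨F.coeff m, Finset.mem_image_of_mem _ (mem_support_iff.mpr hm0)⟩
  obtain ⟨m0, hm0, rfl⟩ := Finset.mem_image.mp hc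
  rw [mem_support_iff] at hm0
  have hcs' : ∀ n, ∃ h ∉ Q.comap (algebraMap B E), F.coeff m0 ∣ h * F.coeff n := by
    intro n
    by_cases hn : F.coeff n = 0
    · exact ⟨1, fun h1 => (Ideal.IsPrime.ne_top (inferInstance : (Q.comap (algebraMap B E)).IsPrime)) ((Ideal.eq_top_iff_one _).mpr h1), by simp [hn]⟩
    · exact hcs _ (Finset.mem_image_of_mem _ (mem_support_iff.mpr hn))
  choose H hH1 hH2 using hcs'
  let h0 := ∏ n ∈ F.support, H n
  have hh0 : h0 ∉ Q.comap (algebraMap B E) := by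
    rw [Ideal.IsPrime.prod_mem_iff (p := Q.comap (algebraMap B E))]
    rintro ⟨n, _, hn⟩; exact hH1 n hn
  have hdvd : ∀ n, F.coeff m0 ∣ h0 * F.coeff n := by
    intro n
    by_cases hn : n ∈ F.support
    · exact (hH2 n).trans (mul_dvd_mul_right (Finset.dvd_prod_of_mem _ hn) _)
    · rw [notMem_support_iff.mp hn]; simp
  have : C (F.coeff m0) ∣ C h0 * F := by
    rw [C_dvd_iff_dvd_coeff]
    intro n; rw [coeff_C_mul]; exact hdvd n
  obtain ⟨G, hG⟩ := this
  refine ⟨G, ⟨m0, ?_⟩, ?_⟩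
  · have := congrArg (coeff m0) hG
    rw [coeff_C_mul, coeff_C_mul, mul_comm] at this
    have := mul_left_cancel₀ hm0 this
    rw [← this]; exact hh0
  · have := congrArg (aeval v) hG
    rw [map_mul, map_mul, hF, mul_zero, aeval_C] at this
    rw [tf _ _ hm0 this.symm]; exact Q.zero_mem
end

section
variable {R E : Type*} [CommRing R] [CommRing E] [Algebra R E]

/-- existence of a bound -/
lemma TL.exists_of_finiteType [Algebra.FiniteType R E] : ∃ d, ∀ Q : Ideal E, Q.IsPrime → TL R Q d := by
  obtain ⟨n, φ, hφ⟩ := Algebra.FiniteType.iff_quotient_mvPolynomial''.mp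
    (inferInstance : Algebra.FiniteType R E)
  refine ⟨n + 1, fun Q hQ => TL.of_alg (Nat.lt_succ_self n) (fun i => φ (X i)) 1 ?_ fun x => ⟨0, ?_⟩⟩
  · exact fun h1 => hQ.ne_top ((Ideal.eq_top_iff_one _).mpr h1)
  · obtain ⟨F, rfl⟩ := hφ x
    have : aeval (fun i => φ (X i)) = φ := by ext; simp
    rw [this, pow_zero, one_mul]
    exact RingHom.isIntegralElem_map _

end
end

section
open MvPolynomial

/-- Abstract form of the fibre ring. -/
structure FibData {R E k F : Type*} [CommRing R] [CommRing E] [Algebra R E] [Field k] [CommRing F]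
    [Algebra k F] (s : Ideal R) (j : R →+* k) (φ : E →+* F) : Prop where
  comp : ∀ r, φ (algebraMap R E r) = algebraMap k F (j r)
  hj : ∀ r, j r = 0 ↔ r ∈ s
  dk : ∀ c : k, ∃ r ∉ s, ∃ r', j r * c = j r'
  dF : ∀ x : F, ∃ r ∉ s, ∃ e, algebraMap k F (j r) * x = φ e
  pr : ∀ Q : Ideal E, Q.IsPrime → Q.comap (algebraMap R E) = s →
    ∃ Q' : Ideal F, Q'.IsPrime ∧ Q'.comap φ = Q

section
variable {R E k F : Type*} [CommRing R] [CommRing E] [Algebra R E] [Field k] [CommRing F]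
    [Algebra k F] {s : Ideal R} {j : R →+* k} {φ : E →+* F}

lemma FibData.over (c : FibData s j φ) (N : Ideal F) [hN : N.IsPrime] :
    (N.comap φ).comap (algebraMap R E) = s := by
  ext r
  rw [Ideal.mem_comap, Ideal.mem_comap, c.comp, ← c.hj]
  constructor
  · intro h
    by_contra h0
    exact hN.ne_top (Ideal.eq_top_of_isUnit_mem _ h ((isUnit_iff_ne_zero.mpr h0).map _))
  · intro h; rw [h, map_zero]; exact N.zero_mem

lemma FibData.unit (c : FibData s j φ) {r : R} (hr : r ∉ s) : IsUnit (algebraMap k F (j r)) :=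
  (isUnit_iff_ne_zero.mpr fun h => hr ((c.hj r).mp h)).map _

lemma FibData.dpoly (c : FibData s j φ) [hs : s.IsPrime] {σ : Type*} (f : MvPolynomial σ k) :
    ∃ r ∉ s, ∃ f' : MvPolynomial σ R, C (j r) * f = map j f' := by
  induction f using MvPolynomial.induction_on with
  | C a =>
    obtain ⟨r, hr, r', h⟩ := c.dk a
    exact ⟨r, hr, C r', by rw [← MvPolynomial.C_mul, h, map_C]⟩
  | add p q hp hq =>
    obtain ⟨r, hr, f, hf⟩ := hp
    obtain ⟨r', hr', f', hf'⟩ := hq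
    refine ⟨r * r', fun h => (hs.mem_or_mem h).elim hr hr', C r' * f + C r * f', ?_⟩
    simp only [map_add, map_mul, map_C, ← hf, ← hf']
    ring
  | mul_X p n hp =>
    obtain ⟨r, hr, f, hf⟩ := hp
    exact ⟨r, hr, f * X n, by rw [map_mul, ← hf, map_X, mul_assoc]⟩

lemma FibData.aeval_eq (c : FibData s j φ) {σ : Type*} (w : σ → E) (f : MvPolynomial σ R) :
    φ (aeval w f) = aeval (fun i => φ (w i)) (map j f) := by
  induction f using MvPolynomial.induction_on with
  | C a => rw [aeval_C, map_C, aeval_C, c.comp]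
  | add p q hp hq => rw [map_add, map_add, map_add, map_add, hp, hq]
  | mul_X p n hp => rw [map_mul, map_mul, map_mul, map_mul, hp, aeval_X, map_X, aeval_X]

lemma noether_scaled (c : FibData s j φ) [hs : s.IsPrime] [Algebra.FiniteType k F] (J : Ideal F) (hJ : J ≠ ⊤) :
    ∃ (m : ℕ) (w : Fin m → E),
      Function.Injective (aeval (fun i => Ideal.Quotient.mk J (φ (w i))) : MvPolynomial (Fin m) k →ₐ[k] F ⧸ J) ∧
      (aeval (fun i => Ideal.Quotient.mk J (φ (w i))) : MvPolynomial (Fin m) k →ₐ[k] F ⧸ J).Finite := by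
  haveI : Nontrivial (F ⧸ J) := Ideal.Quotient.nontrivial_iff.mpr hJ
  obtain ⟨m, g, ginj, gfin⟩ := exists_finite_inj_algHom_of_fg k (F ⧸ J)
  choose z hz using fun i => Ideal.Quotient.mk_surjective (I := J) (g (X i))
  choose r hr w hw using fun i => c.dF (z i)
  refine ⟨m, w, ?_⟩
  let σ : MvPolynomial (Fin m) k →ₐ[k] MvPolynomial (Fin m) k := aeval fun i => C (j (r i)) * X i
  let τ : MvPolynomial (Fin m) k →ₐ[k] MvPolynomial (Fin m) k := aeval fun i => C (j (r i))⁻¹ * X i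
  have hne : ∀ i, j (r i) ≠ 0 := fun i h => hr i ((c.hj _).mp h)
  have h1 : σ.comp τ = AlgHom.id k _ := by
    ext1 i
    simp only [σ, τ, AlgHom.comp_apply, aeval_X, map_mul, AlgHom.id_apply]
    rw [← algebraMap_eq, AlgHom.commutes, algebraMap_eq, ← mul_assoc, ← MvPolynomial.C_mul, inv_mul_cancel₀ (hne i), C_1, one_mul]
  have h2 : τ.comp σ = AlgHom.id k _ := by
    ext1 i
    simp only [σ, τ, AlgHom.comp_apply, aeval_X, map_mul, AlgHom.id_apply]
    rw [← algebraMap_eq, AlgHom.commutes, algebraMap_eq, ← mul_assoc, ← MvPolynomial.C_mul, mul_inv_cancel₀ (hne i), C_1, one_mul]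
  have hg : (aeval (fun i => Ideal.Quotient.mk J (φ (w i))) : MvPolynomial (Fin m) k →ₐ[k] F ⧸ J) = g.comp σ := by
    ext1 i
    simp only [σ, AlgHom.comp_apply, aeval_X, map_mul]
    rw [← algebraMap_eq, AlgHom.commutes, ← hz, ← hw, map_mul]; rfl
  rw [hg]
  constructor
  · refine ginj.comp ?_
    exact Function.LeftInverse.injective (g := τ) fun x => DFunLike.congr_fun h2 x
  · refine AlgHom.Finite.comp gfin (AlgHom.Finite.of_surjective _ ?_)
    exact Function.RightInverse.surjective (g := τ) fun x => DFunLike.congr_fun h1 x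

lemma qf_aux (c : FibData s j φ) [hs : s.IsPrime] [Algebra.FiniteType k F] {d : ℕ}
    (P : Ideal E) [hP : P.IsPrime] (hPs : P.comap (algebraMap R E) = s)
    (H : ∀ Q : Ideal E, Q.IsPrime → Q ≤ P → Q.comap (algebraMap R E) = s → TL R Q d) :
    ∃ (m : ℕ) (_ : m < d) (w : Fin m → E) (e : E), e ∉ P ∧
      ∀ Q : Ideal E, Q.IsPrime → e ∉ Q →
        Q.comap (aeval w : MvPolynomial (Fin m) R →ₐ[R] E).toRingHom =
          P.comap (aeval w : MvPolynomial (Fin m) R →ₐ[R] E).toRingHom → Q = P := by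
  classical
  obtain ⟨P1, hP1, rfl⟩ := c.pr P hP hPs
  haveI : IsNoetherianRing F := Algebra.FiniteType.isNoetherianRing k F
  have hfin := minimalPrimes.finite_of_isNoetherianRing F
  let M1 : Finset (Ideal F) := hfin.toFinset.filter (· ≤ P1)
  let M2 : Finset (Ideal F) := hfin.toFinset.filter (¬ · ≤ P1)
  have hM2 : ∀ N : Ideal F, ∃ x, ¬ N ≤ P1 → x ∈ N ∧ x ∉ P1 := by
    intro N
    by_cases hN : N ≤ P1
    · exact ⟨0, fun h => absurd hN h⟩
    · obtain ⟨x, hx, hx'⟩ := SetLike.not_le_iff_exists.mp hN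
      exact ⟨x, fun _ => ⟨hx, hx'⟩⟩
  choose x hx using hM2
  obtain ⟨r0, hr0, e, he⟩ := c.dF (∏ N ∈ M2, x N)
  have heP : φ e ∉ P1 := by
    rw [← he]
    intro h
    rcases hP1.mem_or_mem h with h | h
    · exact hP1.ne_top (Ideal.eq_top_of_isUnit_mem _ h (c.unit hr0))
    · rw [Ideal.IsPrime.prod_mem_iff (p := P1)] at h
      obtain ⟨N, hN, hxN⟩ := h
      exact (hx N (Finset.mem_filter.mp hN).2).2 hxN
  let J : Ideal F := M1.inf id
  have hJP : J ≤ P1 := by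
    obtain ⟨N, hN, hNP⟩ := Ideal.exists_minimalPrimes_le (bot_le : (⊥ : Ideal F) ≤ P1)
    have : N ∈ M1 := Finset.mem_filter.mpr ⟨hfin.mem_toFinset.mpr hN, hNP⟩
    exact (Finset.inf_le this).trans hNP
  -- primes of F avoiding e contain J
  have hJle : ∀ Q : Ideal F, Q.IsPrime → φ e ∉ Q → J ≤ Q := by
    intro Q hQ heQ
    obtain ⟨N, hN, hNQ⟩ := Ideal.exists_minimalPrimes_le (bot_le : (⊥ : Ideal F) ≤ Q)
    have : N ∈ M1 := by
      refine Finset.mem_filter.mpr ⟨hfin.mem_toFinset.mpr hN, ?_⟩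
      by_contra hNP
      apply heQ
      rw [← he]
      refine Q.mul_mem_left _ (hNQ ?_)
      exact Ideal.mem_of_dvd _ (Finset.dvd_prod_of_mem x (Finset.mem_filter.mpr ⟨hfin.mem_toFinset.mpr hN, hNP⟩)) (hx N hNP).1
    exact (Finset.inf_le this).trans hNQ
  obtain ⟨m, w, winj, wfin⟩ := noether_scaled c J (fun h => hP1.ne_top (top_le_iff.mp (h ▸ hJP)))
  set g : MvPolynomial (Fin m) k →ₐ[k] F ⧸ J := aeval (fun i => Ideal.Quotient.mk J (φ (w i))) with hg
  letI : Algebra (MvPolynomial (Fin m) k) (F ⧸ J) := g.toRingHom.toAlgebra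
  haveI : Module.Finite (MvPolynomial (Fin m) k) (F ⧸ J) := wfin
  have hgmap : algebraMap (MvPolynomial (Fin m) k) (F ⧸ J) = g.toRingHom := rfl
  have hgF : ∀ f : MvPolynomial (Fin m) R, g (map j f) = Ideal.Quotient.mk J (φ (aeval w f)) := by
    intro f
    rw [c.aeval_eq, hg]
    show _ = (Ideal.Quotient.mkₐ k J) _
    rw [← AlgHom.comp_apply, comp_aeval]; rfl
  have hmd : m < d := by
    by_contra hcon
    push Not at hcon
    have : ∃ N ∈ M1, ∀ f : MvPolynomial (Fin m) R, φ (aeval w f) ∈ N → map j f = 0 := by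
      by_contra hall
      push Not at hall
      choose! f hf1 hf2 using hall
      have h1 : ∏ N ∈ M1, map j (f N) ≠ 0 := Finset.prod_ne_zero_iff.mpr hf2
      apply h1
      apply winj
      rw [map_zero, map_prod, Finset.prod_congr rfl (fun N _ => hgF (f N)), ← map_prod, Ideal.Quotient.eq_zero_iff_mem]
      refine Submodule.mem_finsetInf.mpr fun N hN => ?_
      exact Ideal.mem_of_dvd _ (Finset.dvd_prod_of_mem _ hN) (hf1 N hN)
    obtain ⟨N, hN, hNf⟩ := this
    have hN' := Finset.mem_filter.mp hN
    haveI hNp : N.IsPrime := (hfin.mem_toFinset.mp hN'.1).1.1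
    obtain ⟨f, ⟨n, hn⟩, hf⟩ := H (N.comap φ) inferInstance (Ideal.comap_mono hN'.2) (c.over N)
      (fun i => w (Fin.castLE hcon i))
    have h2 : map j (rename (Fin.castLE hcon) f) = 0 := by
      apply hNf
      rw [aeval_rename]; exact hf
    rw [map_rename] at h2
    have h3 : map j f = 0 := rename_injective _ (Fin.castLE_injective hcon) (h2.trans (map_zero _).symm)
    apply hn
    rw [Ideal.mem_comap, c.comp, ← coeff_map, h3]; simp
  -- the fibre
  let p0 := P1.map (Ideal.Quotient.mk J)
  have key : ∀ Q Q' : Ideal F, J ≤ Q → J ≤ Q' →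
      (Q.comap φ).comap (aeval w : MvPolynomial (Fin m) R →ₐ[R] E).toRingHom =
          (Q'.comap φ).comap (aeval w : MvPolynomial (Fin m) R →ₐ[R] E).toRingHom →
      (Q.map (Ideal.Quotient.mk J)).comap g.toRingHom ≤
        (Q'.map (Ideal.Quotient.mk J)).comap g.toRingHom := by
    intro Q Q' hJQ hJQ' hE f hf
    obtain ⟨r, hr, f', hf'⟩ := c.dpoly f
    have hmem : ∀ N : Ideal F, J ≤ N → (g f ∈ N.map (Ideal.Quotient.mk J) ↔ φ (aeval w f') ∈ N) := by
      intro N hJN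
      have hu : IsUnit (g (C (j r))) := (((isUnit_iff_ne_zero.mpr fun h => hr ((c.hj r).mp h)).map C)).map g
      have : g (C (j r)) * g f = Ideal.Quotient.mk J (φ (aeval w f')) := by
        rw [← map_mul, hf', hgF]
      rw [← Ideal.unit_mul_mem_iff_mem _ hu, this, ← Ideal.mem_comap, Ideal.comap_map_mk hJN]
    have h1 := (hmem Q hJQ).mp hf
    have h2 : f' ∈ (Q.comap φ).comap (aeval w : MvPolynomial (Fin m) R →ₐ[R] E).toRingHom := h1
    rw [hE] at h2
    exact (hmem Q' hJQ').mpr h2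
  have hmapP : ∀ Q : Ideal F, Q.IsPrime → J ≤ Q → (Q.map (Ideal.Quotient.mk J)).IsPrime := by
    intro Q hQ hJQ
    exact Ideal.map_isPrime_of_surjective Ideal.Quotient.mk_surjective (by rwa [Ideal.mk_ker])
  haveI hp0 : p0.IsPrime := hmapP _ hP1 hJP
  set q0 := p0.comap g.toRingHom with hq0
  have hSf := Algebra.QuasiFinite.finite_primesOver (R := MvPolynomial (Fin m) k) (S := F ⧸ J) q0
  have hp0q : p0.LiesOver q0 := ⟨rfl⟩
  have hch : ∀ N : Ideal (F ⧸ J), ∃ y : F, (N ∈ q0.primesOver (F ⧸ J) ∧ N ≠ p0) →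
      y ∈ N.comap (Ideal.Quotient.mk J) ∧ y ∉ P1 := by
    intro N
    by_cases h : N ∈ q0.primesOver (F ⧸ J) ∧ N ≠ p0
    · haveI := h.1.1
      have : ¬ N.comap (Ideal.Quotient.mk J) ≤ P1 := by
        intro hle
        apply h.2
        have hle2 : N ≤ p0 := by
          rw [← Ideal.map_comap_of_surjective _ Ideal.Quotient.mk_surjective N]
          exact Ideal.map_mono hle
        refine Algebra.QuasiFinite.eq_of_le_of_under_eq (R := MvPolynomial (Fin m) k) N p0 hle2 ?_
        rw [← h.1.2.over, ← hp0q.over]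
      obtain ⟨y, hy, hy'⟩ := SetLike.not_le_iff_exists.mp this
      exact ⟨y, fun _ => ⟨hy, hy'⟩⟩
    · exact ⟨0, fun h' => absurd h' h⟩
  choose y hy using hch
  let Sg2 := hSf.toFinset.filter (· ≠ p0)
  obtain ⟨r1, hr1, e1, he1⟩ := c.dF (∏ N ∈ Sg2, y N)
  have he1P : φ e1 ∉ P1 := by
    rw [← he1]
    intro h
    rcases hP1.mem_or_mem h with h | h
    · exact hP1.ne_top (Ideal.eq_top_of_isUnit_mem _ h (c.unit hr1))
    · rw [Ideal.IsPrime.prod_mem_iff (p := P1)] at h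
      obtain ⟨N, hN, hxN⟩ := h
      have := Finset.mem_filter.mp hN
      exact (hy N ⟨hSf.mem_toFinset.mp this.1, this.2⟩).2 hxN
  refine ⟨m, hmd, w, e * e1, ?_, ?_⟩
  · rw [Ideal.mem_comap, map_mul]
    exact fun h => (hP1.mem_or_mem h).elim heP he1P
  intro Q hQ heQ hE
  have hQs : Q.comap (algebraMap R E) = s := by
    rw [← hPs]
    ext r
    have := Ideal.ext_iff.mp hE (C r)
    simpa [Ideal.mem_comap] using this
  obtain ⟨Q1, hQ1, rfl⟩ := c.pr Q hQ hQs
  have h1 : φ e ∉ Q1 := fun h => heQ (by rw [Ideal.mem_comap, map_mul]; exact Ideal.mul_mem_right _ _ h)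
  have h2 : φ e1 ∉ Q1 := fun h => heQ (by rw [Ideal.mem_comap, map_mul]; exact Ideal.mul_mem_left _ _ h)
  have hJQ := hJle Q1 hQ1 h1
  have heq := le_antisymm (key Q1 P1 hJQ hJP hE) (key P1 Q1 hJP hJQ hE.symm)
  by_cases hne : Q1.map (Ideal.Quotient.mk J) = p0
  · congr 1
    rw [← Ideal.comap_map_mk hJQ, hne, Ideal.comap_map_mk hJP]
  · exfalso
    apply h2
    rw [← he1]
    have hmem : Q1.map (Ideal.Quotient.mk J) ∈ q0.primesOver (F ⧸ J) := ⟨hmapP _ hQ1 hJQ, ⟨heq.symm⟩⟩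
    have := (hy _ ⟨hmem, hne⟩).1
    rw [Ideal.comap_map_mk hJQ] at this
    refine Q1.mul_mem_left _ (Ideal.mem_of_dvd _ (Finset.dvd_prod_of_mem y ?_) this)
    exact Finset.mem_filter.mpr ⟨hSf.mem_toFinset.mpr hmem, hne⟩

end

section
variable {R E : Type*} [CommRing R] [CommRing E] [Algebra R E]

open TensorProduct in
lemma fibData (s : Ideal R) [s.IsPrime] :
    FibData (k := s.ResidueField) (F := s.Fiber E) s (algebraMap R s.ResidueField)
      (Algebra.TensorProduct.includeRight : E →ₐ[R] s.Fiber E).toRingHom where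
  comp r := by
    show Algebra.TensorProduct.includeRight (algebraMap R E r) = _
    rw [AlgHom.commutes]
    rfl
  hj r := by rw [← RingHom.mem_ker, Ideal.ker_algebraMap_residueField]
  dk c := by
    obtain ⟨⟨a, b⟩, h⟩ := IsLocalization.surj (M := nonZeroDivisors (R ⧸ s)) c
    obtain ⟨a, rfl⟩ := Ideal.Quotient.mk_surjective a
    obtain ⟨b', hb⟩ : ∃ b', Ideal.Quotient.mk s b' = b.1 := Ideal.Quotient.mk_surjective _
    refine ⟨b', fun hm => nonZeroDivisors.ne_zero b.2 (hb ▸ Ideal.Quotient.eq_zero_iff_mem.mpr hm), a, ?_⟩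
    simp only [← hb] at h
    rw [mul_comm]; exact h
  dF x := by
    obtain ⟨r, hr, e, h⟩ := Ideal.Fiber.exists_smul_eq_one_tmul s x
    refine ⟨r, hr, e, ?_⟩
    rw [← IsScalarTower.algebraMap_apply, ← Algebra.smul_def, h]; rfl
  pr Q hQ hQs := by
    have hov : Q.LiesOver s := ⟨hQs.symm⟩
    refine ⟨(PrimeSpectrum.primesOverOrderIsoFiber R E s ⟨Q, hQ, hov⟩).asIdeal, inferInstance, ?_⟩
    exact congrArg Subtype.val ((PrimeSpectrum.primesOverOrderIsoFiber R E s).symm_apply_apply ⟨Q, hQ, hov⟩)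

/-- Openness of the fibre dimension bound. -/
lemma qf [Algebra.FiniteType R E] {d : ℕ} (P : Ideal E) [hP : P.IsPrime]
    (H : ∀ Q : Ideal E, Q.IsPrime → Q ≤ P → Q.comap (algebraMap R E) = P.comap (algebraMap R E) →
      TL R Q d) : ∃ η ∉ P, ∀ Q : Ideal E, Q.IsPrime → η ∉ Q → TL R Q d := by
  obtain ⟨m, hmd, w, e, heP, he⟩ := qf_aux (fibData (E := E) (P.comap (algebraMap R E))) P rfl H
  letI : Algebra (MvPolynomial (Fin m) R) E := (aeval w : MvPolynomial (Fin m) R →ₐ[R] E).toRingHom.toAlgebra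
  haveI : IsScalarTower R (MvPolynomial (Fin m) R) E := .of_algebraMap_eq fun r => by
    show _ = aeval w _
    rw [AlgHom.commutes]
  haveI : Algebra.FiniteType (MvPolynomial (Fin m) R) E := .of_restrictScalars_finiteType R _ _
  haveI : Algebra.QuasiFiniteAt (MvPolynomial (Fin m) R) P := by
    refine Algebra.QuasiFiniteAt.of_isOpen_singleton_fiber (R := MvPolynomial (Fin m) R) ⟨P, hP⟩ ?_
    have : ({⟨⟨P, hP⟩, rfl⟩} : Set (PrimeSpectrum.comap (algebraMap (MvPolynomial (Fin m) R) E) ⁻¹'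
        {PrimeSpectrum.comap (algebraMap (MvPolynomial (Fin m) R) E) ⟨P, hP⟩})) =
        Subtype.val ⁻¹' (PrimeSpectrum.basicOpen e : Set (PrimeSpectrum E)) := by
      ext ⟨Q, hQ⟩
      constructor
      · intro h
        have h2 : Q = ⟨P, hP⟩ := congrArg Subtype.val h
        show e ∉ Q.asIdeal
        rw [h2]; exact heP
      · intro h
        apply Subtype.ext
        apply PrimeSpectrum.ext
        exact he Q.asIdeal Q.isPrime h (congrArg PrimeSpectrum.asIdeal hQ)
    rw [this]
    exact (PrimeSpectrum.basicOpen e).isOpen.preimage continuous_subtype_val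
  obtain ⟨r, hr, h⟩ := Algebra.zariskisMainProperty_iff'.mp (Algebra.ZariskisMainProperty.of_finiteType (R := MvPolynomial (Fin m) R) P)
  exact ⟨r, hr, fun Q hQ hrQ => TL.of_alg hmd w r hrQ h⟩

end
end

section
open MvPolynomial

/-- fibre-generic primes -/
def FG (B : Type*) {E : Type*} [CommRing B] [CommRing E] [Algebra B E] (Q : Ideal E) : Prop :=
  ∀ Q' : Ideal E, Q'.IsPrime → Q' ≤ Q →
    Q'.comap (algebraMap B E) = Q.comap (algebraMap B E) → Q' = Q

section
variable {B E : Type*} [CommRing B] [CommRing E] [Algebra B E]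

lemma not_TL_zero (Q : Ideal E) : ¬ TL B Q 0 := by
  intro h
  obtain ⟨F, ⟨m, hm⟩, hF⟩ := h Fin.elim0
  apply hm
  rw [eq_C_of_isEmpty F, aeval_C] at hF
  rwa [Subsingleton.elim m 0]

lemma exists_min_over {I Q : Ideal E} [hQ : Q.IsPrime] (hI : I ≤ Q)
    (hI' : (Q.comap (algebraMap B E)).map (algebraMap B E) ≤ I) :
    ∃ P' ∈ I.minimalPrimes, P' ≤ Q ∧ P'.comap (algebraMap B E) = Q.comap (algebraMap B E) := by
  obtain ⟨P', hP', hle⟩ := Ideal.exists_minimalPrimes_le hI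
  refine ⟨P', hP', hle, le_antisymm (Ideal.comap_mono hle) ?_⟩
  exact Ideal.map_le_iff_le_comap.mp (hI'.trans hP'.1.2)

lemma FG_of_min {P' : Ideal E}
    (h : P' ∈ ((P'.comap (algebraMap B E)).map (algebraMap B E)).minimalPrimes) : FG B P' := by
  intro Q' hQ' hle hc
  refine le_antisymm hle (h.2 ⟨hQ', ?_⟩ hle)
  rw [← hc]
  exact Ideal.map_comap_le

lemma FG.min {P' : Ideal E} [hp : P'.IsPrime] (h : FG B P') :
    P' ∈ ((P'.comap (algebraMap B E)).map (algebraMap B E)).minimalPrimes := by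
  obtain ⟨Q, h1, h2, h3⟩ := exists_min_over (B := B) (Q := P') Ideal.map_comap_le le_rfl
  have := h Q h1.1.1 h2 h3
  rwa [this] at h1

lemma exists_FG (Q : Ideal E) [hQ : Q.IsPrime] : ∃ P' : Ideal E, P'.IsPrime ∧ P' ≤ Q ∧
    P'.comap (algebraMap B E) = Q.comap (algebraMap B E) ∧ FG B P' := by
  obtain ⟨P', h1, h2, h3⟩ := exists_min_over (B := B) (Q := Q) Ideal.map_comap_le le_rfl
  exact ⟨P', h1.1.1, h2, h3, FG_of_min (by rwa [h3])⟩

lemma fg_dom [IsDomain B] [IsDomain E] [Algebra.FiniteType B E]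
    (tf : ∀ (b : B) (x : E), b ≠ 0 → algebraMap B E b * x = 0 → x = 0)
    (hv : ∀ q : Ideal B, q.IsPrime → ValAt q) (P : Ideal E) [hP : P.IsPrime] (a : E)
    (ha : ∀ P' : Ideal E, P'.IsPrime → P' ≤ P →
      P'.comap (algebraMap B E) = P.comap (algebraMap B E) → FG B P' → a ∉ P') :
    ∃ η ∉ P, ∀ Q : Ideal E, Q.IsPrime → η ∉ Q → FG B Q → a ∉ Q := by
  classical
  have hbot : (⊥ : Ideal E).IsPrime := Ideal.isPrime_bot
  have hex : ∃ d, TL B (⊥ : Ideal E) d := by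
    obtain ⟨d, hd⟩ := TL.exists_of_finiteType (R := B) (E := E)
    exact ⟨d, hd _ hbot⟩
  obtain ⟨d, hd, hmin⟩ : ∃ d, TL B (⊥ : Ideal E) (d + 1) ∧ ¬ TL B (⊥ : Ideal E) d := by
    have h1 := Nat.find_spec hex
    have h0 : Nat.find hex ≠ 0 := fun h => not_TL_zero _ (h ▸ h1)
    obtain ⟨d, hd⟩ := Nat.exists_eq_succ_of_ne_zero h0
    rw [hd] at h1; exact ⟨d, h1, Nat.find_min hex (by omega)⟩
  have key : ∀ Q : Ideal E, Q.IsPrime → FG B Q → ¬ TL B Q d := by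
    intro Q hQ hfg hT
    obtain ⟨η, h1, h2⟩ := qf (R := B) (d := d) Q (fun Q1 h1 h2 h3 => by rw [hfg Q1 h1 h2 h3]; exact hT)
    refine hmin (h2 ⊥ hbot fun h => h1 ?_)
    rw [Ideal.mem_bot.mp h]; exact Q.zero_mem
  by_cases haP : a ∈ P
  swap
  · exact ⟨a, haP, fun Q _ h _ => h⟩
  let π : E →ₐ[B] (E ⧸ Ideal.span {a}) := Ideal.Quotient.mkₐ B _
  have hπ : Function.Surjective π.toRingHom := Ideal.Quotient.mk_surjective
  have hker : RingHom.ker π.toRingHom = Ideal.span {a} := Ideal.mk_ker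
  have hcm : ∀ Q : Ideal E, Q.IsPrime → a ∈ Q → (Q.map π.toRingHom).IsPrime ∧
      (Q.map π.toRingHom).comap π.toRingHom = Q := by
    intro Q hQ haQ
    have hk : RingHom.ker π.toRingHom ≤ Q := by
      rw [hker, Ideal.span_singleton_le_iff_mem]; exact haQ
    exact ⟨Ideal.map_isPrime_of_surjective hπ hk, by
      rw [Ideal.comap_map_of_surjective' _ hπ, sup_eq_left]; exact hk⟩
  obtain ⟨hp1, hp2⟩ := hcm P hP haP
  obtain ⟨η1, hη1, H⟩ := qf (R := B) (d := d) (P.map π.toRingHom) (fun Q1 hQ1 hle hc => by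
    have hq2 : (Q1.comap π.toRingHom).IsPrime := inferInstance
    have haq : a ∈ Q1.comap π.toRingHom := by
      have : π.toRingHom a = 0 := by
        have : a ∈ RingHom.ker π.toRingHom := by rw [hker]; exact Ideal.mem_span_singleton_self a
        exact this
      rw [Ideal.mem_comap, this]; exact Q1.zero_mem
    have hle2 : Q1.comap π.toRingHom ≤ P := by
      rw [← hp2]; exact Ideal.comap_mono hle
    have hcc : ∀ J : Ideal (E ⧸ Ideal.span {a}), (J.comap π.toRingHom).comap (algebraMap B E) =
        J.comap (algebraMap B _) := fun J => by
      rw [Ideal.comap_comap]; rfl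
    obtain ⟨P', p1, p2, p3, p4⟩ := exists_FG (B := B) (Q1.comap π.toRingHom)
    have haP' := ha P' p1 (p2.trans hle2) (by rw [p3, hcc, hc, ← hcc, hp2]) p4
    have hlt : P' < Q1.comap π.toRingHom := lt_of_le_of_ne p2 fun h => haP' (h ▸ haq)
    refine TL.map_surj π hπ (TL.strict hlt (fun r hr => ?_) (TL.scale tf P' (hv _ inferInstance) hd))
    have : r ∈ (Q1.comap π.toRingHom).comap (algebraMap B E) := hr
    rw [← p3] at this
    exact this)
  obtain ⟨η, rfl⟩ := hπ η1
  refine ⟨η, fun h => hη1 (Ideal.mem_map_of_mem _ h), fun Q hQ hηQ hfg haQ => ?_⟩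
  obtain ⟨q1, q2⟩ := hcm Q hQ haQ
  refine key Q hQ hfg ?_
  have := TL.comap π (H _ q1 fun h => hηQ (by rw [← q2]; exact h))
  rwa [q2] at this

end
end

section

/-- base ring: all localizations are DVRs or fields -/
structure BD (B : Type*) [CommRing B] : Prop where
  dom : IsDomain B
  val : ∀ q : Ideal B, q.IsPrime → ValAt q
  unif : ∀ q : Ideal B, q.IsPrime → q ≠ ⊥ → ∃ t ∈ q, ∀ b ∈ q, ∃ h ∉ q, t ∣ h * b
  noeth : ∀ (q : Ideal B) [q.IsPrime], IsNoetherianRing (Localization.AtPrime q)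

/-- the fibre ideal -/
def fibI (B : Type*) {S : Type*} [CommRing B] [CommRing S] [Algebra B S] (P : Ideal S) : Ideal S :=
  (P.comap (algebraMap B S)).map (algebraMap B S)

def NzAt {S : Type*} [CommRing S] (P : Ideal S) (a : S) : Prop :=
  ∀ z, a * z = 0 → ∃ f ∉ P, f * z = 0

def DvdAt {S : Type*} [CommRing S] (P : Ideal S) (c d : S) : Prop := ∃ f ∉ P, c ∣ f * d

def NzMod (B : Type*) {S : Type*} [CommRing B] [CommRing S] [Algebra B S] (P : Ideal S) (a : S) : Prop :=
  ∀ z, a * z ∈ fibI B P → ∃ f ∉ P, f * z ∈ fibI B P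

section loc
variable {S A : Type*} [CommRing S] [CommRing A] [Algebra S A] {P : Ideal S} [hP : P.IsPrime]
  [IsLocalization.AtPrime A P]

lemma loc_eq_zero (x : S) : algebraMap S A x = 0 ↔ ∃ f ∉ P, f * x = 0 := by
  rw [IsLocalization.map_eq_zero_iff P.primeCompl A]
  exact ⟨fun ⟨m, hm⟩ => ⟨m, m.2, hm⟩, fun ⟨f, hf, h⟩ => ⟨⟨f, hf⟩, h⟩⟩

lemma loc_unit {f : S} (hf : f ∉ P) : IsUnit (algebraMap S A f) :=
  IsLocalization.map_units A (⟨f, hf⟩ : P.primeCompl)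

lemma loc_surj (P : Ideal S) [P.IsPrime] [IsLocalization.AtPrime A P] (x : A) :
    ∃ f ∉ P, ∃ y, algebraMap S A f * x = algebraMap S A y := by
  obtain ⟨⟨y, s⟩, h⟩ := IsLocalization.surj P.primeCompl x
  exact ⟨s, s.2, y, by rw [mul_comm]; exact h⟩

lemma loc_dvd (c d : S) : algebraMap S A c ∣ algebraMap S A d ↔ DvdAt P c d := by
  constructor
  · rintro ⟨x, hx⟩
    obtain ⟨f, hf, y, hy⟩ := loc_surj P x
    have : algebraMap S A (f * d - c * y) = 0 := by
      rw [map_sub, map_mul, map_mul, ← hy, hx]; ring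
    obtain ⟨g, hg, h⟩ := (loc_eq_zero (P := P) _).mp this
    refine ⟨g * f, hP.mul_notMem hg hf, g * y, ?_⟩
    linear_combination h
  · rintro ⟨f, hf, h⟩
    have := map_dvd (algebraMap S A) h
    rw [map_mul] at this
    exact (IsUnit.dvd_mul_left (loc_unit (P := P) hf)).mp this

lemma loc_nz (a : S) : (∀ z : A, algebraMap S A a * z = 0 → z = 0) ↔ NzAt P a := by
  constructor
  · intro h z hz
    exact (loc_eq_zero (A := A) z).mp (h _ (by rw [← map_mul, hz, map_zero]))
  · intro h z hz
    obtain ⟨f, hf, y, hy⟩ := loc_surj P z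
    have : algebraMap S A (a * y) = 0 := by
      rw [map_mul, ← hy]; linear_combination (algebraMap S A f) * hz
    obtain ⟨g, hg, h1⟩ := (loc_eq_zero (P := P) _).mp this
    obtain ⟨g', hg', h2⟩ := h (g * y) (by linear_combination h1)
    have h3 : algebraMap S A y = 0 := (loc_eq_zero (P := P) y).mpr
      ⟨g' * g, hP.mul_notMem hg' hg, by linear_combination h2⟩
    rw [h3] at hy
    exact (loc_unit (P := P) hf).mul_right_eq_zero.mp hy

lemma loc_mem_max [IsLocalRing A] (x : S) : algebraMap S A x ∈ maximalIdeal A ↔ x ∈ P := by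
  exact IsLocalization.AtPrime.to_map_mem_maximal_iff A P x

end loc

section
variable {B S : Type*} [CommRing B] [CommRing S] [Algebra B S]

lemma fibI_le (P : Ideal S) : fibI B P ≤ P := Ideal.map_comap_le

lemma fibI_congr {P Q : Ideal S} (h : P.comap (algebraMap B S) = Q.comap (algebraMap B S)) :
    fibI B P = fibI B Q := by rw [fibI, fibI, h]

lemma NzMod.mono {P Q : Ideal S} (h : P.comap (algebraMap B S) = Q.comap (algebraMap B S)) (hle : P ≤ Q)
    {a : S} (ha : NzMod B Q a) : NzMod B P a := by
  intro z hz
  rw [fibI_congr h] at hz ⊢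
  obtain ⟨f, hf, h⟩ := ha z hz
  exact ⟨f, fun hh => hf (hle hh), h⟩

lemma NzMod.mul {P : Ideal S} [hP : P.IsPrime] {a b : S} (ha : NzMod B P a) (hb : NzMod B P b) :
    NzMod B P (a * b) := by
  intro z hz
  obtain ⟨f, hf, h⟩ := ha (b * z) (by rwa [← mul_assoc])
  obtain ⟨g, hg, h'⟩ := hb (f * z) (by convert h using 1; ring)
  exact ⟨g * f, hP.mul_notMem hg hf, by rwa [mul_assoc]⟩

lemma NzMod.pow {P : Ideal S} [hP : P.IsPrime] {a : S} (ha : NzMod B P a) (n : ℕ) :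
    NzMod B P (a ^ n) := by
  induction n with
  | zero => exact fun z hz => ⟨1, hP.one_notMem, by simpa using hz⟩
  | succ n ih => rw [pow_succ]; exact ih.mul ha

lemma unif_mem {q : Ideal B} [hq : q.IsPrime] {t : B} (ht : ∀ b ∈ q, ∃ h ∉ q, t ∣ h * b) {x : S}
    (hx : x ∈ q.map (algebraMap B S)) : ∃ h ∉ q, algebraMap B S t ∣ algebraMap B S h * x := by
  rw [Ideal.map] at hx
  induction hx using Submodule.span_induction with
  | mem x hx =>
    obtain ⟨b, hb, rfl⟩ := hx
    obtain ⟨h, h1, h2⟩ := ht b hb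
    exact ⟨h, h1, by rw [← map_mul]; exact map_dvd _ h2⟩
  | zero => exact ⟨1, hq.one_notMem, by simp⟩
  | add x y _ _ hx hy =>
    obtain ⟨h, h1, h2⟩ := hx
    obtain ⟨g, g1, g2⟩ := hy
    refine ⟨h * g, hq.mul_notMem h1 g1, ?_⟩
    rw [map_mul, mul_add]
    refine dvd_add ?_ ?_
    · rw [mul_right_comm]; exact h2.mul_right _
    · rw [mul_assoc]; exact g2.mul_left _
  | smul c x _ hx =>
    obtain ⟨h, h1, h2⟩ := hx
    refine ⟨h, h1, ?_⟩
    rw [smul_eq_mul, mul_left_comm]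
    exact h2.mul_left _

/-- In the stalk, the fibre ideal is generated by the uniformizer. -/
lemma mem_fibI_iff {A : Type*} [CommRing A] [Algebra S A] {P : Ideal S} [hP : P.IsPrime]
    [IsLocalization.AtPrime A P] {t : B} (htm : t ∈ P.comap (algebraMap B S))
    (ht : ∀ b ∈ P.comap (algebraMap B S), ∃ h ∉ P.comap (algebraMap B S), t ∣ h * b) (x : S) :
    algebraMap S A (algebraMap B S t) ∣ algebraMap S A x ↔ ∃ f ∉ P, f * x ∈ fibI B P := by
  rw [loc_dvd (P := P)]
  constructor
  · rintro ⟨f, hf, h⟩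
    refine ⟨f, hf, Ideal.mem_of_dvd _ h (Ideal.mem_map_of_mem _ htm)⟩
  · rintro ⟨f, hf, h⟩
    obtain ⟨g, hg, h'⟩ := unif_mem ht h
    exact ⟨algebraMap B S g * f, hP.mul_notMem hg hf, by rwa [mul_assoc]⟩

lemma NZm_iff {A : Type*} [CommRing A] [Algebra S A] {P : Ideal S} [hP : P.IsPrime]
    [IsLocalization.AtPrime A P] {t : B} (htm : t ∈ P.comap (algebraMap B S))
    (ht : ∀ b ∈ P.comap (algebraMap B S), ∃ h ∉ P.comap (algebraMap B S), t ∣ h * b) (a : S) :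
    NZm (algebraMap S A (algebraMap B S t)) (algebraMap S A a) ↔ NzMod B P a := by
  constructor
  · intro h z hz
    refine (mem_fibI_iff (A := A) htm ht z).mp (h _ ?_)
    rw [← map_mul]
    exact (mem_fibI_iff htm ht _).mpr ⟨1, hP.one_notMem, by rwa [one_mul]⟩
  · intro h z hz
    obtain ⟨f, hf, y, hy⟩ := loc_surj P z
    have h1 : algebraMap S A (algebraMap B S t) ∣ algebraMap S A (a * y) := by
      rw [map_mul, ← hy, mul_left_comm]; exact hz.mul_left _
    obtain ⟨g, hg, h2⟩ := (mem_fibI_iff htm ht _).mp h1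
    obtain ⟨g', hg', h3⟩ := h (g * y) (by convert h2 using 1; ring)
    have h4 := (mem_fibI_iff (A := A) htm ht y).mpr ⟨g' * g, hP.mul_notMem hg' hg, by rwa [mul_assoc]⟩
    rw [← hy] at h4
    exact (IsUnit.dvd_mul_left (loc_unit (P := P) hf)).mp h4

end

lemma fg_local {A : Type*} [CommRing A] [IsNoetherianRing A] [IsLocalRing A] {t a : A}
    (tm : t ∈ maximalIdeal A) (tnz : ∀ z, t * z = 0 → z = 0) (Q0 : Ideal A)
    (hQ0 : Q0 ∈ minimalPrimes A)
    (hm : maximalIdeal A ∈ (Q0 ⊔ Ideal.span {t}).minimalPrimes) (ha : NZm t a) :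
    a ∉ maximalIdeal A := by
  intro haM
  have hpr := hQ0.1.1
  obtain ⟨Q, hQ, hle, -, z, hz⟩ := exists_ass_le (⊤ : Ideal A) Q0 (fun a h => by
    rw [← mul_one a, h 1 trivial]; exact Q0.zero_mem)
  have hQQ : Q0 = Q := le_antisymm (hQ0.2 ⟨hQ, bot_le⟩ hle) hle
  rw [← hQQ] at hz
  have hz0 : z ≠ 0 := by
    rintro rfl
    exact hpr.one_notMem ((hz 1).mpr (by simp))
  have hex : ∃ n, ¬ t ^ n ∣ z := by
    by_contra hcon
    push Not at hcon
    have : z ∈ ⨅ n, maximalIdeal A ^ n := by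
      rw [Ideal.mem_iInf]
      intro n
      exact Ideal.mem_of_dvd _ (hcon n) (Ideal.pow_mem_pow tm n)
    rw [Ideal.iInf_pow_eq_bot_of_isLocalRing _ (IsLocalRing.maximalIdeal.isMaximal A).ne_top] at this
    exact hz0 this
  classical
  have h1 := Nat.find_spec hex
  have h0 : Nat.find hex ≠ 0 := fun h => by rw [h] at h1; simp at h1
  obtain ⟨n, hn⟩ := Nat.exists_eq_succ_of_ne_zero h0
  have h2 := Nat.find_min hex (m := n) (by omega)
  rw [hn] at h1
  push Not at h2
  obtain ⟨w, hw⟩ := h2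
  have htw : ¬ t ∣ w := fun ⟨v, hv⟩ => h1 ⟨v, by rw [hw, hv, pow_succ]; ring⟩
  have tn : ∀ k y, t ^ k * y = 0 → y = 0 := by
    intro k
    induction k with
    | zero => intro y hy; simpa using hy
    | succ k ih => intro y hy; exact ih y (tnz _ (by rw [← hy]; ring))
  have hann : ∀ y ∈ Q0, y * w = 0 := fun y hy => tn n _ (by
    have := (hz y).mp hy
    rw [hw] at this; linear_combination this)
  obtain ⟨k, e, he, hk⟩ := mem_minimal_pow hm haM
  obtain ⟨y, hy, s, hs, hys⟩ := Submodule.mem_sup.mp hk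
  obtain ⟨s', rfl⟩ := Ideal.mem_span_singleton'.mp hs
  have h3 : t ∣ a ^ k * (e * w) := ⟨s' * w, by linear_combination (-w) * hys + hann y hy⟩
  have h4 := ha.pow k _ h3
  have hu : IsUnit e := by
    by_contra h; exact he ((IsLocalRing.mem_maximalIdeal _).mpr h)
  exact htw ((IsUnit.dvd_mul_left hu).mp h4)

end

section

section
variable {B S : Type*} [CommRing B] [CommRing S] [Algebra B S]

lemma noeth_loc (hB : BD B) [Algebra.EssFiniteType B S] (P : Ideal S) [hP : P.IsPrime] :
    IsNoetherianRing (Localization.AtPrime P) := by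
  let q := P.comap (algebraMap B S)
  haveI : IsNoetherianRing (Localization.AtPrime q) := hB.noeth q
  letI : Algebra (Localization.AtPrime q) (Localization.AtPrime P) :=
    (Localization.localRingHom q P (algebraMap B S) rfl).toAlgebra
  haveI : IsScalarTower B (Localization.AtPrime q) (Localization.AtPrime P) := by
    refine IsScalarTower.of_algebraMap_eq fun x => ?_
    rw [RingHom.algebraMap_toAlgebra, Localization.localRingHom_to_map]
    rfl
  haveI : Algebra.EssFiniteType B (Localization.AtPrime P) := Algebra.EssFiniteType.comp B S _
  haveI := Algebra.EssFiniteType.of_comp B (Localization.AtPrime q) (Localization.AtPrime P)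
  exact Algebra.EssFiniteType.isNoetherianRing (Localization.AtPrime q) _

lemma min_over_zero [IsDomain B]
    (tf : ∀ (b : B) (x : S), b ≠ 0 → algebraMap B S b * x = 0 → x = 0) {Q0 : Ideal S}
    (h : Q0 ∈ minimalPrimes S) : Q0.comap (algebraMap B S) = ⊥ := by
  rw [eq_bot_iff]
  intro b hb
  by_contra hb0
  obtain ⟨k, e, he, hk⟩ := mem_minimal_pow h hb
  apply he
  rw [tf (b ^ k) e (pow_ne_zero _ hb0) (by rw [map_pow, mul_comm]; exact hk)]
  exact Q0.zero_mem

lemma finite_min [IsDomain B] [Algebra.EssFiniteType B S]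
    (tf : ∀ (b : B) (x : S), b ≠ 0 → algebraMap B S b * x = 0 → x = 0) :
    (minimalPrimes S).Finite := by
  let K := Localization (nonZeroDivisors B)
  let L := Localization (Algebra.algebraMapSubmonoid S (nonZeroDivisors B))
  letI : Algebra K L := localizationAlgebra (nonZeroDivisors B) S
  haveI : IsScalarTower B K L := IsScalarTower.of_algebraMap_eq' (by
    rw [IsScalarTower.algebraMap_eq B S L]
    symm
    exact IsLocalization.map_comp _)
  haveI : Algebra.EssFiniteType B L := Algebra.EssFiniteType.comp B S _
  haveI := Algebra.EssFiniteType.of_comp B K L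
  letI : Field K := IsFractionRing.toField B
  haveI : IsNoetherianRing L := Algebra.EssFiniteType.isNoetherianRing K _
  refine Set.Finite.subset ((minimalPrimes.finite_of_isNoetherianRing L).image
    (Ideal.comap (algebraMap S L))) ?_
  intro Q0 hQ0
  have hz := min_over_zero tf hQ0
  have hpr := hQ0.1.1
  have hd : Disjoint (Algebra.algebraMapSubmonoid S (nonZeroDivisors B) : Set S) (Q0 : Set S) := by
    rw [Set.disjoint_left]
    rintro _ ⟨b, hb, rfl⟩ hbQ
    have : b ∈ Q0.comap (algebraMap B S) := hbQ
    rw [hz] at this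
    exact nonZeroDivisors.ne_zero hb this
  have hc : (Q0.map (algebraMap S L)).comap (algebraMap S L) = Q0 :=
    IsLocalization.under_map_of_isPrime_disjoint _ _ hpr hd
  refine ⟨Q0.map (algebraMap S L), ⟨⟨IsLocalization.isPrime_of_isPrime_disjoint _ _ _ hpr hd, bot_le⟩, ?_⟩, hc⟩
  rintro J ⟨hJ, -⟩ hJle
  have h1 : J.comap (algebraMap S L) ≤ Q0 := by
    rw [← hc]; exact Ideal.comap_mono hJle
  have h2 := hQ0.2 ⟨inferInstance, bot_le⟩ h1
  exact Ideal.map_le_iff_le_comap.mpr h2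

lemma fg_hyp (hB : BD B) [Algebra.EssFiniteType B S]
    (tf : ∀ (b : B) (x : S), b ≠ 0 → algebraMap B S b * x = 0 → x = 0)
    {Q0 P : Ideal S} [hP : P.IsPrime] (hQ0 : Q0 ∈ minimalPrimes S)
    (hPm : P ∈ (Q0 ⊔ fibI B P).minimalPrimes) {a : S} (ha : NzMod B P a) : a ∉ P := by
  have := hB.dom
  have hpr := hQ0.1.1
  have hle : Q0 ≤ P := le_sup_left.trans hPm.1.2
  by_cases hp : P.comap (algebraMap B S) = ⊥
  · have hfib : fibI B P = ⊥ := by rw [fibI, hp, Ideal.map_bot]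
    rw [hfib, sup_bot_eq] at hPm
    have : P = Q0 := le_antisymm (hPm.2 ⟨hpr, le_rfl⟩ hle) hle
    subst this
    intro haP
    obtain ⟨k, e, he, hk⟩ := mem_minimal_pow hQ0 haP
    obtain ⟨f, hf, h⟩ := ha.pow k e (by rw [hfib, mul_comm]; exact hk)
    rw [hfib] at h
    exact hP.mul_notMem hf he (by rw [Ideal.mem_bot.mp h]; exact P.zero_mem)
  obtain ⟨t, htm, ht⟩ := hB.unif _ inferInstance hp
  have ht0 : t ≠ 0 := by
    rintro rfl
    obtain ⟨b, hb, hb0⟩ := Submodule.exists_mem_ne_zero_of_ne_bot hp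
    obtain ⟨h, h1, h2⟩ := ht b hb
    rcases mul_eq_zero.mp (zero_dvd_iff.mp h2) with h | h
    · rw [h] at h1; exact h1 (Ideal.zero_mem _)
    · exact hb0 h
  let A := Localization.AtPrime P
  haveI : IsNoetherianRing A := noeth_loc hB P
  have hd : Disjoint (P.primeCompl : Set S) (Q0 : Set S) := by
    rw [Set.disjoint_left]; exact fun x hx h => hx (hle h)
  have hc : (Q0.map (algebraMap S A)).comap (algebraMap S A) = Q0 :=
    IsLocalization.under_map_of_isPrime_disjoint _ _ hpr hd
  have key : ∀ J : Ideal A, J.IsPrime → J.comap (algebraMap S A) ≤ P := by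
    intro J hJ x hx
    by_contra h
    exact hJ.ne_top (Ideal.eq_top_of_isUnit_mem _ hx (loc_unit (P := P) h))
  have hmm : maximalIdeal A = P.map (algebraMap S A) :=
    (Localization.AtPrime.map_eq_maximalIdeal (I := P)).symm
  intro haP
  refine fg_local (t := algebraMap S A (algebraMap B S t)) (a := algebraMap S A a)
    ((loc_mem_max (P := P) _).mpr htm) ((loc_nz (P := P) _).mpr fun z hz =>
      ⟨1, hP.one_notMem, by rw [one_mul]; exact tf t z ht0 hz⟩) (Q0.map (algebraMap S A)) ?_ ?_
      ((NZm_iff htm ht a).mpr ha) ((loc_mem_max (P := P) _).mpr haP)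
  · refine ⟨⟨IsLocalization.isPrime_of_isPrime_disjoint _ _ _ hpr hd, bot_le⟩, ?_⟩
    rintro J ⟨hJ, -⟩ hJle
    have h1 : J.comap (algebraMap S A) ≤ Q0 := by
      rw [← hc]; exact Ideal.comap_mono hJle
    exact Ideal.map_le_iff_le_comap.mpr (hQ0.2 ⟨inferInstance, bot_le⟩ h1)
  · refine ⟨⟨inferInstance, sup_le ?_ ?_⟩, ?_⟩
    · rw [hmm]; exact Ideal.map_mono hle
    · rw [Ideal.span_singleton_le_iff_mem]; exact (loc_mem_max (P := P) _).mpr htm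
    · rintro J ⟨hJ, hJ2⟩ -
      rw [hmm, Ideal.map_le_iff_le_comap]
      refine hPm.2 ⟨inferInstance, sup_le ?_ ?_⟩ (key J hJ)
      · exact Ideal.map_le_iff_le_comap.mp (le_sup_left.trans hJ2)
      · rw [fibI, Ideal.map_le_iff_le_comap]
        intro b hb
        obtain ⟨h, h1, h2⟩ := ht b hb
        have h3 : algebraMap S A (algebraMap B S (h * b)) ∈ J :=
          Ideal.mem_of_dvd _ (map_dvd _ (map_dvd _ h2)) (hJ2 (Ideal.mem_sup_right
            (Ideal.mem_span_singleton_self _)))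
        rw [map_mul, map_mul] at h3
        refine (hJ.mem_or_mem h3).resolve_left fun h4 => h1 (key J hJ h4)

lemma fg_ft (hB : BD B) [Algebra.FiniteType B S]
    (tf : ∀ (b : B) (x : S), b ≠ 0 → algebraMap B S b * x = 0 → x = 0)
    (P : Ideal S) [hP : P.IsPrime] {a : S} (ha : NzMod B P a) :
    ∃ η ∉ P, ∀ Q : Ideal S, Q.IsPrime → η ∉ Q → FG B Q → a ∉ Q := by
  classical
  have := hB.dom
  have hfin := finite_min (B := B) (S := S) tf
  have step : ∀ Q0 ∈ minimalPrimes S, ∃ η ∉ P, ∀ Q : Ideal S, Q.IsPrime → Q0 ≤ Q → η ∉ Q →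
      FG B Q → a ∉ Q := by
    intro Q0 hQ0
    have hpr := hQ0.1.1
    by_cases hle : Q0 ≤ P
    swap
    · obtain ⟨η, h1, h2⟩ := Set.not_subset.mp hle
      exact ⟨η, h2, fun Q _ h h' => absurd (h h1) h'⟩
    let π : S →ₐ[B] (S ⧸ Q0) := Ideal.Quotient.mkₐ B _
    have hπ : Function.Surjective π.toRingHom := Ideal.Quotient.mk_surjective
    have hker : RingHom.ker π.toRingHom = Q0 := Ideal.mk_ker
    have hcm : ∀ Q : Ideal S, Q.IsPrime → Q0 ≤ Q → (Q.map π.toRingHom).IsPrime ∧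
        (Q.map π.toRingHom).comap π.toRingHom = Q := by
      intro Q hQ haQ
      rw [← hker] at haQ
      exact ⟨Ideal.map_isPrime_of_surjective hπ haQ, by
        rw [Ideal.comap_map_of_surjective' _ hπ, sup_eq_left]; exact haQ⟩
    have hle0 : ∀ J : Ideal (S ⧸ Q0), Q0 ≤ J.comap π.toRingHom := fun J => by
      conv_lhs => rw [← hker]
      exact Ideal.comap_mono bot_le
    have hcc : ∀ J : Ideal (S ⧸ Q0), (J.comap π.toRingHom).comap (algebraMap B S) =
        J.comap (algebraMap B _) := fun J => by
      rw [Ideal.comap_comap]; rfl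
    obtain ⟨hp1, hp2⟩ := hcm P hP hle
    have hz := min_over_zero tf hQ0
    haveI : IsDomain (S ⧸ Q0) := Ideal.Quotient.isDomain Q0
    obtain ⟨η1, hη1, H⟩ := fg_dom (B := B) (E := S ⧸ Q0) (by
      intro b x hb hbx
      obtain ⟨y, rfl⟩ := hπ x
      have : algebraMap B S b * y ∈ Q0 := by
        rw [← hker, RingHom.mem_ker, map_mul]; exact hbx
      have hy := (hpr.mem_or_mem this).resolve_left fun h => hb (by
        have : b ∈ Q0.comap (algebraMap B S) := h
        rwa [hz] at this)
      rwa [← hker] at hy) hB.val (P.map π.toRingHom) (π a) (by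
      intro P1 h1 h2 h3 h4 h5
      have e1 : P1.comap π.toRingHom ≤ P := by rw [← hp2]; exact Ideal.comap_mono h2
      have e2 : (P1.comap π.toRingHom).comap (algebraMap B S) = P.comap (algebraMap B S) := by
        rw [hcc, h3, ← hcc, hp2]
      refine fg_hyp hB tf hQ0 (P := P1.comap π.toRingHom) ⟨⟨inferInstance, sup_le (hle0 _) (fibI_le _)⟩, ?_⟩
        (ha.mono e2 e1) h5
      rintro J ⟨hJ1, hJ2⟩ hJle
      obtain ⟨j1, j2⟩ := hcm J hJ1 (le_sup_left.trans hJ2)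
      have : J.map π.toRingHom = P1 := by
        refine h4 _ j1 ?_ ?_
        · rw [← Ideal.map_comap_of_surjective _ hπ P1]; exact Ideal.map_mono hJle
        · rw [← hcc, ← hcc, j2]
          refine le_antisymm (Ideal.comap_mono hJle) ?_
          exact Ideal.map_le_iff_le_comap.mp (le_sup_right.trans hJ2)
      rw [← this, j2])
    obtain ⟨η, rfl⟩ := hπ η1
    refine ⟨η, fun h => hη1 (Ideal.mem_map_of_mem _ h), fun Q hQ hle hηQ hfg haQ => ?_⟩
    obtain ⟨q1, q2⟩ := hcm Q hQ hle
    refine H _ q1 (fun h => hηQ (by rw [← q2]; exact h)) ?_ (Ideal.mem_map_of_mem _ haQ)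
    intro Q' h1 h2 h3
    have := hfg (Q'.comap π.toRingHom) inferInstance (by rw [← q2]; exact Ideal.comap_mono h2)
      (by rw [hcc, h3, ← hcc, q2])
    rw [← this, Ideal.map_comap_of_surjective _ hπ]
  choose! η h1 h2 using step
  refine ⟨∏ Q0 ∈ hfin.toFinset, η Q0, ?_, ?_⟩
  · rw [Ideal.IsPrime.prod_mem_iff]
    rintro ⟨Q0, hQ0, h⟩
    exact h1 Q0 (hfin.mem_toFinset.mp hQ0) h
  · intro Q hQ hη hfg
    obtain ⟨Q0, hQ0, hle⟩ := Ideal.exists_minimalPrimes_le (I := (⊥ : Ideal S)) (J := Q) bot_le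
    refine h2 Q0 hQ0 Q hQ hle (fun h => hη ?_) hfg
    rw [Ideal.IsPrime.prod_mem_iff]
    exact ⟨Q0, hfin.mem_toFinset.mpr hQ0, h⟩

/-- FG lemma for essentially finite type algebras. -/
lemma fg_lemma (hB : BD B) [Algebra.EssFiniteType B S]
    (tf : ∀ (b : B) (x : S), b ≠ 0 → algebraMap B S b * x = 0 → x = 0)
    (P : Ideal S) [hP : P.IsPrime] {a : S} (ha : NzMod B P a) :
    ∃ η ∉ P, ∀ Q : Ideal S, Q.IsPrime → η ∉ Q → FG B Q → a ∉ Q := by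
  let S' := Algebra.EssFiniteType.subalgebra B S
  let M := Algebra.EssFiniteType.submonoid B S
  have hinj : Function.Injective (algebraMap S' S) := Subtype.val_injective
  obtain ⟨⟨a', m⟩, ham⟩ := IsLocalization.surj M a
  have hm : IsUnit (algebraMap S' S m) := IsLocalization.map_units S m
  have hcc : ∀ J : Ideal S, (J.comap (algebraMap S' S)).comap (algebraMap B S') =
      J.comap (algebraMap B S) := fun J => by
    rw [Ideal.comap_comap]; rfl
  have hfm : ∀ J : Ideal S, (fibI B (J.comap (algebraMap S' S))).map (algebraMap S' S) = fibI B J := by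
    intro J
    rw [fibI, fibI, hcc, Ideal.map_map]; rfl
  obtain ⟨η, hη, H⟩ := fg_ft (B := B) (S := S') hB (by
    intro b x hb hx
    refine hinj (tf b _ hb ?_)
    have := congrArg (algebraMap S' S) hx
    rwa [map_mul, map_zero] at this) (P.comap (algebraMap S' S)) (a := a') (by
    intro z hz
    have h1 : algebraMap S' S (a' * z) ∈ fibI B P := by
      rw [← hfm]; exact Ideal.mem_map_of_mem _ hz
    rw [map_mul, ← ham] at h1
    obtain ⟨f, hf, h2⟩ := ha (algebraMap S' S z) (by
      rw [mul_right_comm] at h1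
      rw [mul_comm] at h1
      exact (Ideal.unit_mul_mem_iff_mem _ hm).mp h1)
    obtain ⟨⟨f', n⟩, hfn⟩ := IsLocalization.surj M f
    have h3 : algebraMap S' S (f' * z) ∈ fibI B P := by
      rw [map_mul, ← hfn, mul_right_comm]; exact Ideal.mul_mem_right _ _ h2
    have hnP : ∀ n : M, algebraMap S' S n ∉ P := fun n h =>
      hP.ne_top (Ideal.eq_top_of_isUnit_mem _ h (IsLocalization.map_units S n))
    rw [← hfm, IsLocalization.algebraMap_mem_map_algebraMap_iff M] at h3
    obtain ⟨k, hk, h4⟩ := h3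
    refine ⟨k * f', ?_, by rwa [mul_assoc]⟩
    intro h
    rw [Ideal.mem_comap, map_mul] at h
    rcases hP.mem_or_mem h with h | h
    · exact hnP ⟨k, hk⟩ h
    · dsimp only at hfn
      rw [← hfn] at h
      exact (hP.mem_or_mem h).elim hf (hnP n))
  refine ⟨algebraMap S' S η, hη, fun Q hQ hηQ hfg haQ => ?_⟩
  refine H (Q.comap (algebraMap S' S)) inferInstance hηQ ?_ ?_
  · intro Q1 h1 h2 h3
    have hd : Disjoint (M : Set S') (Q1 : Set S') := by
      rw [Set.disjoint_left]
      intro x hx h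
      exact hQ.ne_top (Ideal.eq_top_of_isUnit_mem _ (h2 h) (IsLocalization.map_units S (⟨x, hx⟩ : M)))
    have hc : (Q1.map (algebraMap S' S)).comap (algebraMap S' S) = Q1 :=
      IsLocalization.under_map_of_isPrime_disjoint _ _ h1 hd
    have := hfg (Q1.map (algebraMap S' S)) (IsLocalization.isPrime_of_isPrime_disjoint M _ _ h1 hd)
      (Ideal.map_le_iff_le_comap.mpr h2) (by rw [← hcc, hc, h3, hcc])
    rw [← this, hc]
  · rw [Ideal.mem_comap, ← ham]
    exact Ideal.mul_mem_right _ _ haQ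

end
end

section

def AssocAt {S : Type*} [CommRing S] (P : Ideal S) (c d : S) : Prop := DvdAt P c d ∧ DvdAt P d c

def DvdMod (B : Type*) {S : Type*} [CommRing B] [CommRing S] [Algebra B S] (P : Ideal S) (c d : S) : Prop :=
  ∃ f ∉ P, ∃ e, f * d - c * e ∈ fibI B P

def RegMod (B : Type*) {S : Type*} [CommRing B] [CommRing S] [Algebra B S] (P : Ideal S) (x y : S) : Prop :=
  NzMod B P x ∧ ∀ z w, y * z - x * w ∈ fibI B P → ∃ f ∉ P, ∃ v, f * z - x * v ∈ fibI B P

def Good {S : Type*} [CommRing S] {ι : Type*} (η a b : ι → S) (P : Ideal S) : Prop :=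
  ∃ α β, NzAt P α ∧ NzAt P β ∧ ∀ P' : Ideal S, P'.IsPrime → P' ≤ P → ∀ i, η i ∉ P' →
    AssocAt P' (α * b i) (β * a i)

def RGood (B : Type*) {S : Type*} [CommRing B] [CommRing S] [Algebra B S] {ι : Type*} (η a b : ι → S)
    (P : Ideal S) : Prop :=
  ∃ α β, NzMod B P α ∧ NzMod B P β ∧ ∀ P' : Ideal S, P'.IsPrime → P' ≤ P → ∀ i, η i ∉ P' →
    AssocAt P' (α * b i) (β * a i)

/-- `P` and `Q` lie over the same prime of `B`. -/
def Ov (B : Type*) {S : Type*} [CommRing B] [CommRing S] [Algebra B S] (P Q : Ideal S) : Prop :=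
  P.comap (algebraMap B S) = Q.comap (algebraMap B S)

structure AlgData (B S : Type*) [CommRing B] [CommRing S] [Algebra B S] {ι : Type*} (η a b : ι → S)
    (inW : Ideal S → Prop) : Prop where
  bd : BD B
  eft : Algebra.EssFiniteType B S
  tf : ∀ (b : B) (x : S), b ≠ 0 → algebraMap B S b * x = 0 → x = 0
  s1 : ∀ P0 P : Ideal S, P0.IsPrime → P.IsPrime → P0 < P → Ov B P0 P → ∃ x ∈ P, NzMod B P x
  s2 : ∀ P0 P1 P : Ideal S, P0.IsPrime → P1.IsPrime → P.IsPrime → P0 < P1 → P1 < P → Ov B P0 P →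
    ∃ x ∈ P, ∃ y ∈ P, RegMod B P x y
  nza : ∀ i (P : Ideal S), P.IsPrime → η i ∉ P → NzAt P (a i) ∧ NzMod B P (a i)
  nzb : ∀ i (P : Ideal S), P.IsPrime → η i ∉ P → NzAt P (b i) ∧ NzMod B P (b i)
  comp : ∀ i j (P : Ideal S), P.IsPrime → η i ∉ P → η j ∉ P → DvdAt P (a j * b i) (a i * b j)
  cV : ∀ P : Ideal S, P.IsPrime → (∀ i, η i ∈ P) →
    ∃ P0 P1 : Ideal S, P0.IsPrime ∧ P1.IsPrime ∧ P0 < P1 ∧ P1 < P ∧ Ov B P0 P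
  cW : ∀ P : Ideal S, P.IsPrime → inW P → ∃ P0 P1 P2 : Ideal S, P0.IsPrime ∧ P1.IsPrime ∧ P2.IsPrime ∧
    P0 < P1 ∧ P1 < P2 ∧ P2 < P ∧ Ov B P0 P
  fc : ∀ P : Ideal S, P.IsPrime → ∃ α β, NzMod B P α ∧ NzMod B P β ∧
    ∀ P' : Ideal S, P'.IsPrime → P' ≤ P → Ov B P' P → ∀ i, η i ∉ P' →
      DvdMod B P' (α * b i) (β * a i) ∧ DvdMod B P' (β * a i) (α * b i)
  good : ∀ P : Ideal S, P.IsPrime → ¬ inW P → Good η a b P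

section
variable {B S A : Type*} [CommRing B] [CommRing S] [Algebra B S] [CommRing A] [Algebra S A] [Algebra B A]
  [IsScalarTower B S A] (M : Submonoid S) [IsLocalization M A]

lemma tr_comap (Q : Ideal A) : (Q.comap (algebraMap S A)).comap (algebraMap B S) = Q.comap (algebraMap B A) := by
  rw [Ideal.comap_comap, ← IsScalarTower.algebraMap_eq]

lemma tr_fibI (Q : Ideal A) : fibI B Q = (fibI B (Q.comap (algebraMap S A))).map (algebraMap S A) := by
  rw [fibI, fibI, tr_comap, Ideal.map_map, ← IsScalarTower.algebraMap_eq]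

lemma tr_Ov {Q Q' : Ideal A} : Ov B Q Q' ↔ Ov B (Q.comap (algebraMap S A)) (Q'.comap (algebraMap S A)) := by
  rw [Ov, Ov, tr_comap, tr_comap]

include M in
lemma tr_notMem (Q : Ideal A) [hQ : Q.IsPrime] (m : M) : (m : S) ∉ Q.comap (algebraMap S A) := fun h =>
  hQ.ne_top (Ideal.eq_top_of_isUnit_mem _ h (IsLocalization.map_units A m))

include M in
lemma tr_mem_fibI (Q : Ideal A) [hQ : Q.IsPrime] (x : S) : algebraMap S A x ∈ fibI B Q ↔
    ∃ f ∈ M, f * x ∈ fibI B (Q.comap (algebraMap S A)) := by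
  rw [tr_fibI (S := S), IsLocalization.algebraMap_mem_map_algebraMap_iff M]

include M in
lemma tr_surj (x : A) : ∃ m : M, ∃ y, algebraMap S A m * x = algebraMap S A y := by
  obtain ⟨⟨y, s⟩, h⟩ := IsLocalization.surj M x
  exact ⟨s, y, by rw [mul_comm]; exact h⟩

include M in
lemma tr_NzAt {Q : Ideal A} [hQ : Q.IsPrime] {a : S} (h : NzAt (Q.comap (algebraMap S A)) a) :
    NzAt Q (algebraMap S A a) := by
  intro z hz
  obtain ⟨m, y, hy⟩ := tr_surj M z
  have : algebraMap S A (a * y) = 0 := by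
    rw [map_mul, ← hy]; linear_combination (algebraMap S A m) * hz
  obtain ⟨n, hn⟩ := (IsLocalization.map_eq_zero_iff M A _).mp this
  obtain ⟨f, hf, h1⟩ := h (n * y) (by linear_combination hn)
  refine ⟨algebraMap S A (f * n * m), ?_, ?_⟩
  · exact Ideal.IsPrime.mul_notMem inferInstance (Ideal.IsPrime.mul_notMem inferInstance hf
      (tr_notMem M Q n)) (tr_notMem M Q m)
  · rw [map_mul, mul_assoc, hy, ← map_mul, mul_assoc, h1, map_zero]

include M in
lemma tr_NzMod {Q : Ideal A} [hQ : Q.IsPrime] {a : S} (h : NzMod B (Q.comap (algebraMap S A)) a) :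
    NzMod B Q (algebraMap S A a) := by
  intro z hz
  obtain ⟨m, y, hy⟩ := tr_surj M z
  have : algebraMap S A (a * y) ∈ fibI B Q := by
    rw [map_mul, ← hy, mul_left_comm]; exact Ideal.mul_mem_left _ _ hz
  obtain ⟨n, hn, hn'⟩ := (tr_mem_fibI M Q _).mp this
  obtain ⟨f, hf, h1⟩ := h (n * y) (by rwa [mul_left_comm])
  refine ⟨algebraMap S A (f * n * m), ?_, ?_⟩
  · exact Ideal.IsPrime.mul_notMem inferInstance (Ideal.IsPrime.mul_notMem inferInstance hf
      (tr_notMem M Q ⟨n, hn⟩)) (tr_notMem M Q m)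
  · rw [map_mul, mul_assoc, hy, ← map_mul, mul_assoc, tr_fibI (S := S)]
    exact Ideal.mem_map_of_mem _ h1

lemma tr_DvdAt {Q : Ideal A} {c d : S} (h : DvdAt (Q.comap (algebraMap S A)) c d) :
    DvdAt Q (algebraMap S A c) (algebraMap S A d) := by
  obtain ⟨f, hf, h⟩ := h
  exact ⟨algebraMap S A f, hf, by rw [← map_mul]; exact map_dvd _ h⟩

lemma tr_DvdMod {Q : Ideal A} {c d : S} (h : DvdMod B (Q.comap (algebraMap S A)) c d) :
    DvdMod B Q (algebraMap S A c) (algebraMap S A d) := by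
  obtain ⟨f, hf, e, h⟩ := h
  refine ⟨algebraMap S A f, hf, algebraMap S A e, ?_⟩
  rw [← map_mul, ← map_mul, ← map_sub, tr_fibI (S := S)]
  exact Ideal.mem_map_of_mem _ h

include M in
lemma tr_RegMod {Q : Ideal A} [hQ : Q.IsPrime] {x y : S} (h : RegMod B (Q.comap (algebraMap S A)) x y) :
    RegMod B Q (algebraMap S A x) (algebraMap S A y) := by
  refine ⟨tr_NzMod M h.1, fun z w hzw => ?_⟩
  obtain ⟨m, z', hz⟩ := tr_surj M z
  obtain ⟨n, w', hw⟩ := tr_surj M w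
  have : algebraMap S A (y * (n * z') - x * (m * w')) ∈ fibI B Q := by
    have e : algebraMap S A (y * (n * z') - x * (m * w')) =
      algebraMap S A (m * n) * (algebraMap S A y * z - algebraMap S A x * w) := by
      simp only [map_mul, map_sub, ← hz, ← hw]; ring
    rw [e]; exact Ideal.mul_mem_left _ _ hzw
  obtain ⟨k, hk, hk'⟩ := (tr_mem_fibI M Q _).mp this
  obtain ⟨f, hf, v, h1⟩ := h.2 (k * (n * z')) (k * (m * w')) (by convert hk' using 1; ring)
  refine ⟨algebraMap S A (f * k * n * m), ?_, algebraMap S A v, ?_⟩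
  · exact Ideal.IsPrime.mul_notMem inferInstance (Ideal.IsPrime.mul_notMem inferInstance
      (Ideal.IsPrime.mul_notMem inferInstance hf (tr_notMem M Q ⟨k, hk⟩)) (tr_notMem M Q n)) (tr_notMem M Q m)
  · rw [map_mul, mul_assoc, hz, ← map_mul, ← map_mul, ← map_sub, tr_fibI (S := S)]
    refine Ideal.mem_map_of_mem _ ?_
    convert h1 using 1; ring

include M in
/-- going back -/
lemma rt_DvdAt {Q : Ideal A} [hQ : Q.IsPrime] {c d : S} (h : DvdAt Q (algebraMap S A c) (algebraMap S A d)) :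
    DvdAt (Q.comap (algebraMap S A)) c d := by
  obtain ⟨f, hf, e, he⟩ := h
  obtain ⟨m, f', hf'⟩ := tr_surj M f
  obtain ⟨n, e', he'⟩ := tr_surj M e
  have : algebraMap S A (n * f' * d - m * (c * e')) = 0 := by
    simp only [map_mul, map_sub, ← hf', ← he']
    linear_combination (algebraMap S A m * algebraMap S A n) * he
  obtain ⟨k, hk⟩ := (IsLocalization.map_eq_zero_iff M A _).mp this
  refine ⟨k * (n * f'), ?_, k * (m * e'), by linear_combination hk⟩
  refine Ideal.IsPrime.mul_notMem inferInstance (tr_notMem M Q k) (Ideal.IsPrime.mul_notMem inferInstance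
    (tr_notMem M Q n) ?_)
  rw [Ideal.mem_comap, ← hf']
  exact hQ.mul_notMem (tr_notMem M Q m) hf

include M in
lemma rt_NzMod {Q : Ideal A} [hQ : Q.IsPrime] {a : S} (h : NzMod B Q (algebraMap S A a)) :
    NzMod B (Q.comap (algebraMap S A)) a := by
  intro z hz
  obtain ⟨f, hf, h1⟩ := h (algebraMap S A z) (by
    rw [← map_mul, tr_fibI (S := S)]; exact Ideal.mem_map_of_mem _ hz)
  obtain ⟨m, f', hf'⟩ := tr_surj M f
  have : algebraMap S A (f' * z) ∈ fibI B Q := by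
    rw [map_mul, ← hf', mul_assoc]; exact Ideal.mul_mem_left _ _ h1
  obtain ⟨n, hn, hn'⟩ := (tr_mem_fibI M Q _).mp this
  refine ⟨n * f', ?_, by rwa [mul_assoc]⟩
  refine Ideal.IsPrime.mul_notMem inferInstance (tr_notMem M Q ⟨n, hn⟩) ?_
  rw [Ideal.mem_comap, ← hf']
  exact hQ.mul_notMem (tr_notMem M Q m) hf

include M in
lemma rt_lt {P Q : Ideal A} (h : P < Q) : P.comap (algebraMap S A) < Q.comap (algebraMap S A) :=
  comap_lt_loc M h

end

section
variable {B S : Type*} [CommRing B] [CommRing S] [Algebra B S] {ι : Type*} {η a b : ι → S}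
  {inW : Ideal S → Prop}

lemma AlgData.loc (c : AlgData B S η a b inW) {A : Type*} [CommRing A] [Algebra S A] [Algebra B A]
    [IsScalarTower B S A] (P : Ideal S) [hP : P.IsPrime] [IsLocalization.AtPrime A P] :
    AlgData B A (fun i => algebraMap S A (η i)) (fun i => algebraMap S A (a i))
      (fun i => algebraMap S A (b i)) (fun Q => inW (Q.comap (algebraMap S A))) := by
  let M := P.primeCompl
  have hle : ∀ Q : Ideal A, Q.IsPrime → Q.comap (algebraMap S A) ≤ P := by
    intro Q hQ x hx
    by_contra h
    exact tr_notMem M Q ⟨x, h⟩ hx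
  have hd : ∀ Q : Ideal S, Q ≤ P → Disjoint (M : Set S) (Q : Set S) := fun Q h => by
    rw [Set.disjoint_left]; exact fun x hx hh => hx (h hh)
  have hc : ∀ Q : Ideal S, Q.IsPrime → Q ≤ P → (Q.map (algebraMap S A)).comap (algebraMap S A) = Q :=
    fun Q hQ h => IsLocalization.under_map_of_isPrime_disjoint M A hQ (hd Q h)
  have hpr : ∀ Q : Ideal S, Q.IsPrime → Q ≤ P → (Q.map (algebraMap S A)).IsPrime :=
    fun Q hQ h => IsLocalization.isPrime_of_isPrime_disjoint M A _ hQ (hd Q h)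
  have hlt : ∀ Q Q' : Ideal S, Q.IsPrime → Q'.IsPrime → Q < Q' → Q' ≤ P →
      Q.map (algebraMap S A) < Q'.map (algebraMap S A) := by
    intro Q Q' h1 h2 h3 h4
    refine lt_of_le_of_ne (Ideal.map_mono h3.le) fun h => h3.ne ?_
    rw [← hc Q h1 (h3.le.trans h4), h, hc Q' h2 h4]
  have hmc : ∀ Q : Ideal A, (Q.comap (algebraMap S A)).map (algebraMap S A) = Q :=
    fun Q => IsLocalization.map_under M A Q
  refine ⟨c.bd, ?_, ?_, ?_, ?_, ?_, ?_, ?_, ?_, ?_, ?_, ?_⟩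
  · haveI := c.eft
    haveI : Algebra.EssFiniteType S A := Algebra.EssFiniteType.of_isLocalization A M
    exact Algebra.EssFiniteType.comp B S A
  · intro b x hb hx
    rw [IsScalarTower.algebraMap_apply B S A] at hx
    exact (loc_nz (P := P) (algebraMap B S b)).mpr
      (fun z hz => ⟨1, hP.one_notMem, by rw [one_mul]; exact c.tf b z hb hz⟩) x hx
  · intro P0 Q h0 hQ h1 h2
    obtain ⟨x, hx, h⟩ := c.s1 _ _ inferInstance inferInstance (rt_lt M h1) (tr_Ov.mp h2)
    exact ⟨_, hx, tr_NzMod M h⟩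
  · intro P0 P1 Q h0 h1 hQ h01 h12 h2
    obtain ⟨x, hx, y, hy, h⟩ := c.s2 _ _ _ inferInstance inferInstance inferInstance (rt_lt M h01)
      (rt_lt M h12) (tr_Ov.mp h2)
    exact ⟨_, hx, _, hy, tr_RegMod M h⟩
  · intro i Q hQ h
    obtain ⟨h1, h2⟩ := c.nza i (Q.comap (algebraMap S A)) inferInstance h
    exact ⟨tr_NzAt M h1, tr_NzMod M h2⟩
  · intro i Q hQ h
    obtain ⟨h1, h2⟩ := c.nzb i (Q.comap (algebraMap S A)) inferInstance h
    exact ⟨tr_NzAt M h1, tr_NzMod M h2⟩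
  · intro i j Q hQ h h'
    have := tr_DvdAt (c.comp i j _ inferInstance h h')
    rwa [map_mul, map_mul] at this
  · intro Q hQ h
    obtain ⟨P0, P1, h0, h1, h01, h12, ho⟩ := c.cV (Q.comap (algebraMap S A)) inferInstance h
    have l1 := h12.le.trans (hle Q hQ)
    have l0 := h01.le.trans l1
    have h3 := hlt _ _ h1 inferInstance h12 (hle Q hQ)
    rw [hmc] at h3
    exact ⟨_, _, hpr P0 h0 l0, hpr P1 h1 l1, hlt _ _ h0 h1 h01 l1, h3, tr_Ov.mpr (by rwa [hc P0 h0 l0])⟩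
  · intro Q hQ h
    obtain ⟨P0, P1, P2, h0, h1, h2, h01, h12, h23, ho⟩ := c.cW _ inferInstance h
    have l2 := h23.le.trans (hle Q hQ)
    have l1 := h12.le.trans l2
    have l0 := h01.le.trans l1
    have h3 := hlt _ _ h2 inferInstance h23 (hle Q hQ)
    rw [hmc] at h3
    exact ⟨_, _, _, hpr P0 h0 l0, hpr P1 h1 l1, hpr P2 h2 l2, hlt _ _ h0 h1 h01 l1, hlt _ _ h1 h2 h12 l2, h3,
      tr_Ov.mpr (by rwa [hc P0 h0 l0])⟩
  · intro Q hQ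
    obtain ⟨α, β, h1, h2, h3⟩ := c.fc (Q.comap (algebraMap S A)) inferInstance
    refine ⟨_, _, tr_NzMod M h1, tr_NzMod M h2, fun Q' hQ' hle' hO i hi => ?_⟩
    obtain ⟨h4, h5⟩ := h3 (Q'.comap (algebraMap S A)) inferInstance (Ideal.comap_mono hle') (tr_Ov.mp hO) i hi
    have h4 := tr_DvdMod h4
    have h5 := tr_DvdMod h5
    rw [map_mul, map_mul] at h4 h5
    exact ⟨h4, h5⟩
  · intro Q hQ h
    obtain ⟨α, β, h1, h2, h3⟩ := c.good (Q.comap (algebraMap S A)) inferInstance h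
    refine ⟨_, _, tr_NzAt M h1, tr_NzAt M h2, fun Q' hQ' hle' i hi => ?_⟩
    obtain ⟨h4, h5⟩ := h3 (Q'.comap (algebraMap S A)) inferInstance (Ideal.comap_mono hle') i hi
    have h4 := tr_DvdAt h4
    have h5 := tr_DvdAt h5
    rw [map_mul, map_mul] at h4 h5
    exact ⟨h4, h5⟩

lemma RGood.of_loc {A : Type*} [CommRing A] [Algebra S A] [Algebra B A] [IsLocalRing A]
    [IsScalarTower B S A] (P : Ideal S) [hP : P.IsPrime] [IsLocalization.AtPrime A P]
    (h : RGood B (fun i => algebraMap S A (η i)) (fun i => algebraMap S A (a i))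
      (fun i => algebraMap S A (b i)) (maximalIdeal A)) : RGood B η a b P := by
  let M := P.primeCompl
  obtain ⟨α, β, h1, h2, h3⟩ := h
  obtain ⟨m, α', hα⟩ := tr_surj M α
  obtain ⟨n, β', hβ⟩ := tr_surj M β
  have hPc : (maximalIdeal A).comap (algebraMap S A) = P := by
    ext x; rw [Ideal.mem_comap]; exact loc_mem_max x
  have hum := IsLocalization.map_units A m
  have hun := IsLocalization.map_units A n
  have hU : ∀ (u x : A), IsUnit u → NzMod B (maximalIdeal A) x →
      NzMod B (maximalIdeal A) (u * x) := by
    intro u x hu hx z hz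
    rw [mul_assoc] at hz
    exact hx z ((Ideal.unit_mul_mem_iff_mem _ hu).mp hz)
  refine ⟨n * α', m * β', ?_, ?_, ?_⟩
  · have := rt_NzMod M (Q := maximalIdeal A) (a := n * α') (by
      rw [map_mul, ← hα]; exact hU _ _ hun (hU _ _ hum h1))
    rwa [hPc] at this
  · have := rt_NzMod M (Q := maximalIdeal A) (a := m * β') (by
      rw [map_mul, ← hβ]; exact hU _ _ hum (hU _ _ hun h2))
    rwa [hPc] at this
  · intro P' hP' hle i hi
    have hd : Disjoint (M : Set S) (P' : Set S) := by
      rw [Set.disjoint_left]; exact fun x hx hh => hx (hle hh)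
    have hc : (P'.map (algebraMap S A)).comap (algebraMap S A) = P' :=
      IsLocalization.under_map_of_isPrime_disjoint M A hP' hd
    have hpr : (P'.map (algebraMap S A)).IsPrime := IsLocalization.isPrime_of_isPrime_disjoint M A _ hP' hd
    obtain ⟨⟨f, hf, h4⟩, ⟨g, hg, h5⟩⟩ := h3 (P'.map (algebraMap S A)) hpr (IsLocalRing.le_maximalIdeal hpr.ne_top)
      i (by rw [← hc] at hi; exact hi)
    have e1 : algebraMap S A (n * α' * b i) = (algebraMap S A n * algebraMap S A m) * (α * algebraMap S A (b i)) := by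
      rw [map_mul, map_mul, ← hα]; ring
    have e2 : algebraMap S A (m * β' * a i) = (algebraMap S A n * algebraMap S A m) * (β * algebraMap S A (a i)) := by
      rw [map_mul, map_mul, ← hβ]; ring
    rw [← hc]
    refine ⟨rt_DvdAt M ⟨f, hf, ?_⟩, rt_DvdAt M ⟨g, hg, ?_⟩⟩
    · rw [e1, e2, mul_left_comm f]; exact mul_dvd_mul_left _ h4
    · rw [e1, e2, mul_left_comm g]; exact mul_dvd_mul_left _ h5

/-- changing the index -/
lemma AlgData.trans_dvd (c : AlgData B S η a b inW) {P : Ideal S} [hP : P.IsPrime] {i j : ι} (hi : η i ∉ P)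
    (hj : η j ∉ P) {α β : S} (h : AssocAt P (α * b j) (β * a j)) : AssocAt P (α * b i) (β * a i) := by
  have key : ∀ (a b : ι → S) (α β : S), DvdAt P (α * b j) (β * a j) → DvdAt P (a j * b i) (a i * b j) →
      NzAt P (a j) → NzAt P (b j) → NzAt P (b i) → DvdAt P (a i * b j) (a j * b i) →
      DvdAt P (α * b i) (β * a i) := by
    rintro a b α β ⟨f, hf, u, hu⟩ ⟨g, hg, v, hv⟩ _ h2 _ _
    obtain ⟨k, hk, hk'⟩ := h2 (f * g * β * a i - α * b i * u * v) (by
      linear_combination (f * β) * hv + (b i * v) * hu)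
    exact ⟨k * f * g, hP.mul_notMem (hP.mul_notMem hk hf) hg, k * u * v, by linear_combination hk'⟩
  have c1 := c.comp i j P hP hi hj
  have c2 := c.comp j i P hP hj hi
  refine ⟨key a b α β h.1 c1 (c.nza j P hP hj).1 (c.nzb j P hP hj).1 (c.nzb i P hP hi).1 c2,
    key b a β α h.2 ?_ (c.nzb j P hP hj).1 (c.nza j P hP hj).1 (c.nza i P hP hi).1 ?_⟩
  · rwa [mul_comm (b j), mul_comm (b i)]
  · rwa [mul_comm (b j), mul_comm (b i)]

end
end

section

section
variable {A : Type*} [CommRing A]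

lemma pow_of_primes (J : Ideal A) (η : A) (h : ∀ Q : Ideal A, Q.IsPrime → η ∉ Q → ∃ f ∉ Q, f ∈ J) :
    ∃ N, η ^ N ∈ J := by
  by_contra hcon
  have : η ∉ J.radical := fun h => hcon h
  rw [Ideal.radical_eq_sInf, Ideal.mem_sInf] at this
  push Not at this
  obtain ⟨Q, ⟨h1, h2⟩, h3⟩ := this
  obtain ⟨f, hf, hf'⟩ := h Q h2 h3
  exact hf (h1 hf')

lemma exists_reg2 [IsNoetherianRing A] (s : S2R A) (I : Ideal A)
    (hI : ∀ Q : Ideal A, Q.IsPrime → I ≤ Q → ∃ P0 P1 : Ideal A, P0.IsPrime ∧ P1.IsPrime ∧ P0 < P1 ∧ P1 < Q) :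
    ∃ x ∈ I, ∃ y ∈ I, Reg2 A x y := by
  obtain ⟨x, hxI, hx⟩ := exists_nzm (0 : A) I (by
    intro c hc
    by_contra hc0
    rw [zero_dvd_iff] at hc0
    obtain ⟨Q, hQ, hle⟩ := exists_le_isAssociatedPrime_of_isNoetherianRing A c hc0
    obtain ⟨hp, z, hz⟩ := (isAssociatedPrime_iff).mp hQ
    obtain ⟨P0, P1, h0, h1, h01, h12⟩ := hI Q hp (fun j hj => hle (by
      rw [Submodule.mem_colon_singleton]
      have := zero_dvd_iff.mp (hc j hj)
      simpa using this))
    refine s.ass (P0 := P0) (P := Q) (z := z) (fun a => ?_) (h01.trans h12)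
    rw [hz, Submodule.mem_colon_singleton]; simp)
  have hxn : ∀ z, x * z = 0 → z = 0 := fun z hz => zero_dvd_iff.mp (hx z (by rw [hz]))
  obtain ⟨y, hyI, hy⟩ := exists_nzm x I (by
    intro c hc
    by_contra hc0
    have hmk : ∀ d : A, Ideal.Quotient.mk (Ideal.span {x}) d = 0 ↔ x ∣ d := fun d => by
      rw [Ideal.Quotient.eq_zero_iff_mem, Ideal.mem_span_singleton]
    obtain ⟨Q, hQ, hle⟩ := exists_le_isAssociatedPrime_of_isNoetherianRing A
      (Ideal.Quotient.mk (Ideal.span {x}) c) (fun h => hc0 ((hmk c).mp h))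
    obtain ⟨hp, z, hz⟩ := (isAssociatedPrime_iff).mp hQ
    obtain ⟨z, rfl⟩ := Ideal.Quotient.mk_surjective z
    have hsm : ∀ a d : A, a • Ideal.Quotient.mk (Ideal.span {x}) d = Ideal.Quotient.mk _ (a * d) := fun a d => rfl
    obtain ⟨P0, P1, h0, h1, h01, h12⟩ := hI Q hp (fun j hj => hle (by
      rw [Submodule.mem_colon_singleton, hsm]
      exact (hmk _).mpr (hc j hj)))
    refine s.ass2 (P0 := P0) (P1 := P1) (P := Q) (g := x) (z := z) hxn (fun a => ?_) h01 h12
    rw [hz, Submodule.mem_colon_singleton, hsm]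
    exact hmk _)
  exact ⟨x, hxI, y, hyI, hxn, fun z w hzw => hy z ⟨w, hzw⟩⟩

lemma reg2_of_reg2m [IsNoetherianRing A] [IsLocalRing A] {t g h : A}
    (tm : t ∈ maximalIdeal A) (tnz : ∀ z, t * z = 0 → z = 0) (H : Reg2m t g h) : Reg2 A g h := by
  refine ⟨nzd_of_NZm tm tnz H.1, fun z w hzw => ?_⟩
  let N : Ideal A := (Ideal.span {g}).colon {h}
  have hN : ∀ z, z ∈ N ↔ ∃ w, h * z = g * w := fun z => by
    rw [Submodule.mem_colon_singleton, smul_eq_mul, Ideal.mem_span_singleton, mul_comm]; rfl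
  have : N ≤ Ideal.span {g} := by
    refine Submodule.le_of_le_smul_of_le_jacobson_bot (I := maximalIdeal A)
      (IsNoetherian.noetherian N) (IsLocalRing.maximalIdeal_le_jacobson _) ?_
    intro z hz
    obtain ⟨w, hw⟩ := (hN z).mp hz
    obtain ⟨v, z1, hv⟩ := H.2 z w ⟨0, by rw [hw]; ring⟩
    obtain ⟨w1, hw1⟩ := H.1 (w - h * v) ⟨h * z1, by linear_combination (-1 : A) * hw + h * hv⟩
    have hz1 : z1 ∈ N := (hN z1).mpr ⟨w1, by
      have := tnz (h * z1 - g * w1) (by linear_combination hw - h * hv + g * hw1)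
      linear_combination this⟩
    refine Submodule.mem_sup.mpr ⟨g * v, Ideal.mul_mem_right _ _ (Ideal.mem_span_singleton_self g), t * z1, ?_, ?_⟩
    · exact Submodule.smul_mem_smul tm hz1
    · linear_combination (-1 : A) * hv
  obtain ⟨v, hv⟩ := Ideal.mem_span_singleton.mp (this ((hN z).mpr ⟨w, hzw⟩))
  exact ⟨v, hv⟩

end
end

section

lemma exists_finite_idx {A : Type*} [CommRing A] [IsNoetherianRing A] {ι : Type*} (η : ι → A) :
    ∃ F : Set ι, F.Finite ∧ Ideal.span (Set.range η) = Ideal.span (Set.range fun i : F => η i) := by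
  have h : (Ideal.span (Set.range η)).FG := IsNoetherian.noetherian _
  obtain ⟨s, hs, hs2⟩ := Submodule.fg_span_iff_fg_span_finset_subset _ |>.mp h
  choose g hg using fun x : (s : Set A) => hs x.2
  refine ⟨Set.range g, Set.finite_range g, le_antisymm ?_ ?_⟩
  · have h3 : Ideal.span (Set.range η) = Ideal.span (s : Set A) := hs2
    rw [h3, Ideal.span_le]
    intro x hx
    refine Ideal.subset_span ⟨⟨g ⟨x, hx⟩, _, rfl⟩, hg ⟨x, hx⟩⟩
  · refine Ideal.span_mono ?_
    rintro _ ⟨i, rfl⟩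
    exact ⟨i, rfl⟩

variable {B A : Type u} [CommRing B] [CommRing A] [Algebra B A] [IsLocalRing A] {ι : Type*} {η a b : ι → A}
  {inW : Ideal A → Prop}

open IsLocalRing in
lemma local_good (c : AlgData B A η a b inW) [IsNoetherianRing A] (hW : inW (maximalIdeal A))
    (hp : (maximalIdeal A).comap (algebraMap B A) ≠ ⊥)
    (ih : ∀ P : Ideal A, P.IsPrime → P ≠ maximalIdeal A → Good η a b P) :
    RGood B η a b (maximalIdeal A) := by
  have hdom := c.bd.dom
  haveI := c.eft
  let p := (maximalIdeal A).comap (algebraMap B A)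
  obtain ⟨t, htm, ht⟩ := c.bd.unif p inferInstance hp
  have ht0 : t ≠ 0 := by
    rintro rfl
    obtain ⟨b, hb, hb0⟩ := Submodule.exists_mem_ne_zero_of_ne_bot hp
    obtain ⟨h, h1, h2⟩ := ht b hb
    rcases mul_eq_zero.mp (zero_dvd_iff.mp h2) with h | h
    · rw [h] at h1; exact h1 (Ideal.zero_mem _)
    · exact hb0 h
  set τ := algebraMap B A t with hτ
  have tm : τ ∈ maximalIdeal A := htm
  have tnz : ∀ z, τ * z = 0 → z = 0 := fun z hz => c.tf t z ht0 hz
  have hun : ∀ h : B, h ∉ p → IsUnit (algebraMap B A h) := fun h hh => by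
    by_contra hcon; exact hh ((mem_maximalIdeal _).mpr hcon)
  have hfib : ∀ Q : Ideal A, Ov B Q (maximalIdeal A) → ∀ x, x ∈ fibI B Q ↔ τ ∣ x := by
    intro Q hQ x
    rw [fibI_congr hQ]
    constructor
    · intro h
      obtain ⟨h, h1, h2⟩ := unif_mem ht h
      exact (IsUnit.dvd_mul_left (hun h h1)).mp h2
    · intro h
      exact Ideal.mem_of_dvd _ h (Ideal.mem_map_of_mem _ htm)
  have hOv : ∀ Q : Ideal A, Q.IsPrime → τ ∈ Q → Ov B Q (maximalIdeal A) := by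
    intro Q hQ hτQ
    refine le_antisymm (Ideal.comap_mono (le_maximalIdeal hQ.ne_top)) fun b hb => ?_
    obtain ⟨h, h1, h2⟩ := ht b hb
    have : algebraMap B A (h * b) ∈ Q := Ideal.mem_of_dvd _ (map_dvd _ h2) hτQ
    rw [map_mul] at this
    exact (Ideal.unit_mul_mem_iff_mem _ (hun h h1)).mp this
  have hOvτ : ∀ Q : Ideal A, Ov B Q (maximalIdeal A) → τ ∈ Q := by
    intro Q hQ
    have : t ∈ Q.comap (algebraMap B A) := by rw [hQ]; exact htm
    exact this
  -- the fibre ring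
  let Ā := A ⧸ Ideal.span {τ}
  let π : A →+* Ā := Ideal.Quotient.mk _
  have hπ : Function.Surjective π := Ideal.Quotient.mk_surjective
  have hmk : ∀ d : A, π d = 0 ↔ τ ∣ d := fun d => by
    rw [Ideal.Quotient.eq_zero_iff_mem, Ideal.mem_span_singleton]
  haveI : Nontrivial Ā := Ideal.Quotient.nontrivial_iff.mpr (by
    rw [Ne, Ideal.span_singleton_eq_top]; exact (mem_maximalIdeal _).mp tm)
  haveI : IsLocalRing Ā := IsLocalRing.of_surjective' π hπ
  haveI : IsLocalHom π := IsLocalHom.of_surjective π hπ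
  let κ := p.ResidueField
  letI algκ : Algebra κ Ā := (Ideal.ResidueField.lift p (algebraMap B Ā) (by
      intro b hb
      rw [RingHom.mem_ker]
      obtain ⟨h, h1, h2⟩ := ht b hb
      have : τ ∣ algebraMap B A b := by
        have := map_dvd (algebraMap B A) h2
        rw [map_mul] at this
        exact (IsUnit.dvd_mul_left (hun h h1)).mp this
      exact (hmk _).mpr this) (by
      intro h hh
      exact (hun h hh).map π)).toAlgebra
  haveI : IsScalarTower B κ Ā := IsScalarTower.of_algebraMap_eq fun x => by
    exact (Ideal.ResidueField.lift_algebraMap _ _ _ _ x).symm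
  haveI : Algebra.EssFiniteType κ Ā := Algebra.EssFiniteType.of_comp B κ Ā
  have hmc : ∀ Q : Ideal Ā, (maximalIdeal Ā).comap π = maximalIdeal A := fun _ => by
    ext x
    rw [Ideal.mem_comap, mem_maximalIdeal, mem_maximalIdeal, mem_nonunits_iff, mem_nonunits_iff, isUnit_map_iff]
  have hcτ : ∀ Q : Ideal Ā, τ ∈ Q.comap π := fun Q => by
    rw [Ideal.mem_comap, (hmk τ).mpr dvd_rfl]; exact Q.zero_mem
  have hcl : ∀ {Q Q' : Ideal Ā}, Q < Q' → Q.comap π < Q'.comap π := fun h =>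
    lt_of_le_of_ne (Ideal.comap_mono h.le) fun h2 => h.ne (Ideal.comap_injective_of_surjective _ hπ h2)
  have hmap : ∀ Q : Ideal A, Q.IsPrime → τ ∈ Q → (Q.map π).IsPrime ∧ (Q.map π).comap π = Q := by
    intro Q hQ haQ
    have hk : RingHom.ker π ≤ Q := by
      rw [Ideal.mk_ker, Ideal.span_singleton_le_iff_mem]; exact haQ
    exact ⟨Ideal.map_isPrime_of_surjective hπ hk, by
      rw [Ideal.comap_map_of_surjective' _ hπ, sup_eq_left]; exact hk⟩
  have hmlt : ∀ Q Q' : Ideal A, Q.IsPrime → Q'.IsPrime → τ ∈ Q → Q < Q' → Q.map π < Q'.map π := by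
    intro Q Q' h1 h2 h3 h4
    refine lt_of_le_of_ne (Ideal.map_mono h4.le) fun h => h4.ne ?_
    rw [← (hmap Q h1 h3).2, h, (hmap Q' h2 (h4.le h3)).2]
  have nzbar : ∀ (Q : Ideal Ā) [Q.IsPrime] (x : A), NzMod B (Q.comap π) x →
      ∀ z, π x * z = 0 → ∃ f ∉ Q, f * z = 0 := by
    intro Q hQ x hx z hz
    obtain ⟨z, rfl⟩ := hπ z
    rw [← map_mul, hmk, ← hfib _ (hOv _ inferInstance (hcτ Q))] at hz
    obtain ⟨f, hf, h⟩ := hx z hz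
    rw [hfib _ (hOv _ inferInstance (hcτ Q)), ← hmk, map_mul] at h
    exact ⟨_, hf, h⟩
  have hS2 : S2R Ā := by
    refine ⟨?_, ?_⟩
    · intro P0 P h0 hP hlt
      obtain ⟨x, hx, h⟩ := c.s1 (P0.comap π) (P.comap π) inferInstance inferInstance (hcl hlt)
        ((hOv _ inferInstance (hcτ _)).trans (hOv _ inferInstance (hcτ _)).symm)
      exact ⟨π x, hx, nzbar P x h⟩
    · intro P0 P1 P h0 h1 hP h01 h12
      obtain ⟨x, hx, y, hy, h⟩ := c.s2 (P0.comap π) (P1.comap π) (P.comap π) inferInstance inferInstance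
        inferInstance (hcl h01) (hcl h12)
        ((hOv _ inferInstance (hcτ _)).trans (hOv _ inferInstance (hcτ _)).symm)
      refine ⟨π x, hx, π y, hy, nzbar P x h.1, ?_⟩
      intro z w hzw
      obtain ⟨z, rfl⟩ := hπ z
      obtain ⟨w, rfl⟩ := hπ w
      have hzw : τ ∣ y * z - x * w := by rw [← hmk, map_sub, map_mul, map_mul, hzw, sub_self]
      rw [← hfib _ (hOv _ inferInstance (hcτ P))] at hzw
      obtain ⟨f, hf, v, hv⟩ := h.2 z w hzw
      rw [hfib _ (hOv _ inferInstance (hcτ P)), ← hmk, map_sub, map_mul, map_mul, sub_eq_zero] at hv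
      exact ⟨π f, hf, π v, hv⟩
  have regbar : ∀ x y : A, Reg2 Ā (π x) (π y) → Reg2m τ x y := by
    intro x y h
    refine ⟨fun z hz => ?_, fun z w hzw => ?_⟩
    · rw [← hmk, map_mul] at hz
      exact (hmk _).mp (h.1 _ hz)
    · rw [← hmk, map_sub, map_mul, map_mul, sub_eq_zero] at hzw
      obtain ⟨v, hv⟩ := h.2 _ _ hzw
      obtain ⟨v, rfl⟩ := hπ v
      exact ⟨v, by rw [← hmk, map_sub, map_mul, hv, sub_self]⟩
  -- g, h
  have hmaxc : (maximalIdeal Ā).comap π = maximalIdeal A := hmc ⊥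
  have hmaxm : (maximalIdeal A).map π = maximalIdeal Ā := by
    rw [← hmaxc, Ideal.map_comap_of_surjective _ hπ]
  obtain ⟨g, hg, h, hh, r1, r2, r3⟩ : ∃ g ∈ maximalIdeal A, ∃ h ∈ maximalIdeal A, Reg2 Ā (π g) (π h) ∧
      Reg2 Ā (π h) (π g) ∧ ∀ (k : ℕ) (b : Ā) (K : ℕ),
      (∀ a ∈ maximalIdeal Ā ^ K, ∃ c1 c2, a * b = c1 * π h ^ k + c2 * π g ^ k) →
      (∃ c1 c2, π g * b = c1 * π h ^ k + c2 * π g ^ k) ∧ ∃ c1 c2, π h * b = c1 * π h ^ k + c2 * π g ^ k := by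
    obtain ⟨P0, P1, P2, h0, h1, h2, h01, h12, h23, ho⟩ := c.cW _ inferInstance hW
    have t0 := hOvτ P0 ho
    have t1 := h01.le t0
    have t2 := h12.le t1
    haveI := (hmap P0 h0 t0).1
    haveI := (hmap P1 h1 t1).1
    haveI := (hmap P2 h2 t2).1
    have h3 := hmlt P2 _ h2 inferInstance t2 h23
    rw [hmaxm] at h3
    obtain ⟨g, hg, h, hh, r⟩ := fibre_main κ Ā hS2 (hmlt P0 P1 h0 h1 t0 h01) (hmlt P1 P2 h1 h2 t1 h12) h3
    obtain ⟨g, rfl⟩ := hπ g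
    obtain ⟨h, rfl⟩ := hπ h
    refine ⟨g, ?_, h, ?_, r⟩
    · rw [← hmaxc]; exact hg
    · rw [← hmaxc]; exact hh
  -- finite subcover
  obtain ⟨F, hF, hspan⟩ := exists_finite_idx η
  have hFc : ∀ (Q : Ideal A) i, η i ∉ Q → ∃ j : F, η j ∉ Q := by
    intro Q i hi
    by_contra hcon
    push Not at hcon
    apply hi
    have : Ideal.span (Set.range η) ≤ Q := by
      rw [hspan, Ideal.span_le]; rintro _ ⟨j, rfl⟩; exact hcon j
    exact this (Ideal.subset_span ⟨i, rfl⟩)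
  haveI : Finite F := hF
  obtain ⟨x, hx, y, hy, rxy⟩ : ∃ x ∈ Ideal.span (Set.range fun i : F => η i),
      ∃ y ∈ Ideal.span (Set.range fun i : F => η i), Reg2 Ā (π x) (π y) := by
    rw [← hspan]
    obtain ⟨x, hx, y, hy, r⟩ := exists_reg2 hS2 ((Ideal.span (Set.range η)).map π) (by
      intro Q hQ hle
      obtain ⟨P0, P1, h0, h1, h01, h12, ho⟩ := c.cV (Q.comap π) inferInstance (fun i =>
        hle (Ideal.mem_map_of_mem _ (Ideal.subset_span ⟨i, rfl⟩)))
      have t0 := hOvτ P0 (ho.trans (hOv _ inferInstance (hcτ Q)))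
      have h3 := hmlt P1 _ h1 inferInstance (h01.le t0) h12
      rw [Ideal.map_comap_of_surjective _ hπ] at h3
      exact ⟨_, _, (hmap P0 h0 t0).1, (hmap P1 h1 (h01.le t0)).1, hmlt P0 P1 h0 h1 t0 h01, h3⟩)
    obtain ⟨x', hx', rfl⟩ := (Ideal.mem_map_iff_of_surjective _ hπ).mp hx
    obtain ⟨y', hy', rfl⟩ := (Ideal.mem_map_iff_of_surjective _ hπ).mp hy
    exact ⟨x', hx', y', hy', r⟩
  obtain ⟨a0, b0, na0, nb0, hfc⟩ := c.fc (maximalIdeal A) inferInstance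
  have hOm : Ov B (maximalIdeal A) (maximalIdeal A) := rfl
  have nzm : ∀ x, NZm τ x ↔ NzMod B (maximalIdeal A) x := by
    intro x
    constructor
    · intro h z hz
      rw [hfib _ hOm] at hz
      exact ⟨1, Ideal.IsPrime.one_notMem inferInstance, by rw [hfib _ hOm, one_mul]; exact h z hz⟩
    · intro h z hz
      rw [← hfib _ hOm] at hz
      obtain ⟨f, hf, h'⟩ := h z hz
      rw [hfib _ hOm] at h'
      exact (IsUnit.dvd_mul_left (by by_contra hcon; exact hf ((mem_maximalIdeal _).mpr hcon))).mp h'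
  have nz1 : ∀ (i : ι) (w : A), (∀ P : Ideal A, P.IsPrime → η i ∉ P → NzAt P w ∧ NzMod B P w) →
      (∀ z, τ ∣ w * z → ∃ N, τ ∣ η i ^ N * z) ∧ (∀ z, w * z = 0 → ∃ N, η i ^ N * z = 0) := by
    intro i w hw
    refine ⟨fun z hz => ?_, fun z hz => ?_⟩
    · obtain ⟨N, hN⟩ := pow_of_primes ((Ideal.span {τ}).colon {z}) (η i) (fun Q hQ hi => by
        by_cases hτQ : τ ∈ Q
        · obtain ⟨f, hf, h'⟩ := (hw Q hQ hi).2 z ((hfib Q (hOv Q hQ hτQ) _).mpr hz)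
          exact ⟨f, hf, by
            rw [Submodule.mem_colon_singleton, smul_eq_mul, Ideal.mem_span_singleton]
            exact (hfib Q (hOv Q hQ hτQ) _).mp h'⟩
        · exact ⟨τ, hτQ, by
            rw [Submodule.mem_colon_singleton, smul_eq_mul, Ideal.mem_span_singleton]
            exact dvd_mul_right _ _⟩)
      rw [Submodule.mem_colon_singleton, smul_eq_mul, Ideal.mem_span_singleton] at hN
      exact ⟨N, hN⟩
    · obtain ⟨N, hN⟩ := pow_of_primes ((⊥ : Ideal A).colon {z}) (η i) (fun Q hQ hi => by
        obtain ⟨f, hf, h'⟩ := (hw Q hQ hi).1 z hz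
        exact ⟨f, hf, by rw [Submodule.mem_colon_singleton]; exact h'⟩)
      rw [Submodule.mem_colon_singleton] at hN
      exact ⟨N, hN⟩
  have hcol : ∀ c d : A, ∀ f, f ∈ (Ideal.span {c}).colon {d} ↔ c ∣ f * d := fun c d f => by
    rw [Submodule.mem_colon_singleton, smul_eq_mul, Ideal.mem_span_singleton]
  have hcol2 : ∀ c d : A, ∀ f, f ∈ (Ideal.span {τ, c}).colon {d} ↔ ∃ e, τ ∣ f * d - c * e := fun c d f => by
    rw [Submodule.mem_colon_singleton, smul_eq_mul, Ideal.mem_span_pair]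
    constructor
    · rintro ⟨u, v, huv⟩
      exact ⟨v, u, by rw [← huv]; ring⟩
    · rintro ⟨e, u, hu⟩
      exact ⟨u, e, by linear_combination (-1 : A) * hu⟩
  have hff : ∀ (i : ι) (u v : A), (∀ P' : Ideal A, P'.IsPrime → Ov B P' (maximalIdeal A) → η i ∉ P' →
      DvdMod B P' u v) → ∃ N e, τ ∣ η i ^ N * v - u * e := by
    intro i u v huv
    obtain ⟨N, hN⟩ := pow_of_primes ((Ideal.span {τ, u}).colon {v}) (η i) (fun Q hQ hi => by
      by_cases hτQ : τ ∈ Q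
      · obtain ⟨f, hf, e, h'⟩ := huv Q hQ (hOv Q hQ hτQ) hi
        exact ⟨f, hf, (hcol2 _ _ _).mpr ⟨e, (hfib Q (hOv Q hQ hτQ) _).mp h'⟩⟩
      · exact ⟨τ, hτQ, (hcol2 _ _ _).mpr ⟨0, by simp⟩⟩)
    exact ⟨N, (hcol2 _ _ _).mp hN⟩
  have hC : CData A τ g h x y a0 b0 (fun i : F => η i) (fun i : F => a i) (fun i : F => b i) := by
    refine ⟨tm, tnz, fun i => (nz1 i _ (c.nza i)).1, fun i => (nz1 i _ (c.nzb i)).1,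
      fun i => (nz1 i _ (c.nza i)).2, fun i => (nz1 i _ (c.nzb i)).2, ?_, hx, hy,
      reg2_of_reg2m tm tnz (regbar _ _ rxy), regbar _ _ rxy, hg, hh, reg2_of_reg2m tm tnz (regbar _ _ r1),
      regbar _ _ r1, regbar _ _ r2, (nzm _).mpr na0, (nzm _).mpr nb0, ?_, ?_, ?_, ?_⟩
    · intro i j
      obtain ⟨N, hN⟩ := pow_of_primes ((Ideal.span {a j * b i}).colon {a i * b j}) (η i * η j) (fun Q hQ hi => by
        obtain ⟨f, hf, h'⟩ := c.comp i j Q hQ (fun h => hi (Ideal.mul_mem_right _ _ h))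
          (fun h => hi (Ideal.mul_mem_left _ _ h))
        exact ⟨f, hf, (hcol _ _ _).mpr h'⟩)
      exact ⟨N, (hcol _ _ _).mp hN⟩
    · intro i
      exact hff i _ _ fun P' h1 h2 h3 => (hfc P' h1 (le_maximalIdeal h1.ne_top) h2 i h3).2
    · intro i
      exact hff i _ _ fun P' h1 h2 h3 => (hfc P' h1 (le_maximalIdeal h1.ne_top) h2 i h3).1
    · intro P hP hPm
      obtain ⟨aP, bP, n1, n2, H⟩ := ih P hP hPm
      refine ⟨aP, bP, n1, n2, fun i => ?_⟩
      have key : ∀ u v : A, (∀ P' : Ideal A, P'.IsPrime → P' ≤ P → η i ∉ P' → DvdAt P' u v) →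
          ∃ N, ∃ f ∉ P, u ∣ f * η i ^ N * v := by
        intro u v huv
        by_contra hcon
        obtain ⟨Q, hQ, hIQ, hQP, hQη⟩ := exists_prime_avoid P ((Ideal.span {u}).colon {v})
          (Submonoid.powers (η i)) (by
            rintro _ ⟨N, rfl⟩ f hf hmem
            refine hcon ⟨N, f, hf, ?_⟩
            rw [hcol] at hmem
            rwa [mul_comm f])
        obtain ⟨f, hf, h'⟩ := huv Q hQ hQP (hQη _ (Submonoid.mem_powers _))
        exact hf (hIQ ((hcol _ _ _).mpr h'))
      obtain ⟨N1, f1, hf1, e1⟩ := key (bP * a i) (aP * b i) (fun P' h1 h2 h3 => (H P' h1 h2 i h3).2)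
      obtain ⟨N2, f2, hf2, e2⟩ := key (aP * b i) (bP * a i) (fun P' h1 h2 h3 => (H P' h1 h2 i h3).1)
      refine ⟨N1 + N2, f1 * f2, hP.mul_notMem hf1 hf2, ?_, ?_⟩
      · refine (e1.mul_left (f2 * η i ^ N2)).trans (dvd_of_eq ?_); ring
      · refine (e2.mul_left (f1 * η i ^ N1)).trans (dvd_of_eq ?_); ring
    · intro k b K hK
      have tr : ∀ u : A, (∃ c1 c2, π u * π b = c1 * π h ^ k + c2 * π g ^ k) →
          ∃ c1 c2, τ ∣ u * b - (c1 * h ^ k + c2 * g ^ k) := by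
        rintro u ⟨c1, c2, e⟩
        obtain ⟨c1, rfl⟩ := hπ c1
        obtain ⟨c2, rfl⟩ := hπ c2
        refine ⟨c1, c2, ?_⟩
        rw [← hmk]
        simp only [map_sub, map_mul, map_add, map_pow]
        rw [e, sub_self]
      obtain ⟨q1, q2⟩ := r3 k (π b) K (by
        intro a' ha'
        rw [← hmaxm, ← Ideal.map_pow] at ha'
        obtain ⟨a2, ha2, rfl⟩ := (Ideal.mem_map_iff_of_surjective _ hπ).mp ha'
        obtain ⟨c1, c2, e⟩ := hK a2 ha2
        refine ⟨π c1, π c2, ?_⟩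
        rw [← hmk] at e
        simp only [map_sub, map_mul, map_add, map_pow] at e
        exact sub_eq_zero.mp e)
      exact ⟨tr g q1, tr h q2⟩
  obtain ⟨α, β, nα, nβ, H⟩ := hC.main
  refine ⟨α, β, (nzm _).mp nα, (nzm _).mp nβ, fun P' hP' _ i hi => ?_⟩
  obtain ⟨j, hj⟩ := hFc P' i hi
  refine c.trans_dvd hi hj ?_
  obtain ⟨N, h1, h2⟩ := H j
  have hN : η j ^ N ∉ P' := fun h => hj (hP'.mem_of_pow_mem _ h)
  exact ⟨⟨_, hN, h2⟩, ⟨_, hN, h1⟩⟩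

end

section

section
variable {B S : Type*} [CommRing B] [CommRing S] [Algebra B S]

lemma fibI_bot {P : Ideal S} (h : P.comap (algebraMap B S) = ⊥) : fibI B P = ⊥ := by
  rw [fibI, h, Ideal.map_bot]

lemma unif_ne_zero {p : Ideal B} [p.IsPrime] [IsDomain B] (hp : p ≠ ⊥) {t : B}
    (ht : ∀ b ∈ p, ∃ h ∉ p, t ∣ h * b) : t ≠ 0 := by
  rintro rfl
  obtain ⟨b, hb, hb0⟩ := Submodule.exists_mem_ne_zero_of_ne_bot hp
  obtain ⟨h, h1, h2⟩ := ht b hb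
  rcases mul_eq_zero.mp (zero_dvd_iff.mp h2) with h | h
  · rw [h] at h1; exact h1 (Ideal.zero_mem _)
  · exact hb0 h

lemma NzMod.nzAt (hB : BD B) [Algebra.EssFiniteType B S]
    (tf : ∀ (b : B) (x : S), b ≠ 0 → algebraMap B S b * x = 0 → x = 0) {P : Ideal S} [hP : P.IsPrime]
    {a : S} (ha : NzMod B P a) : NzAt P a := by
  have := hB.dom
  by_cases hp : P.comap (algebraMap B S) = ⊥
  · intro z hz
    have := ha z (by rw [hz]; exact Ideal.zero_mem _)
    simpa only [fibI_bot hp, Ideal.mem_bot] using this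
  obtain ⟨t, htm, ht⟩ := hB.unif _ inferInstance hp
  have ht0 := unif_ne_zero hp ht
  let A := Localization.AtPrime P
  haveI : IsNoetherianRing A := noeth_loc hB P
  rw [← loc_nz (A := A)]
  refine nzd_of_NZm (t := algebraMap S A (algebraMap B S t)) ((loc_mem_max (P := P) _).mpr htm) ?_
    ((NZm_iff htm ht a).mpr ha)
  exact (loc_nz (P := P) _).mpr fun z hz => ⟨1, hP.one_notMem, by rw [one_mul]; exact tf t z ht0 hz⟩
end

variable {B S : Type u} [CommRing B] [CommRing S] [Algebra B S] {ι : Type*} {η a b : ι → S}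
  {inW : Ideal S → Prop}

theorem AlgData.rgood (c : AlgData B S η a b inW) (P : Ideal S) [hP : P.IsPrime] (hW : inW P) :
    RGood B η a b P := by
  haveI := c.eft
  have hfin : ∀ P : Ideal S, P.IsPrime → P.FiniteHeight := by
    intro P hP
    let A := Localization.AtPrime P
    haveI : IsNoetherianRing A := noeth_loc c.bd P
    refine ⟨Or.inr ?_⟩
    have h := IsLocalization.height_under P.primeCompl (maximalIdeal A)
    rw [Localization.AtPrime.under_maximalIdeal] at h
    rw [h]
    exact Ideal.height_ne_top_of_isPrime
  suffices H : ∀ n : ℕ∞, ∀ P : Ideal S, P.IsPrime → inW P → P.height = n → RGood B η a b P from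
    H _ P hP hW rfl
  intro n
  induction n using WellFoundedLT.induction with
  | ind n IH =>
  intro P hP hW hn
  by_cases hp : P.comap (algebraMap B S) = ⊥
  · obtain ⟨α, β, h1, h2, h3⟩ := c.fc P hP
    refine ⟨α, β, h1, h2, fun P' hP' hle i hi => ?_⟩
    have hp' : P'.comap (algebraMap B S) = ⊥ := eq_bot_iff.mpr ((Ideal.comap_mono hle).trans hp.le)
    obtain ⟨h4, h5⟩ := h3 P' hP' hle (hp'.trans hp.symm) i hi
    have key : ∀ c d : S, DvdMod B P' c d → DvdAt P' c d := by
      rintro c d ⟨f, hf, e, he⟩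
      rw [fibI_bot hp', Ideal.mem_bot] at he
      exact ⟨f, hf, e, sub_eq_zero.mp he⟩
    exact ⟨key _ _ h4, key _ _ h5⟩
  let A := Localization.AtPrime P
  haveI : IsNoetherianRing A := noeth_loc c.bd P
  have hmc : (maximalIdeal A).comap (algebraMap S A) = P := Localization.AtPrime.under_maximalIdeal
  have cA := c.loc (A := A) P
  refine RGood.of_loc (A := A) P (local_good cA (by rwa [hmc]) ?_ ?_)
  · rwa [← tr_comap (S := S), hmc]
  intro Q hQ hne
  by_cases hW' : inW (Q.comap (algebraMap S A))
  swap
  · exact cA.good Q hQ hW'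
  have hlt : Q < maximalIdeal A := lt_of_le_of_ne (IsLocalRing.le_maximalIdeal hQ.ne_top) hne
  have hlt' := rt_lt P.primeCompl hlt
  rw [hmc] at hlt'
  haveI := hfin P hP
  obtain ⟨α, β, h1, h2, h3⟩ := IH _ (by
    rw [← hn]; exact Ideal.height_strict_mono_of_isPrime_of_isPrime hlt') (Q.comap (algebraMap S A)) inferInstance hW' rfl
  refine ⟨algebraMap S A α, algebraMap S A β, tr_NzAt P.primeCompl (h1.nzAt c.bd c.tf),
    tr_NzAt P.primeCompl (h2.nzAt c.bd c.tf), fun P' hP' hle i hi => ?_⟩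
  obtain ⟨h4, h5⟩ := h3 (P'.comap (algebraMap S A)) inferInstance (Ideal.comap_mono hle) i hi
  rw [← map_mul, ← map_mul]
  exact ⟨tr_DvdAt h4, tr_DvdAt h5⟩

end

section

lemma ass_prime {S : Type*} [CommRing S] (Q : Ideal S) [hQ : Q.IsPrime] [IsNoetherianRing (Localization.AtPrime Q)]
    {c d : S} (h : ¬ DvdAt Q c d) : ∃ Q0 : Ideal S, Q0.IsPrime ∧ Q0 ≤ Q ∧ ∃ z,
      (∀ x, DvdAt Q c (x * z) ↔ x ∈ Q0) ∧ ∀ x, DvdAt Q c (x * d) → x ∈ Q0 := by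
  let A := Localization.AtPrime Q
  let φ := algebraMap S A
  have h0 : (Submodule.Quotient.mk (φ d) : A ⧸ Ideal.span {φ c}) ≠ 0 := by
    rw [Ne, Submodule.Quotient.mk_eq_zero, Ideal.mem_span_singleton, loc_dvd (P := Q)]
    exact h
  obtain ⟨J, hJ, hle⟩ := exists_le_isAssociatedPrime_of_isNoetherianRing A _ h0
  rw [isAssociatedPrime_iff] at hJ
  obtain ⟨hJp, z, hz⟩ := hJ
  obtain ⟨z, rfl⟩ := Submodule.Quotient.mk_surjective _ z
  obtain ⟨s, hs, z', hz'⟩ := loc_surj Q z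
  have key : ∀ x y : A, x ∈ Submodule.colon (⊥ : Submodule A (A ⧸ Ideal.span {φ c}))
      {(Submodule.Quotient.mk y : A ⧸ Ideal.span {φ c})} ↔ φ c ∣ x * y := by
    intro x y
    rw [Submodule.mem_colon_singleton, ← Submodule.Quotient.mk_smul, Submodule.mem_bot,
      Submodule.Quotient.mk_eq_zero, Ideal.mem_span_singleton, smul_eq_mul]
  refine ⟨J.comap φ, inferInstance, fun x hx => ?_, z', fun x => ?_, fun x hx => ?_⟩
  · by_contra hxQ
    exact hJp.ne_top (Ideal.eq_top_of_isUnit_mem _ hx (loc_unit (P := Q) hxQ))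
  · rw [← loc_dvd (A := A), map_mul, ← hz', Ideal.mem_comap, hz, key, mul_left_comm]
    exact IsUnit.dvd_mul_left (loc_unit hs)
  · refine hle ?_
    rw [key, ← map_mul]
    exact (loc_dvd (P := Q) _ _).mpr hx

section
variable {B S : Type*} [CommRing B] [CommRing S] [Algebra B S]

/-- generic fibre is Noetherian -/
lemma gen_noeth [IsDomain B] [Algebra.EssFiniteType B S] :
    IsNoetherianRing (Localization (Algebra.algebraMapSubmonoid S (nonZeroDivisors B))) := by
  let K := Localization (nonZeroDivisors B)
  let L := Localization (Algebra.algebraMapSubmonoid S (nonZeroDivisors B))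
  letI : Algebra K L := localizationAlgebra (nonZeroDivisors B) S
  haveI : IsScalarTower B K L := IsScalarTower.of_algebraMap_eq' (by
    rw [IsScalarTower.algebraMap_eq B S L]
    symm
    exact IsLocalization.map_comp _)
  haveI : Algebra.EssFiniteType B L := Algebra.EssFiniteType.comp B S _
  haveI := Algebra.EssFiniteType.of_comp B K L
  letI : Field K := IsFractionRing.toField B
  exact Algebra.EssFiniteType.isNoetherianRing K _

lemma mem_gen_span [IsDomain B] {s : Set S} {x : S}
    (h : algebraMap S (Localization (Algebra.algebraMapSubmonoid S (nonZeroDivisors B))) x ∈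
      (Ideal.span s).map (algebraMap S (Localization (Algebra.algebraMapSubmonoid S (nonZeroDivisors B))))) :
    ∃ b : B, b ≠ 0 ∧ algebraMap B S b * x ∈ Ideal.span s := by
  rw [IsLocalization.algebraMap_mem_map_algebraMap_iff (Algebra.algebraMapSubmonoid S (nonZeroDivisors B))] at h
  obtain ⟨_, ⟨b, hb, rfl⟩, h⟩ := h
  exact ⟨b, nonZeroDivisors.ne_zero hb, h⟩

/-- every family has a finite subfamily generating the same ideal over the generic point -/
lemma gen_finite [IsDomain B] [Algebra.EssFiniteType B S] {ι : Type*} (η : ι → S) :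
    ∃ F : Set ι, F.Finite ∧ ∀ x ∈ Ideal.span (Set.range η), ∃ b : B, b ≠ 0 ∧
      algebraMap B S b * x ∈ Ideal.span (Set.range fun i : F => η i) := by
  let L := Localization (Algebra.algebraMapSubmonoid S (nonZeroDivisors B))
  haveI : IsNoetherianRing L := gen_noeth
  obtain ⟨F, hF, h⟩ := exists_finite_idx (fun i => algebraMap S L (η i))
  refine ⟨F, hF, fun x hx => mem_gen_span ?_⟩
  have h1 := Ideal.mem_map_of_mem (algebraMap S L) hx
  rw [Ideal.map_span] at h1 ⊢
  rw [← Set.range_comp] at h1 ⊢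
  exact h.le h1
end

lemma nz_over_zero {B S : Type*} [CommRing B] [CommRing S] [Algebra B S] [IsDomain B]
    [Algebra.EssFiniteType B S] (tf : ∀ (b : B) (x : S), b ≠ 0 → algebraMap B S b * x = 0 → x = 0)
    {P : Ideal S} [hP : P.IsPrime] {α : S} (h : NzAt P α) :
    ∃ f ∉ P, ∀ z, α * z = 0 → f * z = 0 := by
  classical
  obtain ⟨F, hF, h1⟩ := gen_finite (B := B) (fun z : {z : S // α * z = 0} => (z : S))
  choose g hg hg2 using fun z : {z : S // α * z = 0} => h z z.2
  refine ⟨∏ i ∈ hF.toFinset, g i, fun hm => ?_, fun z hz => ?_⟩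
  · obtain ⟨i, -, hi⟩ := (Ideal.IsPrime.prod_mem_iff (hp := hP)).mp hm
    exact hg i hi
  · obtain ⟨b, hb, hm⟩ := h1 z (Ideal.subset_span ⟨⟨z, hz⟩, rfl⟩)
    refine tf b _ hb ?_
    rw [mul_left_comm]
    generalize algebraMap B S b * z = y at hm
    induction hm using Submodule.span_induction with
    | mem x hx =>
      obtain ⟨i, rfl⟩ := hx
      obtain ⟨e, he⟩ := Finset.dvd_prod_of_mem g (hF.mem_toFinset.mpr i.2)
      dsimp only
      rw [he, mul_right_comm, hg2, zero_mul]
    | zero => rw [mul_zero]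
    | add x y _ _ hx hy => rw [mul_add, hx, hy, add_zero]
    | smul a x _ hx => rw [smul_eq_mul, mul_left_comm, hx, mul_zero]

/-- spreading of regularity -/
lemma nz_spread {B S : Type*} [CommRing B] [CommRing S] [Algebra B S] (hB : BD B)
    [Algebra.EssFiniteType B S] (tf : ∀ (b : B) (x : S), b ≠ 0 → algebraMap B S b * x = 0 → x = 0)
    {P : Ideal S} [hP : P.IsPrime] {α : S} (h : NzMod B P α) :
    ∃ f ∉ P, ∀ Q : Ideal S, f ∉ Q → NzAt Q α := by
  have := hB.dom
  obtain ⟨f, hf, h⟩ := nz_over_zero tf (h.nzAt hB tf)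
  exact ⟨f, hf, fun Q hQ z hz => ⟨f, hQ, h z hz⟩⟩

lemma dvd_over_zero {B S : Type*} [CommRing B] [CommRing S] [Algebra B S] [IsDomain B]
    {P : Ideal S} [hP : P.IsPrime] {c d η : S}
    (h : ∀ Q : Ideal S, Q.IsPrime → Q ≤ P → η ∉ Q → DvdAt Q c d) :
    ∃ f ∉ P, ∀ Q : Ideal S, Q.IsPrime → Q.comap (algebraMap B S) = ⊥ → f ∉ Q → η ∉ Q → DvdAt Q c d := by
  by_contra hcon
  push Not at hcon
  let I : Ideal S := (Ideal.span {c}).colon (Ideal.span {d})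
  have hI : ∀ x, x ∈ I ↔ c ∣ x * d := fun x => by
    rw [Ideal.mem_colon_span_singleton, Ideal.mem_span_singleton]
  obtain ⟨Q, h1, h2, h3, h4⟩ := exists_prime_avoid P I
    (Algebra.algebraMapSubmonoid S (nonZeroDivisors B) ⊔ Submonoid.powers η) (by
    rintro n hn f hf hnf
    obtain ⟨_, ⟨b, hb, rfl⟩, _, ⟨k, rfl⟩, rfl⟩ := Submonoid.mem_sup.mp hn
    obtain ⟨Q, hQ, hQ0, hfQ, hηQ, hd⟩ := hcon f hf
    refine hd ⟨_, ?_, (hI _).mp hnf⟩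
    refine hQ.mul_notMem (hQ.mul_notMem (fun hbQ => ?_) (fun hh => hηQ (hQ.mem_of_pow_mem _ hh))) hfQ
    have : b ∈ Q.comap (algebraMap B S) := hbQ
    rw [hQ0] at this
    exact nonZeroDivisors.ne_zero hb this)
  obtain ⟨f, hf, hd⟩ := h Q h1 h3 (h4 η (Submonoid.mem_sup_right ⟨1, pow_one _⟩))
  exact hf (h2 ((hI f).mpr hd))

theorem AlgData.spread {B S : Type*} [CommRing B] [CommRing S] [Algebra B S] {ι : Type*} {η a b : ι → S}
    {inW : Ideal S → Prop} (c : AlgData B S η a b inW) (P : Ideal S) [hP : P.IsPrime]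
    (h : RGood B η a b P) : ∃ α β, ∃ f ∉ P, ∀ Q : Ideal S, Q.IsPrime → f ∉ Q → NzAt Q α ∧ NzAt Q β ∧
      ∀ i, η i ∉ Q → AssocAt Q (α * b i) (β * a i) := by
  classical
  haveI := c.eft
  have := c.bd.dom
  obtain ⟨α, β, hα, hβ, hab⟩ := h
  obtain ⟨f1, hf1, nα⟩ := nz_spread c.bd c.tf hα
  obtain ⟨f2, hf2, nβ⟩ := nz_spread c.bd c.tf hβ
  obtain ⟨f3, hf3, gα⟩ := fg_lemma c.bd c.tf P hα
  obtain ⟨f4, hf4, gβ⟩ := fg_lemma c.bd c.tf P hβ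
  obtain ⟨F, hF, hspan⟩ := gen_finite (B := B) η
  choose g1 hg1 hg1' using fun i => dvd_over_zero (B := B) (η := η i) (P := P) (fun Q hQ hle hi =>
    (hab Q hQ hle i hi).1)
  choose g2 hg2 hg2' using fun i => dvd_over_zero (B := B) (η := η i) (P := P) (fun Q hQ hle hi =>
    (hab Q hQ hle i hi).2)
  refine ⟨α, β, f1 * f2 * (f3 * f4) * ∏ i ∈ hF.toFinset, (g1 i * g2 i), ?_, ?_⟩
  · refine hP.mul_notMem (hP.mul_notMem (hP.mul_notMem hf1 hf2) (hP.mul_notMem hf3 hf4)) fun hm => ?_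
    obtain ⟨i, -, hi⟩ := (Ideal.IsPrime.prod_mem_iff (hp := hP)).mp hm
    exact hP.mul_notMem (hg1 i) (hg2 i) hi
  have hQf : ∀ Q : Ideal S, f1 * f2 * (f3 * f4) * ∏ i ∈ hF.toFinset, (g1 i * g2 i) ∉ Q →
      f1 ∉ Q ∧ f2 ∉ Q ∧ f3 ∉ Q ∧ f4 ∉ Q ∧ ∀ i ∈ F, g1 i ∉ Q ∧ g2 i ∉ Q := by
    intro Q hQ
    have hd : ∀ x, x ∣ f1 * f2 * (f3 * f4) * ∏ i ∈ hF.toFinset, (g1 i * g2 i) → x ∉ Q := fun x hx h =>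
      hQ (Ideal.mem_of_dvd _ hx h)
    refine ⟨hd _ ?_, hd _ ?_, hd _ ?_, hd _ ?_, fun i hi => ⟨hd _ ?_, hd _ ?_⟩⟩
    · exact dvd_mul_of_dvd_left (dvd_mul_of_dvd_left (dvd_mul_right _ _) _) _
    · exact dvd_mul_of_dvd_left (dvd_mul_of_dvd_left (dvd_mul_left _ _) _) _
    · exact dvd_mul_of_dvd_left (dvd_mul_of_dvd_right (dvd_mul_right _ _) _) _
    · exact dvd_mul_of_dvd_left (dvd_mul_of_dvd_right (dvd_mul_left _ _) _) _
    · exact dvd_mul_of_dvd_right ((dvd_mul_right _ _).trans (Finset.dvd_prod_of_mem _ (hF.mem_toFinset.mpr hi))) _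
    · exact dvd_mul_of_dvd_right ((dvd_mul_left _ _).trans (Finset.dvd_prod_of_mem _ (hF.mem_toFinset.mpr hi))) _
  have gen : ∀ Q : Ideal S, Q.IsPrime → Q.comap (algebraMap B S) = ⊥ →
      f1 * f2 * (f3 * f4) * ∏ i ∈ hF.toFinset, (g1 i * g2 i) ∉ Q → ∀ i, η i ∉ Q →
      AssocAt Q (α * b i) (β * a i) := by
    intro Q hQ hQ0 hfQ i hi
    obtain ⟨-, -, -, -, h5⟩ := hQf Q hfQ
    obtain ⟨j, hj, hjF⟩ : ∃ j, η j ∉ Q ∧ j ∈ F := by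
      by_contra hcon
      push Not at hcon
      obtain ⟨s, hs, hm⟩ := hspan (η i) (Ideal.subset_span ⟨i, rfl⟩)
      have : algebraMap B S s * η i ∈ Q := by
        refine (Ideal.span_le.mpr ?_) hm
        rintro _ ⟨j, rfl⟩
        by_contra h
        exact hcon j h j.2
      refine (hQ.mem_or_mem this).elim (fun h => hs ?_) hi
      have h' : s ∈ Q.comap (algebraMap B S) := h
      rwa [hQ0] at h'
    obtain ⟨h6, h7⟩ := h5 j hjF
    exact c.trans_dvd hi hj ⟨hg1' j Q hQ hQ0 h6 hj, hg2' j Q hQ hQ0 h7 hj⟩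
  intro Q hQ hfQ
  refine ⟨nα Q (hQf Q hfQ).1, nβ Q (hQf Q hfQ).2.1, fun i hi => ?_⟩
  have core : ∀ γ δ d : S, (∀ Q' : Ideal S, Q'.IsPrime → Q' ≤ Q → NzAt Q' (γ * δ)) →
      (∀ Q' : Ideal S, Q'.IsPrime → Q' ≤ Q → FG B Q' → γ ∉ Q') →
      (∀ Q' : Ideal S, Q'.IsPrime → Q' ≤ Q → NzMod B Q' δ) →
      (∀ Q' : Ideal S, Q'.IsPrime → Q' ≤ Q → Q'.comap (algebraMap B S) = ⊥ → DvdAt Q' (γ * δ) d) →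
      DvdAt Q (γ * δ) d := by
    intro γ δ d hnz hγ hδ h0
    by_contra hcon
    haveI : IsNoetherianRing (Localization.AtPrime Q) := noeth_loc c.bd Q
    obtain ⟨Q0, hQ0, hle, z, hz, hd⟩ := ass_prime Q hcon
    have hmono : ∀ x y, DvdAt Q0 x y → ∃ f ∉ Q0, x ∣ f * y := fun x y h => h
    by_cases hq : Q0.comap (algebraMap B S) = ⊥
    · obtain ⟨f, hf, h⟩ := h0 Q0 hQ0 hle hq
      exact hf (hd f ⟨1, hQ.one_notMem, by rwa [one_mul]⟩)
    have hnd : ¬ DvdAt Q0 (γ * δ) z := by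
      rintro ⟨f, hf, h⟩
      exact hf ((hz f).mp ⟨1, hQ.one_notMem, by rwa [one_mul]⟩)
    by_cases hFG : FG B Q0
    · refine hnd ⟨γ * δ, hQ0.mul_notMem (hγ Q0 hQ0 hle hFG) fun hδQ => ?_, dvd_mul_right _ _⟩
      obtain ⟨k, e, he, hk⟩ := mem_minimal_pow hFG.min hδQ
      obtain ⟨f, hf, h⟩ := (hδ Q0 hQ0 hle).pow k e (by rw [mul_comm]; exact hk)
      exact hQ0.mul_notMem hf he (fibI_le Q0 h)
    · have : ∃ P0 : Ideal S, P0.IsPrime ∧ P0 < Q0 ∧ Ov B P0 Q0 := by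
        rw [FG] at hFG
        push Not at hFG
        obtain ⟨P0, h1, h2, h3, h4⟩ := hFG
        exact ⟨P0, h1, lt_of_le_of_ne h2 h4, h3⟩
      obtain ⟨P0, h1, h2, h3⟩ := this
      obtain ⟨x, hx, hxn⟩ := c.s1 P0 Q0 h1 hQ0 h2 h3
      obtain ⟨t, htm, ht⟩ := c.bd.unif _ inferInstance hq
      have ht0 := unif_ne_zero hq ht
      let A := Localization.AtPrime Q0
      let φ := algebraMap S A
      have hNZ : NZm (φ (algebraMap B S t)) (φ x) := (NZm_iff htm ht x).mpr hxn
      have tnz : ∀ z, φ (algebraMap B S t) * z = 0 → z = 0 := (loc_nz (P := Q0) _).mpr fun z hz =>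
        ⟨1, hQ0.one_notMem, by rw [one_mul]; exact c.tf t z ht0 hz⟩
      have hcn := (loc_nz (A := A) _).mpr (hnz Q0 hQ0 hle)
      have hdv : ∀ y ∈ Q0, φ (γ * δ) ∣ φ y * φ z := by
        intro y hy
        obtain ⟨f, hf, h⟩ := (hz y).mpr hy
        rw [← map_mul]
        exact (loc_dvd (P := Q0) _ _).mpr ⟨f, fun h => hf (hle h), h⟩
      obtain ⟨w1, e1⟩ := hdv _ htm
      obtain ⟨w2, e2⟩ := hdv _ hx
      have e3 : φ x * w1 = φ (algebraMap B S t) * w2 := sub_eq_zero.mp (hcn _ (by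
        linear_combination φ (algebraMap B S t) * e2 - φ x * e1))
      obtain ⟨v, rfl⟩ := hNZ w1 ⟨w2, e3⟩
      have e4 : φ z = φ (γ * δ) * v := sub_eq_zero.mp (tnz _ (by linear_combination e1))
      exact hnd ((loc_dvd (A := A) _ _).mp ⟨v, e4⟩)
  have hnzmul : ∀ (Q' : Ideal S) (x y : S), Q'.IsPrime → NzAt Q' x → NzAt Q' y → NzAt Q' (x * y) := by
    intro Q' x y hQ' hx hy z hz
    obtain ⟨f, hf, h⟩ := hx (y * z) (by rwa [← mul_assoc])
    obtain ⟨g, hg, h'⟩ := hy (f * z) (by linear_combination h)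
    exact ⟨g * f, hQ'.mul_notMem hg hf, by linear_combination h'⟩
  have hsm : ∀ Q' : Ideal S, Q' ≤ Q → f1 * f2 * (f3 * f4) * ∏ i ∈ hF.toFinset, (g1 i * g2 i) ∉ Q' :=
    fun Q' hle h => hfQ (hle h)
  constructor
  · refine core _ _ _ (fun Q' hQ' hle => hnzmul _ _ _ hQ' (nα Q' (hQf Q' (hsm Q' hle)).1)
      (c.nzb i Q' hQ' fun h => hi (hle h)).1) (fun Q' hQ' hle hF => gα Q' hQ' (hQf Q' (hsm Q' hle)).2.2.1 hF)
      (fun Q' hQ' hle => (c.nzb i Q' hQ' fun h => hi (hle h)).2) fun Q' hQ' hle h0 =>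
      (gen Q' hQ' h0 (hsm Q' hle) i fun h => hi (hle h)).1
  · refine core _ _ _ (fun Q' hQ' hle => hnzmul _ _ _ hQ' (nβ Q' (hQf Q' (hsm Q' hle)).2.1)
      (c.nza i Q' hQ' fun h => hi (hle h)).1) (fun Q' hQ' hle hF => gβ Q' hQ' (hQf Q' (hsm Q' hle)).2.2.2.1 hF)
      (fun Q' hQ' hle => (c.nza i Q' hQ' fun h => hi (hle h)).2) fun Q' hQ' hle h0 =>
      (gen Q' hQ' h0 (hsm Q' hle) i fun h => hi (hle h)).2

end

section
open scoped Pointwise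

theorem AlgData.ext_dvd {B S : Type*} [CommRing B] [CommRing S] [Algebra B S] {ι : Type*} {η a b : ι → S}
    {inW : Ideal S → Prop} (C : AlgData B S η a b inW) (Q : Ideal S) [hQ : Q.IsPrime] {c d : S}
    (hnz : ∀ Q' : Ideal S, Q'.IsPrime → Q' ≤ Q → NzAt Q' c)
    (h : ∀ Q' : Ideal S, Q'.IsPrime → Q' ≤ Q → ∀ i, η i ∉ Q' → DvdAt Q' c d) : DvdAt Q c d := by
  haveI := C.eft
  have := C.bd.dom
  by_contra hcon
  haveI : IsNoetherianRing (Localization.AtPrime Q) := noeth_loc C.bd Q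
  obtain ⟨Q0, hQ0, hle, z, hz, hd⟩ := ass_prime Q hcon
  have hη : ∀ i, η i ∈ Q0 := by
    intro i
    by_contra hi
    obtain ⟨f, hf, h⟩ := h Q0 hQ0 hle i hi
    exact hf (hd f ⟨1, hQ.one_notMem, by rwa [one_mul]⟩)
  have hnd : ¬ DvdAt Q0 c z := by
    rintro ⟨f, hf, h⟩
    exact hf ((hz f).mp ⟨1, hQ.one_notMem, by rwa [one_mul]⟩)
  obtain ⟨P0, P1, h1, h2, h3, h4, h5⟩ := C.cV Q0 hQ0 hη
  let A := Localization.AtPrime Q0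
  let φ := algebraMap S A
  have hcn := (loc_nz (A := A) _).mpr (hnz Q0 hQ0 hle)
  have hdv : ∀ y ∈ Q0, φ c ∣ φ y * φ z := by
    intro y hy
    obtain ⟨f, hf, h⟩ := (hz y).mpr hy
    rw [← map_mul]
    exact (loc_dvd (P := Q0) _ _).mpr ⟨f, fun h => hf (hle h), h⟩
  by_cases hq : Q0.comap (algebraMap B S) = ⊥
  · obtain ⟨x, hx, y, hy, hr⟩ := C.s2 P0 P1 Q0 h1 h2 hQ0 h3 h4 h5
    have hf0 := fibI_bot hq
    have hxn : ∀ z, φ x * z = 0 → z = 0 := (loc_nz (P := Q0) _).mpr fun z hz => by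
      simpa [hf0] using hr.1 z (by simp [hf0, hz])
    obtain ⟨w1, e1⟩ := hdv _ hx
    obtain ⟨w2, e2⟩ := hdv _ hy
    have e3 : φ y * w1 = φ x * w2 := sub_eq_zero.mp (hcn _ (by
        linear_combination φ x * e2 - φ y * e1))
    have : φ x ∣ w1 := by
      obtain ⟨s, hs, w1', hw1⟩ := loc_surj Q0 w1
      have h6 : φ x ∣ φ (y * w1') := ⟨algebraMap S A s * w2, by
        rw [map_mul, ← hw1]; linear_combination (algebraMap S A s) * e3⟩
      obtain ⟨g, hg, w, hw⟩ := (loc_dvd (P := Q0) _ _).mp h6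
      obtain ⟨f, hf, v, hv⟩ := hr.2 (g * w1') w (by
        rw [hf0, show y * (g * w1') - x * w = 0 by linear_combination hw]; exact zero_mem _)
      have h7 : φ x ∣ φ (s * 1) * w1 := by
        rw [mul_one, hw1]
        refine (loc_dvd (P := Q0) _ _).mpr ⟨f * g, hQ0.mul_notMem hf hg, v, ?_⟩
        rw [hf0, Ideal.mem_bot] at hv
        linear_combination hv
      rw [mul_one] at h7
      exact (IsUnit.dvd_mul_left (loc_unit hs)).mp h7
    obtain ⟨v, rfl⟩ := this
    have e4 : φ z = φ c * v := sub_eq_zero.mp (hxn _ (by linear_combination e1))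
    exact hnd ((loc_dvd (A := A) _ _).mp ⟨v, e4⟩)
  · obtain ⟨x, hx, hxn⟩ := C.s1 P0 Q0 h1 hQ0 (h3.trans h4) h5
    obtain ⟨t, htm, ht⟩ := C.bd.unif _ inferInstance hq
    have ht0 := unif_ne_zero hq ht
    have hNZ : NZm (φ (algebraMap B S t)) (φ x) := (NZm_iff htm ht x).mpr hxn
    have tnz : ∀ z, φ (algebraMap B S t) * z = 0 → z = 0 := (loc_nz (P := Q0) _).mpr fun z hz =>
      ⟨1, hQ0.one_notMem, by rw [one_mul]; exact C.tf t z ht0 hz⟩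
    obtain ⟨w1, e1⟩ := hdv _ htm
    obtain ⟨w2, e2⟩ := hdv _ hx
    have e3 : φ x * w1 = φ (algebraMap B S t) * w2 := sub_eq_zero.mp (hcn _ (by
      linear_combination φ (algebraMap B S t) * e2 - φ x * e1))
    obtain ⟨v, rfl⟩ := hNZ w1 ⟨w2, e3⟩
    have e4 : φ z = φ c * v := sub_eq_zero.mp (tnz _ (by linear_combination e1))
    exact hnd ((loc_dvd (A := A) _ _).mp ⟨v, e4⟩)

/-- `O` is the local ring at `P` of the fibre of `S` over `B` -/
structure IsFib (B : Type*) {S O : Type*} [CommRing B] [CommRing S] [CommRing O] [Algebra B S]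
    (P : Ideal S) (ψ : S →+* O) : Prop where
  unit : ∀ f ∉ P, IsUnit (ψ f)
  surj : ∀ o, ∃ f ∉ P, ∃ y, ψ f * o = ψ y
  ker : ∀ s, ψ s = 0 ↔ ∃ f ∉ P, f * s ∈ fibI B P

section
variable {B S O : Type*} [CommRing B] [CommRing S] [CommRing O] [Algebra B S]
  {P : Ideal S} [hP : P.IsPrime] {ψ : S →+* O}

lemma IsFib.nzMod (c : IsFib B P ψ) (a : S) : NzMod B P a ↔ ψ a ∈ nonZeroDivisors O := by
  rw [mem_nonZeroDivisors_iff_right]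
  constructor
  · intro h z hz
    obtain ⟨f, hf, y, hy⟩ := c.surj z
    obtain ⟨g, hg, h1⟩ := (c.ker (a * y)).mp (by rw [map_mul, ← hy]; linear_combination ψ f * hz)
    obtain ⟨k, hk, h2⟩ := h (g * y) (by rwa [mul_left_comm])
    have : ψ (g * y) = 0 := (c.ker _).mpr ⟨k, hk, h2⟩
    rw [map_mul, (c.unit g hg).mul_right_eq_zero, ← hy, (c.unit f hf).mul_right_eq_zero] at this
    exact this
  · intro h z hz
    refine (c.ker z).mp (h _ ?_)
    rw [← map_mul, mul_comm]
    exact (c.ker _).mpr ⟨1, hP.one_notMem, by rwa [one_mul]⟩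

lemma IsFib.dvdMod (c : IsFib B P ψ) (a b : S) : DvdMod B P a b ↔ ψ a ∣ ψ b := by
  constructor
  · rintro ⟨f, hf, e, h⟩
    have := (c.ker (f * b - a * e)).mpr ⟨1, hP.one_notMem, by rwa [one_mul]⟩
    rw [map_sub, map_mul, map_mul, sub_eq_zero] at this
    exact (c.unit f hf).dvd_mul_left.mp ⟨_, this⟩
  · rintro ⟨o, h⟩
    obtain ⟨f, hf, y, hy⟩ := c.surj o
    obtain ⟨g, hg, h1⟩ := (c.ker (f * b - a * y)).mp (by
      rw [map_sub, map_mul, map_mul, ← hy]; linear_combination ψ f * h)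
    exact ⟨g * f, hP.mul_notMem hg hf, g * y, by convert h1 using 1; ring⟩

lemma IsFib.regMod (c : IsFib B P ψ) {x y : S} (hx : ψ x ∈ nonZeroDivisors O)
    (h : ∀ z, ψ x ∣ ψ y * z → ψ x ∣ z) : RegMod B P x y := by
  refine ⟨(c.nzMod x).mpr hx, fun z w hw => ?_⟩
  have := (c.ker _).mpr ⟨1, hP.one_notMem, by rwa [one_mul]⟩
  rw [map_sub, map_mul, map_mul, sub_eq_zero] at this
  exact (c.dvdMod _ _).mpr (h _ ⟨_, this⟩)

lemma IsFib.mem_max (c : IsFib B P ψ) [IsLocalRing O] {o : O} (ho : o ∈ maximalIdeal O) :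
    ∃ x ∈ P, ∃ u : O, IsUnit u ∧ ψ x = u * o := by
  obtain ⟨f, hf, y, hy⟩ := c.surj o
  refine ⟨y, ?_, ψ f, c.unit f hf, hy.symm⟩
  by_contra h
  have := c.unit y h
  rw [← hy] at this
  exact ho (isUnit_of_mul_isUnit_right this)

lemma IsFib.s1 {O : Type u} [CommRing O] {ψ : S →+* O} (c : IsFib B P ψ) [IsLocalRing O]
    (h : LocalPic.DepthGE O 1) : ∃ x ∈ P, NzMod B P x := by
  obtain ⟨rs, hl, hm, hr⟩ := h
  obtain ⟨r, rfl⟩ := List.length_eq_one_iff.mp hl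
  obtain ⟨x, hx, u, hu, he⟩ := c.mem_max (hm r (by simp))
  refine ⟨x, hx, (c.nzMod x).mpr ?_⟩
  rw [he]
  refine mul_mem hu.mem_nonZeroDivisors ?_
  rw [RingTheory.Sequence.isWeaklyRegular_cons_iff] at hr
  exact mem_nonZeroDivisors_iff_right.mpr fun z hz => hr.1.right_eq_zero_of_smul (by
    rwa [smul_eq_mul, mul_comm])

lemma IsFib.s2 {O : Type u} [CommRing O] {ψ : S →+* O} (c : IsFib B P ψ) [IsLocalRing O]
    (h : LocalPic.DepthGE O 2) : ∃ x ∈ P, ∃ y ∈ P, RegMod B P x y := by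
  obtain ⟨rs, hl, hm, hr⟩ := h
  obtain ⟨r, s, rfl⟩ := List.length_eq_two.mp hl
  obtain ⟨x, hx, u, hu, he⟩ := c.mem_max (hm r (by simp))
  obtain ⟨y, hy, v, hv, he'⟩ := c.mem_max (hm s (by simp))
  rw [RingTheory.Sequence.isWeaklyRegular_cons_iff, RingTheory.Sequence.isWeaklyRegular_cons_iff] at hr
  obtain ⟨h1, h2, -⟩ := hr
  refine ⟨x, hx, y, hy, c.regMod ?_ ?_⟩
  · rw [he]
    refine mul_mem hu.mem_nonZeroDivisors ?_
    exact mem_nonZeroDivisors_iff_right.mpr fun z hz => h1.right_eq_zero_of_smul (by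
      rwa [smul_eq_mul, mul_comm])
  · intro z hz
    rw [he, hu.mul_left_dvd] at hz ⊢
    rw [he', mul_assoc, hv.dvd_mul_left] at hz
    have key : ∀ w : O, w ∈ (r • (⊤ : Submodule O O)) ↔ r ∣ w := fun w => by
      simp [Submodule.mem_smul_pointwise_iff_exists, dvd_def, eq_comm]
    rw [← key] at hz ⊢
    exact (isSMulRegular_quotient_iff_mem_of_smul_mem _ _).mp h2 z hz

end
end

section

lemma reg_local {R : Type u} [CommRing R] [IsLocalRing R] (h : LocalPic.IsRegularLocal R)
    (hd : ringKrullDim R ≤ 1) : IsDomain R ∧ (∃ t : R, maximalIdeal R = Ideal.span {t}) ∧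
      ∀ c d : R, c ∣ d ∨ d ∣ c := by
  obtain ⟨hN, hf⟩ := h
  have h1 : Module.finrank (IsLocalRing.ResidueField R) (IsLocalRing.CotangentSpace R) ≤ 1 := by
    rw [hf] at hd
    exact_mod_cast hd
  obtain ⟨t, ht⟩ := (IsLocalRing.finrank_cotangentSpace_le_one_iff.mp h1).principal
  have ht : maximalIdeal R = Ideal.span {t} := ht
  have key : ∀ x : R, x ≠ 0 → ∃ n : ℕ, ∃ u : R, IsUnit u ∧ x = u * t ^ n := by
    intro x hx
    have h2 : ∃ n, ¬ t ^ n ∣ x := by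
      by_contra hc
      push Not at hc
      refine hx ?_
      have : x ∈ ⨅ i : ℕ, maximalIdeal R ^ i := by
        rw [Ideal.mem_iInf]
        intro i
        rw [ht, Ideal.span_singleton_pow, Ideal.mem_span_singleton]
        exact hc i
      rwa [Ideal.iInf_pow_eq_bot_of_isLocalRing _ (IsLocalRing.maximalIdeal.isMaximal R).ne_top] at this
    classical
    have h3 := Nat.find_spec h2
    have h4 := fun m => Nat.find_min h2 (m := m)
    obtain ⟨n, hn⟩ : ∃ n, Nat.find h2 = n + 1 := Nat.exists_eq_succ_of_ne_zero (fun h0 => by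
      rw [h0] at h3; simp at h3)
    obtain ⟨u, hu⟩ := not_not.mp (h4 n (by omega))
    refine ⟨n, u, ?_, by rw [hu, mul_comm]⟩
    by_contra hun
    have : u ∈ maximalIdeal R := hun
    rw [ht, Ideal.mem_span_singleton] at this
    obtain ⟨v, rfl⟩ := this
    exact h3 ⟨v, by rw [hn, hu, pow_succ]; ring⟩
  refine ⟨?_, ⟨t, ht⟩, fun c d => ?_⟩
  · by_cases hnil : ∃ n, t ^ n = 0
    · obtain ⟨n, hn⟩ := hnil
      have h5 : Ring.KrullDimLE 0 R := by
        refine Ring.krullDimLE_zero_iff.mpr fun I hI => ?_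
        have : I = maximalIdeal R := le_antisymm (IsLocalRing.le_maximalIdeal hI.ne_top) (by
          rw [ht, Ideal.span_singleton_le_iff_mem]
          exact hI.mem_of_pow_mem n (by rw [hn]; exact zero_mem _))
        rw [this]
        infer_instance
      rw [Ring.krullDimLE_iff, hf] at h5
      have h6 : Module.finrank (IsLocalRing.ResidueField R) (IsLocalRing.CotangentSpace R) = 0 :=
        Nat.le_zero.mp (by exact_mod_cast h5)
      exact (IsLocalRing.finrank_cotangentSpace_eq_zero_iff.mp h6).isDomain
    · push Not at hnil
      haveI : NoZeroDivisors R := ⟨fun {a b} hab => by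
        by_contra hc
        push Not at hc
        obtain ⟨n, u, hu, rfl⟩ := key a hc.1
        obtain ⟨m, v, hv, rfl⟩ := key b hc.2
        refine hnil (n + m) ((hu.mul hv).mul_right_eq_zero.mp ?_)
        rw [← hab]; ring⟩
      exact NoZeroDivisors.to_isDomain R
  · by_cases hc : c = 0
    · exact Or.inr (hc ▸ dvd_zero d)
    by_cases hd : d = 0
    · exact Or.inl (hd ▸ dvd_zero c)
    obtain ⟨n, u, hu, rfl⟩ := key c hc
    obtain ⟨m, v, hv, rfl⟩ := key d hd
    rw [hu.mul_left_dvd, hv.dvd_mul_left, hv.mul_left_dvd, hu.dvd_mul_left]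
    exact (le_total n m).imp (pow_dvd_pow t) (pow_dvd_pow t)

lemma stalk_dim (T : Scheme.{u}) (t : T) : ringKrullDim (T.presheaf.stalk t) ≤ topologicalKrullDim T := by
  rw [← PrimeSpectrum.topologicalKrullDim_eq_ringKrullDim]
  exact Topology.IsInducing.topologicalKrullDim_le (T.fromSpecStalk t).isEmbedding.isInducing

end

section

section
variable {X : Scheme.{u}} {U : X.Opens}

/-- germ of a section -/
noncomputable abbrev gm (x : X) (hx : x ∈ U) : Γ(X, U) →+* X.presheaf.stalk x := (X.presheaf.germ U x hx).hom

/-- the prime of a point -/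
noncomputable def pt (U : X.Opens) (x : X) (hx : x ∈ U) : Ideal Γ(X, U) :=
  (maximalIdeal (X.presheaf.stalk x)).comap (gm x hx)

instance pt_prime (x : X) (hx : x ∈ U) : (pt U x hx).IsPrime := by unfold pt; infer_instance

lemma notMem_pt {x : X} {hx : x ∈ U} {s : Γ(X, U)} : s ∉ pt U x hx ↔ x ∈ X.basicOpen s := by
  rw [X.mem_basicOpen s x hx]
  simp [pt]

lemma notMem_pt' {x : X} {hx : x ∈ U} {s : Γ(X, U)} : s ∉ pt U x hx ↔ IsUnit (gm x hx s) := by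
  simp [pt]

variable (hU : IsAffineOpen U)
include hU

lemma pt_eq (x : X) (hx : x ∈ U) : pt U x hx = (hU.primeIdealOf ⟨x, hx⟩).asIdeal := by
  rw [hU.primeIdealOf_eq_map_closedPoint]
  rfl

lemma exists_pt (P : Ideal Γ(X, U)) (hP : P.IsPrime) : ∃ x, ∃ hx : x ∈ U, pt U x hx = P := by
  have h1 : hU.fromSpec ⟨P, hP⟩ ∈ U := by
    have : hU.fromSpec ⟨P, hP⟩ ∈ Set.range hU.fromSpec := ⟨_, rfl⟩
    rwa [hU.range_fromSpec] at this
  refine ⟨_, h1, ?_⟩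
  rw [pt_eq hU]
  have := hU.fromSpec_primeIdealOf ⟨_, h1⟩
  rw [hU.fromSpec.isOpenEmbedding.injective this]

lemma pt_le {x y : X} (hx : x ∈ U) (hy : y ∈ U) : pt U y hy ≤ pt U x hx ↔ y ⤳ x := by
  rw [pt_eq hU, pt_eq hU, PrimeSpectrum.asIdeal_le_asIdeal, PrimeSpectrum.le_iff_specializes]
  have := hU.fromSpec.isOpenEmbedding.isInducing.specializes_iff (x := hU.primeIdealOf ⟨y, hy⟩)
    (y := hU.primeIdealOf ⟨x, hx⟩)
  rw [hU.fromSpec_primeIdealOf, hU.fromSpec_primeIdealOf] at this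
  exact this.symm

lemma pt_inj {x y : X} (hx : x ∈ U) (hy : y ∈ U) : pt U y hy = pt U x hx ↔ y = x := by
  rw [pt_eq hU, pt_eq hU]
  constructor
  · intro h
    have := congrArg hU.fromSpec (PrimeSpectrum.ext h)
    rwa [hU.fromSpec_primeIdealOf, hU.fromSpec_primeIdealOf] at this
  · rintro rfl; rfl

lemma pt_lt {x y : X} (hx : x ∈ U) (hy : y ∈ U) : pt U y hy < pt U x hx ↔ y ⤳ x ∧ y ≠ x := by
  rw [lt_iff_le_and_ne, pt_le hU, Ne, pt_inj hU]

lemma gm_loc (x : X) (hx : x ∈ U) : letI := (gm x hx).toAlgebra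
    IsLocalization.AtPrime (X.presheaf.stalk x) (pt U x hx) := by
  have := hU.isLocalization_stalk ⟨x, hx⟩
  simp only [pt_eq hU x hx]
  exact this

lemma gm_surj {x : X} (hx : x ∈ U) (o : X.presheaf.stalk x) : ∃ f ∉ pt U x hx, ∃ y, gm x hx f * o = gm x hx y := by
  letI := (gm x hx).toAlgebra
  haveI := gm_loc hU x hx
  exact loc_surj (pt U x hx) o

lemma gm_dvd {x : X} (hx : x ∈ U) (c d : Γ(X, U)) : gm x hx c ∣ gm x hx d ↔ DvdAt (pt U x hx) c d := by
  letI := (gm x hx).toAlgebra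
  haveI := gm_loc hU x hx
  exact loc_dvd (A := X.presheaf.stalk x) c d

lemma gm_nz {x : X} (hx : x ∈ U) (c : Γ(X, U)) :
    gm x hx c ∈ nonZeroDivisors (X.presheaf.stalk x) ↔ NzAt (pt U x hx) c := by
  letI := (gm x hx).toAlgebra
  haveI := gm_loc hU x hx
  rw [← loc_nz (A := X.presheaf.stalk x) c, mem_nonZeroDivisors_iff_right]
  simp only [mul_comm]
  rfl

end

/-- the base ring -/
lemma bd_of {T : Scheme.{u}} [IrreducibleSpace T] (hreg : ∀ t : T, LocalPic.IsRegularLocal (T.presheaf.stalk t))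
    (hdim1 : topologicalKrullDim T = 1) {U : T.Opens} (hU : IsAffineOpen U) (hne : Nonempty U) : BD Γ(T, U) := by
  have hr := fun t => reg_local (hreg t) (hdim1 ▸ stalk_dim T t)
  haveI : ∀ t : T, IsReduced (T.presheaf.stalk t) := fun t => by
    haveI := (hr t).1; infer_instance
  haveI := isReduced_of_isReduced_stalk T
  haveI := isIntegral_of_irreducibleSpace_of_isReduced T
  refine ⟨inferInstance, fun q hq => ?_, fun q hq h0 => ?_, fun q hq => ?_⟩
  · obtain ⟨x, hx, rfl⟩ := exists_pt hU q hq
    intro c d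
    have := (hr x).2.2 (gm x hx c) (gm x hx d)
    rwa [gm_dvd hU, gm_dvd hU] at this
  · obtain ⟨x, hx, rfl⟩ := exists_pt hU q hq
    obtain ⟨o, ho⟩ := (hr x).2.1
    obtain ⟨f, hf, y, hy⟩ := gm_surj hU hx o
    have hu := notMem_pt'.mp hf
    refine ⟨y, ?_, fun b hb => ?_⟩
    · change gm x hx y ∈ maximalIdeal _
      rw [ho, ← hy, Ideal.mem_span_singleton]
      exact dvd_mul_left _ _
    · refine (gm_dvd hU hx y b).mp ?_
      have : gm x hx b ∈ maximalIdeal _ := hb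
      rw [ho, Ideal.mem_span_singleton] at this
      rwa [← hy, hu.mul_left_dvd]
  · obtain ⟨x, hx, rfl⟩ := exists_pt hU q hq
    letI := (gm x hx).toAlgebra
    haveI := gm_loc hU x hx
    haveI := (hreg x).1
    exact isNoetherianRing_of_ringEquiv _ (IsLocalization.algEquiv (pt U x hx).primeCompl
      (T.presheaf.stalk x) (Localization.AtPrime (pt U x hx))).toRingEquiv

end

section

variable {X T : Scheme.{u}}

noncomputable abbrev Fb (f : X ⟶ T) (t : T) : Scheme.{u} := Limits.pullback f (T.fromSpecResidueField t)
noncomputable abbrev pr (f : X ⟶ T) (t : T) : Fb f t ⟶ X := Limits.pullback.fst f (T.fromSpecResidueField t)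

instance pr_pre (f : X ⟶ T) (t : T) : IsPreimmersion (pr f t) := inferInstanceAs (IsPreimmersion (f.fiberι t))

lemma pr_range (f : X ⟶ T) (t : T) : Set.range (pr f t) = f ⁻¹' {t} := f.range_fiberι t

lemma f_pr (f : X ⟶ T) (t : T) (z : Fb f t) : f (pr f t z) = t := by
  have : pr f t z ∈ Set.range (pr f t) := ⟨z, rfl⟩
  rwa [pr_range] at this

lemma exists_z (f : X ⟶ T) {t : T} {x : X} (h : f x = t) : ∃ z, pr f t z = x := by
  have : x ∈ f ⁻¹' {t} := h
  rwa [← pr_range] at this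

lemma pr_spec (f : X ⟶ T) (t : T) {z z' : Fb f t} : pr f t z' ⤳ pr f t z ↔ z' ⤳ z :=
  (pr f t).isEmbedding.isInducing.specializes_iff

lemma pr_inj (f : X ⟶ T) (t : T) {z z' : Fb f t} : pr f t z' = pr f t z ↔ z' = z :=
  (pr f t).isEmbedding.injective.eq_iff

lemma comap_pt {f : X ⟶ T} {U : X.Opens} {W : T.Opens} (hU : IsAffineOpen U) (hW : IsAffineOpen W)
    (hle : U ≤ f ⁻¹ᵁ W) {x : X} (hx : x ∈ U) :
    (pt U x hx).comap (f.appLE W U hle).hom = pt W (f x) (hle hx) := by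
  rw [pt_eq hU]
  exact (congrArg PrimeSpectrum.asIdeal (IsAffineOpen.comap_primeIdealOf_appLE W hW U hU hle hx)).trans
    (pt_eq hW _ _).symm

/-- restriction to the local ring of the fibre -/
noncomputable abbrev psi (f : X ⟶ T) (t : T) {U : X.Opens} (z : Fb f t) (hz : pr f t z ∈ U) :
    Γ(X, U) →+* (Fb f t).presheaf.stalk z :=
  (gm (U := pr f t ⁻¹ᵁ U) z hz).comp ((pr f t).app U).hom

lemma psi_gm (f : X ⟶ T) (t : T) {U : X.Opens} (z : Fb f t) (hz : pr f t z ∈ U) (s : Γ(X, U)) :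
    psi f t z hz s = (pr f t).stalkMap z (gm _ hz s) := by
  exact (Scheme.Hom.germ_stalkMap_apply (pr f t) U z hz s).symm

lemma psi_base {f : X ⟶ T} {t : T} {U : X.Opens} {W : T.Opens} (hle : U ≤ f ⁻¹ᵁ W) (z : Fb f t)
    (hz : pr f t z ∈ U) {b : Γ(T, W)} (hb : t ∉ T.basicOpen b) : psi f t z hz (f.appLE W U hle b) = 0 := by
  have h0 : (T.fromSpecResidueField t).app W b = 0 := by
    rw [← basicOpen_eq_bot_iff, ← Scheme.preimage_basicOpen]
    ext y
    have : T.fromSpecResidueField t y ∈ Set.range (T.fromSpecResidueField t) := ⟨y, rfl⟩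
    rw [Scheme.range_fromSpecResidueField] at this
    simp only [Set.mem_singleton_iff] at this
    change T.fromSpecResidueField t y ∈ T.basicOpen b ↔ _
    rw [this]
    simpa using hb
  have h1 : (pr f t ≫ f).app W b = 0 := by
    have : ∀ g, g = Limits.pullback.snd f (T.fromSpecResidueField t) ≫ T.fromSpecResidueField t →
        g.app W b = 0 := by
      rintro _ rfl
      rw [Scheme.Hom.comp_app]
      exact (congrArg ((Limits.pullback.snd f (T.fromSpecResidueField t)).app _).hom h0).trans (map_zero _)
    exact this _ Limits.pullback.condition
  have h2 : (pr f t).app U (f.appLE W U hle b) = (Fb f t).presheaf.map (homOfLE (fun y hy => hle hy)).op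
      ((pr f t ≫ f).app W b) := by
    simp only [← CommRingCat.comp_apply]
    congr 2
    simp [Scheme.Hom.appLE, Scheme.Hom.comp_app]
  change gm _ _ ((pr f t).app U (f.appLE W U hle b)) = 0
  rw [h2, h1, map_zero, map_zero]

lemma lift_ker {f : X ⟶ T} {U : X.Opens} {x : X} (hx : x ∈ U) (z : Fb f (f x)) (hz : pr f (f x) z = x)
    (I : Ideal (X.presheaf.stalk x)) (hI : I ≤ maximalIdeal _)
    (hm : ∀ o ∈ maximalIdeal (T.presheaf.stalk (f x)), f.stalkMap x o ∈ I)
    {s : Γ(X, U)} (hs : psi f (f x) z (by rwa [hz]) s = 0) : gm x hx s ∈ I := by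
  have hI' : I ≠ ⊤ := fun h => (IsLocalRing.maximalIdeal.isMaximal _).ne_top (top_le_iff.mp (h ▸ hI))
  haveI : Nontrivial (X.presheaf.stalk x ⧸ I) := Ideal.Quotient.nontrivial_iff.mpr hI'
  let R : CommRingCat.{u} := CommRingCat.of (X.presheaf.stalk x ⧸ I)
  let mk : X.presheaf.stalk x ⟶ R := CommRingCat.ofHom (Ideal.Quotient.mk I)
  haveI : Nontrivial R := ‹Nontrivial (X.presheaf.stalk x ⧸ I)›
  have hms : Function.Surjective mk.hom := Ideal.Quotient.mk_surjective
  haveI : IsLocalHom mk.hom := IsLocalHom.of_surjective _ hms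
  haveI : IsLocalRing R := IsLocalRing.of_surjective' mk.hom hms
  let k : T.residueField (f x) ⟶ R := CommRingCat.ofHom (Ideal.Quotient.lift _
    (mk.hom.comp (f.stalkMap x).hom) (fun o ho => Ideal.Quotient.eq_zero_iff_mem.mpr (hm o ho)))
  have hk : T.residue (f x) ≫ k = f.stalkMap x ≫ mk := by
    ext o
    rfl
  let g : Spec R ⟶ Fb f (f x) := Limits.pullback.lift (Spec.map mk ≫ X.fromSpecStalk x) (Spec.map k) (by
    rw [Category.assoc, ← Scheme.SpecMap_stalkMap_fromSpecStalk, Scheme.fromSpecResidueField,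
      ← Spec.map_comp_assoc, ← Spec.map_comp_assoc, hk])
  have hg : Spec.map mk ≫ X.fromSpecStalk x = g ≫ pr f (f x) := (Limits.pullback.lift_fst _ _ _).symm
  have hc : (Spec.map mk ≫ X.fromSpecStalk x) (IsLocalRing.closedPoint R) = x := by
    have h := congrArg (X.fromSpecStalk x) (Spec_closedPoint (f := mk))
    exact h.trans Scheme.fromSpecStalk_closedPoint
  have hz' : g (IsLocalRing.closedPoint R) = z := by
    apply (pr f (f x)).isEmbedding.injective
    rw [hz]
    refine Eq.trans ?_ hc
    rw [hg]
    rfl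
  subst hz'
  have h1 : ∀ h', h' = g ≫ pr f (f x) → ∀ hU, Scheme.stalkClosedPointTo h'
      (X.presheaf.germ U (h' (IsLocalRing.closedPoint R)) hU s) = 0 := by
    rintro _ rfl hU
    rw [Scheme.stalkClosedPointTo_comp]
    have := psi_gm f (f x) (g (IsLocalRing.closedPoint R)) (by rwa [hz]) s
    rw [hs] at this
    exact (congrArg (Scheme.stalkClosedPointTo g) this.symm).trans (map_zero _)
  have h2 := h1 _ hg (by rwa [hc])
  have h3 := Scheme.germ_stalkClosedPointTo_Spec_fromSpecStalk mk U (by rwa [hc])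
  exact Ideal.Quotient.eq_zero_iff_mem.mp ((ConcreteCategory.congr_hom h3 s).symm.trans h2)

/-- local ring of the fibre -/
lemma isFib_psi {f : X ⟶ T} {U : X.Opens} {W : T.Opens} (hU : IsAffineOpen U) (hW : IsAffineOpen W)
    (hle : U ≤ f ⁻¹ᵁ W) {x : X} (hx : x ∈ U) {t : T} (z : Fb f t) (hz : pr f t z = x) :
    letI := (f.appLE W U hle).hom.toAlgebra
    IsFib Γ(T, W) (pt U x hx) (psi f t z (hz.symm ▸ hx)) := by
  letI := (f.appLE W U hle).hom.toAlgebra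
  have hxU : pr f t z ∈ U := hz.symm ▸ hx
  have hft : f x = t := by rw [← hz, f_pr]
  have hP : pt U x hx = pt U _ hxU := ((pt_inj hU _ _).mpr hz).symm
  have hfib : fibI Γ(T, W) (pt U x hx) = (pt W (f x) (hle hx)).map (f.appLE W U hle).hom := by
    rw [← comap_pt hU hW hle hx]; rfl
  refine ⟨fun s hs => ?_, fun o => ?_, fun s => ⟨fun hs => ?_, ?_⟩⟩
  · rw [hP, notMem_pt'] at hs
    rw [psi_gm]
    exact hs.map ((pr f t).stalkMap z).hom
  · obtain ⟨o, rfl⟩ := (pr f t).stalkMap_surjective z o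
    obtain ⟨s, hs, y, hy⟩ := gm_surj hU hxU o
    refine ⟨s, hP ▸ hs, y, ?_⟩
    rw [psi_gm, psi_gm, ← hy]
    exact (map_mul _ _ _).symm
  · subst hft
    have h1 := lift_ker hx z hz ((fibI Γ(T, W) (pt U x hx)).map (gm x hx)) (by
      rw [Ideal.map_le_iff_le_comap]
      exact fibI_le _) (fun o ho => by
      obtain ⟨s, hs, y, hy⟩ := gm_surj hW (hle hx) o
      have hy' : y ∈ pt W (f x) (hle hx) := by
        change gm _ _ y ∈ maximalIdeal _
        rw [← hy]
        exact Ideal.mul_mem_left _ _ ho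
      have h2 : (f.stalkMap x).hom (gm (f x) (hle hx) y) ∈ (fibI Γ(T, W) (pt U x hx)).map (gm x hx) := by
        have : (f.stalkMap x).hom (gm (f x) (hle hx) y) = gm x hx (f.appLE W U hle y) :=
          Scheme.Hom.germ_stalkMap_apply f W x (hle hx) y |>.trans (by
            simp only [Scheme.Hom.appLE, CommRingCat.comp_apply]
            exact (X.presheaf.germ_res_apply _ _ _ _).symm)
        rw [this, hfib]
        exact Ideal.mem_map_of_mem _ (Ideal.mem_map_of_mem _ hy')
      rw [← hy, map_mul] at h2
      exact (Ideal.unit_mul_mem_iff_mem _ ((notMem_pt'.mp hs).map (f.stalkMap x).hom)).mp h2) hs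
    letI := (gm x hx).toAlgebra
    haveI := gm_loc hU x hx
    obtain ⟨g, hg, h⟩ := (IsLocalization.algebraMap_mem_map_algebraMap_iff (pt U x hx).primeCompl
      (X.presheaf.stalk x) (fibI Γ(T, W) (pt U x hx)) s).mp h1
    exact ⟨g, hg, h⟩
  · rintro ⟨g, hg, h⟩
    have hu : IsUnit (psi f t z hxU g) := by
      rw [hP, notMem_pt'] at hg
      rw [psi_gm]
      exact hg.map ((pr f t).stalkMap z).hom
    rw [← hu.mul_right_eq_zero, ← map_mul]
    have : fibI Γ(T, W) (pt U x hx) ≤ RingHom.ker (psi f t z hxU) := by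
      rw [hfib, Ideal.map_le_iff_le_comap]
      intro b hb
      refine psi_base hle z hxU fun hbt => ?_
      subst hft
      exact notMem_pt.mpr hbt hb
    exact this h

end

section

variable {X T : Scheme.{u}}

lemma sec_ext {U : X.Opens} {s s' : Γ(X, U)} (h : ∀ x (hx : x ∈ U), gm x hx s = gm x hx s') : s = s' :=
  TopCat.Presheaf.section_ext X.sheaf U s s' h

lemma gm_appLE {f : X ⟶ T} {U : X.Opens} {W : T.Opens} (hle : U ≤ f ⁻¹ᵁ W) {x : X} (hx : x ∈ U) (b : Γ(T, W)) :
    gm x hx (f.appLE W U hle b) = (f.stalkMap x).hom (gm (f x) (hle hx) b) := by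
  symm
  exact Scheme.Hom.germ_stalkMap_apply f W x (hle hx) b |>.trans (by
            simp only [Scheme.Hom.appLE, CommRingCat.comp_apply]
            exact (X.presheaf.germ_res_apply _ _ _ _).symm)

lemma tf_of {f : X ⟶ T} (hflat : LocalPic.IsFlatMorphism f) {U : X.Opens} {W : T.Opens} (hW : IsAffineOpen W)
    (hdom : IsDomain Γ(T, W)) (hle : U ≤ f ⁻¹ᵁ W) (b : Γ(T, W)) (s : Γ(X, U)) (hb : b ≠ 0)
    (h : f.appLE W U hle b * s = 0) : s = 0 := by
  refine sec_ext fun x hx => ?_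
  have h1 : gm (f x) (hle hx) b ∈ nonZeroDivisors _ := (gm_nz hW _ b).mpr fun z hz =>
    ⟨1, (pt_prime _ _).one_notMem, by
      rw [one_mul]; exact (mul_eq_zero.mp hz).resolve_left hb⟩
  letI : Algebra (T.presheaf.stalk (f x)) (X.presheaf.stalk x) := (f.stalkMap x).hom.toAlgebra
  haveI : Module.Flat (T.presheaf.stalk (f x)) (X.presheaf.stalk x) := hflat x
  have h2 := Module.Flat.isSMulRegular_of_nonZeroDivisors (M := X.presheaf.stalk x) h1
  rw [map_zero]
  refine h2.right_eq_zero_of_smul ?_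
  have h3 := congrArg (gm x hx) h
  rw [map_mul, map_zero, gm_appLE] at h3
  rw [Algebra.smul_def]
  exact h3

lemma stalk_prime {F : Scheme.{u}} {z z0 : F} (h : z0 ⤳ z) :
    ∃ q : PrimeSpectrum (F.presheaf.stalk z), F.fromSpecStalk z q = z0 := by
  have : z0 ∈ Set.range (F.fromSpecStalk z) := by
    rw [Scheme.range_fromSpecStalk]; exact h
  exact this

lemma stalk_lt {F : Scheme.{u}} {z : F} {q q' : PrimeSpectrum (F.presheaf.stalk z)}
    (h : F.fromSpecStalk z q ⤳ F.fromSpecStalk z q') (hne : F.fromSpecStalk z q ≠ F.fromSpecStalk z q') : q < q' := by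
  refine lt_of_le_of_ne ?_ fun h => hne (by rw [h])
  rw [PrimeSpectrum.le_iff_specializes]
  exact ((F.fromSpecStalk z).isEmbedding.isInducing.specializes_iff).mp h

lemma dim_one {F : Scheme.{u}} {z z0 : F} (h : z0 ⤳ z) (hne : z0 ≠ z) : 1 ≤ ringKrullDim (F.presheaf.stalk z) := by
  obtain ⟨q, hq⟩ := stalk_prime h
  obtain ⟨q', hq'⟩ := stalk_prime (specializes_refl z)
  have := stalk_lt (q := q) (q' := q') (by rwa [hq, hq']) (by rwa [hq, hq'])
  exact Order.LTSeries.length_le_krullDim ((RelSeries.singleton _ q).snoc q' this)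

lemma dim_two {F : Scheme.{u}} {z z1 z0 : F} (h : z1 ⤳ z) (hne : z1 ≠ z) (h' : z0 ⤳ z1) (hne' : z0 ≠ z1) :
    2 ≤ ringKrullDim (F.presheaf.stalk z) := by
  obtain ⟨q1, hq1⟩ := stalk_prime h
  obtain ⟨q0, hq0⟩ := stalk_prime (h'.trans h)
  obtain ⟨q, hq⟩ := stalk_prime (specializes_refl z)
  have h1 := stalk_lt (q := q1) (q' := q) (by rwa [hq, hq1]) (by rwa [hq, hq1])
  have h0 := stalk_lt (q := q0) (q' := q1) (by rwa [hq0, hq1]) (by rwa [hq0, hq1])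
  exact Order.LTSeries.length_le_krullDim (⟨2, ![q0, q1, q], fun i => by
    fin_cases i
    exacts [h0, h1]⟩ : LTSeries (PrimeSpectrum (F.presheaf.stalk z)))

section
variable {f : X ⟶ T} {U : X.Opens} {W : T.Opens} (hU : IsAffineOpen U) (hW : IsAffineOpen W) (hle : U ≤ f ⁻¹ᵁ W)
include hU hW

lemma ov_iff {x y : X} (hx : x ∈ U) (hy : y ∈ U) : letI := (f.appLE W U hle).hom.toAlgebra
    Ov Γ(T, W) (pt U y hy) (pt U x hx) ↔ f y = f x := by
  letI := (f.appLE W U hle).hom.toAlgebra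
  rw [← pt_inj hW (hle hx) (hle hy), ← comap_pt hU hW hle, ← comap_pt hU hW hle]
  rfl

lemma s1_of (hS2 : ∀ t : T, LocalPic.IsS2Scheme (Fb f t)) (P0 P : Ideal Γ(X, U)) (h0 : P0.IsPrime) (h : P.IsPrime)
    (hlt : P0 < P) : letI := (f.appLE W U hle).hom.toAlgebra
    Ov Γ(T, W) P0 P → ∃ x ∈ P, NzMod Γ(T, W) P x := by
  letI := (f.appLE W U hle).hom.toAlgebra
  obtain ⟨x, hx, rfl⟩ := exists_pt hU P h
  obtain ⟨y, hy, rfl⟩ := exists_pt hU P0 h0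
  intro hov
  replace hov := (ov_iff hU hW hle hx hy).mp hov
  rw [pt_lt hU] at hlt
  obtain ⟨z, hz⟩ := exists_z f (rfl : f x = f x)
  obtain ⟨z0, hz0⟩ := exists_z f hov
  rw [← hz, ← hz0, pr_spec, Ne, pr_inj] at hlt
  refine (isFib_psi hU hW hle hx z hz).s1 (hS2 _ z 1 (le_min (by rw [Nat.cast_one]; exact one_le_two) ?_))
  exact_mod_cast dim_one hlt.1 hlt.2

lemma s2_of (hS2 : ∀ t : T, LocalPic.IsS2Scheme (Fb f t)) (P0 P1 P : Ideal Γ(X, U)) (h0 : P0.IsPrime)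
    (h1 : P1.IsPrime) (h : P.IsPrime) (hlt : P0 < P1) (hlt' : P1 < P) : letI := (f.appLE W U hle).hom.toAlgebra
    Ov Γ(T, W) P0 P → ∃ x ∈ P, ∃ y ∈ P, RegMod Γ(T, W) P x y := by
  letI := (f.appLE W U hle).hom.toAlgebra
  intro hov
  have hov1 : Ov Γ(T, W) P1 P := le_antisymm (Ideal.comap_mono hlt'.le) (by
    rw [← show P0.comap (algebraMap Γ(T, W) Γ(X, U)) = P.comap _ from hov]; exact Ideal.comap_mono hlt.le)
  obtain ⟨x, hx, rfl⟩ := exists_pt hU P h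
  obtain ⟨y, hy, rfl⟩ := exists_pt hU P0 h0
  obtain ⟨w, hw, rfl⟩ := exists_pt hU P1 h1
  replace hov := (ov_iff hU hW hle hx hy).mp hov
  replace hov1 := (ov_iff hU hW hle hx hw).mp hov1
  rw [pt_lt hU] at hlt hlt'
  obtain ⟨z, hz⟩ := exists_z f (rfl : f x = f x)
  obtain ⟨z0, hz0⟩ := exists_z f hov
  obtain ⟨z1, hz1⟩ := exists_z f hov1
  rw [← hz1, ← hz0, pr_spec, Ne, pr_inj] at hlt
  rw [← hz, ← hz1, pr_spec, Ne, pr_inj] at hlt'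
  refine (isFib_psi hU hW hle hx z hz).s2 (hS2 _ z 2 (le_min le_rfl ?_))
  exact_mod_cast dim_two hlt'.1 hlt'.2 hlt.1 hlt.2

/-- chains in the fibres -/
lemma chain_of {Z : Set X} {n : ℕ} (h : ∀ t : T, LocalPic.CodimGE {z : Fb f t | pr f t z ∈ Z} n)
    {x : X} (hx : x ∈ U) (hxZ : x ∈ Z) : ∃ c : Fin (n + 1) → Ideal Γ(X, U), c 0 = pt U x hx ∧
      (∀ i, (c i).IsPrime) ∧ (∀ i : Fin n, c i.succ < c i.castSucc) ∧
      letI := (f.appLE W U hle).hom.toAlgebra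
      ∀ i, Ov Γ(T, W) (c i) (pt U x hx) := by
  obtain ⟨z, hz⟩ := exists_z f (rfl : f x = f x)
  obtain ⟨c, hc0, hc⟩ := h (f x) z (show pr f (f x) z ∈ Z by rwa [hz])
  have hspec : ∀ i, c i ⤳ z := by
    intro i
    induction i using Fin.induction with
    | zero => rw [hc0]
    | succ i ih => exact (hc i).1.trans ih
  have hcU : ∀ i, pr f (f x) (c i) ∈ U := fun i =>
    ((pr_spec f (f x)).mpr (hspec i)).mem_open U.isOpen (by rwa [hz])
  refine ⟨fun i => pt U _ (hcU i), ?_, fun i => inferInstance, fun i => ?_, fun i => ?_⟩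
  · exact (pt_inj hU _ _).mpr (by rw [hc0, hz])
  · rw [pt_lt hU, pr_spec, Ne, pr_inj]
    exact hc i
  · rw [ov_iff hU hW, f_pr]
end

end

section
open LocalPic

/-- mutual divisibility -/
def Dv {R : Type*} [CommRing R] (c d : R) : Prop := c ∣ d ∧ d ∣ c

namespace Dv
variable {R : Type*} [CommRing R] {c d e c' d' : R}
lemma rfl : Dv c c := ⟨dvd_rfl, dvd_rfl⟩
lemma symm (h : Dv c d) : Dv d c := ⟨h.2, h.1⟩
lemma trans (h : Dv c d) (h' : Dv d e) : Dv c e := ⟨h.1.trans h'.1, h'.2.trans h.2⟩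
lemma mul (h : Dv c d) (h' : Dv c' d') : Dv (c * c') (d * d') := ⟨mul_dvd_mul h.1 h'.1, mul_dvd_mul h.2 h'.2⟩
lemma map {S : Type*} [CommRing S] (φ : R →+* S) (h : Dv c d) : Dv (φ c) (φ d) := ⟨map_dvd φ h.1, map_dvd φ h.2⟩
lemma unit (h : IsUnit e) : Dv (e * c) c := ⟨h.mul_left_dvd.mpr dvd_rfl, dvd_mul_left _ _⟩
lemma of_eq (h : c = d) : Dv c d := h ▸ rfl
lemma cancel (he : e ∈ nonZeroDivisors R) (h : Dv (e * c) (e * d)) : Dv c d :=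
  ⟨dvd_cancel_left_mem_nonZeroDivisors he |>.mp h.1, dvd_cancel_left_mem_nonZeroDivisors he |>.mp h.2⟩
end Dv

variable {X T : Scheme.{u}}

lemma gm_res {U U' : X.Opens} (h : U' ≤ U) {y : X} (hy : y ∈ U') (s : Γ(X, U)) :
    gm y hy (X.presheaf.map (homOfLE h).op s) = gm y (h hy) s := X.presheaf.germ_res_apply _ _ _ _

lemma gm_resS {U U' : X.Opens} (h : U' ≤ U) {y : X} (hy : y ∈ U') (s : Γ(X, U)) :
    gm y hy (resS X h s) = gm y (h hy) s := gm_res h hy s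

noncomputable abbrev sp {y' y : X} (h : y' ⤳ y) : X.presheaf.stalk y →+* X.presheaf.stalk y' :=
  (X.presheaf.stalkSpecializes h).hom

lemma sp_gm {U : X.Opens} {y' y : X} (h : y' ⤳ y) (hy : y ∈ U) (s : Γ(X, U)) :
    sp h (gm y hy s) = gm y' (h.mem_open U.isOpen hy) s :=
  ConcreteCategory.congr_hom (X.presheaf.germ_stalkSpecializes hy h) s

section
variable {V V' : X.Opens} (D : CartierDataOn X V) {D' : CartierDataOn X V'}

lemma rel_gm {i j : D.ι} {y : X} (hi : y ∈ D.U i) (hj : y ∈ D.U j) :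
    Dv (gm y hi (D.a i) * gm y hj (D.b j)) (gm y hj (D.a j) * gm y hi (D.b i)) := by
  have hy : y ∈ D.U i ⊓ D.U j := ⟨hi, hj⟩
  have h := congrArg (gm y hy) (D.rel i j)
  rw [map_mul, map_mul, map_mul, gm_resS, gm_resS, gm_resS, gm_resS] at h
  rw [← h]
  exact Dv.unit ((D.t i j).isUnit.map _)

lemma same_gm (h : SameDiv D D') {i : D.ι} {j : D'.ι} {y : X} (hi : y ∈ D.U i) (hj : y ∈ D'.U j) :
    Dv (gm y hi (D.a i) * gm y hj (D'.b j)) (gm y hj (D'.a j) * gm y hi (D.b i)) := by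
  obtain ⟨u, h⟩ := h i j
  have hy : y ∈ D.U i ⊓ D'.U j := ⟨hi, hj⟩
  replace h := congrArg (gm y hy) h
  rw [map_mul, map_mul, map_mul, gm_resS, gm_resS, gm_resS, gm_resS] at h
  rw [h]
  exact Dv.unit (u.isUnit.map _)

lemma ext_gm {F : Scheme.{u}} {p : F ⟶ X} {VF : F.Opens} {Dt : CartierDataOn F VF} (h : ExtendsPullback p Dt D)
    {α : Dt.ι} {i : D.ι} {z : F} (hα : z ∈ Dt.U α) (hi : p z ∈ D.U i) :
    Dv (gm z hα (Dt.a α) * (p.stalkMap z).hom (gm (p z) hi (D.b i)))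
      (gm z hα (Dt.b α) * (p.stalkMap z).hom (gm (p z) hi (D.a i))) := by
  obtain ⟨u, h⟩ := h α i
  have hy : z ∈ Dt.U α ⊓ p ⁻¹ᵁ D.U i := ⟨hα, hi⟩
  replace h := congrArg (gm z hy) h
  rw [map_mul, map_mul, map_mul, gm_resS, gm_resS, gm_appLE, gm_appLE] at h
  rw [h, mul_comm (gm z hα (Dt.b α))]
  exact Dv.unit (u.isUnit.map _)
end

lemma lift_sec {U U' : X.Opens} (hU : IsAffineOpen U) (g : Γ(X, U)) (hg : X.basicOpen g ≤ U') (s : Γ(X, U')) :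
    ∃ s' : Γ(X, U), ∀ y (hy : y ∈ X.basicOpen g),
      Dv (gm y (X.basicOpen_le g hy) s') (gm y (hg hy) s) := by
  haveI := hU.isLocalization_basicOpen g
  obtain ⟨⟨s', n, hn⟩, h⟩ := IsLocalization.surj (Submonoid.powers g) (X.presheaf.map (homOfLE hg).op s)
  refine ⟨s', fun y hy => ?_⟩
  have h1 := congrArg (gm y hy) h
  rw [map_mul] at h1
  have e1 : ∀ r : Γ(X, U), gm y hy (algebraMap Γ(X, U) Γ(X, X.basicOpen g) r) = gm y (X.basicOpen_le g hy) r :=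
    fun r => gm_res (X.basicOpen_le g) hy r
  have h2 := (Dv.of_eq h1.symm).trans ((Dv.of_eq (mul_comm _ _)).trans (Dv.unit (by
    refine IsUnit.map _ (IsLocalization.map_units _ ⟨n, hn⟩))))
  exact (Dv.of_eq (e1 s').symm).trans (h2.trans (Dv.of_eq (gm_res hg hy s)))

end

section
open LocalPic

variable {X T : Scheme.{u}}

lemma Dv.nz {R : Type*} [CommRing R] {c d : R} (h : Dv c d) (hd : d ∈ nonZeroDivisors R) : c ∈ nonZeroDivisors R := by
  obtain ⟨e, rfl⟩ := h.1
  exact (mul_mem_nonZeroDivisors.mp hd).1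

lemma assocAt_iff {U : X.Opens} (hU : IsAffineOpen U) {y : X} (hy : y ∈ U) {c d : Γ(X, U)} :
    AssocAt (pt U y hy) c d ↔ Dv (gm y hy c) (gm y hy d) :=
  and_congr (gm_dvd hU hy c d).symm (gm_dvd hU hy d c).symm

/-- local equations lifted to an affine open -/
structure Ix {V : X.Opens} (D : CartierDataOn X V) (U : X.Opens) where
  i : D.ι
  η : Γ(X, U)
  a : Γ(X, U)
  b : Γ(X, U)
  le : X.basicOpen η ≤ D.U i
  ha : ∀ y (hy : y ∈ X.basicOpen η), Dv (gm y (X.basicOpen_le η hy) a) (gm y (le hy) (D.a i))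
  hb : ∀ y (hy : y ∈ X.basicOpen η), Dv (gm y (X.basicOpen_le η hy) b) (gm y (le hy) (D.b i))

lemma exists_ix {V : X.Opens} (D : CartierDataOn X V) {U : X.Opens} (hU : IsAffineOpen U) {x : X} (hx : x ∈ U)
    (i : D.ι) (hi : x ∈ D.U i) : ∃ j : Ix D U, j.i = i ∧ x ∈ X.basicOpen j.η := by
  obtain ⟨g, hg, hxg⟩ := hU.exists_basicOpen_le ⟨x, hi⟩ hx
  obtain ⟨a, ha⟩ := lift_sec hU g hg (D.a i)
  obtain ⟨b, hb⟩ := lift_sec hU g hg (D.b i)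
  exact ⟨⟨i, g, a, b, hg, ha, hb⟩, rfl, hxg⟩

lemma exists_tz (f : X ⟶ T) (x : X) : ∃ t, ∃ z : Fb f t, pr f t z = x :=
  ⟨f x, exists_z f rfl⟩

lemma sp_psi (f : X ⟶ T) (t : T) {U : X.Opens} {z z' : Fb f t} (h : z' ⤳ z) (hz : pr f t z ∈ U)
    (hz' : pr f t z' ∈ U) (s : Γ(X, U)) : sp h (psi f t z hz s) = psi f t z' hz' s :=
  sp_gm (U := pr f t ⁻¹ᵁ U) h hz _

section
variable {V : X.Opens} {D : CartierDataOn X V} {f : X ⟶ T} {U : X.Opens}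

lemma Ix.psi_a (j : Ix D U) {t : T} {z : Fb f t} (hz : pr f t z ∈ U) (hy : pr f t z ∈ X.basicOpen j.η) :
    Dv (psi f t z hz j.a) (((pr f t).stalkMap z).hom (gm _ (j.le hy) (D.a j.i))) := by
  rw [psi_gm]
  exact (j.ha _ hy).map ((pr f t).stalkMap z).hom

lemma Ix.psi_b (j : Ix D U) {t : T} {z : Fb f t} (hz : pr f t z ∈ U) (hy : pr f t z ∈ X.basicOpen j.η) :
    Dv (psi f t z hz j.b) (((pr f t).stalkMap z).hom (gm _ (j.le hy) (D.b j.i))) := by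
  rw [psi_gm]
  exact (j.hb _ hy).map ((pr f t).stalkMap z).hom

variable {W' : T.Opens} (hU : IsAffineOpen U) (hW' : IsAffineOpen W') (hle : U ≤ f ⁻¹ᵁ W')
include hU hW'

lemma fc_of {t : T} {Dt : CartierDataOn (Fb f t) ⊤} (hext : ExtendsPullback (pr f t) Dt D)
    (z : Fb f t) (hx : pr f t z ∈ U) :
    letI := (f.appLE W' U hle).hom.toAlgebra
    ∃ α β, NzMod Γ(T, W') (pt U _ hx) α ∧ NzMod Γ(T, W') (pt U _ hx) β ∧
    ∀ P' : Ideal Γ(X, U), P'.IsPrime → P' ≤ (pt U _ hx) → Ov Γ(T, W') P' (pt U _ hx) → ∀ i : Ix D U, i.η ∉ P' →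
      DvdMod Γ(T, W') P' (α * i.b) (β * i.a) ∧ DvdMod Γ(T, W') P' (β * i.a) (α * i.b) := by
  letI := (f.appLE W' U hle).hom.toAlgebra
  obtain ⟨k, hk⟩ := Dt.covers z trivial
  have F := isFib_psi hU hW' hle hx z rfl
  obtain ⟨s, hs, α, hα⟩ := F.surj (gm z hk (Dt.a k))
  obtain ⟨r, hr, β, hβ⟩ := F.surj (gm z hk (Dt.b k))
  refine ⟨α, β, ?_, ?_, ?_⟩
  · rw [F.nzMod, ← hα]
    exact mul_mem_nonZeroDivisors.mpr ⟨(F.unit s hs).mem_nonZeroDivisors, Dt.rega k z hk⟩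
  · rw [F.nzMod, ← hβ]
    exact mul_mem_nonZeroDivisors.mpr ⟨(F.unit r hr).mem_nonZeroDivisors, Dt.regb k z hk⟩
  · intro P' hP' hle' hov i hi
    obtain ⟨y, hy, rfl⟩ := exists_pt hU P' hP'
    replace hov := ((ov_iff hU hW' hle hx hy).mp hov).trans (f_pr f t z)
    obtain ⟨z', rfl⟩ := exists_z f hov
    have hzz : z' ⤳ z := (pr_spec f t).mp ((pt_le hU _ _).mp hle')
    have F' := isFib_psi hU hW' hle hy z' rfl
    have hk' : z' ∈ Dt.U k := hzz.mem_open (Dt.U k).isOpen hk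
    have hiy : pr f t z' ∈ X.basicOpen i.η := notMem_pt.mp hi
    have e1 : Dv (psi f t z' hy α) (gm z' hk' (Dt.a k)) := by
      have := congrArg (sp hzz) hα
      rw [map_mul, sp_psi f t hzz hx hy, sp_psi f t hzz hx hy, sp_gm] at this
      rw [← this]
      exact Dv.unit (F'.unit s fun h => hs (hle' h))
    have e2 : Dv (psi f t z' hy β) (gm z' hk' (Dt.b k)) := by
      have := congrArg (sp hzz) hβ
      rw [map_mul, sp_psi f t hzz hx hy, sp_psi f t hzz hx hy, sp_gm] at this
      rw [← this]
      exact Dv.unit (F'.unit r fun h => hr (hle' h))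
    rw [F'.dvdMod, F'.dvdMod, map_mul, map_mul]
    exact (e1.mul (i.psi_b hy hiy)).trans ((ext_gm D hext hk' (i.le hiy)).trans (e2.mul (i.psi_a hy hiy)).symm)

end
end

section
open LocalPic

theorem algData {X T : Scheme.{u}} [IrreducibleSpace T]
    (hreg : ∀ t : T, IsRegularLocal (T.presheaf.stalk t)) (hdim1 : topologicalKrullDim T = 1)
    (f : X ⟶ T) (hflat : IsFlatMorphism f) (hS2 : ∀ t : T, IsS2Scheme (Fb f t))
    (V : X.Opens) (D : CartierDataOn X V)
    (hD : IsGenericallyFlatFamilyOfCartierDivisors f D) (W : Set X)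
    (hWcodim : ∀ t : T, CodimGE {z : Fb f t | pr f t z ∈ W} 3)
    (VW : X.Opens) (hVW : (VW : Set X) = Wᶜ) (DW : CartierDataOn X VW) (hDW : SameDiv DW D)
    {U : X.Opens} {W' : T.Opens} (hU : IsAffineOpen U) (hW' : IsAffineOpen W') (hle : U ≤ f ⁻¹ᵁ W')
    (hne : Nonempty W')
    (heft : letI := (f.appLE W' U hle).hom.toAlgebra; Algebra.EssFiniteType Γ(T, W') Γ(X, U)) :
    letI := (f.appLE W' U hle).hom.toAlgebra
    AlgData Γ(T, W') Γ(X, U) (fun j : Ix D U => j.η) (fun j => j.a) (fun j => j.b)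
      (fun P => ∃ x, ∃ hx : x ∈ U, x ∈ W ∧ P = pt U x hx) := by
  letI := (f.appLE W' U hle).hom.toAlgebra
  have hbd := bd_of hreg hdim1 hW' hne
  obtain ⟨hcod, hFR, hext⟩ := hD
  refine ⟨hbd, heft, tf_of hflat hW' hbd.dom hle |> fun h b x hb hx => h b x hb hx, ?_, ?_, ?_, ?_, ?_, ?_, ?_, ?_, ?_⟩
  · exact s1_of hU hW' hle hS2
  · exact s2_of hU hW' hle hS2
  · intro j P hP hj
    obtain ⟨x, hx, rfl⟩ := exists_pt hU P hP
    have hxj := notMem_pt.mp hj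
    refine ⟨(gm_nz hU hx _).mp ((j.ha x hxj).nz (D.rega _ _ _)), ?_⟩
    obtain ⟨t, z, rfl⟩ := exists_tz f x
    rw [(isFib_psi hU hW' hle hx z rfl).nzMod]
    refine (j.psi_a hx hxj).nz ?_
    rw [← psi_gm f t z (j.le hxj)]
    exact (hFR t z j.i (j.le hxj)).1
  · intro j P hP hj
    obtain ⟨x, hx, rfl⟩ := exists_pt hU P hP
    have hxj := notMem_pt.mp hj
    refine ⟨(gm_nz hU hx _).mp ((j.hb x hxj).nz (D.regb _ _ _)), ?_⟩
    obtain ⟨t, z, rfl⟩ := exists_tz f x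
    rw [(isFib_psi hU hW' hle hx z rfl).nzMod]
    refine (j.psi_b hx hxj).nz ?_
    rw [← psi_gm f t z (j.le hxj)]
    exact (hFR t z j.i (j.le hxj)).2
  · intro i j P hP hi hj
    obtain ⟨x, hx, rfl⟩ := exists_pt hU P hP
    have hxi := notMem_pt.mp hi
    have hxj := notMem_pt.mp hj
    rw [← gm_dvd hU, map_mul, map_mul]
    exact (((j.ha x hxj).mul (i.hb x hxi)).trans
      ((rel_gm D (j.le hxj) (i.le hxi)).trans ((i.ha x hxi).mul (j.hb x hxj)).symm)).1
  · intro P hP hη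
    obtain ⟨x, hx, rfl⟩ := exists_pt hU P hP
    have hxV : x ∈ ((V : Set X)ᶜ) := by
      intro hxV
      obtain ⟨i, hi⟩ := D.covers x hxV
      obtain ⟨j, -, hj⟩ := exists_ix D hU hx i hi
      exact notMem_pt.mpr hj (hη j)
    obtain ⟨c, h0, hp, hc, hov⟩ := chain_of hU hW' hle hcod hx hxV
    exact ⟨c 2, c 1, hp _, hp _, hc 1, h0 ▸ hc 0, hov 2⟩
  · rintro _ hP ⟨x, hx, hxW, rfl⟩
    obtain ⟨c, h0, hp, hc, hov⟩ := chain_of hU hW' hle hWcodim hx hxW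
    exact ⟨c 3, c 2, c 1, hp _, hp _, hp _, hc 2, hc 1, h0 ▸ hc 0, hov 3⟩
  · intro P hP
    obtain ⟨x, hx, rfl⟩ := exists_pt hU P hP
    obtain ⟨t, z, rfl⟩ := exists_tz f x
    obtain ⟨Dt, hDt⟩ := hext t
    exact fc_of hU hW' hle hDt z hx
  · intro P hP hin
    obtain ⟨x, hx, rfl⟩ := exists_pt hU P hP
    have hxW : x ∈ VW := by
      change x ∈ (VW : Set X)
      rw [hVW]
      exact fun h => hin ⟨x, hx, h, rfl⟩
    obtain ⟨i, hi⟩ := DW.covers x hxW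
    obtain ⟨j, -, hj⟩ := exists_ix DW hU hx i hi
    refine ⟨j.a, j.b, (gm_nz hU hx _).mp ((j.ha x hj).nz (DW.rega _ _ _)),
      (gm_nz hU hx _).mp ((j.hb x hj).nz (DW.regb _ _ _)), fun P' hP' hle' k hk => ?_⟩
    obtain ⟨y, hy, rfl⟩ := exists_pt hU P' hP'
    have hyk := notMem_pt.mp hk
    have hyj := ((pt_le hU hx hy).mp hle').mem_open (X.basicOpen j.η).isOpen hj
    rw [assocAt_iff hU, map_mul, map_mul]
    exact ((j.ha y hyj).mul (k.hb y hyk)).trans ((same_gm DW hDW (j.le hyj) (k.le hyk)).trans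
      ((Dv.of_eq (mul_comm _ _)).trans ((j.hb y hyj).mul (k.ha y hyk)).symm))

end

section
open LocalPic

variable {X : Scheme.{u}}

lemma loc_quot {U : X.Opens} {c d : Γ(X, U)} (h : ∀ y (hy : y ∈ U), gm y hy c ∣ gm y hy d) {y : X} (hy : y ∈ U) :
    ∃ V : X.Opens, ∃ hV : V ≤ U, y ∈ V ∧ ∃ s : Γ(X, V), ∀ y' (hy' : y' ∈ V),
      gm y' (hV hy') d = gm y' (hV hy') c * gm y' hy' s := by
  obtain ⟨e, he⟩ := h y hy
  obtain ⟨W0, h0, s0, rfl⟩ := X.presheaf.exists_germ_eq e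
  have h1 : y ∈ W0 ⊓ U := ⟨h0, hy⟩
  obtain ⟨W, hW, i, i', hi⟩ := X.presheaf.germ_eq y h1 h1 (resS X inf_le_right d)
    (resS X inf_le_right c * resS X inf_le_left s0) (by
      refine (gm_resS inf_le_right h1 d).trans (he.trans (Eq.symm ?_))
      refine (map_mul (gm y h1) _ _).trans ?_
      rw [gm_resS, gm_resS])
  refine ⟨W, i.le.trans inf_le_right, hW, resS X (i.le.trans inf_le_left) s0, fun y' hy' => ?_⟩
  have h2 := congrArg (gm y' hy') hi
  have h3 := (gm_res i.le hy' (resS X inf_le_right d)).symm.trans (h2.trans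
    (gm_res i.le hy' (resS X inf_le_right c * resS X inf_le_left s0)))
  rw [map_mul, gm_resS, gm_resS, gm_resS] at h3
  rw [gm_resS]
  exact h3

lemma glue_quot {U : X.Opens} {c d : Γ(X, U)} (hc : ∀ y (hy : y ∈ U), gm y hy c ∈ nonZeroDivisors _)
    (h : ∀ y (hy : y ∈ U), gm y hy c ∣ gm y hy d) : ∃ e, d = c * e := by
  choose V hV hmem s hs using fun y : U => loc_quot h y.2
  obtain ⟨e, he, -⟩ := X.sheaf.existsUnique_gluing' V U (fun y => homOfLE (hV y))
    (fun y hy => TopologicalSpace.Opens.mem_iSup.mpr ⟨⟨y, hy⟩, hmem _⟩) s (fun i j => by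
      refine sec_ext (U := V i ⊓ V j) fun y hy => ?_
      refine (gm_res inf_le_left hy (s i)).trans (Eq.trans ?_ (gm_res inf_le_right hy (s j)).symm)
      exact mul_cancel_left_mem_nonZeroDivisors (hc y (hV i hy.1)) |>.mp ((hs i y hy.1).symm.trans (hs j y hy.2)))
  obtain ⟨e, he⟩ : ∃ e : Γ(X, U), ∀ y, X.presheaf.map (homOfLE (hV y)).op e = s y := ⟨e, he⟩
  refine ⟨e, sec_ext fun y hy => ?_⟩
  rw [map_mul, hs ⟨y, hy⟩ y (hmem _)]
  congr 1
  rw [← he ⟨y, hy⟩]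
  exact gm_res (hV ⟨y, hy⟩) (hmem _) e

lemma glue_unit {U : X.Opens} {c d : Γ(X, U)} (hc : ∀ y (hy : y ∈ U), gm y hy c ∈ nonZeroDivisors _)
    (h : ∀ y (hy : y ∈ U), Dv (gm y hy c) (gm y hy d)) : ∃ u : (Γ(X, U))ˣ, d = u * c := by
  obtain ⟨e, he⟩ := glue_quot hc fun y hy => (h y hy).1
  obtain ⟨e', he'⟩ := glue_quot (fun y hy => (h y hy).symm.nz (hc y hy)) fun y hy => (h y hy).2
  have h1 : e * e' = 1 := sec_ext fun y hy => by
    refine mul_cancel_left_mem_nonZeroDivisors (hc y hy) |>.mp ?_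
    rw [← map_mul, ← map_mul, ← mul_assoc, ← he, ← he', mul_one]
  exact ⟨⟨e, e', h1, (mul_comm _ _).trans h1⟩, he.trans (mul_comm _ _)⟩

lemma dv_aux {R : Type*} [CommRing R] {a b a1 b1 a2 b2 : R} (ha : a ∈ nonZeroDivisors R) (hb : b ∈ nonZeroDivisors R)
    (h1 : Dv (a1 * b) (b1 * a)) (h2 : Dv (a2 * b) (b2 * a)) : a2 * b1 ∣ a1 * b2 := by
  refine (Dv.cancel (e := a * b) (mul_mem ha hb) ?_).2
  refine Dv.trans (Dv.of_eq ?_) ((h1.mul h2.symm).trans (Dv.of_eq ?_)) <;> ring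

lemma cocyc_aux {R : Type*} [CommRing R] {ai bi aj bj ak bk tij tjk tik : R} (h1 : bi ∈ nonZeroDivisors R)
    (h2 : ak ∈ nonZeroDivisors R) (h3 : aj ∈ nonZeroDivisors R) (h4 : bj ∈ nonZeroDivisors R)
    (e1 : tij * (aj * bi) = ai * bj) (e2 : tjk * (ak * bj) = aj * bk) (e3 : tik * (ak * bi) = ai * bk) :
    tij * tjk = tik := by
  have h : (bi * ak) * (aj * bj) ∈ nonZeroDivisors R := mul_mem (mul_mem h1 h2) (mul_mem h3 h4)
  refine (mul_cancel_left_mem_nonZeroDivisors h).mp ?_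
  linear_combination (tjk * (ak * bj)) * e1 + (ai * bj) * e2 - (aj * bj) * e3

/-- a chart of the extended divisor -/
structure Ch {V : X.Opens} (D : CartierDataOn X V) where
  U : X.Opens
  a : Γ(X, U)
  b : Γ(X, U)
  ra : ∀ y (hy : y ∈ U), gm y hy a ∈ nonZeroDivisors _
  rb : ∀ y (hy : y ∈ U), gm y hy b ∈ nonZeroDivisors _
  eq : ∀ y (hy : y ∈ U) i (hi : y ∈ D.U i), Dv (gm y hy a * gm y hi (D.b i)) (gm y hy b * gm y hi (D.a i))

theorem finish {V : X.Opens} (D : CartierDataOn X V) (h1 : ∀ x, ∃ C : Ch D, x ∈ C.U)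
    (h2 : ∀ (y : X) (c d : X.presheaf.stalk y), (∀ y' (h : y' ⤳ y), sp h c ∈ nonZeroDivisors _) →
      (∀ y' (h : y' ⤳ y), y' ∈ V → sp h c ∣ sp h d) → c ∣ d) :
    ∃ Df : CartierDataOn X ⊤, SameDiv Df D := by
  choose C hC using h1
  have key : ∀ (i j : X) (y : X) (hi : y ∈ (C i).U) (hj : y ∈ (C j).U),
      gm y hj (C j).a * gm y hi (C i).b ∣ gm y hi (C i).a * gm y hj (C j).b := by
    intro i j y hi hj
    refine h2 y _ _ (fun y' h => ?_) (fun y' h hV => ?_)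
    · rw [map_mul, sp_gm, sp_gm]
      exact mul_mem_nonZeroDivisors.mpr ⟨(C j).ra _ _, (C i).rb _ _⟩
    · rw [map_mul, map_mul, sp_gm, sp_gm, sp_gm, sp_gm]
      obtain ⟨k, hk⟩ := D.covers y' hV
      have e1 := (C i).eq y' (h.mem_open (C i).U.isOpen hi) k hk
      have e2 := (C j).eq y' (h.mem_open (C j).U.isOpen hj) k hk
      exact dv_aux (D.rega k y' hk) (D.regb k y' hk) e1 e2
  have hu : ∀ i j : X, ∃ u : (Γ(X, (C i).U ⊓ (C j).U))ˣ,
      resS X inf_le_left (C i).a * resS X inf_le_right (C j).b =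
        (u : Γ(X, (C i).U ⊓ (C j).U)) * (resS X inf_le_right (C j).a * resS X inf_le_left (C i).b) := by
    intro i j
    refine glue_unit (fun y hy => ?_) (fun y hy => ?_)
    · rw [map_mul, gm_resS, gm_resS]
      exact mul_mem_nonZeroDivisors.mpr ⟨(C j).ra _ _, (C i).rb _ _⟩
    · rw [map_mul, map_mul, gm_resS, gm_resS, gm_resS, gm_resS]
      exact ⟨key i j y _ _, key j i y _ _⟩
  have hs : ∀ (i : X) (k : D.ι), ∃ u : (Γ(X, (C i).U ⊓ D.U k))ˣ,
      resS X inf_le_left (C i).a * resS X inf_le_right (D.b k) =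
        (u : Γ(X, (C i).U ⊓ D.U k)) * (resS X inf_le_right (D.a k) * resS X inf_le_left (C i).b) := by
    intro i k
    refine glue_unit (fun y hy => ?_) (fun y hy => ?_)
    · rw [map_mul, gm_resS, gm_resS]
      exact mul_mem_nonZeroDivisors.mpr ⟨D.rega k _ _, (C i).rb _ _⟩
    · rw [map_mul, map_mul, gm_resS, gm_resS, gm_resS, gm_resS]
      exact (Dv.of_eq (mul_comm _ _)).trans ((C i).eq y hy.1 k hy.2).symm
  choose t ht using hu
  have hg : ∀ i j y (hy : y ∈ (C i).U ⊓ (C j).U), gm y hy (t i j : Γ(X, (C i).U ⊓ (C j).U)) *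
      (gm y hy.2 (C j).a * gm y hy.1 (C i).b) = gm y hy.1 (C i).a * gm y hy.2 (C j).b := by
    intro i j y hy
    have := congrArg (gm y hy) (ht i j)
    rw [map_mul, map_mul, map_mul, gm_resS, gm_resS, gm_resS, gm_resS] at this
    exact this.symm
  refine ⟨⟨⟨X, fun i => (C i).U, fun _ => le_top, fun x _ => ⟨x, hC x⟩, t, fun i j k => ?_⟩,
    fun i => (C i).a, fun i => (C i).b, fun i => (C i).ra, fun i => (C i).rb, fun i j => (ht i j).symm⟩, ?_⟩
  · refine Units.ext (sec_ext fun y hy => ?_)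
    have hij : y ∈ (C i).U ⊓ (C j).U := hy.1
    have hjk : y ∈ (C j).U ⊓ (C k).U := ⟨hy.1.2, hy.2⟩
    have hik : y ∈ (C i).U ⊓ (C k).U := ⟨hy.1.1, hy.2⟩
    have e1 := hg i j y hij
    have e2 := hg j k y hjk
    have e3 := hg i k y hik
    refine (map_mul (gm y hy) _ _).trans ?_
    refine (congrArg₂ (· * ·) (gm_res _ hy _) (gm_res _ hy _)).trans (Eq.trans ?_ (gm_res _ hy _).symm)
    exact cocyc_aux ((C i).rb y hij.1) ((C k).ra y hjk.2) ((C j).ra y hij.2) ((C j).rb y hij.2) e1 e2 e3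
  · exact hs

end

section
open LocalPic

theorem main {X T : Scheme.{u}} [IrreducibleSpace T]
    (hreg : ∀ t : T, IsRegularLocal (T.presheaf.stalk t)) (hdim1 : topologicalKrullDim T = 1)
    (f : X ⟶ T) (hflat : IsFlatMorphism f) (heft : IsEssFiniteTypeMorphism f)
    (hS2 : ∀ t : T, IsS2Scheme (Fb f t)) (V : X.Opens) (D : CartierDataOn X V)
    (hD : IsGenericallyFlatFamilyOfCartierDivisors f D) (W : Set X)
    (hWcodim : ∀ t : T, CodimGE {z : Fb f t | pr f t z ∈ W} 3)
    (VW : X.Opens) (hVW : (VW : Set X) = Wᶜ) (DW : CartierDataOn X VW) (hDW : SameDiv DW D) :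
    ∃ Df : CartierDataOn X ⊤, SameDiv Df D := by
  refine finish D (fun x => ?_) (fun y c d hc hcd => ?_)
  · by_cases hxW : x ∈ W
    · obtain ⟨U, hx, hU, W', hW', hle, he⟩ := heft x
      letI := (f.appLE W' U hle).hom.toAlgebra
      have A := algData hreg hdim1 f hflat hS2 V D hD W hWcodim VW hVW DW hDW hU hW' hle ⟨⟨f x, hle hx⟩⟩ he
      obtain ⟨α, β, g, hg, h⟩ := A.spread _ (A.rgood (pt U x hx) ⟨x, hx, hxW, rfl⟩)
      have hlt := X.basicOpen_le g
      have hQ : ∀ y (hy : y ∈ X.basicOpen g), g ∉ pt U y (hlt hy) := fun y hy => notMem_pt.mpr hy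
      refine ⟨⟨X.basicOpen g, resS X hlt α, resS X hlt β, fun y hy => ?_, fun y hy => ?_, fun y hy i hi => ?_⟩,
        notMem_pt.mp hg⟩
      · rw [gm_resS, gm_nz hU]
        exact (h _ inferInstance (hQ y hy)).1
      · rw [gm_resS, gm_nz hU]
        exact (h _ inferInstance (hQ y hy)).2.1
      · rw [gm_resS, gm_resS]
        obtain ⟨j, rfl, hj⟩ := exists_ix D hU (hlt hy) i hi
        have := (assocAt_iff hU _).mp ((h _ inferInstance (hQ y hy)).2.2 j (notMem_pt.mpr hj))
        rw [map_mul, map_mul] at this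
        exact (Dv.rfl.mul (j.hb y hj).symm).trans (this.trans (Dv.rfl.mul (j.ha y hj)))
    · have hx : x ∈ (VW : Set X) := by rw [hVW]; exact hxW
      obtain ⟨i, hi⟩ := DW.covers x hx
      exact ⟨⟨DW.U i, DW.a i, DW.b i, DW.rega i, DW.regb i, fun y hy k hk =>
        (same_gm DW hDW hy hk).trans (Dv.of_eq (mul_comm _ _))⟩, hi⟩
  · obtain ⟨U, hy, hU, W', hW', hle, he⟩ := heft y
    letI := (f.appLE W' U hle).hom.toAlgebra
    have A := algData hreg hdim1 f hflat hS2 V D hD W hWcodim VW hVW DW hDW hU hW' hle ⟨⟨f y, hle hy⟩⟩ he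
    obtain ⟨s, hs, c', e1⟩ := gm_surj hU hy c
    obtain ⟨r, hr, d', e2⟩ := gm_surj hU hy d
    have hs' := notMem_pt'.mp hs
    have hr' := notMem_pt'.mp hr
    have e1' : ∀ y' (h : y' ⤳ y) (hy' : y' ∈ U), Dv (gm y' hy' c') (sp h c) := fun y' h hy' => by
      have := congrArg (sp h) e1
      rw [map_mul, sp_gm, sp_gm] at this
      exact (Dv.of_eq this.symm).trans (Dv.unit (by rw [← sp_gm h hy]; exact hs'.map (sp h)))
    have e2' : ∀ y' (h : y' ⤳ y) (hy' : y' ∈ U), Dv (gm y' hy' d') (sp h d) := fun y' h hy' => by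
      have := congrArg (sp h) e2
      rw [map_mul, sp_gm, sp_gm] at this
      exact (Dv.of_eq this.symm).trans (Dv.unit (by rw [← sp_gm h hy]; exact hr'.map (sp h)))
    have key : DvdAt (pt U y hy) c' d' := by
      refine A.ext_dvd _ (fun Q' hQ' hle' => ?_) (fun Q' hQ' hle' j hj => ?_)
      · obtain ⟨y', hy', rfl⟩ := exists_pt hU Q' hQ'
        have h := (pt_le hU hy hy').mp hle'
        exact (gm_nz hU hy' c').mp ((e1' y' h hy').nz (hc y' h))
      · obtain ⟨y', hy', rfl⟩ := exists_pt hU Q' hQ'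
        have h := (pt_le hU hy hy').mp hle'
        rw [← gm_dvd hU]
        exact (e1' y' h hy').1.trans ((hcd y' h (D.le _ (j.le (notMem_pt.mp hj)))).trans (e2' y' h hy').2)
    rw [← gm_dvd hU, ← e1, ← e2, hr'.dvd_mul_left, hs'.mul_left_dvd] at key
    exact key

end

end LPaux

namespace LocalPic

/-- Let `T` be an irreducible regular `1`-dimensional scheme and `f : X ⟶ T` a flat
morphism, essentially of finite type, with `S2` fibers. Let `D` be a generically flat
family of fiber-wise Cartier divisors on `X`. Assume there is a closed subset `W` of
`X` of fiber-wise codimension `≥ 3` such that `D` is a Cartier divisor on `X \ W`.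
Then `D` is a Cartier divisor on `X`. -/
theorem stmt_18 (T : Scheme.{u}) [IrreducibleSpace ↥T]
    (hreg : ∀ t : ↥T, IsRegularLocal ↥(T.presheaf.stalk t))
    (hdim1 : topologicalKrullDim ↥T = 1)
    (X : Scheme.{u}) (f : X ⟶ T) (hflat : IsFlatMorphism f)
    (heft : IsEssFiniteTypeMorphism f)
    (hS2 : ∀ t : ↥T, IsS2Scheme (Limits.pullback f (T.fromSpecResidueField t)))
    (V : X.Opens) (D : CartierDataOn X V)
    (hD : IsGenericallyFlatFamilyOfCartierDivisors f D)
    (W : Set ↥X) (hWcl : IsClosed W)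
    (hWcodim : ∀ t : ↥T, CodimGE {z : ↥(Limits.pullback f (T.fromSpecResidueField t)) |
      (Limits.pullback.fst f (T.fromSpecResidueField t)).base z ∈ W} 3)
    (VW : X.Opens) (hVW : (VW : Set ↥X) = Wᶜ)
    (hDW : ∃ DW : CartierDataOn X VW, SameDiv DW D) :
    ∃ Dfull : CartierDataOn X ⊤, SameDiv Dfull D := by
  obtain ⟨DW, hDW⟩ := hDW
  exact LPaux.main hreg hdim1 f hflat heft hS2 V D hD W hWcodim VW hVW DW hDW

end LocalPic
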